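/- Let π be an irreducible cuspidal ψ-generic representation of the quasi-split non-split group SO_{2l}. Then γ(π×τ,ψ) = γ(π^c×τ,ψ) for every irreducible ψ^{−1}-generic representation τ of GL_l(F). -/

import Mathlib

open scoped MatrixGroups
open Matrix

noncomputable section

namespace ConverseSO

open Classical in
/-- Evaluate a function defined on `G` at a point of `M` through the (typically injective)
map `c : G → M`, extending by zero. -/
def matFun {G M R : Type*} [Zero R] (c : G → M) (φ : G → R) (m : M) : R :=
  if h : ∃ g, c g = m then φ h.choose else 0

variable (F : Type) [Field F] [Fintype F]

/-- The antidiagonal matrix `J_m`. -/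
def Jmat (m : ℕ) : Matrix (Fin m) (Fin m) F :=
  Matrix.of fun i j => if (i : ℕ) + (j : ℕ) + 1 = m then 1 else 0

/-- The middle-block modification `diag(I_{l-1}, [[0,1],[-ρ,0]], I_{l-1})`. -/
def Dmat (l : ℕ) (ρ : F) : Matrix (Fin (2*l)) (Fin (2*l)) F :=
  Matrix.of fun i j =>
    if (i : ℕ) = l - 1 ∧ (j : ℕ) = l then 1
    else if (i : ℕ) = l ∧ (j : ℕ) = l - 1 then -ρ
    else if i = j ∧ (i : ℕ) ≠ l - 1 ∧ (i : ℕ) ≠ l then 1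
    else 0

/-- `J_{2l,ρ}`. -/
def Jrho (l : ℕ) (ρ : F) : Matrix (Fin (2*l)) (Fin (2*l)) F := Dmat F l ρ * Jmat F (2*l)

/-- The matrix-level special orthogonal "set" attached to a matrix `Jm`. -/
def SOset (m : ℕ) (Jm : Matrix (Fin m) (Fin m) F) : Set (Matrix (Fin m) (Fin m) F) :=
  {g | g.det = 1 ∧ gᵀ * Jm * g = Jm}

/-- The special orthogonal group attached to a matrix `Jm`, as a subgroup of `GL`. -/
def SOgrp (m : ℕ) (Jm : Matrix (Fin m) (Fin m) F) : Subgroup (GL (Fin m) F) where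
  carrier := {g | ((g : Matrix (Fin m) (Fin m) F)).det = 1 ∧
    ((g : Matrix (Fin m) (Fin m) F))ᵀ * Jm * ((g : Matrix (Fin m) (Fin m) F)) = Jm}
  one_mem' := ⟨by simp, by simp⟩
  mul_mem' := by
    rintro a b ⟨ha1, ha2⟩ ⟨hb1, hb2⟩
    refine ⟨by rw [Units.val_mul, Matrix.det_mul, ha1, hb1, one_mul], ?_⟩
    have hab : ((a * b : GL (Fin m) F) : Matrix (Fin m) (Fin m) F)
        = (a : Matrix (Fin m) (Fin m) F) * (b : Matrix (Fin m) (Fin m) F) := Units.val_mul a b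
    rw [hab, Matrix.transpose_mul]
    calc (b : Matrix (Fin m) (Fin m) F)ᵀ * (a : Matrix (Fin m) (Fin m) F)ᵀ * Jm *
          ((a : Matrix (Fin m) (Fin m) F) * (b : Matrix (Fin m) (Fin m) F))
        = (b : Matrix (Fin m) (Fin m) F)ᵀ *
            ((a : Matrix (Fin m) (Fin m) F)ᵀ * Jm * (a : Matrix (Fin m) (Fin m) F)) *
            (b : Matrix (Fin m) (Fin m) F) := by
          simp only [mul_assoc]
      _ = Jm := by rw [ha2, hb2]
  inv_mem' := by
    intro g hg
    obtain ⟨h1, h2⟩ := hg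
    have hv1 : ((g⁻¹ : GL (Fin m) F) : Matrix (Fin m) (Fin m) F) * (g : Matrix (Fin m) (Fin m) F)
        = 1 := by rw [← Units.val_mul, inv_mul_cancel, Units.val_one]
    have hv2 : (g : Matrix (Fin m) (Fin m) F) * ((g⁻¹ : GL (Fin m) F) : Matrix (Fin m) (Fin m) F)
        = 1 := by rw [← Units.val_mul, mul_inv_cancel, Units.val_one]
    constructor
    · have hd := congrArg Matrix.det hv1
      rw [Matrix.det_mul, h1, mul_one, Matrix.det_one] at hd
      exact hd
    · calc ((g⁻¹ : GL (Fin m) F) : Matrix (Fin m) (Fin m) F)ᵀ * Jm *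
            ((g⁻¹ : GL (Fin m) F) : Matrix (Fin m) (Fin m) F)
          = ((g⁻¹ : GL (Fin m) F) : Matrix (Fin m) (Fin m) F)ᵀ *
              ((g : Matrix (Fin m) (Fin m) F)ᵀ * Jm * (g : Matrix (Fin m) (Fin m) F)) *
              ((g⁻¹ : GL (Fin m) F) : Matrix (Fin m) (Fin m) F) := by rw [h2]
        _ = ((g : Matrix (Fin m) (Fin m) F) *
              ((g⁻¹ : GL (Fin m) F) : Matrix (Fin m) (Fin m) F))ᵀ * Jm *
              ((g : Matrix (Fin m) (Fin m) F) *
              ((g⁻¹ : GL (Fin m) F) : Matrix (Fin m) (Fin m) F)) := by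
            rw [Matrix.transpose_mul]; simp only [mul_assoc]
        _ = Jm := by rw [hv2]; simp

/-- The quasi-split even special orthogonal group `SO_{2l}` attached to `J_{2l,ρ}`. -/
abbrev SO2l (l : ℕ) (ρ : F) : Subgroup (GL (Fin (2*l)) F) := SOgrp F (2*l) (Jrho F l ρ)

/-- The odd special orthogonal group `SO_{2m+1}` (split form). -/
abbrev SOodd (m : ℕ) : Subgroup (GL (Fin (2*m+1)) F) := SOgrp F (2*m+1) (Jmat F (2*m+1))

/-- The underlying matrix of an element of a special orthogonal group. -/
def mat {m : ℕ} {Jm : Matrix (Fin m) (Fin m) F} (g : SOgrp F m Jm) :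
    Matrix (Fin m) (Fin m) F :=
  ((g : GL (Fin m) F) : Matrix (Fin m) (Fin m) F)

/-- Upper triangular unipotent predicate for matrices. -/
def upUnip {m : ℕ} (M : Matrix (Fin m) (Fin m) F) : Prop :=
  ∀ i j : Fin m, (j : ℕ) ≤ (i : ℕ) → M i j = if i = j then 1 else 0

/-- The upper triangular unipotent subgroup (as a set) of `SO_{2l}`. -/
def USet (l : ℕ) (ρ : F) : Set (SO2l F l ρ) := {u | upUnip F (mat F u)}

/-- The upper triangular unipotent matrices in `SO_{2m+1}` (matrix level). -/
def UoddMatSet (m : ℕ) : Set (Matrix (Fin (2*m+1)) (Fin (2*m+1)) F) :=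
  {g | g ∈ SOset F (2*m+1) (Jmat F (2*m+1)) ∧ upUnip F g}

/-- The generic character of the upper unipotent subgroup of `SO_{2l}`:
`ψ(u_{1,2} + ⋯ + u_{l-2,l-1} + (1/2)·u_{l-1,l+1})` (1-indexed). -/
def psiU (l : ℕ) (ψ : AddChar F ℂ) (M : Matrix (Fin (2*l)) (Fin (2*l)) F) : ℂ :=
  ψ (∑ i : Fin (2*l), ∑ j : Fin (2*l),
    (if (j : ℕ) = (i : ℕ) + 1 ∧ (i : ℕ) + 3 ≤ l then M i j
     else if (i : ℕ) + 2 = l ∧ (j : ℕ) = l then (2 : F)⁻¹ * M i j else 0))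

/-- The sum `u_{1,2} + ⋯ + u_{n-1,n}` for an `n × n` matrix. -/
def glUSum (n : ℕ) (M : Matrix (Fin n) (Fin n) F) : F :=
  ∑ i : Fin n, ∑ j : Fin n, (if (j : ℕ) = (i : ℕ) + 1 then M i j else 0)

/-- The character `ψ_γ` of `N^{l-n}`:
`ψ(Σ_{i=1}^{l-n-1} v_{i,i+1} + (1/2)·v_{l-n-1,l+1})` (1-indexed). -/
def psiGam (l n : ℕ) (ψ : AddChar F ℂ) (M : Matrix (Fin (2*l)) (Fin (2*l)) F) : ℂ :=
  ψ (∑ i : Fin (2*l), ∑ j : Fin (2*l),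
    (if (j : ℕ) = (i : ℕ) + 1 ∧ (i : ℕ) + 2 + n ≤ l then M i j
     else if (i : ℕ) + 2 + n = l ∧ (j : ℕ) = l then (2 : F)⁻¹ * M i j else 0))

/-- Irreducibility of a representation. -/
def IsIrrep {G V : Type*} [Group G] [AddCommGroup V] [Module ℂ V]
    (π : Representation ℂ G V) : Prop :=
  (∃ v : V, v ≠ 0) ∧
    ∀ W : Submodule ℂ V, (∀ g : G, ∀ v ∈ W, π g v ∈ W) → W = ⊥ ∨ W = ⊤

/-- Block index function determined by a set `C` of cuts (and their mirrors) for `SO_{2l}`. -/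
def blkCut (l : ℕ) (C : Finset ℕ) (i : ℕ) : ℕ :=
  (C.filter (fun c => c ≤ i)).card + (C.filter (fun c => 2*l - c ≤ i)).card

/-- The unipotent radical of the standard parabolic subgroup of `SO_{2l}` given by cuts `C`. -/
def cuspUnip (l : ℕ) (ρ : F) (C : Finset ℕ) : Set (SO2l F l ρ) :=
  {g | ∀ i j : Fin (2*l), blkCut l C (j : ℕ) ≤ blkCut l C (i : ℕ) →
    mat F g i j = if i = j then 1 else 0}

/-- Cuspidality: the full unipotent-radical sums vanish for every proper standard parabolic. -/
def IsCuspidal (l : ℕ) (ρ : F) {V : Type*} [AddCommGroup V] [Module ℂ V]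
    (π : Representation ℂ (SO2l F l ρ) V) : Prop :=
  ∀ C : Finset ℕ, C.Nonempty → (∀ c ∈ C, 1 ≤ c ∧ c ≤ l - 1) →
    ∀ v : V, (∑ᶠ u ∈ cuspUnip F l ρ C, π u v) = 0

/-- `Γ` is a (nonzero) `ψ`-Whittaker functional for `π`. -/
def IsWhittaker (l : ℕ) (ρ : F) (ψ : AddChar F ℂ) {V : Type*} [AddCommGroup V] [Module ℂ V]
    (π : Representation ℂ (SO2l F l ρ) V) (Γ : V →ₗ[ℂ] ℂ) : Prop :=
  Γ ≠ 0 ∧ ∀ u ∈ USet F l ρ, ∀ v : V, Γ (π u v) = psiU F l ψ (mat F u) * Γ v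

/-- `v₀` is a Whittaker vector with `Γ v₀ ≠ 0`. -/
def IsWhitVec (l : ℕ) (ρ : F) (ψ : AddChar F ℂ) {V : Type*} [AddCommGroup V] [Module ℂ V]
    (π : Representation ℂ (SO2l F l ρ) V) (Γ : V →ₗ[ℂ] ℂ) (v₀ : V) : Prop :=
  Γ v₀ ≠ 0 ∧ ∀ u ∈ USet F l ρ, π u v₀ = psiU F l ψ (mat F u) • v₀

/-- The normalized Bessel function attached to the Whittaker data `(Γ, v₀)`. -/
def Bessel (l : ℕ) (ρ : F) {V : Type*} [AddCommGroup V] [Module ℂ V]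
    (π : Representation ℂ (SO2l F l ρ) V) (Γ : V →ₗ[ℂ] ℂ) (v₀ : V) :
    SO2l F l ρ → ℂ :=
  fun g => Γ (π g v₀) / Γ v₀

/-- Equality of central characters. -/
def SameCentralChar (l : ℕ) (ρ : F) {V V' : Type*} [AddCommGroup V] [Module ℂ V]
    [AddCommGroup V'] [Module ℂ V'] (π : Representation ℂ (SO2l F l ρ) V)
    (π' : Representation ℂ (SO2l F l ρ) V') : Prop :=
  ∃ ω : ℂ, (∀ g : SO2l F l ρ, mat F g = -1 → ∀ v : V, π g v = ω • v) ∧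
    (∀ g : SO2l F l ρ, mat F g = -1 → ∀ v' : V', π' g v' = ω • v')
/-- `a^* = J_n · (a⁻¹)ᵀ · J_n`. -/
def aStar (n : ℕ) (a : Matrix (Fin n) (Fin n) F) : Matrix (Fin n) (Fin n) F :=
  Jmat F n * (a⁻¹)ᵀ * Jmat F n

/-- The permutation matrix of `σ`. -/
def permMat (n : ℕ) (σ : Equiv.Perm (Fin n)) : Matrix (Fin n) (Fin n) F :=
  Matrix.of fun i j => if σ j = i then 1 else 0

/-- `t_n(a) = diag(a, I_{2l-2n}, a^*)` inside `2l × 2l` matrices. -/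
def tnMat (l n : ℕ) (a : Matrix (Fin n) (Fin n) F) : Matrix (Fin (2*l)) (Fin (2*l)) F :=
  Matrix.of fun i j =>
    if hi : (i : ℕ) < n then (if hj : (j : ℕ) < n then a ⟨i, hi⟩ ⟨j, hj⟩ else 0)
    else if hi2 : (i : ℕ) < 2*l - n then (if i = j then 1 else 0)
    else if hj2 : 2*l - n ≤ (j : ℕ) then
      aStar F n a ⟨(i : ℕ) - (2*l - n), by have := i.isLt; omega⟩
        ⟨(j : ℕ) - (2*l - n), by have := j.isLt; omega⟩
    else 0

/-- The Weyl representative `w̃_n` of `SO_{2l}` as a block matrix. -/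
def wTildeMat (l n : ℕ) : Matrix (Fin (2*l)) (Fin (2*l)) F :=
  Matrix.of fun i j =>
    if (i : ℕ) < n then (if (j : ℕ) = (i : ℕ) + (2*l - n) then 1 else 0)
    else if (i : ℕ) < l - 1 then (if i = j then 1 else 0)
    else if (i : ℕ) = l - 1 then (if i = j then (-1)^n else 0)
    else if (i : ℕ) < 2*l - n then (if i = j then 1 else 0)
    else (if (j : ℕ) + (2*l - n) = (i : ℕ) then 1 else 0)

/-- The torus matrix `diag(t_1,…,t_{l-1}, [[a,bρ],[b,a]], t_{l-1}⁻¹,…,t_1⁻¹)`. -/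
def torusMat (l : ℕ) (ρ : F) (tv : ℕ → Fˣ) (a b : F) :
    Matrix (Fin (2*l)) (Fin (2*l)) F :=
  Matrix.of fun i j =>
    if (i : ℕ) < l - 1 then (if i = j then (tv (i : ℕ) : F) else 0)
    else if (i : ℕ) = l - 1 then
      (if (j : ℕ) = l - 1 then a else if (j : ℕ) = l then b * ρ else 0)
    else if (i : ℕ) = l then
      (if (j : ℕ) = l - 1 then b else if (j : ℕ) = l then a else 0)
    else (if i = j then ((tv (2*l - 1 - (i : ℕ)))⁻¹ : F) else 0)

/-- The outer element `c = diag(I_{l-1}, 1, -1, I_{l-1})`. -/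
def cMat (l : ℕ) : Matrix (Fin (2*l)) (Fin (2*l)) F :=
  Matrix.of fun i j => if i = j then (if (i : ℕ) = l then -1 else 1) else 0

/-- The torus element `t̃ = diag(I_{l-1}, -1, -1, I_{l-1})`. -/
def tTildeMat (l : ℕ) : Matrix (Fin (2*l)) (Fin (2*l)) F :=
  Matrix.of fun i j =>
    if i = j then (if (i : ℕ) = l - 1 ∨ (i : ℕ) = l then -1 else 1) else 0

/-- `l_n(a) = diag(a, 1, a^*)` inside `(2n+1) × (2n+1)` matrices. -/
def lnMat (n : ℕ) (a : Matrix (Fin n) (Fin n) F) :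
    Matrix (Fin (2*n+1)) (Fin (2*n+1)) F :=
  Matrix.of fun i j =>
    if hi : (i : ℕ) < n then (if hj : (j : ℕ) < n then a ⟨i, hi⟩ ⟨j, hj⟩ else 0)
    else if hi2 : (i : ℕ) = n then (if i = j then 1 else 0)
    else if hj2 : n + 1 ≤ (j : ℕ) then
      aStar F n a ⟨(i : ℕ) - (n+1), by have := i.isLt; omega⟩
        ⟨(j : ℕ) - (n+1), by have := j.isLt; omega⟩
    else 0

/-- The Weyl element `w_n` of `SO_{2n+1}` with block rows `(0,0,I_n)`, `(0,(-1)^n,0)`, `(I_n,0,0)`. -/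
def wnOddMat (n : ℕ) : Matrix (Fin (2*n+1)) (Fin (2*n+1)) F :=
  Matrix.of fun i j =>
    if (i : ℕ) < n then (if (j : ℕ) = (i : ℕ) + n + 1 then 1 else 0)
    else if (i : ℕ) = n then (if i = j then (-1)^n else 0)
    else (if (j : ℕ) + n + 1 = (i : ℕ) then 1 else 0)

/-- `d_n = diag(-1, 1, …, (-1)^n)`. -/
def dnMat (n : ℕ) : Matrix (Fin n) (Fin n) F :=
  Matrix.of fun i j => if i = j then (-1)^((i : ℕ) + 1) else 0

/-- The block permutation matrix `w^{l,n}` of `SO_{2l}`. -/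
def wlnMat (l n : ℕ) : Matrix (Fin (2*l)) (Fin (2*l)) F :=
  Matrix.of fun i j =>
    if (i : ℕ) < n then (if (j : ℕ) = (i : ℕ) + (l - n - 1) then 1 else 0)
    else if (i : ℕ) < l - 1 then (if (j : ℕ) + n = (i : ℕ) then 1 else 0)
    else if (i : ℕ) < l + 1 then (if i = j then 1 else 0)
    else if (i : ℕ) < 2*l - n then (if (j : ℕ) = (i : ℕ) + n then 1 else 0)
    else (if (j : ℕ) + (l - n - 1) = (i : ℕ) then 1 else 0)

/-- `w_{l,l} = diag(γ·I_l, 1, γ⁻¹·I_l)` with `γ = ρ/2`. -/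
def wllMat (l : ℕ) (ρ : F) : Matrix (Fin (2*l+1)) (Fin (2*l+1)) F :=
  Matrix.of fun i j =>
    if i = j then
      (if (i : ℕ) < l then ρ/2 else if (i : ℕ) = l then 1 else (ρ/2)⁻¹)
    else 0

/-- The conjugating matrix `M` for the embedding of `SO_{2l}` into `SO_{2l+1}`. -/
def Mtop (l : ℕ) (ρ : F) : Matrix (Fin (2*l+1)) (Fin (2*l+1)) F :=
  Matrix.of fun i j =>
    if (i : ℕ) + 2 = l + 1 then (if (j : ℕ) = l then 1 else 0)
    else if (i : ℕ) = l then
      (if (j : ℕ) + 2 = l + 1 then (2 : F)⁻¹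
       else if (j : ℕ) = l + 1 then (2 * (ρ/2))⁻¹ else 0)
    else if (i : ℕ) = l + 1 then
      (if (j : ℕ) + 2 = l + 1 then (2 : F)⁻¹
       else if (j : ℕ) = l + 1 then -(2 * (ρ/2))⁻¹ else 0)
    else if i = j then 1 else 0

/-- Insert a trivial `(l+1)`-st row and column (1-indexed) into a `2l × 2l` matrix. -/
def insTop (l : ℕ) (g : Matrix (Fin (2*l)) (Fin (2*l)) F) :
    Matrix (Fin (2*l+1)) (Fin (2*l+1)) F :=
  Matrix.of fun i j =>
    if hi : (i : ℕ) = l then (if (j : ℕ) = l then 1 else 0)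
    else if hj : (j : ℕ) = l then 0
    else
      g ⟨if (i : ℕ) < l then (i : ℕ) else (i : ℕ) - 1, by have := i.isLt; split <;> omega⟩
        ⟨if (j : ℕ) < l then (j : ℕ) else (j : ℕ) - 1, by have := j.isLt; split <;> omega⟩

/-- The embedding of `SO_{2l}` into `SO_{2l+1}` at the matrix level. -/
def embTop (l : ℕ) (ρ : F) (g : Matrix (Fin (2*l)) (Fin (2*l)) F) :
    Matrix (Fin (2*l+1)) (Fin (2*l+1)) F :=
  (Mtop F l ρ)⁻¹ * insTop F l g * Mtop F l ρ

/-- The conjugating matrix `M = diag(I_n, [[0,2],[1,0]], I_n)` (size `2n+2`). -/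
def Mlow (n : ℕ) : Matrix (Fin (2*n+2)) (Fin (2*n+2)) F :=
  Matrix.of fun i j =>
    if (i : ℕ) = n then (if (j : ℕ) = n + 1 then 2 else 0)
    else if (i : ℕ) = n + 1 then (if (j : ℕ) = n then 1 else 0)
    else if i = j then 1 else 0

/-- Insert a trivial `(n+2)`-nd row and column (1-indexed) into a `(2n+1) × (2n+1)` matrix. -/
def insLow (n : ℕ) (g : Matrix (Fin (2*n+1)) (Fin (2*n+1)) F) :
    Matrix (Fin (2*n+2)) (Fin (2*n+2)) F :=
  Matrix.of fun i j =>
    if hi : (i : ℕ) = n + 1 then (if (j : ℕ) = n + 1 then 1 else 0)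
    else if hj : (j : ℕ) = n + 1 then 0
    else
      g ⟨if (i : ℕ) < n + 1 then (i : ℕ) else (i : ℕ) - 1, by have := i.isLt; split <;> omega⟩
        ⟨if (j : ℕ) < n + 1 then (j : ℕ) else (j : ℕ) - 1, by have := j.isLt; split <;> omega⟩

/-- The middle `2n+2` block of the embedding of `SO_{2n+1}` into `SO_{2l}`. -/
def embLowMid (n : ℕ) (g : Matrix (Fin (2*n+1)) (Fin (2*n+1)) F) :
    Matrix (Fin (2*n+2)) (Fin (2*n+2)) F :=
  (Mlow F n)⁻¹ * insLow F n g * Mlow F n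

/-- The embedding of `SO_{2n+1}` into `SO_{2l}` (for `n < l`) at the matrix level. -/
def embLow (l n : ℕ) (g : Matrix (Fin (2*n+1)) (Fin (2*n+1)) F) :
    Matrix (Fin (2*l)) (Fin (2*l)) F :=
  Matrix.of fun i j =>
    if h : l - n - 1 ≤ (i : ℕ) ∧ (i : ℕ) < l + n + 1 ∧ l - n - 1 ≤ (j : ℕ) ∧ (j : ℕ) < l + n + 1
    then embLowMid F n g ⟨(i : ℕ) - (l - n - 1), by omega⟩ ⟨(j : ℕ) - (l - n - 1), by omega⟩
    else if i = j then 1 else 0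
/-- The maximal torus `T` of `SO_{2l}`. -/
def TSet (l : ℕ) (ρ : F) : Set (SO2l F l ρ) :=
  {g | ∃ (tv : ℕ → Fˣ) (a b : F), a^2 - b^2 * ρ = 1 ∧ mat F g = torusMat F l ρ tv a b}

/-- The split subtorus `S` of `T`. -/
def SSet (l : ℕ) (ρ : F) : Set (SO2l F l ρ) :=
  {g | ∃ tv : ℕ → Fˣ, mat F g = torusMat F l ρ tv 1 0}

/-- The standard Borel subgroup `B = T·U` of `SO_{2l}` (as a set). -/
def BorelSet (l : ℕ) (ρ : F) : Set (SO2l F l ρ) :=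
  {b | ∃ t ∈ TSet F l ρ, ∃ u ∈ USet F l ρ, b = t * u}

/-- `w` normalizes the torus `T`. -/
def NormalizesT (l : ℕ) (ρ : F) (w : SO2l F l ρ) : Prop :=
  ∀ t ∈ TSet F l ρ, w * t * w⁻¹ ∈ TSet F l ρ ∧ w⁻¹ * t * w ∈ TSet F l ρ

/-- Standard basis weight `e_k` (as an integral character vector). -/
def eVec (k : ℕ) : ℕ → ℤ := fun i => if i = k then 1 else 0

/-- The simple (restricted) roots of `SO_{2l}`: `α_k = e_k - e_{k+1}` for `k < l-2`
(0-indexed) and `α_{l-2} = e_{l-2}`. -/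
def simpleRoot (l k : ℕ) : ℕ → ℤ :=
  fun i => (if i = k then 1 else 0) - (if i = k + 1 ∧ k + 3 ≤ l then 1 else 0)

/-- The positive (restricted) roots of `SO_{2l}` (type `B_{l-1}`). -/
def posRoot (l : ℕ) : Set (ℕ → ℤ) :=
  {α | (∃ i j, i < j ∧ j < l - 1 ∧ α = fun k => eVec i k - eVec j k) ∨
       (∃ i j, i < j ∧ j < l - 1 ∧ α = fun k => eVec i k + eVec j k) ∨
       (∃ i, i < l - 1 ∧ α = eVec i)}

/-- Negative roots. -/
def negRoot (l : ℕ) : Set (ℕ → ℤ) := {α | (fun k => -(α k)) ∈ posRoot l}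

/-- Simple roots (as a set). -/
def isSimpleRoot (l : ℕ) (α : ℕ → ℤ) : Prop := ∃ k, k < l - 1 ∧ α = simpleRoot l k

/-- Evaluation of an integral character vector on an element of the split torus. -/
def rootEval (l : ℕ) (ρ : F) (α : ℕ → ℤ) (g : SO2l F l ρ) : F :=
  ∏ i : Fin (2*l), (if (i : ℕ) < l - 1 then (mat F g i i) ^ (α (i : ℕ)) else 1)

/-- The Weyl representative `w` maps the character `α` of `S` to the character `β`. -/
def mapsRoot (l : ℕ) (ρ : F) (w : SO2l F l ρ) (α β : ℕ → ℤ) : Prop :=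
  ∀ s ∈ SSet F l ρ, w⁻¹ * s * w ∈ SSet F l ρ ∧
    rootEval F l ρ β s = rootEval F l ρ α (w⁻¹ * s * w)

/-- The Weyl representative `w` supports Bessel functions: every simple root is mapped
to a negative or simple root. -/
def SupportsBessel (l : ℕ) (ρ : F) (w : SO2l F l ρ) : Prop :=
  ∀ k, k < l - 1 → ∃ β : ℕ → ℤ, mapsRoot F l ρ w (simpleRoot l k) β ∧
    (β ∈ negRoot l ∨ isSimpleRoot l β)

/-- `θ_w = {k : wα_k is positive}`. -/
def besselTheta (l : ℕ) (ρ : F) (w : SO2l F l ρ) : Set ℕ :=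
  {k | k < l - 1 ∧ ∃ β : ℕ → ℤ, mapsRoot F l ρ w (simpleRoot l k) β ∧ β ∈ posRoot l}

/-- The cell `B_n(SO_{2l}) = {t_n(w')·w̃_n : w' ∈ W(GL_n)}`. -/
def BnSet (l : ℕ) (ρ : F) (n : ℕ) : Set (SO2l F l ρ) :=
  {g | ∃ σ : Equiv.Perm (Fin n), mat F g = tnMat F l n (permMat F n σ) * wTildeMat F l n}

/-- Block index for the Siegel parabolic of `SO_{2n+1}`. -/
def blkSiegel (n i : ℕ) : ℕ := if i < n then 0 else if i = n then 1 else 2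

/-- The unipotent radical `V_n` of the Siegel parabolic of `SO_{2n+1}` (matrix level). -/
def VnSet (n : ℕ) : Set (Matrix (Fin (2*n+1)) (Fin (2*n+1)) F) :=
  {m | m ∈ SOset F (2*n+1) (Jmat F (2*n+1)) ∧
    ∀ i j : Fin (2*n+1), blkSiegel n (j : ℕ) ≤ blkSiegel n (i : ℕ) →
      m i j = if i = j then 1 else 0}

/-- The group `R^{l,n}` (matrix level). -/
def RlnSet (l : ℕ) (ρ : F) (n : ℕ) : Set (Matrix (Fin (2*l)) (Fin (2*l)) F) :=
  {m | m ∈ SOset F (2*l) (Jrho F l ρ) ∧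
    ∀ i j : Fin (2*l),
      ¬((n ≤ (i : ℕ) ∧ (i : ℕ) < l - 1 ∧ (j : ℕ) < n) ∨
        (2*l - n ≤ (i : ℕ) ∧ l + 1 ≤ (j : ℕ) ∧ (j : ℕ) < 2*l - n)) →
      m i j = if i = j then 1 else 0}

/-- The subgroup `N^{l-n} = U_{GL_{l-n-1}}·N_{l-n-1}` of `SO_{2l}`. -/
def NlnSet (l : ℕ) (ρ : F) (n : ℕ) : Set (SO2l F l ρ) :=
  {g | upUnip F (mat F g) ∧
    ∀ i j : Fin (2*l), l - n - 1 ≤ (i : ℕ) → (i : ℕ) < l + n + 1 →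
      l - n - 1 ≤ (j : ℕ) → (j : ℕ) < l + n + 1 →
      mat F g i j = if i = j then 1 else 0}

/-- Block index for standard parabolic subgroups of `SO_{2m+1}`, given cuts `C`. -/
def blkB (m : ℕ) (C : Finset ℕ) (i : ℕ) : ℕ :=
  (C.filter (fun c => c ≤ i)).card + (C.filter (fun c => 2*m + 1 - c ≤ i)).card

/-- The standard parabolic subgroup of `SO_{2m+1}` given by cuts `C` (as a set). -/
def pbP (m : ℕ) (C : Finset ℕ) : Set (SOodd F m) :=
  {g | ∀ i j : Fin (2*m+1), blkB m C (j : ℕ) < blkB m C (i : ℕ) → mat F g i j = 0}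

/-- The unipotent radical of the standard parabolic subgroup of `SO_{2m+1}` given by cuts `C`. -/
def pbV (m : ℕ) (C : Finset ℕ) : Set (SOodd F m) :=
  {g | ∀ i j : Fin (2*m+1), blkB m C (j : ℕ) ≤ blkB m C (i : ℕ) →
    mat F g i j = if i = j then 1 else 0}
/-- Apply a representation of `GL_n(F)` at a plain matrix (zero if not invertible). -/
def tauApp (n : ℕ) {Wτ : Type*} [AddCommGroup Wτ] [Module ℂ Wτ]
    (τ : Representation ℂ (GL (Fin n) F) Wτ) (m : Matrix (Fin n) (Fin n) F) :
    Wτ →ₗ[ℂ] Wτ :=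
  matFun (fun g : GL (Fin n) F => (g : Matrix (Fin n) (Fin n) F)) (fun g => τ g) m

/-- `Λ` is a nonzero `ψ⁻¹`-Whittaker functional for the representation `τ` of `GL_n(F)`. -/
def IsGenericGLinv (n : ℕ) (ψ : AddChar F ℂ) {Wτ : Type*} [AddCommGroup Wτ] [Module ℂ Wτ]
    (τ : Representation ℂ (GL (Fin n) F) Wτ) (Λ : Wτ →ₗ[ℂ] ℂ) : Prop :=
  Λ ≠ 0 ∧ ∀ u : GL (Fin n) F, upUnip F ((u : Matrix (Fin n) (Fin n) F)) →
    ∀ x : Wτ, Λ (τ u x) = ψ (-(glUSum F n (u : Matrix (Fin n) (Fin n) F))) * Λ x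

/-- The induced space `I(τ) = Ind_{Q_n}^{SO_{2n+1}} τ` (matrix level). -/
def IndTau (n : ℕ) {Wτ : Type*} [AddCommGroup Wτ] [Module ℂ Wτ]
    (τ : Representation ℂ (GL (Fin n) F) Wτ) :
    Set (Matrix (Fin (2*n+1)) (Fin (2*n+1)) F → Wτ) :=
  {ξ | (∀ g, g ∉ SOset F (2*n+1) (Jmat F (2*n+1)) → ξ g = 0) ∧
    ∀ a : GL (Fin n) F, ∀ u ∈ VnSet F n, ∀ g,
      ξ (lnMat F n (a : Matrix (Fin n) (Fin n) F) * u * g) = τ a (ξ g)}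

/-- The space `I(τ, ψ⁻¹)` spanned by the functions `f_ξ(g,a) = Λ(τ(a)ξ(g))`. -/
def Imodel (n : ℕ) {Wτ : Type*} [AddCommGroup Wτ] [Module ℂ Wτ]
    (τ : Representation ℂ (GL (Fin n) F) Wτ) (Λ : Wτ →ₗ[ℂ] ℂ) :
    Set (Matrix (Fin (2*n+1)) (Fin (2*n+1)) F → Matrix (Fin n) (Fin n) F → ℂ) :=
  {f | ∃ ξ ∈ IndTau F n τ, f = fun g a => Λ (tauApp F n τ a (ξ g))}

open Classical in
/-- The section `ξ_v ∈ I(τ)` supported on the Siegel parabolic with `ξ_v(l_n(a)u) = τ(a)v`. -/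
def xiv (n : ℕ) {Wτ : Type*} [AddCommGroup Wτ] [Module ℂ Wτ]
    (τ : Representation ℂ (GL (Fin n) F) Wτ) (v : Wτ) :
    Matrix (Fin (2*n+1)) (Fin (2*n+1)) F → Wτ :=
  fun m =>
    if h : ∃ p : (GL (Fin n) F) × Matrix (Fin (2*n+1)) (Fin (2*n+1)) F,
        p.2 ∈ VnSet F n ∧ m = lnMat F n ((p.1 : Matrix (Fin n) (Fin n) F)) * p.2
    then τ h.choose.1 v else 0

/-- The function `f_v = f_{ξ_v} ∈ I(τ, ψ⁻¹)`. -/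
def fvFun (n : ℕ) {Wτ : Type*} [AddCommGroup Wτ] [Module ℂ Wτ]
    (τ : Representation ℂ (GL (Fin n) F) Wτ) (Λ : Wτ →ₗ[ℂ] ℂ) (v : Wτ) :
    Matrix (Fin (2*n+1)) (Fin (2*n+1)) F → Matrix (Fin n) (Fin n) F → ℂ :=
  fun g a => Λ (tauApp F n τ a (xiv F n τ v g))

/-- The intertwining operator `M(τ, ψ⁻¹)` at the level of functions. -/
def MOp (n : ℕ)
    (f : Matrix (Fin (2*n+1)) (Fin (2*n+1)) F → Matrix (Fin n) (Fin n) F → ℂ) :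
    Matrix (Fin (2*n+1)) (Fin (2*n+1)) F → Matrix (Fin n) (Fin n) F → ℂ :=
  fun h a => ∑ᶠ u ∈ VnSet F n, f (wnOddMat F n * u * h) (dnMat F n * aStar F n a)

/-- The zeta integral for `n < l`, via the embedding `SO_{2n+1} → SO_{2l}`
(the sum over coset representatives is realized as `|U|⁻¹` times the full sum). -/
def ZetaLow (l : ℕ) (ρ : F) (n : ℕ) (φ : SO2l F l ρ → ℂ)
    (f : Matrix (Fin (2*n+1)) (Fin (2*n+1)) F → Matrix (Fin n) (Fin n) F → ℂ) : ℂ :=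
  (Nat.card (UoddMatSet F n) : ℂ)⁻¹ *
    ∑ᶠ g ∈ SOset F (2*n+1) (Jmat F (2*n+1)),
      (∑ᶠ r ∈ RlnSet F l ρ n,
        matFun (fun x : SO2l F l ρ => mat F x) φ
          (r * wlnMat F l n * embLow F l n g * (wlnMat F l n)⁻¹)) * f g 1

/-- The zeta integral for `n = l`, via the embedding `SO_{2l} → SO_{2l+1}`. -/
def ZetaTop (l : ℕ) (ρ : F) (φ : SO2l F l ρ → ℂ)
    (f : Matrix (Fin (2*l+1)) (Fin (2*l+1)) F → Matrix (Fin l) (Fin l) F → ℂ) : ℂ :=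
  (Nat.card (USet F l ρ) : ℂ)⁻¹ *
    ∑ᶠ g : SO2l F l ρ, φ g * f (wllMat F l ρ * embTop F l ρ (mat F g)) 1

/-- The combined zeta integral `Ψ` for `1 ≤ n ≤ l`. -/
def Zeta (l : ℕ) (ρ : F) (n : ℕ) (φ : SO2l F l ρ → ℂ)
    (f : Matrix (Fin (2*n+1)) (Fin (2*n+1)) F → Matrix (Fin n) (Fin n) F → ℂ) : ℂ :=
  if n < l then ZetaLow F l ρ n φ f
  else if h : n = l then ZetaTop F l ρ φ (cast (by rw [h]) f)
  else 0

/-- `c` is the gamma factor `γ(π × τ, ψ)`: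
`c · Ψ(W_v, f) = Ψ(W_v, M(τ,ψ⁻¹) f)` for all Whittaker functions `W_v` of `π`
and all `f ∈ I(τ, ψ⁻¹)`. -/
def IsGamma (l : ℕ) (ρ : F) (n : ℕ) {V : Type*} [AddCommGroup V] [Module ℂ V]
    (π : Representation ℂ (SO2l F l ρ) V) (Γ : V →ₗ[ℂ] ℂ)
    {Wτ : Type*} [AddCommGroup Wτ] [Module ℂ Wτ]
    (τ : Representation ℂ (GL (Fin n) F) Wτ) (Λ : Wτ →ₗ[ℂ] ℂ) (c : ℂ) : Prop :=
  ∀ v : V, ∀ f ∈ Imodel F n τ Λ,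
    c * Zeta F l ρ n (fun g => Γ (π g v)) f =
      Zeta F l ρ n (fun g => Γ (π g v)) (MOp F n f)

/-- The Bessel function of the conjugate representation `π^c`:
`B_{π^c,ψ}(g) = B_{π,ψ}(c·t̃⁻¹·g·t̃·c)`. -/
def BesselConj (l : ℕ) (ρ : F) (B : SO2l F l ρ → ℂ) : SO2l F l ρ → ℂ :=
  fun g => matFun (fun x : SO2l F l ρ => mat F x) B
    (cMat F l * (tTildeMat F l)⁻¹ * mat F g * tTildeMat F l * cMat F l)

section

variable {F : Type} [Field F] [Fintype F]

set_option linter.unusedSectionVars false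

/-- A self-map of `{0,…,N-1}` all of whose ascents are steps by one is, up to reversal,
an involution; data constant along ascents is invariant under the reversed map. -/
theorem reversal_of_unit_ascents {X : Type*} (N : ℕ) (σ : ℕ → ℕ) (s : ℕ → X)
    (hmap : ∀ i < N, σ i < N) (hinj : ∀ i < N, ∀ j < N, σ i = σ j → i = j)
    (hasc : ∀ i, i + 1 < N → σ (i + 1) < σ i ∨ (σ (i + 1) = σ i + 1 ∧ s (i + 1) = s i)) :
    ∀ i < N, σ (N - 1 - σ i) = N - 1 - i ∧ s (N - 1 - σ i) = s i := by
  induction N using Nat.strong_induction_on generalizing σ s with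
  | _ N ih =>
  rcases Nat.eq_zero_or_pos N with rfl | hN
  · intro i hi; omega
  -- the index where the maximum is attained
  obtain ⟨m, hm, hσm⟩ : ∃ m < N, σ m = N - 1 := by
    have hb : Function.Surjective (fun i : Fin N => (⟨σ i, hmap i i.2⟩ : Fin N)) := by
      apply Finite.surjective_of_injective
      intro i j hij
      exact Fin.ext (hinj i i.2 j j.2 (by simpa using hij))
    obtain ⟨i, hi⟩ := hb ⟨N - 1, by omega⟩
    exact ⟨i, i.2, by simpa using hi⟩
  have hrun : ∀ k ≤ m, σ (m - k) + k = N - 1 ∧ s (m - k) = s m := by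
    intro k
    induction k using Nat.strong_induction_on with
    | _ k ihk =>
    intro hk
    rcases Nat.eq_zero_or_pos k with rfl | hk0
    · simp [hσm]
    obtain ⟨h1, h2⟩ := ihk (k - 1) (by omega) (by omega)
    have e : m - (k - 1) = m - k + 1 := by omega
    rw [e] at h1 h2
    rcases hasc (m - k) (by omega) with h | ⟨h, h'⟩
    · exfalso
      have hlt := hmap (m - k) (by omega)
      set d := σ (m - k) with hd
      obtain ⟨h3, -⟩ := ihk (N - 1 - d) (by omega) (by omega)
      have := hinj (m - (N - 1 - d)) (by omega) (m - k) (by omega) (by omega)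
      omega
    · exact ⟨by omega, by rw [← h', h2]⟩
  have hrun' : ∀ i ≤ m, σ i = N - 1 - m + i ∧ s i = s m := by
    intro i hi
    obtain ⟨h1, h2⟩ := hrun (m - i) (by omega)
    have e : m - (m - i) = i := by omega
    rw [e] at h1 h2
    exact ⟨by omega, h2⟩
  have hrest : ∀ i < N, m < i → σ i < N - 1 - m := by
    intro i hi hmi
    by_contra hcon
    have h1 := hmap i hi
    have h2 := (hrun' (σ i - (N - 1 - m)) (by omega)).1
    have := hinj (σ i - (N - 1 - m)) (by omega) i hi (by omega)
    omega
  have key := ih (N - 1 - m) (by omega) (fun i => σ (i + (m + 1))) (fun i => s (i + (m + 1)))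
    (fun i hi => hrest _ (by omega) (by omega))
    (fun i hi j hj hij => by
      have := hinj _ (by omega) _ (by omega) hij
      omega)
    (fun i hi => by
      have := hasc (i + (m + 1)) (by omega)
      rwa [show i + (m + 1) + 1 = i + 1 + (m + 1) by omega] at this)
  intro i hi
  rcases le_or_gt i m with him | him
  · obtain ⟨h1, h2⟩ := hrun' i him
    have e : N - 1 - σ i = m - i := by omega
    rw [e]
    obtain ⟨h3, h4⟩ := hrun' (m - i) (by omega)
    exact ⟨by omega, by rw [h4, h2]⟩
  · have h0 := hrest i hi him
    obtain ⟨h1, h2⟩ := key (i - (m + 1)) (by omega)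
    have e : i - (m + 1) + (m + 1) = i := by omega
    rw [e] at h1 h2
    have e2 : N - 1 - m - 1 - σ i + (m + 1) = N - 1 - σ i := by omega
    rw [e2] at h1 h2
    exact ⟨by omega, h2⟩

section Gelfand

variable {G V : Type*} [Group G] [Finite G] [AddCommGroup V] [Module ℂ V]

/-- An irreducible representation is spanned by the orbit of any nonzero vector. -/
theorem IsIrrep.span_orbit {G V : Type*} [Group G] [AddCommGroup V] [Module ℂ V]
    {π : Representation ℂ G V} (h : IsIrrep π) {w : V}
    (hw : w ≠ 0) : Submodule.span ℂ (Set.range fun g => π g w) = ⊤ := by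
  have hst : ∀ g : G, ∀ v ∈ Submodule.span ℂ (Set.range fun g => π g w),
      π g v ∈ Submodule.span ℂ (Set.range fun g => π g w) := by
    intro g v hv
    induction hv using Submodule.span_induction with
    | mem x hx =>
      obtain ⟨k, rfl⟩ := hx
      exact Submodule.subset_span ⟨g * k, by simp⟩
    | zero => simp
    | add x y _ _ hx hy => rw [map_add]; exact Submodule.add_mem _ hx hy
    | smul c x _ hx => rw [map_smul]; exact Submodule.smul_mem _ _ hx
  rcases h.2 _ hst with h0 | h1
  · exfalso
    apply hw
    have : w ∈ Submodule.span ℂ (Set.range fun g => π g w) :=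
      Submodule.subset_span ⟨1, by simp⟩
    rwa [h0, Submodule.mem_bot] at this
  · exact h1

theorem IsIrrep.finiteDimensional {π : Representation ℂ G V} (h : IsIrrep π) :
    FiniteDimensional ℂ V := by
  obtain ⟨v, hv⟩ := h.1
  rw [FiniteDimensional, Module.finite_def, ← h.span_orbit hv]
  exact Submodule.fg_span (Set.finite_range _)

variable {π : Representation ℂ G V} {U : Subgroup G} {χ : G → ℂ}

/-- Gelfand's trick: if some anti-involution fixes every function that is `(U, χ)`-equivariant
on both sides, then an irreducible representation has at most one `(U, χ)`-functional. -/
theorem equivariant_functional_unique (hπ : IsIrrep π)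
    (hχ0 : ∀ u ∈ U, χ u ≠ 0) (hχ : ∀ u ∈ U, ∀ u' ∈ U, χ (u * u') = χ u * χ u')
    (σ : G → G) (hσmul : ∀ g h, σ (g * h) = σ h * σ g) (hσσ : ∀ g, σ (σ g) = g)
    (hσU : ∀ u ∈ U, σ u ∈ U) (hσχ : ∀ u ∈ U, χ (σ u) = χ u)
    (hfix : ∀ φ : G → ℂ, (∀ u ∈ U, ∀ g, φ (u * g) = χ u * φ g) →
      (∀ u ∈ U, ∀ g, φ (g * u) = χ u * φ g) → ∀ g, φ (σ g) = φ g)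
    (Γ Γ' : V →ₗ[ℂ] ℂ) (hΓ0 : Γ ≠ 0) (hΓ : ∀ u ∈ U, ∀ v, Γ (π u v) = χ u * Γ v)
    (hΓ' : ∀ u ∈ U, ∀ v, Γ' (π u v) = χ u * Γ' v) : ∃ c : ℂ, Γ' = c • Γ := by
  classical
  have := Fintype.ofFinite G
  have hfd := hπ.finiteDimensional
  have hU0 : (Fintype.card U : ℂ) ≠ 0 := by exact_mod_cast Fintype.card_ne_zero
  obtain ⟨e, he⟩ : ∃ e : V →ₗ[ℂ] V,
      ∀ v, e v = (Fintype.card U : ℂ)⁻¹ • ∑ u : U, (χ u)⁻¹ • π u v :=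
    ⟨(Fintype.card U : ℂ)⁻¹ • ∑ u : U, (χ u)⁻¹ • π u, fun v => by simp [LinearMap.sum_apply]⟩
  have hχinv : ∀ u : U, ∀ u' : U, χ (u * u' : U) = χ u * χ u' := fun u u' => hχ u u.2 u' u'.2
  have hef : ∀ (L : V →ₗ[ℂ] ℂ), (∀ u ∈ U, ∀ v, L (π u v) = χ u * L v) → ∀ v, L (e v) = L v := by
    intro L hL v
    rw [he, map_smul, map_sum]
    have : ∀ u : U, L ((χ u)⁻¹ • π u v) = L v := by
      intro u
      rw [map_smul, hL u u.2, smul_eq_mul, inv_mul_cancel_left₀ (hχ0 u u.2)]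
    simp only [this, Finset.sum_const, Finset.card_univ, nsmul_eq_mul, smul_eq_mul]
    rw [inv_mul_cancel_left₀ hU0]
  have heu : ∀ u ∈ U, ∀ v, e (π u v) = χ u • e v := by
    intro u hu v
    rw [he, he, smul_comm (χ u), Finset.smul_sum (r := χ u)]
    congr 1
    refine Fintype.sum_equiv (Equiv.mulRight (⟨u, hu⟩ : U)) _ _ ?_
    intro x
    have h1 : χ ((x * ⟨u, hu⟩ : U) : G) = χ x * χ u := hχ x x.2 u hu
    simp only [Equiv.coe_mulRight, h1]
    rw [smul_smul, _root_.mul_inv_rev, mul_inv_cancel_left₀ (hχ0 u hu)]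
    simp
  have hue : ∀ u ∈ U, ∀ v, π u (e v) = χ u • e v := by
    intro u hu v
    rw [he, map_smul, map_sum, smul_comm (χ u), Finset.smul_sum (r := χ u)]
    congr 1
    refine Fintype.sum_equiv (Equiv.mulLeft (⟨u, hu⟩ : U)) _ _ ?_
    intro x
    have h1 : χ ((⟨u, hu⟩ * x : U) : G) = χ u * χ x := hχ u hu x x.2
    simp only [Equiv.coe_mulLeft, h1, map_smul]
    rw [smul_smul, _root_.mul_inv, mul_inv_cancel_left₀ (hχ0 u hu)]
    simp
  have hee : ∀ v, e (e v) = e v := by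
    intro v
    rw [he (e v)]
    have : ∀ u : U, (χ u)⁻¹ • π u (e v) = e v := by
      intro u
      rw [hue u u.2, smul_smul, inv_mul_cancel₀ (hχ0 u u.2), one_smul]
    simp only [this, Finset.sum_const, Finset.card_univ]
    rw [← Nat.cast_smul_eq_nsmul ℂ, smul_smul, inv_mul_cancel₀ hU0, one_smul]
  have hsym : ∀ (L : V →ₗ[ℂ] ℂ) (v : V) (g : G), L (e (π (σ g) (e v))) = L (e (π g (e v))) := by
    intro L v
    refine hfix (fun g => L (e (π g (e v)))) ?_ ?_
    · intro u hu g
      simp only [map_mul, Module.End.mul_apply]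
      rw [heu u hu, map_smul, smul_eq_mul]
    · intro u hu g
      simp only [map_mul, Module.End.mul_apply]
      rw [hue u hu, map_smul, map_smul, map_smul, smul_eq_mul]
  have hsym' : ∀ (v : V) (g : G), e (π (σ g) (e v)) = e (π g (e v)) := by
    intro v g
    rw [← sub_eq_zero, ← Module.forall_dual_apply_eq_zero_iff ℂ]
    intro L
    rw [map_sub, hsym, sub_self]
  have hexp : ∀ (g h : G) (v : V), e (π g (e (π h (e v)))) =
      (Fintype.card U : ℂ)⁻¹ • ∑ u : U, (χ u)⁻¹ • e (π (g * u * h) (e v)) := by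
    intro g h v
    conv_lhs => rw [he (π h (e v))]
    simp only [map_smul, map_sum, map_mul, Module.End.mul_apply]
  have hcomm : ∀ (g h : G) (v : V), e (π g (e (π h (e v)))) = e (π h (e (π g (e v)))) := by
    intro g h v
    have h1 : e (π h (e (π g (e v)))) = e (π (σ h) (e (π (σ g) (e v)))) := by
      rw [hsym' (π (σ g) (e v)), hsym' v g]
    rw [h1, hexp, hexp]
    congr 1
    have hbij : Function.Bijective (fun u : U => (⟨σ u, hσU u u.2⟩ : U)) := by
      refine Function.Involutive.bijective ?_
      intro u; ext; simp [hσσ]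
    refine Fintype.sum_bijective _ hbij _ _ ?_
    intro u
    simp only [hσχ u u.2]
    rw [← hsym' v (g * u * h), hσmul, hσmul, mul_assoc]
  -- the image of the projection is one-dimensional
  let E : Submodule ℂ V := LinearMap.range e
  have hEe : ∀ v ∈ E, e v = v := by
    rintro _ ⟨w, rfl⟩; exact hee w
  obtain ⟨v₁, hv₁⟩ : ∃ v, Γ v ≠ 0 := by
    by_contra hcon
    push Not at hcon
    exact hΓ0 (LinearMap.ext hcon)
  have hEnt : Nontrivial E := by
    refine ⟨⟨⟨e v₁, ⟨v₁, rfl⟩⟩, 0, ?_⟩⟩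
    intro h0
    apply hv₁
    rw [← hef Γ hΓ, show e v₁ = 0 from congrArg Subtype.val h0, map_zero]
  have hspan : ∀ w ∈ E, w ≠ 0 → ∀ S : Submodule ℂ V, (∀ g, e (π g w) ∈ S) → ∀ v ∈ E, v ∈ S := by
    intro w _ hw0 S hS v hv
    rw [← hEe v hv]
    have hvt : v ∈ Submodule.span ℂ (Set.range fun g => π g w) := by
      rw [hπ.span_orbit hw0]; trivial
    have : Submodule.span ℂ (Set.range fun g => π g w) ≤ S.comap e := by
      rw [Submodule.span_le]
      rintro _ ⟨g, rfl⟩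
      exact hS g
    exact this hvt
  have hscal : ∀ g : G, ∃ c : ℂ, ∀ v ∈ E, e (π g v) = c • v := by
    intro g
    let T : E →ₗ[ℂ] E := (e ∘ₗ π g).restrict (p := E) (q := E) (fun v _ => ⟨π g v, rfl⟩)
    obtain ⟨c, hc⟩ := Module.End.exists_eigenvalue T
    obtain ⟨w, hw⟩ := hc.exists_hasEigenvector
    have hw1 : e (π g w) = c • (w : V) := congrArg Subtype.val hw.apply_eq_smul
    refine ⟨c, ?_⟩
    have := hspan w w.2 (fun h => hw.2 (Subtype.ext h)) (LinearMap.ker (e ∘ₗ π g - c • LinearMap.id)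
      ) (by
      intro h
      rw [LinearMap.mem_ker, LinearMap.sub_apply, LinearMap.comp_apply, LinearMap.smul_apply,
        LinearMap.id_apply, sub_eq_zero]
      have h2 := hcomm g h w
      rw [hEe w w.2] at h2
      rw [h2, hw1, map_smul, map_smul])
    intro v hv
    have h3 := this v hv
    rwa [LinearMap.mem_ker, LinearMap.sub_apply, LinearMap.comp_apply, LinearMap.smul_apply,
        LinearMap.id_apply, sub_eq_zero] at h3
  have hline : ∀ v, ∃ c : ℂ, e v = c • e v₁ := by
    intro v
    have hne : e v₁ ≠ 0 := by
      intro h0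
      apply hv₁
      rw [← hef Γ hΓ, h0, map_zero]
    have := hspan (e v₁) ⟨v₁, rfl⟩ hne (Submodule.span ℂ {e v₁}) (by
      intro g
      obtain ⟨c, hc⟩ := hscal g
      rw [hc _ ⟨v₁, rfl⟩]
      exact Submodule.smul_mem _ _ (Submodule.mem_span_singleton_self _)) (e v) ⟨v, rfl⟩
    obtain ⟨c, hc⟩ := Submodule.mem_span_singleton.mp this
    exact ⟨c, hc.symm⟩
  refine ⟨Γ' v₁ / Γ v₁, LinearMap.ext fun v => ?_⟩
  obtain ⟨c, hc⟩ := hline v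
  rw [LinearMap.smul_apply, smul_eq_mul, ← hef Γ hΓ v, ← hef Γ' hΓ' v, hc, map_smul, map_smul,
    hef Γ hΓ, hef Γ' hΓ', smul_eq_mul, smul_eq_mul]
  field_simp

end Gelfand

section UpperUnipotent

/-- A multiplicatively closed nonempty subset of a finite group is a subgroup. -/
def finiteSubgroup {G : Type*} [Group G] [Finite G] (S : Set G) (h1 : 1 ∈ S)
    (hmul : ∀ a ∈ S, ∀ b ∈ S, a * b ∈ S) : Subgroup G where
  carrier := S
  one_mem' := h1
  mul_mem' := fun ha hb => hmul _ ha _ hb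
  inv_mem' := by
    intro x hx
    have hpow : ∀ n : ℕ, x ^ n ∈ S := by
      intro n
      induction n with
      | zero => simpa using h1
      | succ n ih => rw [pow_succ]; exact hmul _ ih _ hx
    have : x⁻¹ = x ^ (orderOf x - 1) := by
      rw [inv_eq_iff_mul_eq_one, ← pow_succ', Nat.sub_add_cancel (orderOf_pos x), pow_orderOf_eq_one]
    rw [this]
    exact hpow _

theorem upUnip_one (m : ℕ) : upUnip F (1 : Matrix (Fin m) (Fin m) F) := by
  intro i j _
  rw [Matrix.one_apply]

theorem upUnip.apply_self {m : ℕ} {A : Matrix (Fin m) (Fin m) F} (hA : upUnip F A) (i : Fin m) :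
    A i i = 1 := by
  simpa using hA i i le_rfl

theorem upUnip.apply_of_lt {m : ℕ} {A : Matrix (Fin m) (Fin m) F} (hA : upUnip F A) {i j : Fin m}
    (h : j < i) : A i j = 0 := by
  rw [hA i j h.le, if_neg h.ne']

theorem upUnip.mul {m : ℕ} {A B : Matrix (Fin m) (Fin m) F} (hA : upUnip F A) (hB : upUnip F B) :
    upUnip F (A * B) := by
  intro i j hij
  rw [Matrix.mul_apply, Finset.sum_eq_single i]
  · rw [hA.apply_self, one_mul, hB i j hij]
  · intro k _ hk
    rcases lt_or_gt_of_ne hk with h | h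
    · rw [hA.apply_of_lt h, zero_mul]
    · rw [hB.apply_of_lt (lt_of_le_of_lt (show j ≤ i from hij) h), mul_zero]
  · simp

theorem upUnip.det {m : ℕ} {A : Matrix (Fin m) (Fin m) F} (hA : upUnip F A) : A.det = 1 := by
  rw [Matrix.det_of_isUpperTriangular]
  · simp [hA.apply_self]
  · intro i j h
    exact hA.apply_of_lt h

theorem upUnip.mul_apply_succ {m : ℕ} {A B : Matrix (Fin m) (Fin m) F} (hA : upUnip F A)
    (hB : upUnip F B) {i j : Fin m} (h : (j : ℕ) = i + 1) : (A * B) i j = A i j + B i j := by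
  have hij : i ≠ j := by intro h'; subst h'; omega
  rw [Matrix.mul_apply, Finset.sum_eq_add i j hij]
  · rw [hA.apply_self, hB.apply_self, one_mul, mul_one, add_comm]
  · rintro k _ ⟨hk1, hk2⟩
    rcases lt_or_gt_of_ne hk1 with h' | h'
    · rw [hA.apply_of_lt h', zero_mul]
    · have : j < k := by
        have h1 : (i : ℕ) < k := h'
        have h2 : (k : ℕ) ≠ j := fun e => hk2 (Fin.ext e)
        show (j : ℕ) < k
        omega
      rw [hB.apply_of_lt this, mul_zero]
  · simp
  · simp

theorem glUSum_mul {m : ℕ} {A B : Matrix (Fin m) (Fin m) F} (hA : upUnip F A) (hB : upUnip F B) :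
    glUSum F m (A * B) = glUSum F m A + glUSum F m B := by
  unfold glUSum
  rw [← Finset.sum_add_distrib]
  refine Finset.sum_congr rfl fun i _ => ?_
  rw [← Finset.sum_add_distrib]
  refine Finset.sum_congr rfl fun j _ => ?_
  split_ifs with h
  · exact hA.mul_apply_succ hB h
  · simp

/-- The upper unipotent subgroup of `GL_n`. -/
def glUnip (n : ℕ) : Subgroup (GL (Fin n) F) :=
  finiteSubgroup {u | upUnip F (u : Matrix (Fin n) (Fin n) F)} (by simpa using upUnip_one n)
    (fun a ha b hb => by
      show upUnip F ((a * b : GL (Fin n) F) : Matrix (Fin n) (Fin n) F)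
      rw [Units.val_mul]; exact upUnip.mul ha hb)

theorem mem_glUnip {n : ℕ} {u : GL (Fin n) F} :
    u ∈ glUnip n ↔ upUnip F (u : Matrix (Fin n) (Fin n) F) := Iff.rfl

/-- A nontrivial additive character separates scalars. -/
theorem eq_of_forall_char_mul_eq {ψ : AddChar F ℂ} (hψ : ψ ≠ 1) {a b : F}
    (h : ∀ s : F, ψ (a * s) = ψ (b * s)) : a = b := by
  by_contra hab
  apply hψ
  ext x
  have h1 := h (x / (a - b))
  have h2 : x = a * (x / (a - b)) - b * (x / (a - b)) := by
    rw [← sub_mul, mul_div_cancel₀ _ (sub_ne_zero.mpr hab)]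
  have h3 : ψ (b * (x / (a - b))) ≠ 0 := (AddChar.val_isUnit ψ _).ne_zero
  rw [h2, AddChar.map_sub_eq_div, h1, div_self h3]
  rfl

/-- The Bruhat decomposition of `GL_n`: every invertible matrix becomes monomial after
multiplication by upper unipotent matrices on both sides. -/
theorem exists_unip_mul_mul_monomial {n : ℕ} (g : Matrix (Fin n) (Fin n) F) (hg : g.det ≠ 0) :
    ∃ u u' : Matrix (Fin n) (Fin n) F, upUnip F u ∧ upUnip F u' ∧
      ∃ σ : Fin n → Fin n, ∀ j, (u * g * u') (σ j) j ≠ 0 ∧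
        (∀ i, i ≠ σ j → (u * g * u') i j = 0) ∧ ∀ j', j' ≠ j → (u * g * u') (σ j) j' = 0 := by
  classical
  suffices H : ∀ k ≤ n, ∃ u u' : Matrix (Fin n) (Fin n) F, upUnip F u ∧ upUnip F u' ∧
      ∀ j : Fin n, (j : ℕ) < k → ∃ i, (u * g * u') i j ≠ 0 ∧
        (∀ i', i' ≠ i → (u * g * u') i' j = 0) ∧ ∀ j', j' ≠ j → (u * g * u') i j' = 0 by
    obtain ⟨u, u', hu, hu', h⟩ := H n le_rfl
    choose σ hσ using fun j : Fin n => h j j.2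
    exact ⟨u, u', hu, hu', σ, hσ⟩
  intro k
  induction k with
  | zero => intro _; exact ⟨1, 1, upUnip_one n, upUnip_one n, fun j hj => absurd hj (by omega)⟩
  | succ k ih =>
    intro hk
    obtain ⟨u, u', hu, hu', H⟩ := ih (by omega)
    set h := u * g * u' with hh
    have hdet : h.det ≠ 0 := by
      rw [hh, Matrix.det_mul, Matrix.det_mul, hu.det, hu'.det]; simpa using hg
    let c : Fin n := ⟨k, by omega⟩
    have hex : (Finset.univ.filter fun i => h i c ≠ 0).Nonempty := by
      by_contra hcon
      rw [Finset.not_nonempty_iff_eq_empty, Finset.filter_eq_empty_iff] at hcon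
      exact hdet (Matrix.det_eq_zero_of_column_eq_zero c fun i => by simpa using hcon (Finset.mem_univ i))
    obtain ⟨i, hi, himax⟩ := Finset.exists_max_image _ id hex
    have hi0 : h i c ≠ 0 := by simpa using hi
    have hbelow : ∀ i', i < i' → h i' c = 0 := by
      intro i' hi'
      by_contra hne
      exact absurd (himax i' (by simpa using hne)) (not_le.mpr hi')
    have hrow : ∀ j : Fin n, (j : ℕ) < k → h i j = 0 := by
      intro j hj
      obtain ⟨i₁, h1, h2, h3⟩ := H j hj
      by_cases e : i = i₁
      · subst e
        exact absurd (h3 c (by intro e; rw [← e] at hj; exact absurd hj (lt_irrefl _))) hi0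
      · exact h2 i e
    let L : Matrix (Fin n) (Fin n) F := Matrix.of fun a b =>
      (if a = b then 1 else 0) + (if b = i ∧ a < i then -(h a c / h i c) else 0)
    let R : Matrix (Fin n) (Fin n) F := Matrix.of fun a b =>
      (if a = b then 1 else 0) + (if a = c ∧ c < b then -(h i b / h i c) else 0)
    have hL : upUnip F L := by
      intro a b hab
      have : ¬ (b = i ∧ a < i) := by rintro ⟨rfl, h'⟩; exact absurd h' (not_lt.mpr hab)
      simp [L, this]
    have hR : upUnip F R := by
      intro a b hab
      have : ¬ (a = c ∧ c < b) := by rintro ⟨rfl, h'⟩; exact absurd h' (not_lt.mpr hab)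
      simp [R, this]
    have hLh : ∀ a b, (L * h) a b = h a b + (if a < i then -(h a c / h i c) * h i b else 0) := by
      intro a b
      rw [Matrix.mul_apply]
      simp only [L, Matrix.of_apply, add_mul, Finset.sum_add_distrib, ite_mul, one_mul, zero_mul,
        Finset.sum_ite_eq, Finset.mem_univ, if_true]
      congr 1
      rw [Finset.sum_eq_single i]
      · simp
      · intro b' _ hb'; simp [hb']
      · simp
    have hLhR : ∀ a b, (L * h * R) a b = (L * h) a b +
        (if c < b then (L * h) a c * -(h i b / h i c) else 0) := by
      intro a b
      rw [Matrix.mul_apply]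
      simp only [R, Matrix.of_apply, mul_add, Finset.sum_add_distrib, mul_ite, mul_one, mul_zero,
        Finset.sum_ite_eq', Finset.mem_univ, if_true]
      congr 1
      rw [Finset.sum_eq_single c]
      · simp
      · intro b' _ hb'; simp [hb']
      · simp
    have hcol : ∀ a, a ≠ i → (L * h) a c = 0 := by
      intro a ha
      rw [hLh]
      rcases lt_or_gt_of_ne ha with h' | h'
      · rw [if_pos h']; field_simp; ring
      · rw [if_neg (not_lt.mpr h'.le), hbelow a h', add_zero]
    have hicol : ∀ b, (L * h) i b = h i b := by
      intro b; rw [hLh, if_neg (lt_irrefl _), add_zero]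
    refine ⟨L * u, u' * R, hL.mul hu, hu'.mul hR, ?_⟩
    have hcomb : L * u * g * (u' * R) = L * h * R := by rw [hh]; simp only [Matrix.mul_assoc]
    rw [hcomb]
    intro j hj
    rcases Nat.lt_succ_iff_lt_or_eq.mp hj with hj | hj
    · obtain ⟨i₁, h1, h2, h3⟩ := H j hj
      have hcj : ¬ c < j := by
        intro h'; have : k < (j : ℕ) := h'; omega
      have hjc : c ≠ j := by intro e; rw [← e] at hj; exact absurd hj (lt_irrefl _)
      have hcolj : ∀ a, (L * h * R) a j = h a j := by
        intro a
        rw [hLhR, if_neg hcj, add_zero, hLh, hrow j hj]; simp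
      refine ⟨i₁, by rwa [hcolj], fun i' hi' => by rw [hcolj]; exact h2 i' hi', ?_⟩
      intro j' hj'
      have h4 : ∀ b, (L * h) i₁ b = h i₁ b := by
        intro b; rw [hLh, h3 c hjc]; simp
      rw [hLhR, h4, h4, h3 c hjc, h3 j' hj']; simp
    · have hjc : j = c := Fin.ext hj
      subst hjc
      refine ⟨i, ?_, ?_, ?_⟩
      · rw [hLhR, if_neg (lt_irrefl _), add_zero, hicol]; exact hi0
      · intro i' hi'
        rw [hLhR, if_neg (lt_irrefl _), add_zero, hcol i' hi']
      · intro j' hj'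
        rw [hLhR, hicol, hicol]
        rcases lt_or_gt_of_ne hj' with h' | h'
        · rw [if_neg (not_lt.mpr h'.le), add_zero]
          exact hrow j' h'
        · rw [if_pos h']; field_simp; ring

end UpperUnipotent

section GLWhittaker

theorem Jmat_mul_apply {n k : ℕ} (A : Matrix (Fin n) (Fin k) F) (i : Fin n) (j : Fin k) :
    (Jmat F n * A) i j = A (Fin.rev i) j := by
  rw [Matrix.mul_apply, Finset.sum_eq_single (Fin.rev i)]
  · rw [Jmat, Matrix.of_apply, if_pos, one_mul]
    rw [Fin.val_rev]; omega
  · intro b _ hb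
    rw [Jmat, Matrix.of_apply, if_neg, zero_mul]
    intro h; apply hb; ext; rw [Fin.val_rev]; omega
  · simp

theorem mul_Jmat_apply {n k : ℕ} (A : Matrix (Fin k) (Fin n) F) (i : Fin k) (j : Fin n) :
    (A * Jmat F n) i j = A i (Fin.rev j) := by
  rw [Matrix.mul_apply, Finset.sum_eq_single (Fin.rev j)]
  · rw [Jmat, Matrix.of_apply, if_pos, mul_one]
    rw [Fin.val_rev]; omega
  · intro b _ hb
    rw [Jmat, Matrix.of_apply, if_neg, mul_zero]
    intro h; apply hb; ext; rw [Fin.val_rev]; omega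
  · simp

theorem Jmat_mul_self (n : ℕ) : Jmat F n * Jmat F n = 1 := by
  ext i j
  rw [Jmat_mul_apply, Jmat, Matrix.of_apply, Matrix.one_apply, Fin.val_rev]
  congr 1
  rw [Fin.ext_iff, eq_iff_iff]
  omega

/-- The anti-involution `g ↦ J gᵀ J` of `GL_n`. -/
def glFlip (n : ℕ) (g : GL (Fin n) F) : GL (Fin n) F where
  val := Jmat F n * (g : Matrix (Fin n) (Fin n) F)ᵀ * Jmat F n
  inv := Jmat F n * ((g⁻¹ : GL (Fin n) F) : Matrix (Fin n) (Fin n) F)ᵀ * Jmat F n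
  val_inv := by
    have h : (g : Matrix (Fin n) (Fin n) F)ᵀ *
        ((g⁻¹ : GL (Fin n) F) : Matrix (Fin n) (Fin n) F)ᵀ = 1 := by
      rw [← Matrix.transpose_mul, ← Units.val_mul, inv_mul_cancel]; simp
    calc _ = Jmat F n * ((g : Matrix (Fin n) (Fin n) F)ᵀ * (Jmat F n * Jmat F n) *
        ((g⁻¹ : GL (Fin n) F) : Matrix (Fin n) (Fin n) F)ᵀ) * Jmat F n := by
          simp only [Matrix.mul_assoc]
      _ = 1 := by rw [Jmat_mul_self, Matrix.mul_one, h, Matrix.mul_one, Jmat_mul_self]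
  inv_val := by
    have h : ((g⁻¹ : GL (Fin n) F) : Matrix (Fin n) (Fin n) F)ᵀ *
        (g : Matrix (Fin n) (Fin n) F)ᵀ = 1 := by
      rw [← Matrix.transpose_mul, ← Units.val_mul, mul_inv_cancel]; simp
    calc _ = Jmat F n * (((g⁻¹ : GL (Fin n) F) : Matrix (Fin n) (Fin n) F)ᵀ *
        (Jmat F n * Jmat F n) * (g : Matrix (Fin n) (Fin n) F)ᵀ) * Jmat F n := by
          simp only [Matrix.mul_assoc]
      _ = 1 := by rw [Jmat_mul_self, Matrix.mul_one, h, Matrix.mul_one, Jmat_mul_self]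

theorem glFlip_apply {n : ℕ} (g : GL (Fin n) F) (i j : Fin n) :
    (glFlip n g : Matrix (Fin n) (Fin n) F) i j =
      (g : Matrix (Fin n) (Fin n) F) (Fin.rev j) (Fin.rev i) := by
  show (Jmat F n * (g : Matrix (Fin n) (Fin n) F)ᵀ * Jmat F n) i j = _
  rw [mul_Jmat_apply, Jmat_mul_apply, Matrix.transpose_apply]

theorem glFlip_mul {n : ℕ} (g h : GL (Fin n) F) : glFlip n (g * h) = glFlip n h * glFlip n g := by
  ext i j
  rw [glFlip_apply, Units.val_mul, Units.val_mul, Matrix.mul_apply, Matrix.mul_apply]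
  refine Fintype.sum_equiv Fin.revPerm _ _ fun k => ?_
  rw [glFlip_apply, glFlip_apply, Fin.revPerm_apply, Fin.rev_rev, mul_comm]

theorem glFlip_glFlip {n : ℕ} (g : GL (Fin n) F) : glFlip n (glFlip n g) = g := by
  ext i j
  rw [glFlip_apply, glFlip_apply, Fin.rev_rev, Fin.rev_rev]

theorem glFlip_mem {n : ℕ} {u : GL (Fin n) F} (hu : u ∈ glUnip n) : glFlip n u ∈ glUnip n := by
  intro i j hij
  rw [glFlip_apply, hu _ _ (by rw [Fin.val_rev, Fin.val_rev]; omega)]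
  congr 1
  rw [eq_iff_iff, Fin.rev_inj, eq_comm]

theorem glUSum_glFlip {n : ℕ} (u : GL (Fin n) F) :
    glUSum F n (glFlip n u : Matrix (Fin n) (Fin n) F) =
      glUSum F n (u : Matrix (Fin n) (Fin n) F) := by
  unfold glUSum
  rw [Finset.sum_comm]
  refine Fintype.sum_equiv Fin.revPerm _ _ fun j => Fintype.sum_equiv Fin.revPerm _ _ fun i => ?_
  rw [glFlip_apply, Fin.revPerm_apply, Fin.revPerm_apply]
  congr 1
  rw [Fin.val_rev, Fin.val_rev, eq_iff_iff]
  omega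

/-- A matrix with nonzero determinant as an element of `GL_n`. -/
def glOfUnip {n : ℕ} (u : Matrix (Fin n) (Fin n) F) (hu : upUnip F u) : GL (Fin n) F :=
  Matrix.GeneralLinearGroup.mkOfDetNeZero u (by rw [hu.det]; exact one_ne_zero)

theorem coe_glOfUnip {n : ℕ} (u : Matrix (Fin n) (Fin n) F) (hu : upUnip F u) :
    (glOfUnip u hu : Matrix (Fin n) (Fin n) F) = u := rfl

theorem upUnip_transvection {n : ℕ} {i j : Fin n} (h : i < j) (s : F) :
    upUnip F (Matrix.transvection i j s) := by
  intro a b hab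
  have hn : ¬ (i = a ∧ j = b) := by
    rintro ⟨rfl, rfl⟩
    exact absurd (show (i : ℕ) < j from h) (not_lt.mpr hab)
  rw [Matrix.transvection, Matrix.add_apply, Matrix.one_apply, Matrix.single_apply,
    if_neg hn, add_zero]

theorem glUSum_transvection {n : ℕ} {i j : Fin n} (h : i < j) (s : F) :
    glUSum F n (Matrix.transvection i j s) = if (j : ℕ) = i + 1 then s else 0 := by
  unfold glUSum
  have : ∀ a b : Fin n, (if (b : ℕ) = (a : ℕ) + 1 then Matrix.transvection i j s a b else 0) =
      if a = i then (if b = j then (if (j : ℕ) = i + 1 then s else 0) else 0) else 0 := by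
    intro a b
    rw [Matrix.transvection, Matrix.add_apply, Matrix.one_apply, Matrix.single_apply]
    by_cases ha : a = i
    · by_cases hb : b = j
      · subst ha hb
        simp [h.ne]
      · rw [if_pos ha, if_neg hb]
        split_ifs with h1 h2 h3 h4
        · subst h2; omega
        · subst h2; omega
        · exact absurd h4.2.symm hb
        · simp
        · rfl
    · rw [if_neg ha]
      split_ifs with h1 h2 h3 h4
      · subst h2; omega
      · subst h2; omega
      · exact absurd h4.1.symm ha
      · simp
      · rfl
  simp only [this]
  simp

/-- Monomial matrices supporting a bi-equivariant function are fixed by the flip. -/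
theorem glFlip_eq_of_monomial {n : ℕ} {ψ : AddChar F ℂ} (hψ : ψ ≠ 1) (φ' : GL (Fin n) F → ℂ)
    (hl : ∀ u ∈ glUnip n, ∀ g,
      φ' (u * g) = ψ (-(glUSum F n (u : Matrix (Fin n) (Fin n) F))) * φ' g)
    (hr : ∀ u ∈ glUnip n, ∀ g,
      φ' (g * u) = ψ (-(glUSum F n (u : Matrix (Fin n) (Fin n) F))) * φ' g)
    (m : GL (Fin n) F) (hm0 : φ' m ≠ 0) (σ : Fin n → Fin n)
    (hσ : ∀ j, (m : Matrix (Fin n) (Fin n) F) (σ j) j ≠ 0 ∧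
      (∀ i, i ≠ σ j → (m : Matrix (Fin n) (Fin n) F) i j = 0) ∧
      ∀ j', j' ≠ j → (m : Matrix (Fin n) (Fin n) F) (σ j) j' = 0) :
    glFlip n m = m := by
  set A := (m : Matrix (Fin n) (Fin n) F) with hA
  have hinj : Function.Injective σ := by
    intro i j hij
    by_contra hne'
    apply (hσ j).1
    rw [← hij]
    exact (hσ i).2.2 j (Ne.symm hne')
  have hasc : ∀ j j' : Fin n, (j' : ℕ) = j + 1 → σ j < σ j' →
      (σ j' : ℕ) = σ j + 1 ∧ A (σ j') j' = A (σ j) j := by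
    intro j j' hjj hlt
    have hjlt : j < j' := by show (j : ℕ) < j'; omega
    have hcomm : ∀ s : F, A * Matrix.transvection j j' s =
        Matrix.transvection (σ j) (σ j') (A (σ j) j * s / A (σ j') j') * A := by
      intro s
      rw [Matrix.transvection, Matrix.transvection, Matrix.mul_add, Matrix.add_mul,
        Matrix.mul_one, Matrix.one_mul]
      congr 1
      ext a b
      by_cases hb : b = j'
      · subst hb
        rw [Matrix.mul_single_apply_same]
        by_cases ha : a = σ j
        · subst ha
          rw [Matrix.single_mul_apply_same, div_mul_cancel₀ _ (hσ b).1]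
        · rw [Matrix.single_mul_apply_of_ne _ _ _ _ _ ha, (hσ j).2.1 a ha, zero_mul]
      · rw [Matrix.mul_single_apply_of_ne _ _ _ _ _ hb]
        by_cases ha : a = σ j
        · subst ha
          rw [Matrix.single_mul_apply_same, (hσ j').2.2 b hb, mul_zero]
        · rw [Matrix.single_mul_apply_of_ne _ _ _ _ _ ha]
    have key : ∀ s : F, ψ (-s) =
        ψ (-(if (σ j' : ℕ) = σ j + 1 then A (σ j) j * s / A (σ j') j' else 0)) := by
      intro s
      have h1 := hr (glOfUnip _ (upUnip_transvection hjlt s)) (upUnip_transvection hjlt s) m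
      have h2 := hl (glOfUnip _ (upUnip_transvection hlt (A (σ j) j * s / A (σ j') j')))
        (upUnip_transvection hlt _) m
      have h3 : m * glOfUnip _ (upUnip_transvection hjlt s) =
          glOfUnip _ (upUnip_transvection hlt (A (σ j) j * s / A (σ j') j')) * m :=
        Units.ext (hcomm s)
      rw [h3, h2, coe_glOfUnip, coe_glOfUnip, glUSum_transvection hjlt,
        glUSum_transvection hlt, if_pos hjj] at h1
      exact (mul_right_cancel₀ hm0 h1).symm
    by_cases hadj : (σ j' : ℕ) = σ j + 1
    · refine ⟨hadj, ?_⟩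
      have : (1 : F) = A (σ j) j / A (σ j') j' := by
        refine eq_of_forall_char_mul_eq hψ fun s => ?_
        have := key (-s)
        rw [if_pos hadj] at this
        rw [one_mul]
        convert this using 2 <;> ring
      rw [eq_div_iff (hσ j').1, one_mul] at this
      exact this
    · exfalso
      have : (1 : F) = 0 := by
        refine eq_of_forall_char_mul_eq hψ fun s => ?_
        have := key (-s)
        rw [if_neg hadj] at this
        simpa using this
      exact one_ne_zero this
  have hrev := reversal_of_unit_ascents n (fun i => if h : i < n then (σ ⟨i, h⟩ : ℕ) else 0)
    (fun i => if h : i < n then A (σ ⟨i, h⟩) ⟨i, h⟩ else 0)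
    (fun i hi => by simp only [dif_pos hi]; exact (σ _).2)
    (fun i hi j hj h => by
      simp only [dif_pos hi, dif_pos hj] at h
      simpa using hinj (Fin.ext h))
    (fun i hi => by
      have hi' : i < n := by omega
      simp only [dif_pos hi, dif_pos hi']
      rcases lt_trichotomy (σ ⟨i, hi'⟩) (σ ⟨i + 1, hi⟩) with h | h | h
      · exact Or.inr (hasc ⟨i, hi'⟩ ⟨i + 1, hi⟩ rfl h)
      · exact absurd (hinj h) (by simp)
      · exact Or.inl h)
  have hrev' : ∀ j : Fin n, σ (Fin.rev (σ j)) = Fin.rev j ∧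
      A (Fin.rev j) (Fin.rev (σ j)) = A (σ j) j := by
    intro j
    have h1 := hrev j j.2
    simp only [dif_pos j.2] at h1
    have h2 : n - 1 - (σ j : ℕ) < n := by omega
    simp only [dif_pos h2] at h1
    have h3 : (⟨n - 1 - (σ j : ℕ), h2⟩ : Fin n) = Fin.rev (σ j) := by
      ext; rw [Fin.val_rev]; simp only; omega
    rw [h3] at h1
    have h4 : σ (Fin.rev (σ j)) = Fin.rev j := by
      ext; rw [h1.1, Fin.val_rev]; omega
    rw [h4] at h1
    exact ⟨h4, h1.2⟩
  ext i j
  rw [glFlip_apply, ← hA]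
  by_cases hi : i = σ j
  · subst hi; exact (hrev' j).2
  · rw [(hσ j).2.1 i hi]
    by_contra hcon
    have h1 : Fin.rev j = σ (Fin.rev i) := by
      by_contra h'; exact hcon ((hσ _).2.1 _ h')
    rw [← (hrev' j).1] at h1
    have := hinj h1
    rw [Fin.rev_inj] at this
    exact hi this.symm

/-- Uniqueness of Whittaker functionals for irreducible representations of `GL_n(F)`. -/
theorem gl_whittaker_unique {n : ℕ} {ψ : AddChar F ℂ} (hψ : ψ ≠ 1)
    {W : Type*} [AddCommGroup W] [Module ℂ W] {τ : Representation ℂ (GL (Fin n) F) W}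
    (hτ : IsIrrep τ) {Λ Λ' : W →ₗ[ℂ] ℂ} (hΛ : IsGenericGLinv F n ψ τ Λ)
    (hΛ' : ∀ u : GL (Fin n) F, upUnip F (u : Matrix (Fin n) (Fin n) F) →
      ∀ x : W, Λ' (τ u x) = ψ (-(glUSum F n (u : Matrix (Fin n) (Fin n) F))) * Λ' x) :
    ∃ c : ℂ, Λ' = c • Λ := by
  have hne : ∀ a : F, ψ a ≠ 0 := fun a => (AddChar.val_isUnit ψ a).ne_zero
  obtain ⟨χ, hχ⟩ : ∃ χ : GL (Fin n) F → ℂ,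
      ∀ u, χ u = ψ (-(glUSum F n (u : Matrix (Fin n) (Fin n) F))) := ⟨_, fun _ => rfl⟩
  have hσχ : ∀ u ∈ glUnip (F := F) n, χ (glFlip n u) = χ u := by
    intro u _; rw [hχ, hχ, glUSum_glFlip]
  have hσU : ∀ u ∈ glUnip (F := F) n, glFlip n u ∈ glUnip n := fun u hu => glFlip_mem hu
  have hmul : ∀ u ∈ glUnip (F := F) n, ∀ u' ∈ glUnip (F := F) n, χ (u * u') = χ u * χ u' := by
    intro u hu u' hu'
    rw [hχ, hχ, hχ, Units.val_mul, glUSum_mul hu hu', neg_add, AddChar.map_add_eq_mul]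
  refine equivariant_functional_unique (U := glUnip n) (χ := χ) hτ
    (fun u _ => by rw [hχ]; exact hne _) hmul (glFlip n) glFlip_mul glFlip_glFlip hσU hσχ ?_
    Λ Λ' hΛ.1
    (fun u hu v => by rw [hχ]; exact hΛ.2 u hu v) (fun u hu v => by rw [hχ]; exact hΛ' u hu v)
  simp only [hχ]
  intro φ hφl hφr
  have hl' : ∀ u ∈ glUnip n, ∀ g, φ (glFlip n (u * g)) =
      ψ (-(glUSum F n (u : Matrix (Fin n) (Fin n) F))) * φ (glFlip n g) := by
    intro u hu g
    rw [glFlip_mul, hφr _ (glFlip_mem hu), glUSum_glFlip]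
  have hr' : ∀ u ∈ glUnip n, ∀ g, φ (glFlip n (g * u)) =
      ψ (-(glUSum F n (u : Matrix (Fin n) (Fin n) F))) * φ (glFlip n g) := by
    intro u hu g
    rw [glFlip_mul, hφl _ (glFlip_mem hu), glUSum_glFlip]
  intro g
  have hdet : (g : Matrix (Fin n) (Fin n) F).det ≠ 0 := by
    exact ((Matrix.isUnit_iff_isUnit_det _).mp g.isUnit).ne_zero
  obtain ⟨u, u', hu, hu', σ, hσ⟩ := exists_unip_mul_mul_monomial _ hdet
  obtain ⟨m, hm⟩ : ∃ m, m = glOfUnip u hu * g * glOfUnip u' hu' := ⟨_, rfl⟩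
  have hmval : u * (g : Matrix (Fin n) (Fin n) F) * u' = m := by rw [hm]; rfl
  rw [hmval] at hσ
  have hfix : φ (glFlip n m) = φ m := by
    by_cases h0 : φ m = 0
    · by_cases h1 : φ (glFlip n m) = 0
      · rw [h0, h1]
      · rw [glFlip_eq_of_monomial hψ (fun g => φ (glFlip n g)) hl' hr' m h1 σ hσ]
    · rw [glFlip_eq_of_monomial hψ φ hφl hφr m h0 σ hσ]
  have e1 : φ m = ψ (-(glUSum F n u')) * (ψ (-(glUSum F n u)) * φ g) := by
    rw [hm, hφr _ (show glOfUnip u' hu' ∈ glUnip n from hu'),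
      hφl _ (show glOfUnip u hu ∈ glUnip n from hu), coe_glOfUnip, coe_glOfUnip]
  have e2 : φ (glFlip n m) = ψ (-(glUSum F n u')) * (ψ (-(glUSum F n u)) * φ (glFlip n g)) := by
    rw [hm, hr' _ (show glOfUnip u' hu' ∈ glUnip n from hu'),
      hl' _ (show glOfUnip u hu ∈ glUnip n from hu), coe_glOfUnip, coe_glOfUnip]
  rw [e1, e2] at hfix
  exact mul_left_cancel₀ (hne _) (mul_left_cancel₀ (hne _) hfix)

end GLWhittaker

section Eichler

variable {ι : Type*} [Fintype ι] [DecidableEq ι]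

/-- The bilinear form attached to a Gram matrix. -/
abbrev gram (S : Matrix ι ι F) : LinearMap.BilinForm F (ι → F) := Matrix.toBilin' S

theorem gram_eq (S : Matrix ι ι F) (x y : ι → F) : gram S x y = x ⬝ᵥ S *ᵥ y :=
  Matrix.toBilin'_apply' S x y

theorem gram_comm {S : Matrix ι ι F} (hS : Sᵀ = S) (x y : ι → F) : gram S x y = gram S y x := by
  rw [gram_eq, gram_eq, Matrix.dotProduct_mulVec, ← Matrix.mulVec_transpose, hS, dotProduct_comm]

/-- Matrices preserving the form, in terms of vectors. -/
theorem transpose_mul_mul_eq_iff {S g : Matrix ι ι F} :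
    gᵀ * S * g = S ↔ ∀ x y, gram S (g *ᵥ x) (g *ᵥ y) = gram S x y := by
  have key : ∀ x y, gram S (g *ᵥ x) (g *ᵥ y) = gram (gᵀ * S * g) x y := by
    intro x y
    rw [gram_eq, gram_eq, ← Matrix.mulVec_mulVec, ← Matrix.mulVec_mulVec,
      Matrix.dotProduct_mulVec x, Matrix.vecMul_transpose]
  constructor
  · intro h x y; rw [key, h]
  · intro h
    apply Matrix.toBilin'.injective
    ext x y
    simpa using (key (Pi.single x 1) (Pi.single y 1)).symm.trans (h (Pi.single x 1) (Pi.single y 1))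

theorem det_sq_eq_one_of_isometry {S g : Matrix ι ι F} (hS : S.det ≠ 0) (h : gᵀ * S * g = S) :
    g.det ^ 2 = 1 := by
  have := congrArg Matrix.det h
  rw [Matrix.det_mul, Matrix.det_mul, Matrix.det_transpose] at this
  have h2 : S.det * (g.det ^ 2) = S.det * 1 := by rw [mul_one]; linear_combination this
  exact mul_left_cancel₀ hS h2

/-- Eichler (Siegel) transformations. -/
def eich (S : Matrix ι ι F) (e x : ι → F) : Matrix ι ι F :=
  1 + Matrix.vecMulVec x (S *ᵥ e) - Matrix.vecMulVec e (S *ᵥ x)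
    - (gram S x x / 2) • Matrix.vecMulVec e (S *ᵥ e)

theorem eich_mulVec (S : Matrix ι ι F) (e x y : ι → F) :
    eich S e x *ᵥ y = y + gram S y e • x - gram S y x • e - (gram S x x / 2 * gram S y e) • e := by
  have h : ∀ w v : ι → F, Matrix.vecMulVec w (S *ᵥ v) *ᵥ y = gram S y v • w := by
    intro w v
    ext i
    rw [Matrix.vecMulVec_mulVec, gram_eq, dotProduct_comm]
    simp [mul_comm]
  rw [eich, Matrix.sub_mulVec, Matrix.sub_mulVec, Matrix.add_mulVec, Matrix.one_mulVec, h, h,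
    Matrix.smul_mulVec, h, smul_smul]

theorem eich_apply (S : Matrix ι ι F) (e x : ι → F) (i j : ι) :
    eich S e x i j = (if i = j then 1 else 0) + x i * (S *ᵥ e) j - e i * (S *ᵥ x) j
      - gram S x x / 2 * (e i * (S *ᵥ e) j) := by
  simp [eich, Matrix.vecMulVec_apply, Matrix.one_apply]

variable {S : Matrix ι ι F}

theorem eich_isometry (hS : Sᵀ = S) (h2 : (2 : F) ≠ 0) {e x : ι → F} (he : gram S e e = 0)
    (hex : gram S e x = 0) : (eich S e x)ᵀ * S * eich S e x = S := by
  rw [transpose_mul_mul_eq_iff]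
  intro y z
  have hxe : gram S x e = 0 := by rw [gram_comm hS, hex]
  rw [eich_mulVec, eich_mulVec]
  simp only [map_add, map_sub, map_smul, LinearMap.add_apply, LinearMap.sub_apply,
    LinearMap.smul_apply, smul_eq_mul, he, hex, hxe, gram_comm hS e z, gram_comm hS x z]
  field_simp
  ring

theorem eich_mul (hS : Sᵀ = S) (h2 : (2 : F) ≠ 0) {e x x' : ι → F} (he : gram S e e = 0)
    (hex : gram S e x = 0)
    (hex' : gram S e x' = 0) : eich S e x * eich S e x' = eich S e (x + x') := by
  apply Matrix.toLin'.injective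
  refine LinearMap.ext fun y => ?_
  rw [Matrix.toLin'_apply, Matrix.toLin'_apply, ← Matrix.mulVec_mulVec, eich_mulVec S e x',
    eich_mulVec, eich_mulVec]
  have hxe' : gram S x' e = 0 := by rw [gram_comm hS, hex']
  simp only [map_add, map_sub, map_smul, LinearMap.add_apply, LinearMap.sub_apply,
    LinearMap.smul_apply, smul_eq_mul, he, hex, hxe', gram_comm hS x' x]
  ext i
  simp only [Pi.add_apply, Pi.sub_apply, Pi.smul_apply, smul_eq_mul]
  field_simp
  ring

theorem eich_det (hS : Sᵀ = S) (h2 : (2 : F) ≠ 0) (hdet : S.det ≠ 0) {e x : ι → F}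
    (he : gram S e e = 0) (hex : gram S e x = 0) :
    (eich S e x).det = 1 := by
  have h3 : gram S e ((2 : F)⁻¹ • x) = 0 := by rw [map_smul, hex, smul_zero]
  have h4 : eich S e x = eich S e ((2 : F)⁻¹ • x) * eich S e ((2 : F)⁻¹ • x) := by
    rw [eich_mul hS h2 he h3 h3, ← add_smul]
    congr 1
    rw [show (2 : F)⁻¹ + 2⁻¹ = 1 by field_simp; norm_num, one_smul]
  rw [h4, Matrix.det_mul, ← pow_two]
  exact det_sq_eq_one_of_isometry hdet (eich_isometry hS h2 he h3)

/-- Conjugating an Eichler transformation by an isometry. -/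
theorem mul_eich {g : Matrix ι ι F} (hg : gᵀ * S * g = S) (e x : ι → F) :
    g * eich S e x = eich S (g *ᵥ e) (g *ᵥ x) * g := by
  apply Matrix.toLin'.injective
  refine LinearMap.ext fun y => ?_
  rw [transpose_mul_mul_eq_iff] at hg
  rw [Matrix.toLin'_apply, Matrix.toLin'_apply, ← Matrix.mulVec_mulVec, ← Matrix.mulVec_mulVec,
    eich_mulVec, eich_mulVec, hg, hg, hg, Matrix.mulVec_sub, Matrix.mulVec_sub,
    Matrix.mulVec_add, Matrix.mulVec_smul, Matrix.mulVec_smul, Matrix.mulVec_smul]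

end Eichler

section EvenOrthogonal

/-- The two middle indices, on which the form `J_{2l,ρ}` is anisotropic. -/
def IsMid (l : ℕ) (i : Fin (2 * l)) : Prop := (i : ℕ) + 1 = l ∨ (i : ℕ) = l

instance (l : ℕ) (i : Fin (2 * l)) : Decidable (IsMid l i) := by unfold IsMid; infer_instance

/-- The index paired with `i` by the form `J_{2l,ρ}`. -/
def dualIdx (l : ℕ) (i : Fin (2 * l)) : Fin (2 * l) := if IsMid l i then i else i.rev

/-- The value of `J_{2l,ρ}` at `(i, dualIdx i)`. -/
def dualCoef (l : ℕ) (ρ : F) (i : Fin (2 * l)) : F := if (i : ℕ) = l then -ρ else 1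

variable {l : ℕ} {ρ : F}

theorem dualIdx_of_isMid {i : Fin (2 * l)} (h : IsMid l i) : dualIdx l i = i := if_pos h

theorem dualIdx_of_not_isMid {i : Fin (2 * l)} (h : ¬ IsMid l i) : dualIdx l i = i.rev := if_neg h

theorem val_dualIdx {i : Fin (2 * l)} (h : ¬ IsMid l i) :
    (dualIdx l i : ℕ) = 2 * l - 1 - i := by
  rw [dualIdx_of_not_isMid h, Fin.val_rev]; omega

theorem isMid_rev {i : Fin (2 * l)} : IsMid l i.rev ↔ IsMid l i := by
  unfold IsMid; rw [Fin.val_rev]; omega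

theorem isMid_dualIdx {i : Fin (2 * l)} : IsMid l (dualIdx l i) ↔ IsMid l i := by
  unfold dualIdx; split_ifs with h
  · rfl
  · exact isMid_rev

theorem dualIdx_dualIdx (i : Fin (2 * l)) : dualIdx l (dualIdx l i) = i := by
  by_cases h : IsMid l i
  · rw [dualIdx_of_isMid h, dualIdx_of_isMid h]
  · rw [dualIdx_of_not_isMid h, dualIdx_of_not_isMid (isMid_rev.not.mpr h), Fin.rev_rev]

theorem dualIdx_injective : Function.Injective (dualIdx l) :=
  Function.LeftInverse.injective dualIdx_dualIdx

theorem dualIdx_eq_iff {i j : Fin (2 * l)} : dualIdx l i = j ↔ i = dualIdx l j := by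
  constructor
  · rintro rfl; rw [dualIdx_dualIdx]
  · rintro rfl; rw [dualIdx_dualIdx]

theorem dualIdx_ne_self {i : Fin (2 * l)} (h : ¬ IsMid l i) : dualIdx l i ≠ i := by
  intro e
  have h1 := congrArg Fin.val e
  rw [val_dualIdx h] at h1
  unfold IsMid at h
  omega

theorem dualCoef_of_not_isMid {i : Fin (2 * l)} (h : ¬ IsMid l i) : dualCoef l ρ i = 1 := by
  unfold IsMid at h; unfold dualCoef; rw [if_neg (by omega)]

theorem dualCoef_dualIdx (i : Fin (2 * l)) : dualCoef l ρ (dualIdx l i) = dualCoef l ρ i := by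
  by_cases h : IsMid l i
  · rw [dualIdx_of_isMid h]
  · rw [dualCoef_of_not_isMid h, dualCoef_of_not_isMid (isMid_dualIdx.not.mpr h)]

theorem Jrho_apply (i j : Fin (2 * l)) :
    Jrho F l ρ i j = if j = dualIdx l i then dualCoef l ρ i else 0 := by
  rw [Jrho, mul_Jmat_apply]
  unfold Dmat dualCoef
  have hi := i.2
  have hj := j.2
  simp only [Matrix.of_apply, Fin.ext_iff, Fin.val_rev]
  by_cases h1 : IsMid l i
  · rw [dualIdx_of_isMid h1]
    rcases h1 with h1 | h1
    · rw [if_neg (show ¬ ((i : ℕ) = l ∧ 2 * l - (j + 1) = l - 1) by omega),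
        if_neg (show ¬ ((i : ℕ) = 2 * l - (j + 1) ∧ (i : ℕ) ≠ l - 1 ∧ (i : ℕ) ≠ l) by omega),
        if_neg (show ¬ (i : ℕ) = l by omega)]
      exact if_congr (by omega) rfl rfl
    · rw [if_neg (show ¬ ((i : ℕ) = l - 1 ∧ 2 * l - (j + 1) = l) by omega),
        if_neg (show ¬ ((i : ℕ) = 2 * l - (j + 1) ∧ (i : ℕ) ≠ l - 1 ∧ (i : ℕ) ≠ l) by omega),
        if_pos h1]
      exact if_congr (by omega) rfl rfl
  · rw [dualIdx_of_not_isMid h1]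
    unfold IsMid at h1
    rw [if_neg (show ¬ ((i : ℕ) = l - 1 ∧ 2 * l - (j + 1) = l) by omega),
      if_neg (show ¬ ((i : ℕ) = l ∧ 2 * l - (j + 1) = l - 1) by omega),
      if_neg (show ¬ (i : ℕ) = l by omega)]
    exact if_congr (by rw [Fin.val_rev]; omega) rfl rfl

theorem Jrho_mulVec (y : Fin (2 * l) → F) (i : Fin (2 * l)) :
    (Jrho F l ρ *ᵥ y) i = dualCoef l ρ i * y (dualIdx l i) := by
  rw [Matrix.mulVec, dotProduct, Finset.sum_eq_single (dualIdx l i)]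
  · rw [Jrho_apply, if_pos rfl]
  · intro j _ hj; rw [Jrho_apply, if_neg hj, zero_mul]
  · simp

theorem Jrho_transpose : (Jrho F l ρ)ᵀ = Jrho F l ρ := by
  ext i j
  rw [Matrix.transpose_apply, Jrho_apply, Jrho_apply]
  by_cases h : j = dualIdx l i
  · subst h; rw [dualIdx_dualIdx, if_pos rfl, if_pos rfl, dualCoef_dualIdx]
  · rw [if_neg h, if_neg]
    rintro rfl; exact h (dualIdx_dualIdx j).symm

theorem Jrho_det (hρ : ρ ≠ 0) : (Jrho F l ρ).det ≠ 0 := by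
  rw [← isUnit_iff_ne_zero, ← Matrix.isUnit_iff_isUnit_det, ← Matrix.mulVec_injective_iff_isUnit]
  intro x y hxy
  ext i
  have h := congrFun hxy (dualIdx l i)
  simp only [Jrho_mulVec, dualIdx_dualIdx] at h
  refine mul_left_cancel₀ ?_ h
  unfold dualCoef; split_ifs
  · exact neg_ne_zero.mpr hρ
  · exact one_ne_zero

variable (l) in
/-- Standard basis vectors. -/
abbrev stdVec (i : Fin (2 * l)) : Fin (2 * l) → F := Pi.single i 1

theorem stdVec_self (i : Fin (2 * l)) : stdVec (F := F) l i i = 1 := Pi.single_eq_same i 1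

theorem stdVec_ne {i j : Fin (2 * l)} (h : j ≠ i) : stdVec (F := F) l i j = 0 :=
  Pi.single_eq_of_ne h 1

theorem gram_stdVec_left (i : Fin (2 * l)) (y : Fin (2 * l) → F) :
    gram (Jrho F l ρ) (stdVec l i) y = dualCoef l ρ i * y (dualIdx l i) := by
  rw [gram_eq, single_one_dotProduct, Jrho_mulVec]

theorem gram_stdVec_right (i : Fin (2 * l)) (y : Fin (2 * l) → F) :
    gram (Jrho F l ρ) y (stdVec l i) = dualCoef l ρ i * y (dualIdx l i) := by
  rw [gram_comm Jrho_transpose, gram_stdVec_left]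

theorem gram_stdVec_left' {i : Fin (2 * l)} (hi : ¬ IsMid l i) (y : Fin (2 * l) → F) :
    gram (Jrho F l ρ) (stdVec l i) y = y (dualIdx l i) := by
  rw [gram_stdVec_left, dualCoef_of_not_isMid hi, one_mul]

theorem gram_stdVec_right' {i : Fin (2 * l)} (hi : ¬ IsMid l i) (y : Fin (2 * l) → F) :
    gram (Jrho F l ρ) y (stdVec l i) = y (dualIdx l i) := by
  rw [gram_stdVec_right, dualCoef_of_not_isMid hi, one_mul]

theorem gram_sum (x y : Fin (2 * l) → F) :
    gram (Jrho F l ρ) x y = ∑ i, x i * (dualCoef l ρ i * y (dualIdx l i)) := by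
  rw [gram_eq, dotProduct]
  simp only [Jrho_mulVec]

theorem mulVec_stdVec {m : ℕ} (A : Matrix (Fin m) (Fin (2 * l)) F) (i : Fin (2 * l)) :
    A *ᵥ stdVec l i = A.col i := by
  simp

/-- Build an element of the orthogonal group from a matrix. -/
def soMk {m : ℕ} {J : Matrix (Fin m) (Fin m) F} (g : Matrix (Fin m) (Fin m) F) (h1 : g.det = 1)
    (h2 : gᵀ * J * g = J) : SOgrp F m J :=
  ⟨Matrix.GeneralLinearGroup.mkOfDetNeZero g (by rw [h1]; exact one_ne_zero), h1, h2⟩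

@[simp] theorem mat_soMk {m : ℕ} {J : Matrix (Fin m) (Fin m) F} (g : Matrix (Fin m) (Fin m) F)
    (h1 : g.det = 1) (h2 : gᵀ * J * g = J) : mat F (soMk g h1 h2) = g := rfl

theorem mat_mul {m : ℕ} {J : Matrix (Fin m) (Fin m) F} (g h : SOgrp F m J) :
    mat F (g * h) = mat F g * mat F h := rfl

theorem mat_one {m : ℕ} {J : Matrix (Fin m) (Fin m) F} : mat F (1 : SOgrp F m J) = 1 := rfl

theorem mat_det {m : ℕ} {J : Matrix (Fin m) (Fin m) F} (g : SOgrp F m J) : (mat F g).det = 1 :=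
  g.2.1

theorem mat_isom {m : ℕ} {J : Matrix (Fin m) (Fin m) F} (g : SOgrp F m J) :
    (mat F g)ᵀ * J * mat F g = J := g.2.2

theorem mat_injective {m : ℕ} {J : Matrix (Fin m) (Fin m) F} :
    Function.Injective (mat F : SOgrp F m J → _) := fun _ _ h => Subtype.ext (Units.ext h)

theorem mat_inv_mul {m : ℕ} {J : Matrix (Fin m) (Fin m) F} (g : SOgrp F m J) :
    mat F g⁻¹ * mat F g = 1 := by rw [← mat_mul, inv_mul_cancel, mat_one]

theorem mat_mul_inv {m : ℕ} {J : Matrix (Fin m) (Fin m) F} (g : SOgrp F m J) :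
    mat F g * mat F g⁻¹ = 1 := by rw [← mat_mul, mul_inv_cancel, mat_one]

theorem gram_mat {m : ℕ} {J : Matrix (Fin m) (Fin m) F} (g : SOgrp F m J) (x y : Fin m → F) :
    gram J (mat F g *ᵥ x) (mat F g *ᵥ y) = gram J x y :=
  transpose_mul_mul_eq_iff.mp (mat_isom g) x y

theorem gram_mat_inv {m : ℕ} {J : Matrix (Fin m) (Fin m) F} (g : SOgrp F m J) (x y : Fin m → F) :
    gram J (mat F g⁻¹ *ᵥ x) y = gram J x (mat F g *ᵥ y) := by
  rw [← gram_mat g, Matrix.mulVec_mulVec, mat_mul_inv, Matrix.one_mulVec]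

theorem eich_smul {m : ℕ} (S : Matrix (Fin m) (Fin m) F) (e x : Fin m → F) (t : F) :
    eich S (t • e) x = eich S e (t • x) := by
  ext i j
  simp only [eich_apply, Matrix.mulVec_smul, Pi.smul_apply, smul_eq_mul, map_smul,
    LinearMap.smul_apply]
  ring

/-- The Eichler element of `SO_{2l}` attached to the basis vector `e_c`. -/
def soEich (h2 : (2 : F) ≠ 0) (hρ : ρ ≠ 0) {c : Fin (2 * l)} (hc : ¬ IsMid l c)
    (x : Fin (2 * l) → F) (hx : x (dualIdx l c) = 0) : SO2l F l ρ :=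
  have h : gram (Jrho F l ρ) (stdVec l c) (stdVec l c) = 0 := by
    rw [gram_stdVec_left' hc, stdVec_ne (dualIdx_ne_self hc)]
  have h' : gram (Jrho F l ρ) (stdVec l c) x = 0 := by rw [gram_stdVec_left' hc, hx]
  soMk (eich (Jrho F l ρ) (stdVec l c) x) (eich_det Jrho_transpose h2 (Jrho_det hρ) h h')
    (eich_isometry Jrho_transpose h2 h h')

theorem soEich_mulVec (h2 : (2 : F) ≠ 0) (hρ : ρ ≠ 0) {c : Fin (2 * l)} (hc : ¬ IsMid l c)
    (x : Fin (2 * l) → F) (hx : x (dualIdx l c) = 0) (y : Fin (2 * l) → F) :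
    mat F (soEich h2 hρ hc x hx) *ᵥ y = y + y (dualIdx l c) • x -
      (gram (Jrho F l ρ) y x + gram (Jrho F l ρ) x x / 2 * y (dualIdx l c)) • stdVec l c := by
  rw [soEich, mat_soMk, eich_mulVec (Jrho F l ρ), gram_stdVec_right' hc, add_smul, sub_sub]

theorem soEich_apply (h2 : (2 : F) ≠ 0) (hρ : ρ ≠ 0) {c : Fin (2 * l)} (hc : ¬ IsMid l c)
    (x : Fin (2 * l) → F) (hx : x (dualIdx l c) = 0) (i j : Fin (2 * l)) :
    mat F (soEich h2 hρ hc x hx) i j = (if i = j then 1 else 0)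
      + x i * (if j = dualIdx l c then 1 else 0)
      - (if i = c then 1 else 0) * (dualCoef l ρ j * x (dualIdx l j))
      - gram (Jrho F l ρ) x x / 2 * ((if i = c then 1 else 0) *
        (if j = dualIdx l c then 1 else 0)) := by
  have h : (Jrho F l ρ *ᵥ stdVec l c) j = if j = dualIdx l c then 1 else 0 := by
    rw [Jrho_mulVec, stdVec, Pi.single_apply]
    by_cases h' : j = dualIdx l c
    · rw [h', dualIdx_dualIdx, if_pos rfl, if_pos rfl,
        dualCoef_of_not_isMid (isMid_dualIdx.not.mpr hc), one_mul]
    · rw [if_neg h', if_neg (by rw [dualIdx_eq_iff]; exact h'), mul_zero]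
  rw [soEich, mat_soMk, eich_apply, h, Jrho_mulVec, stdVec, Pi.single_apply]

/-- A vector supported above a non-middle position has zero norm if that position is in the
upper half. -/
theorem gram_self_of_support {c : Fin (2 * l)} (hc : ¬ IsMid l c)
    (hcl : (dualIdx l c : ℕ) < l) {x : Fin (2 * l) → F}
    (hx : ∀ i, dualIdx l c ≤ i → x i = 0) : gram (Jrho F l ρ) x x = 0 := by
  rw [gram_sum]
  refine Finset.sum_eq_zero fun i _ => ?_
  have hc' : ¬ IsMid l (dualIdx l c) := isMid_dualIdx.not.mpr hc
  by_cases hi : (i : ℕ) + 1 < l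
  · have hm : ¬ IsMid l i := by unfold IsMid; omega
    rw [hx (dualIdx l i), mul_zero, mul_zero]
    rw [Fin.le_def, val_dualIdx hm]; omega
  · rw [hx i, zero_mul]
    unfold IsMid at hc'
    rw [Fin.le_def]; omega

theorem soEich_mem (h2 : (2 : F) ≠ 0) (hρ : ρ ≠ 0) {c : Fin (2 * l)} (hc : ¬ IsMid l c)
    {x : Fin (2 * l) → F} (hx : x (dualIdx l c) = 0) (hxc : x c = 0)
    (hup : ∀ i, dualIdx l c ≤ i → x i = 0) : soEich h2 hρ hc x hx ∈ USet F l ρ := by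
  intro i j hij
  have hc' : ¬ IsMid l (dualIdx l c) := isMid_dualIdx.not.mpr hc
  have e1 : x i * (if j = dualIdx l c then 1 else 0) = 0 := by
    split_ifs with h
    · subst h; rw [hup i hij, zero_mul]
    · rw [mul_zero]
  have e2 : (if i = c then (1 : F) else 0) * (dualCoef l ρ j * x (dualIdx l j)) = 0 := by
    split_ifs with h
    · subst h
      by_cases hj : j = dualIdx l i
      · subst hj; rw [dualIdx_dualIdx, hxc, mul_zero, mul_zero]
      rw [hup (dualIdx l j), mul_zero, mul_zero]
      rw [Fin.le_def, val_dualIdx hc]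
      by_cases hm : IsMid l j
      · rw [dualIdx_of_isMid hm]
        unfold IsMid at hm hc; omega
      · rw [val_dualIdx hm]; omega
    · rw [zero_mul]
  have e3 : gram (Jrho F l ρ) x x / 2 * ((if i = c then (1 : F) else 0) *
        (if j = dualIdx l c then 1 else 0)) = 0 := by
    by_cases h : i = c
    · by_cases h' : j = dualIdx l c
      · rw [gram_self_of_support hc _ hup, zero_div, zero_mul]
        subst h h'
        rw [val_dualIdx hc] at hij ⊢
        unfold IsMid at hc; omega
      · rw [if_neg h', mul_zero, mul_zero]
    · rw [if_neg h, zero_mul, mul_zero]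
  rw [soEich_apply, e1, e2, e3]
  ring

/-- An isotropic vector with a nonzero non-middle coordinate can be cleared to that coordinate by
an Eichler element. -/
theorem exists_clear (h2 : (2 : F) ≠ 0) (hρ : ρ ≠ 0) {c : Fin (2 * l)} (hc : ¬ IsMid l c)
    {w : Fin (2 * l) → F} (hiso : gram (Jrho F l ρ) w w = 0) (hw : w (dualIdx l c) ≠ 0) :
    ∃ u : SO2l F l ρ, ((∀ i, dualIdx l c < i → w i = 0) → u ∈ USet F l ρ) ∧
      mat F u *ᵥ (w (dualIdx l c) • stdVec l (dualIdx l c)) = w ∧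
      mat F u *ᵥ stdVec l c = stdVec l c ∧
      ∀ a, a ≠ c → a ≠ dualIdx l c → w (dualIdx l a) = 0 →
        mat F u *ᵥ stdVec l a = stdVec l a := by
  obtain ⟨t, ht⟩ : ∃ t, t = w (dualIdx l c) := ⟨_, rfl⟩
  rw [← ht] at hw
  have hc' : ¬ IsMid l (dualIdx l c) := isMid_dualIdx.not.mpr hc
  have hne := dualIdx_ne_self hc
  obtain ⟨x, hx⟩ : ∃ x : Fin (2 * l) → F, x = fun i => if i = c ∨ i = dualIdx l c then 0
    else t⁻¹ * w i := ⟨_, rfl⟩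
  have hxc : x c = 0 := by rw [hx]; simp
  have hxd : x (dualIdx l c) = 0 := by rw [hx]; simp
  have hwd : w = t • stdVec l (dualIdx l c) + t • x + w c • stdVec l c := by
    ext i
    simp only [Pi.add_apply, Pi.smul_apply, smul_eq_mul, stdVec, Pi.single_apply, hx]
    by_cases h1 : i = c
    · subst h1; simp [hne.symm]
    · by_cases h3 : i = dualIdx l c
      · subst h3; simp [hne, ht]
      · simp [h1, h3, hw]
  have hnorm : t ^ 2 * gram (Jrho F l ρ) x x + 2 * (t * w c) = 0 := by
    rw [hwd] at hiso
    simp only [map_add, map_smul, LinearMap.add_apply, LinearMap.smul_apply, smul_eq_mul,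
      gram_stdVec_left' hc, gram_stdVec_left' hc', gram_stdVec_right' hc,
      gram_stdVec_right' hc', dualIdx_dualIdx, hxc, hxd, stdVec_self,
      stdVec_ne hne.symm, stdVec_ne hne] at hiso
    linear_combination hiso
  refine ⟨soEich h2 hρ hc x hxd, ?_, ?_, ?_, ?_⟩
  · intro h
    refine soEich_mem h2 hρ hc hxd hxc fun i hi => ?_
    rcases eq_or_lt_of_le hi with h' | h'
    · rw [← h', hxd]
    · rw [hx]; simp [h i h']
  · rw [← ht, soEich_mulVec]
    conv_rhs => rw [hwd]
    simp only [map_smul, LinearMap.smul_apply, smul_eq_mul, gram_stdVec_left' hc',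
      dualIdx_dualIdx, hxc, Pi.smul_apply, stdVec_self, mul_one, mul_zero, zero_add]
    rw [sub_eq_add_neg, ← neg_smul]
    congr 2
    have hg : gram (Jrho F l ρ) x x / 2 * 2 = gram (Jrho F l ρ) x x := div_mul_cancel₀ _ h2
    have : (2 * t) * (w c + gram (Jrho F l ρ) x x / 2 * t) = (2 * t) * 0 := by
      linear_combination hnorm + t ^ 2 * hg
    linear_combination (-1 : F) * mul_left_cancel₀ (mul_ne_zero h2 hw) this
  · rw [soEich_mulVec, gram_stdVec_left' hc, hxd, stdVec_ne hne]
    simp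
  · intro a ha hac hwa
    rw [soEich_mulVec, gram_stdVec_left, stdVec_ne (Ne.symm hac)]
    have : x (dualIdx l a) = 0 := by rw [hx]; simp [hwa]
    rw [this]; simp

end EvenOrthogonal

section Bruhat

variable {l : ℕ} {ρ : F}

/-- The upper unipotent subgroup of `SO_{2l}`. -/
def soUnip (l : ℕ) (ρ : F) : Subgroup (SO2l F l ρ) :=
  finiteSubgroup (USet F l ρ) (upUnip_one _) fun _ ha _ hb => upUnip.mul ha hb

theorem exists_last_coord (hρ : ∀ x : F, x ^ 2 ≠ ρ) {v : Fin (2 * l) → F} (hv : v ≠ 0)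
    (hiso : gram (Jrho F l ρ) v v = 0) :
    ∃ i, ¬ IsMid l i ∧ v i ≠ 0 ∧ ∀ p, i < p → v p = 0 := by
  classical
  have hne : (Finset.univ.filter fun i => v i ≠ 0).Nonempty := by
    obtain ⟨i, hi⟩ := Function.ne_iff.mp hv
    exact ⟨i, by simpa using hi⟩
  obtain ⟨i, hi1, hi2⟩ := Finset.exists_max_image _ id hne
  have hvi : v i ≠ 0 := by simpa using hi1
  have hup : ∀ p, i < p → v p = 0 := by
    intro p hp
    by_contra h
    exact absurd (hi2 p (by simpa using h)) (not_le.mpr hp)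
  refine ⟨i, fun hm => ?_, hvi, hup⟩
  have hl0 : 0 < l := by have := i.2; omega
  obtain ⟨a, ha⟩ : ∃ a : Fin (2 * l), (a : ℕ) + 1 = l := ⟨⟨l - 1, by omega⟩, by simp; omega⟩
  obtain ⟨b, hb⟩ : ∃ b : Fin (2 * l), (b : ℕ) = l := ⟨⟨l, by omega⟩, rfl⟩
  have hab : a ≠ b := by intro h; rw [h] at ha; omega
  have hma : IsMid l a := Or.inl ha
  have hmb : IsMid l b := Or.inr hb
  have hsum : v a ^ 2 - ρ * v b ^ 2 = 0 := by
    rw [gram_sum, Finset.sum_eq_add a b hab] at hiso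
    · rw [dualIdx_of_isMid hma, dualIdx_of_isMid hmb, dualCoef, dualCoef, if_neg (by omega),
        if_pos hb] at hiso
      linear_combination hiso
    · rintro p _ ⟨hpa, hpb⟩
      have hp : ¬ IsMid l p := by
        rintro (h | h)
        · exact hpa (Fin.ext (by omega))
        · exact hpb (Fin.ext (by omega))
      have hp' := hp
      unfold IsMid at hp' hm
      by_cases h : (p : ℕ) < l
      · rw [hup (dualIdx l p), mul_zero, mul_zero]
        rw [Fin.lt_def, val_dualIdx hp]; omega
      · rw [hup p, zero_mul]
        rw [Fin.lt_def]; omega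
    · simp
    · simp
  have hvb : v b = 0 := by
    by_contra h
    apply hρ (v a / v b)
    field_simp
    linear_combination hsum
  have hva : v a = 0 := by
    rw [hvb] at hsum
    simpa using hsum
  rcases hm with h | h
  · exact hvi (by rw [show i = a from Fin.ext (by omega), hva])
  · exact hvi (by rw [show i = b from Fin.ext (by omega), hvb])

/-- The first `k` columns of `h` (and their duals) are monomial. -/
def PartMono (k : ℕ) (h : SO2l F l ρ) : Prop :=
  ∀ j : Fin (2 * l), (j : ℕ) < k → ∃ (a : Fin (2 * l)) (t : F), ¬ IsMid l a ∧ t ≠ 0 ∧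
    mat F h *ᵥ stdVec l j = t • stdVec l a ∧
    mat F h *ᵥ stdVec l (dualIdx l j) = t⁻¹ • stdVec l (dualIdx l a)

theorem mulVec_inv_eq {m : ℕ} {J : Matrix (Fin m) (Fin m) F} (g : SOgrp F m J) {x y : Fin m → F}
    (h : mat F g *ᵥ x = y) : mat F g⁻¹ *ᵥ y = x := by
  rw [← h, Matrix.mulVec_mulVec, mat_inv_mul, Matrix.one_mulVec]

theorem PartMono.step (h2 : (2 : F) ≠ 0) (hρ : ∀ x : F, x ^ 2 ≠ ρ) {k : ℕ} (hk : k + 1 < l)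
    {h : SO2l F l ρ} (hh : PartMono k h) :
    ∃ u ∈ soUnip l ρ, ∃ u' ∈ soUnip l ρ, PartMono (k + 1) (u * h * u') := by
  have hρ0 : ρ ≠ 0 := fun h0 => hρ 0 (by rw [h0]; ring)
  obtain ⟨κ, hκ⟩ : ∃ κ : Fin (2 * l), (κ : ℕ) = k := ⟨⟨k, by omega⟩, rfl⟩
  have hκm : ¬ IsMid l κ := by unfold IsMid; omega
  have hκm' : ¬ IsMid l (dualIdx l κ) := isMid_dualIdx.not.mpr hκm
  have hjm : ∀ j : Fin (2 * l), (j : ℕ) < k → ¬ IsMid l j := by intro j hj; unfold IsMid; omega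
  obtain ⟨v, hv⟩ : ∃ v, v = mat F h *ᵥ stdVec l κ := ⟨_, rfl⟩
  have hiso : gram (Jrho F l ρ) v v = 0 := by
    rw [hv, gram_mat, gram_stdVec_left' hκm, stdVec_ne (dualIdx_ne_self hκm)]
  have hv0 : v ≠ 0 := by
    intro h0
    have h3 := gram_mat h (stdVec l κ) (stdVec l (dualIdx l κ))
    rw [← hv, h0, map_zero, LinearMap.zero_apply, gram_stdVec_left' hκm, stdVec_self] at h3
    exact zero_ne_one h3
  obtain ⟨i, him, hvi, hup⟩ := exists_last_coord hρ hv0 hiso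
  have him' : ¬ IsMid l (dualIdx l i) := isMid_dualIdx.not.mpr him
  -- coordinates of `v` at the positions already used vanish
  have hused : ∀ j : Fin (2 * l), (j : ℕ) < k → ∀ (a : Fin (2 * l)) (t : F), ¬ IsMid l a → t ≠ 0 →
      mat F h *ᵥ stdVec l j = t • stdVec l a →
      mat F h *ᵥ stdVec l (dualIdx l j) = t⁻¹ • stdVec l (dualIdx l a) →
      v a = 0 ∧ v (dualIdx l a) = 0 := by
    intro j hj a t ham ht e1 e2
    have hjκ : κ ≠ j := by intro e; rw [← e] at hj; omega
    have hdκ : dualIdx l κ ≠ j := by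
      intro e
      have := val_dualIdx hκm
      rw [e] at this
      omega
    have e3 := gram_mat h (stdVec l j) (stdVec l κ)
    have e4 := gram_mat h (stdVec l (dualIdx l j)) (stdVec l κ)
    rw [e1, ← hv, map_smul, LinearMap.smul_apply, gram_stdVec_left' ham, gram_stdVec_right' hκm,
      stdVec_ne hdκ, smul_eq_mul] at e3
    rw [e2, ← hv, map_smul, LinearMap.smul_apply, gram_stdVec_left' (isMid_dualIdx.not.mpr ham),
      gram_stdVec_right' hκm, stdVec_ne (fun e => hjκ (dualIdx_injective e)), smul_eq_mul,
      dualIdx_dualIdx] at e4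
    exact ⟨(mul_eq_zero.mp e4).resolve_left (inv_ne_zero ht), (mul_eq_zero.mp e3).resolve_left ht⟩
  -- clear the column from the left
  obtain ⟨u, huU, hu1, hu2, hu3⟩ := exists_clear (c := dualIdx l i) h2 hρ0 him' hiso
    (by rw [dualIdx_dualIdx]; exact hvi)
  rw [dualIdx_dualIdx] at huU hu1 hu3
  replace huU := huU hup
  obtain ⟨g, hg⟩ : ∃ g, g = u⁻¹ * h := ⟨_, rfl⟩
  obtain ⟨t, ht⟩ : ∃ t, t = v i := ⟨_, rfl⟩
  rw [← ht] at hu1 hvi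
  have hgκ : mat F g *ᵥ stdVec l κ = t • stdVec l i := by
    rw [hg, mat_mul, ← Matrix.mulVec_mulVec, ← hv]
    exact mulVec_inv_eq u hu1
  have hgj : ∀ j : Fin (2 * l), (j : ℕ) < k → ∃ (a : Fin (2 * l)) (s : F), ¬ IsMid l a ∧ s ≠ 0 ∧
      a ≠ i ∧ a ≠ dualIdx l i ∧
      mat F g *ᵥ stdVec l j = s • stdVec l a ∧
      mat F g *ᵥ stdVec l (dualIdx l j) = s⁻¹ • stdVec l (dualIdx l a) := by
    intro j hj
    obtain ⟨a, s, ham, hs, e1, e2⟩ := hh j hj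
    obtain ⟨f1, f2⟩ := hused j hj a s ham hs e1 e2
    have hai : a ≠ i := by rintro rfl; exact hvi (ht.trans f1)
    have hai' : a ≠ dualIdx l i := by
      rintro rfl; rw [dualIdx_dualIdx] at f2; exact hvi (ht.trans f2)
    refine ⟨a, s, ham, hs, hai, hai', ?_, ?_⟩
    · rw [hg, mat_mul, ← Matrix.mulVec_mulVec, e1, Matrix.mulVec_smul,
        mulVec_inv_eq u (hu3 a hai' hai f2)]
    · rw [hg, mat_mul, ← Matrix.mulVec_mulVec, e2, Matrix.mulVec_smul,
        mulVec_inv_eq u (hu3 (dualIdx l a) (fun e => hai (dualIdx_injective e))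
          (fun e => hai' (by rw [← e, dualIdx_dualIdx])) (by rw [dualIdx_dualIdx, f1]))]
  -- clear the dual column from the right
  obtain ⟨w, hw⟩ : ∃ w, w = t⁻¹ • mat F g⁻¹ *ᵥ stdVec l (dualIdx l i) := ⟨_, rfl⟩
  have hgw : ∀ y, gram (Jrho F l ρ) w y = t⁻¹ * (mat F g *ᵥ y) i := by
    intro y
    rw [hw, map_smul, LinearMap.smul_apply, gram_mat_inv, gram_stdVec_left' him', dualIdx_dualIdx,
      smul_eq_mul]
  have hwiso : gram (Jrho F l ρ) w w = 0 := by
    rw [hgw, hw, Matrix.mulVec_smul, Matrix.mulVec_mulVec, mat_mul_inv, Matrix.one_mulVec,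
      Pi.smul_apply, stdVec_ne (dualIdx_ne_self him).symm]
    simp
  have hwκ : w (dualIdx l κ) = 1 := by
    rw [← gram_stdVec_right' (ρ := ρ) hκm w, hgw, hgκ, Pi.smul_apply, stdVec_self, smul_eq_mul,
      mul_one, inv_mul_cancel₀ hvi]
  have hwj : ∀ j : Fin (2 * l), (j : ℕ) < k → w j = 0 ∧ w (dualIdx l j) = 0 := by
    intro j hj
    obtain ⟨a, s, ham, hs, hai, hai', e1, e2⟩ := hgj j hj
    constructor
    · rw [← dualIdx_dualIdx j, ← gram_stdVec_right' (ρ := ρ) (isMid_dualIdx.not.mpr (hjm j hj)) w,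
        hgw, e2, Pi.smul_apply, stdVec_ne (by rintro rfl; exact hai' (dualIdx_dualIdx a).symm)]
      simp
    · rw [← gram_stdVec_right' (ρ := ρ) (hjm j hj) w, hgw, e1, Pi.smul_apply, stdVec_ne hai.symm]
      simp
  obtain ⟨u', huU', hu1', hu2', hu3'⟩ := exists_clear (c := κ) h2 hρ0 hκm hwiso
    (by rw [hwκ]; exact one_ne_zero)
  rw [hwκ, one_smul] at hu1'
  have hmem : u' ∈ USet F l ρ := by
    refine huU' fun p hp => ?_
    rw [Fin.lt_def, val_dualIdx hκm] at hp
    have hpm : ¬ IsMid l p := by unfold IsMid; omega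
    have := (hwj (dualIdx l p) (by rw [val_dualIdx hpm]; have := p.2; omega)).2
    rwa [dualIdx_dualIdx] at this
  refine ⟨u⁻¹, inv_mem huU, u', hmem, fun j hj => ?_⟩
  rw [← hg]
  rcases Nat.lt_succ_iff_lt_or_eq.mp hj with hj | hj
  · obtain ⟨a, s, ham, hs, -, -, e1, e2⟩ := hgj j hj
    obtain ⟨f1, f2⟩ := hwj j hj
    have n1 : j ≠ κ := by rintro rfl; omega
    have n2 : j ≠ dualIdx l κ := by
      rintro rfl
      rw [val_dualIdx hκm] at hj; omega
    refine ⟨a, s, ham, hs, ?_, ?_⟩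
    · rw [mat_mul, ← Matrix.mulVec_mulVec, hu3' j n1 n2 f2, e1]
    · rw [mat_mul, ← Matrix.mulVec_mulVec, hu3' (dualIdx l j)
        (fun e => n2 (by rw [← e, dualIdx_dualIdx])) (fun e => n1 (dualIdx_injective e))
        (by rw [dualIdx_dualIdx, f1]), e2]
  · obtain rfl : j = κ := Fin.ext (by omega)
    refine ⟨i, t, him, hvi, ?_, ?_⟩
    · rw [mat_mul, ← Matrix.mulVec_mulVec, hu2', hgκ]
    · rw [mat_mul, ← Matrix.mulVec_mulVec, hu1', hw, Matrix.mulVec_smul, Matrix.mulVec_mulVec,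
        mat_mul_inv, Matrix.one_mulVec]

theorem exists_partMono (h2 : (2 : F) ≠ 0) (hρ : ∀ x : F, x ^ 2 ≠ ρ) (g : SO2l F l ρ) :
    ∀ k, k < l → ∃ u ∈ soUnip l ρ, ∃ u' ∈ soUnip l ρ, PartMono k (u * g * u') := by
  intro k
  induction k with
  | zero =>
    intro _
    exact ⟨1, one_mem _, 1, one_mem _, fun j hj => absurd hj (Nat.not_lt_zero _)⟩
  | succ k ih =>
    intro hk
    obtain ⟨u, hu, u', hu', h⟩ := ih (by omega)
    obtain ⟨v, hv, v', hv', h'⟩ := h.step h2 hρ hk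
    refine ⟨v * u, mul_mem hv hu, u' * v', mul_mem hu' hv', ?_⟩
    have : v * u * g * (u' * v') = v * (u * g * u') * v' := by simp only [mul_assoc]
    rwa [this]

/-- `m` is monomial outside of the middle block. -/
structure IsMonomial (m : SO2l F l ρ) (σ : Fin (2 * l) → Fin (2 * l)) (T : Fin (2 * l) → F) :
    Prop where
  not_mid : ∀ j, ¬ IsMid l j → ¬ IsMid l (σ j)
  ne_zero : ∀ j, ¬ IsMid l j → T j ≠ 0
  col : ∀ j, ¬ IsMid l j → mat F m *ᵥ stdVec l j = T j • stdVec l (σ j)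
  perm_dual : ∀ j, ¬ IsMid l j → σ (dualIdx l j) = dualIdx l (σ j)
  coef_dual : ∀ j, ¬ IsMid l j → T (dualIdx l j) = (T j)⁻¹

theorem PartMono.isMonomial {m : SO2l F l ρ} (h : PartMono (l - 1) m) :
    ∃ σ T, IsMonomial m σ T := by
  have h' : ∀ j : Fin (2 * l), ∃ (a : Fin (2 * l)) (t : F), (j : ℕ) < l - 1 → ¬ IsMid l a ∧
      t ≠ 0 ∧ mat F m *ᵥ stdVec l j = t • stdVec l a ∧
      mat F m *ᵥ stdVec l (dualIdx l j) = t⁻¹ • stdVec l (dualIdx l a) := by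
    intro j
    by_cases hj : (j : ℕ) < l - 1
    · obtain ⟨a, t, h1⟩ := h j hj
      exact ⟨a, t, fun _ => h1⟩
    · exact ⟨j, 1, fun h1 => absurd h1 hj⟩
  choose a t hat using h'
  have hlow : ∀ j, ¬ IsMid l j → ¬ (j : ℕ) < l - 1 → (dualIdx l j : ℕ) < l - 1 := by
    intro j hj h1
    rw [val_dualIdx hj]
    unfold IsMid at hj
    omega
  have hlow' : ∀ j, ¬ IsMid l j → (j : ℕ) < l - 1 → ¬ (dualIdx l j : ℕ) < l - 1 := by
    intro j hj h1
    rw [val_dualIdx hj]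
    omega
  refine ⟨fun j => if (j : ℕ) < l - 1 then a j else dualIdx l (a (dualIdx l j)),
    fun j => if (j : ℕ) < l - 1 then t j else (t (dualIdx l j))⁻¹, ?_, ?_, ?_, ?_, ?_⟩
  all_goals
    intro j hj
    by_cases h1 : (j : ℕ) < l - 1
    · have h3 := hat j h1
      simp only [if_pos h1, if_neg (hlow' j hj h1), dualIdx_dualIdx] <;> first
      | exact h3.1
      | exact h3.2.1
      | exact h3.2.2.1
    · have h3 := hat _ (hlow j hj h1)
      simp only [if_neg h1, if_pos (hlow j hj h1), dualIdx_dualIdx, inv_inv] <;> first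
      | exact isMid_dualIdx.not.mpr h3.1
      | exact inv_ne_zero h3.2.1
      | (have h4 := h3.2.2.2; rwa [dualIdx_dualIdx] at h4)

end Bruhat

section EvenCharacter

variable {l : ℕ} {ρ : F}

/-- The linear form on matrices underlying the generic character of `SO_{2l}`. -/
def soUSum (l : ℕ) (M : Matrix (Fin (2 * l)) (Fin (2 * l)) F) : F :=
  ∑ i : Fin (2 * l), ∑ j : Fin (2 * l),
    (if (j : ℕ) = (i : ℕ) + 1 ∧ (i : ℕ) + 3 ≤ l then M i j
     else if (i : ℕ) + 2 = l ∧ (j : ℕ) = l then (2 : F)⁻¹ * M i j else 0)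

/-- The coefficients of `soUSum`. -/
def soWt (F : Type) [Field F] (l : ℕ) (i j : Fin (2 * l)) : F :=
  if (j : ℕ) = (i : ℕ) + 1 ∧ (i : ℕ) + 3 ≤ l then 1
  else if (i : ℕ) + 2 = l ∧ (j : ℕ) = l then (2 : F)⁻¹ else 0

theorem psiU_eq (ψ : AddChar F ℂ) (M : Matrix (Fin (2 * l)) (Fin (2 * l)) F) :
    psiU F l ψ M = ψ (soUSum l M) := rfl

theorem soUSum_eq (M : Matrix (Fin (2 * l)) (Fin (2 * l)) F) :
    soUSum l M = ∑ i, ∑ j, soWt F l i j * M i j := by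
  unfold soUSum soWt
  refine Finset.sum_congr rfl fun i _ => Finset.sum_congr rfl fun j _ => ?_
  split_ifs <;> simp

theorem soWt_self (i : Fin (2 * l)) : soWt F l i i = 0 := by
  unfold soWt; rw [if_neg (by omega), if_neg (by omega)]

theorem soWt_dual {c : Fin (2 * l)} (hc : ¬ IsMid l c) : soWt F l c (dualIdx l c) = 0 := by
  have := c.2
  unfold soWt
  rw [val_dualIdx hc]
  unfold IsMid at hc
  rw [if_neg (by omega), if_neg (by omega)]

theorem soUSum_one : soUSum l (1 : Matrix (Fin (2 * l)) (Fin (2 * l)) F) = 0 := by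
  rw [soUSum_eq]
  refine Finset.sum_eq_zero fun i _ => Finset.sum_eq_zero fun j _ => ?_
  rw [Matrix.one_apply]
  split_ifs with h
  · subst h; rw [soWt_self, zero_mul]
  · rw [mul_zero]

theorem mid_entry_eq_zero {u : SO2l F l ρ} (hu : u ∈ USet F l ρ) {a b : Fin (2 * l)}
    (ha : (a : ℕ) + 1 = l) (hb : (b : ℕ) = l) : mat F u a b = 0 := by
  have hma : IsMid l a := Or.inl ha
  have hab : b ≠ a := by intro h; rw [h] at hb; omega
  have h := gram_mat u (stdVec l b) (stdVec l a)
  rw [gram_stdVec_right, dualIdx_of_isMid hma, stdVec_ne hab.symm, mul_zero, gram_sum,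
    Finset.sum_eq_single a] at h
  · rw [dualIdx_of_isMid hma, mulVec_stdVec, mulVec_stdVec, Matrix.col_apply, Matrix.col_apply,
      upUnip.apply_self hu, dualCoef, if_neg (by omega)] at h
    linear_combination h
  · intro i _ hi
    rw [mulVec_stdVec, mulVec_stdVec, Matrix.col_apply, Matrix.col_apply]
    by_cases h1 : b < i
    · rw [upUnip.apply_of_lt hu h1, zero_mul]
    · rw [upUnip.apply_of_lt hu (show a < dualIdx l i from ?_), mul_zero, mul_zero]
      rw [Fin.lt_def] at h1 ⊢
      by_cases hm : IsMid l i
      · rw [dualIdx_of_isMid hm]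
        rcases hm with hm | hm
        · exact absurd (Fin.ext (by omega)) hi
        · omega
      · rw [val_dualIdx hm]
        unfold IsMid at hm
        omega
  · simp

theorem soUSum_mul {u v : SO2l F l ρ} (hu : u ∈ USet F l ρ) (hv : v ∈ USet F l ρ) :
    soUSum l (mat F (u * v)) = soUSum l (mat F u) + soUSum l (mat F v) := by
  rw [soUSum_eq, soUSum_eq, soUSum_eq, ← Finset.sum_add_distrib]
  refine Finset.sum_congr rfl fun i _ => ?_
  rw [← Finset.sum_add_distrib]
  refine Finset.sum_congr rfl fun j _ => ?_
  rw [← mul_add, mat_mul]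
  by_cases h1 : (j : ℕ) = (i : ℕ) + 1 ∧ (i : ℕ) + 3 ≤ l
  · rw [upUnip.mul_apply_succ hu hv h1.1]
  by_cases h2 : (i : ℕ) + 2 = l ∧ (j : ℕ) = l
  · congr 1
    have hij : i ≠ j := by intro h; rw [h] at h2; omega
    rw [Matrix.mul_apply, Finset.sum_eq_add i j hij]
    · rw [upUnip.apply_self hu, upUnip.apply_self hv, one_mul, mul_one, add_comm]
    · rintro k _ ⟨hk1, hk2⟩
      rcases lt_or_gt_of_ne hk1 with h' | h'
      · rw [upUnip.apply_of_lt hu h', zero_mul]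
      · rcases lt_or_gt_of_ne hk2 with h'' | h''
        · rw [mid_entry_eq_zero hv (a := k) (by rw [Fin.lt_def] at *; omega) h2.2, mul_zero]
        · rw [upUnip.apply_of_lt hv h'', mul_zero]
    · simp
    · simp
  · rw [soWt, if_neg h1, if_neg h2, zero_mul, zero_mul]

theorem soUSum_inv {u : SO2l F l ρ} (hu : u ∈ USet F l ρ) :
    soUSum l (mat F u⁻¹) = -soUSum l (mat F u) := by
  have h := soUSum_mul (show u⁻¹ ∈ soUnip l ρ from inv_mem hu) hu
  rw [inv_mul_cancel, mat_one, soUSum_one] at h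
  linear_combination -h

theorem soUSum_soEich (h2 : (2 : F) ≠ 0) (hρ : ρ ≠ 0) {c : Fin (2 * l)} (hc : ¬ IsMid l c)
    (x : Fin (2 * l) → F) (hx : x (dualIdx l c) = 0) :
    soUSum l (mat F (soEich h2 hρ hc x hx)) = ∑ i, soWt F l i (dualIdx l c) * x i -
      ∑ j, soWt F l c j * (dualCoef l ρ j * x (dualIdx l j)) := by
  have h1 : ∀ i j, soWt F l i j * mat F (soEich h2 hρ hc x hx) i j =
      (soWt F l i j * if j = dualIdx l c then x i else 0) -
      (if i = c then soWt F l i j * (dualCoef l ρ j * x (dualIdx l j)) else 0) := by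
    intro i j
    rw [soEich_apply]
    have e1 : soWt F l i j * (if i = j then 1 else 0) = 0 := by
      split_ifs with h
      · subst h; rw [soWt_self, zero_mul]
      · rw [mul_zero]
    have e2 : soWt F l i j * ((if i = c then (1 : F) else 0) *
        (if j = dualIdx l c then 1 else 0)) = 0 := by
      by_cases h : i = c
      · by_cases h' : j = dualIdx l c
        · subst h h'; rw [soWt_dual hc, zero_mul]
        · rw [if_neg h', mul_zero, mul_zero]
      · rw [if_neg h, zero_mul, mul_zero]
    have e3 : (if j = dualIdx l c then x i else 0) = x i * (if j = dualIdx l c then 1 else 0) := by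
      split_ifs <;> simp
    have e4 : (if i = c then soWt F l i j * (dualCoef l ρ j * x (dualIdx l j)) else 0) =
      soWt F l i j * ((if i = c then 1 else 0) * (dualCoef l ρ j * x (dualIdx l j))) := by
      split_ifs <;> simp
    rw [e3, e4]
    linear_combination e1 - gram (Jrho F l ρ) x x / 2 * e2
  rw [soUSum_eq]
  simp only [h1, Finset.sum_sub_distrib]
  congr 1
  · refine Finset.sum_congr rfl fun i _ => ?_
    simp
  · rw [Finset.sum_comm]
    refine Finset.sum_congr rfl fun j _ => ?_
    simp

theorem soUSum_soEich_single (h2 : (2 : F) ≠ 0) (hρ : ρ ≠ 0) {a b : Fin (2 * l)}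
    (ha : ¬ IsMid l a) (hb : ¬ IsMid l (dualIdx l b)) (r : F)
    (hx : (r • stdVec l a) (dualIdx l (dualIdx l b)) = 0) :
    soUSum l (mat F (soEich h2 hρ hb (r • stdVec l a) hx)) =
      soWt F l a b * r - soWt F l (dualIdx l b) (dualIdx l a) * r := by
  rw [soUSum_soEich, dualIdx_dualIdx, Finset.sum_eq_single a, Finset.sum_eq_single (dualIdx l a)]
  · rw [dualIdx_dualIdx, dualCoef_of_not_isMid (isMid_dualIdx.not.mpr ha), Pi.smul_apply,
      stdVec_self]
    simp
  · intro j _ hj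
    rw [Pi.smul_apply, stdVec_ne (by rw [Ne, dualIdx_eq_iff]; exact hj)]
    simp
  · simp
  · intro i _ hi
    rw [Pi.smul_apply, stdVec_ne hi]
    simp
  · simp

theorem soUSum_soEich_mid (h2 : (2 : F) ≠ 0) (hρ : ρ ≠ 0) {c L : Fin (2 * l)}
    (hL : (L : ℕ) = l) (hc : ¬ IsMid l c)
    (x : Fin (2 * l) → F) (hx : ∀ i, ¬ IsMid l i → x i = 0) :
    soUSum l (mat F (soEich h2 hρ hc x (hx _ (isMid_dualIdx.not.mpr hc)))) =
      if (c : ℕ) + 2 = l then ρ / 2 * x L else 0 := by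
  have hmL : IsMid l L := Or.inr hL
  rw [soUSum_soEich, Finset.sum_eq_zero, Finset.sum_eq_single L]
  · rw [dualIdx_of_isMid hmL, dualCoef, if_pos hL, soWt, if_neg (by omega)]
    by_cases h : (c : ℕ) + 2 = l
    · rw [if_pos ⟨h, hL⟩, if_pos h]; ring
    · rw [if_neg (by tauto), if_neg h]; ring
  · intro j _ hj
    by_cases hm : IsMid l j
    · have h1 : ¬ (j : ℕ) = l := fun h => hj (Fin.ext (by omega))
      unfold IsMid at hm
      rw [soWt, if_neg (by omega), if_neg (by omega), zero_mul]
    · rw [hx _ (isMid_dualIdx.not.mpr hm), mul_zero, mul_zero]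
  · simp
  · intro i _
    by_cases hm : IsMid l i
    · unfold IsMid at hm
      rw [soWt, if_neg (by omega), if_neg (by omega), zero_mul]
    · rw [hx _ hm, mul_zero]

theorem mul_soEich (h2 : (2 : F) ≠ 0) (hρ : ρ ≠ 0) {m : SO2l F l ρ} {a c : Fin (2 * l)}
    (ha : ¬ IsMid l a) (hc : ¬ IsMid l c) {t : F} (hm : mat F m *ᵥ stdVec l c = t • stdVec l a)
    (x : Fin (2 * l) → F) (hx : x (dualIdx l c) = 0)
    (y : Fin (2 * l) → F) (hxy : t • (mat F m *ᵥ x) = y) (hy : y (dualIdx l a) = 0) :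
    m * soEich h2 hρ hc x hx = soEich h2 hρ ha y hy * m := by
  apply mat_injective
  rw [mat_mul, mat_mul, soEich, soEich, mat_soMk, mat_soMk,
    mul_eich (mat_isom m), hm, eich_smul, hxy]

/-- Conjugation by an isometric involution. -/
def soConj {m : ℕ} {J : Matrix (Fin m) (Fin m) F} (E : Matrix (Fin m) (Fin m) F) (hE : E * E = 1)
    (hJ : Eᵀ * J * E = J) : SOgrp F m J →* SOgrp F m J where
  toFun g := soMk (E * mat F g * E)
    (by
      have h := congrArg Matrix.det hE
      rw [Matrix.det_mul, Matrix.det_one] at h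
      rw [Matrix.det_mul, Matrix.det_mul, mat_det, mul_one, h])
    (by
      rw [transpose_mul_mul_eq_iff] at hJ ⊢
      intro x y
      rw [← Matrix.mulVec_mulVec, ← Matrix.mulVec_mulVec, ← Matrix.mulVec_mulVec,
        ← Matrix.mulVec_mulVec, hJ, gram_mat, hJ])
  map_one' := mat_injective (by rw [mat_soMk, mat_one, mul_one, hE])
  map_mul' g h := mat_injective (by
    rw [mat_soMk, mat_mul, mat_mul, mat_soMk, mat_soMk]
    calc E * (mat F g * mat F h) * E = E * mat F g * 1 * mat F h * E := by
          rw [mul_one]; simp only [mul_assoc]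
      _ = _ := by rw [← hE]; simp only [mul_assoc])

theorem mat_soConj {m : ℕ} {J : Matrix (Fin m) (Fin m) F} (E : Matrix (Fin m) (Fin m) F)
    (hE : E * E = 1) (hJ : Eᵀ * J * E = J) (g : SOgrp F m J) :
    mat F (soConj E hE hJ g) = E * mat F g * E := rfl

theorem soConj_soConj {m : ℕ} {J : Matrix (Fin m) (Fin m) F} (E : Matrix (Fin m) (Fin m) F)
    (hE : E * E = 1) (hJ : Eᵀ * J * E = J) (g : SOgrp F m J) :
    soConj E hE hJ (soConj E hE hJ g) = g := by
  apply mat_injective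
  rw [mat_soConj, mat_soConj, ← mul_assoc, ← mul_assoc, hE, one_mul, mul_assoc, hE, mul_one]

theorem diagonal_isometry {d : Fin (2 * l) → F} (hd : ∀ i, d i * d (dualIdx l i) = 1) :
    (Matrix.diagonal d)ᵀ * Jrho F l ρ * Matrix.diagonal d = Jrho F l ρ := by
  ext i j
  rw [Matrix.diagonal_transpose, Matrix.mul_diagonal, Matrix.diagonal_mul, Jrho_apply]
  split_ifs with h
  · subst h; linear_combination dualCoef l ρ i * hd i
  · ring

/-- The signs of the anti-involution used for the uniqueness of Whittaker functionals. -/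
def flipSign (F : Type) [Field F] (l : ℕ) (i : Fin (2 * l)) : F :=
  if (i : ℕ) + 1 = l then (-1) ^ l else (-1) ^ (if (i : ℕ) < l then l - 1 - i else i - l)

theorem flipSign_mul_self (i : Fin (2 * l)) : flipSign F l i * flipSign F l i = 1 := by
  unfold flipSign
  split_ifs <;> rw [← mul_pow] <;> simp

theorem flipSign_of_lt {i : Fin (2 * l)} (h : (i : ℕ) + 1 < l) :
    flipSign F l i = (-1) ^ (l - 1 - (i : ℕ)) := by
  rw [flipSign, if_neg (show ¬ (i : ℕ) + 1 = l by omega), if_pos (show (i : ℕ) < l by omega)]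

theorem flipSign_of_ge {i : Fin (2 * l)} (h : l ≤ (i : ℕ)) :
    flipSign F l i = (-1) ^ ((i : ℕ) - l) := by
  rw [flipSign, if_neg (show ¬ (i : ℕ) + 1 = l by omega), if_neg (show ¬ (i : ℕ) < l by omega)]

theorem flipSign_dual (i : Fin (2 * l)) : flipSign F l (dualIdx l i) = flipSign F l i := by
  by_cases h : IsMid l i
  · rw [dualIdx_of_isMid h]
  · have h' := val_dualIdx h
    have := i.2
    unfold IsMid at h
    by_cases h1 : (i : ℕ) < l
    · rw [flipSign_of_ge (by omega), flipSign_of_lt (i := i) (by omega), h']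
      congr 1
      omega
    · rw [flipSign_of_lt (by omega), flipSign_of_ge (i := i) (by omega), h']
      congr 1
      omega

theorem flipSign_succ {i j : Fin (2 * l)} (h : soWt F l i j ≠ 0) :
    flipSign F l i * flipSign F l j = -1 := by
  unfold soWt at h
  by_cases h1 : (j : ℕ) = (i : ℕ) + 1 ∧ (i : ℕ) + 3 ≤ l
  · rw [flipSign_of_lt (by omega), flipSign_of_lt (by omega),
      show l - 1 - (i : ℕ) = (l - 1 - j) + 1 by omega, pow_succ, mul_right_comm, ← mul_pow]
    simp
  · rw [if_neg h1] at h
    by_cases h2 : (i : ℕ) + 2 = l ∧ (j : ℕ) = l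
    · rw [flipSign_of_lt (by omega), flipSign_of_ge (by omega),
        show l - 1 - (i : ℕ) = 1 by omega, show (j : ℕ) - l = 0 by omega]
      simp
    · exact absurd (if_neg h2) h

/-- Conjugation by the diagonal sign matrix. -/
def signConj (l : ℕ) (ρ : F) : SO2l F l ρ →* SO2l F l ρ :=
  soConj (Matrix.diagonal (flipSign F l))
    (by
      rw [Matrix.diagonal_mul_diagonal]
      simp only [flipSign_mul_self]
      exact Matrix.diagonal_one)
    (diagonal_isometry fun i => by rw [flipSign_dual, flipSign_mul_self])

theorem signConj_apply (g : SO2l F l ρ) (i j : Fin (2 * l)) :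
    mat F (signConj l ρ g) i j = flipSign F l i * mat F g i j * flipSign F l j := by
  rw [signConj, mat_soConj, Matrix.mul_diagonal, Matrix.diagonal_mul]

theorem signConj_signConj (g : SO2l F l ρ) : signConj l ρ (signConj l ρ g) = g :=
  soConj_soConj _ _ _ g

theorem signConj_mem {u : SO2l F l ρ} (hu : u ∈ soUnip l ρ) : signConj l ρ u ∈ soUnip l ρ := by
  intro i j hij
  rw [signConj_apply]
  rcases eq_or_ne i j with h | h
  · subst h; rw [upUnip.apply_self hu, if_pos rfl, mul_one, flipSign_mul_self]
  · rw [hu i j hij, if_neg h, mul_zero, zero_mul]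

theorem soUSum_signConj (g : SO2l F l ρ) :
    soUSum l (mat F (signConj l ρ g)) = -soUSum l (mat F g) := by
  rw [soUSum_eq, soUSum_eq, ← Finset.sum_neg_distrib]
  refine Finset.sum_congr rfl fun i _ => ?_
  rw [← Finset.sum_neg_distrib]
  refine Finset.sum_congr rfl fun j _ => ?_
  rw [signConj_apply]
  by_cases h : soWt F l i j = 0
  · rw [h]; ring
  · linear_combination soWt F l i j * mat F g i j * flipSign_succ h

/-- The anti-involution `g ↦ D g⁻¹ D`. -/
def soFlip (l : ℕ) (ρ : F) (g : SO2l F l ρ) : SO2l F l ρ := signConj l ρ g⁻¹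

theorem soFlip_mul (g h : SO2l F l ρ) : soFlip l ρ (g * h) = soFlip l ρ h * soFlip l ρ g := by
  rw [soFlip, _root_.mul_inv_rev, map_mul]; rfl

theorem soFlip_soFlip (g : SO2l F l ρ) : soFlip l ρ (soFlip l ρ g) = g := by
  rw [soFlip, soFlip, ← map_inv, inv_inv, signConj_signConj]

theorem soFlip_mem {u : SO2l F l ρ} (hu : u ∈ soUnip l ρ) : soFlip l ρ u ∈ soUnip l ρ :=
  signConj_mem (inv_mem hu)

theorem soUSum_soFlip {u : SO2l F l ρ} (hu : u ∈ soUnip l ρ) :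
    soUSum l (mat F (soFlip l ρ u)) = soUSum l (mat F u) := by
  rw [soFlip, soUSum_signConj, soUSum_inv hu, neg_neg]

end EvenCharacter

section EvenUniqueness

variable {l : ℕ} {ρ : F}

theorem IsMonomial.perm_injOn {m : SO2l F l ρ} {σ : Fin (2 * l) → Fin (2 * l)}
    {T : Fin (2 * l) → F} (hm : IsMonomial m σ T) {i j : Fin (2 * l)} (hi : ¬ IsMid l i)
    (hj : ¬ IsMid l j) (h : σ i = σ j) : i = j := by
  have h1 : mat F m *ᵥ (T j • stdVec l i) = mat F m *ᵥ (T i • stdVec l j) := by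
    rw [Matrix.mulVec_smul, Matrix.mulVec_smul, hm.col i hi, hm.col j hj, h, smul_smul, smul_smul,
      mul_comm (T j)]
  have h3 : T j • stdVec (F := F) l i = T i • stdVec l j := by
    have h4 := congrArg (fun v => mat F m⁻¹ *ᵥ v) h1
    simpa only [Matrix.mulVec_mulVec, mat_inv_mul, Matrix.one_mulVec] using h4
  by_contra hij
  have h5 := congrFun h3 i
  rw [Pi.smul_apply, Pi.smul_apply, stdVec_self, stdVec_ne hij, smul_zero, smul_eq_mul,
    mul_one] at h5
  exact hm.ne_zero j hj h5

/-- The permutation of a monomial element, completed by the identity on the middle. -/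
def midExtend (σ : Fin (2 * l) → Fin (2 * l)) (i : Fin (2 * l)) : Fin (2 * l) :=
  if IsMid l i then i else σ i

theorem IsMonomial.midExtend_injective {m : SO2l F l ρ} {σ : Fin (2 * l) → Fin (2 * l)}
    {T : Fin (2 * l) → F} (hm : IsMonomial m σ T) : Function.Injective (midExtend σ) := by
  intro i j h
  unfold midExtend at h
  split_ifs at h with h1 h2 h2
  · exact h
  · exact absurd (h ▸ h1) (hm.not_mid j h2)
  · exact absurd (h ▸ h2) (hm.not_mid i h1)
  · exact hm.perm_injOn h1 h2 h

theorem IsMonomial.exists_perm_eq {m : SO2l F l ρ} {σ : Fin (2 * l) → Fin (2 * l)}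
    {T : Fin (2 * l) → F} (hm : IsMonomial m σ T) {k : Fin (2 * l)} (hk : ¬ IsMid l k) :
    ∃ j, ¬ IsMid l j ∧ σ j = k := by
  obtain ⟨j, hj⟩ := (Finite.injective_iff_surjective.mp hm.midExtend_injective) k
  unfold midExtend at hj
  split_ifs at hj with h
  · exact absurd (hj ▸ h) hk
  · exact ⟨j, h, hj⟩

theorem IsMonomial.mulVec_mid {m : SO2l F l ρ} {σ : Fin (2 * l) → Fin (2 * l)}
    {T : Fin (2 * l) → F} (hm : IsMonomial m σ T) {x : Fin (2 * l) → F}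
    (hx : ∀ i, ¬ IsMid l i → x i = 0) {k : Fin (2 * l)} (hk : ¬ IsMid l k) :
    (mat F m *ᵥ x) k = 0 := by
  obtain ⟨j, hj, hjk⟩ := hm.exists_perm_eq (isMid_dualIdx.not.mpr hk)
  have h := gram_mat m x (stdVec l j)
  rw [hm.col j hj, map_smul, hjk, gram_stdVec_right' (isMid_dualIdx.not.mpr hk), dualIdx_dualIdx,
    gram_stdVec_right' hj, hx _ (isMid_dualIdx.not.mpr hj), smul_eq_mul] at h
  exact (mul_eq_zero.mp h).resolve_left (hm.ne_zero j hj)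

/-- A function on `SO_{2l}` which is equivariant under the generic character on both sides. -/
structure BiEquivariant (ψ : AddChar F ℂ) (φ : SO2l F l ρ → ℂ) : Prop where
  left : ∀ u ∈ soUnip l ρ, ∀ g, φ (u * g) = ψ (soUSum l (mat F u)) * φ g
  right : ∀ u ∈ soUnip l ρ, ∀ g, φ (g * u) = ψ (soUSum l (mat F u)) * φ g

theorem BiEquivariant.char_eq {ψ : AddChar F ℂ} {φ : SO2l F l ρ → ℂ} (hφ : BiEquivariant ψ φ)
    {m u u' : SO2l F l ρ} (h0 : φ m ≠ 0) (hu : u ∈ soUnip l ρ) (hu' : u' ∈ soUnip l ρ)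
    (h : m * u = u' * m) : ψ (soUSum l (mat F u)) = ψ (soUSum l (mat F u')) := by
  apply mul_right_cancel₀ h0
  rw [← hφ.right u hu, ← hφ.left u' hu', h]

theorem soWt_of_not_isMid {a b : Fin (2 * l)} (hb : ¬ IsMid l b) :
    soWt F l a b = if (b : ℕ) = (a : ℕ) + 1 ∧ (a : ℕ) + 3 ≤ l then 1 else 0 := by
  unfold IsMid at hb
  rw [soWt]
  split_ifs with h1 h2
  · rfl
  · omega
  · rfl

theorem BiEquivariant.adjacent (h2 : (2 : F) ≠ 0) (hρ : ρ ≠ 0) {ψ : AddChar F ℂ} (hψ : ψ ≠ 1)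
    {φ : SO2l F l ρ → ℂ} (hφ : BiEquivariant ψ φ) {m : SO2l F l ρ} (h0 : φ m ≠ 0)
    {σ : Fin (2 * l) → Fin (2 * l)} {T : Fin (2 * l) → F} (hm : IsMonomial m σ T)
    {i j : Fin (2 * l)} (hij : (j : ℕ) = i + 1) (hil : (i : ℕ) + 3 ≤ l) (hlt : σ i < σ j) :
    (σ j : ℕ) = σ i + 1 ∧ (((σ i : ℕ) + 3 ≤ l ∧ T i = T j) ∨ (l + 1 ≤ (σ i : ℕ) ∧ T i = -T j)) := by
  have hi : ¬ IsMid l i := by unfold IsMid; omega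
  have hj : ¬ IsMid l j := by unfold IsMid; omega
  have hdi : ¬ IsMid l (dualIdx l i) := isMid_dualIdx.not.mpr hi
  have hdj : ¬ IsMid l (dualIdx l j) := isMid_dualIdx.not.mpr hj
  have ha := hm.not_mid i hi
  have hb := hm.not_mid j hj
  have hdb : ¬ IsMid l (dualIdx l (σ j)) := isMid_dualIdx.not.mpr hb
  have vdi := val_dualIdx hi
  have vdj := val_dualIdx hj
  have vda := val_dualIdx ha
  have vdb := val_dualIdx hb
  have hne : i ≠ j := by rw [Ne, Fin.ext_iff]; omega
  have hne' : i ≠ dualIdx l j := by rw [Ne, Fin.ext_iff]; omega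
  have hab : σ i ≠ dualIdx l (σ j) := by
    rw [← hm.perm_dual j hj]
    exact fun h => hne' (hm.perm_injOn hi hdj h)
  have hTj := hm.ne_zero j hj
  have key : ∀ s : F, ψ ((T j)⁻¹ * T j * s) =
      ψ ((T j)⁻¹ * ((soWt F l (σ i) (σ j) - soWt F l (dualIdx l (σ j)) (dualIdx l (σ i))) * T i)
        * s) := by
    intro s
    have hx1 : (s • stdVec (F := F) l i) (dualIdx l (dualIdx l j)) = 0 := by
      rw [dualIdx_dualIdx, Pi.smul_apply, stdVec_ne hne.symm, smul_zero]
    have hx2 : ((((T j)⁻¹ * s * T i) • stdVec (F := F) l (σ i)))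
        (dualIdx l (dualIdx l (σ j))) = 0 := by
      rw [dualIdx_dualIdx, Pi.smul_apply, stdVec_ne hlt.ne', smul_zero]
    have hE := mul_soEich h2 hρ (m := m) (a := dualIdx l (σ j)) (c := dualIdx l j) hdb hdj
      (t := (T j)⁻¹) (by rw [hm.col _ hdj, hm.coef_dual j hj, hm.perm_dual j hj]) _ hx1
      (((T j)⁻¹ * s * T i) • stdVec l (σ i))
      (by rw [Matrix.mulVec_smul, hm.col i hi, smul_smul, smul_smul, mul_assoc]) hx2
    have hk := hφ.char_eq h0 (soEich_mem h2 hρ hdj hx1 ?_ ?_)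
      (soEich_mem h2 hρ hdb hx2 ?_ ?_) hE
    · rw [soUSum_soEich_single h2 hρ hi hdj, soUSum_soEich_single h2 hρ ha hdb] at hk
      rw [soWt_of_not_isMid hj, soWt_of_not_isMid hdi, if_pos ⟨hij, hil⟩,
        if_neg (show ¬ ((dualIdx l i : ℕ) = (dualIdx l j : ℕ) + 1 ∧ (dualIdx l j : ℕ) + 3 ≤ l) by
          omega)] at hk
      convert hk using 2
      · field_simp; ring
      · ring
    · rw [Pi.smul_apply, stdVec_ne hne'.symm, smul_zero]
    · intro k hk
      rw [dualIdx_dualIdx, Fin.le_def] at hk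
      rw [Pi.smul_apply, stdVec_ne (show k ≠ i by rw [Ne, Fin.ext_iff]; omega), smul_zero]
    · rw [Pi.smul_apply, stdVec_ne hab.symm, smul_zero]
    · intro k hk
      rw [dualIdx_dualIdx] at hk
      rw [Pi.smul_apply, stdVec_ne (hlt.trans_le hk).ne', smul_zero]
  have hT := mul_left_cancel₀ (inv_ne_zero hTj) (eq_of_forall_char_mul_eq hψ key)
  have va := (σ i).2
  have vb := (σ j).2
  rw [Fin.lt_def] at hlt
  rw [soWt_of_not_isMid hb, soWt_of_not_isMid (isMid_dualIdx.not.mpr ha)] at hT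
  unfold IsMid at ha hb
  by_cases c1 : (σ j : ℕ) = σ i + 1 ∧ (σ i : ℕ) + 3 ≤ l
  · refine ⟨c1.1, Or.inl ⟨c1.2, ?_⟩⟩
    rw [if_pos c1, if_neg (by omega)] at hT
    linear_combination -hT
  · rw [if_neg c1] at hT
    by_cases c2 : (dualIdx l (σ i) : ℕ) = dualIdx l (σ j) + 1 ∧ (dualIdx l (σ j) : ℕ) + 3 ≤ l
    · refine ⟨by omega, Or.inr ⟨by omega, ?_⟩⟩
      rw [if_pos c2] at hT
      linear_combination hT
    · rw [if_neg c2] at hT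
      exact absurd (by linear_combination hT) hTj

theorem BiEquivariant.middle (h2 : (2 : F) ≠ 0) (hρ : ρ ≠ 0) {ψ : AddChar F ℂ} (hψ : ψ ≠ 1)
    {φ : SO2l F l ρ → ℂ} (hφ : BiEquivariant ψ φ) {m : SO2l F l ρ} (h0 : φ m ≠ 0)
    {σ : Fin (2 * l) → Fin (2 * l)} {T : Fin (2 * l) → F} (hm : IsMonomial m σ T)
    {i K L : Fin (2 * l)} (hil : (i : ℕ) + 2 = l) (hK : (K : ℕ) + 1 = l) (hL : (L : ℕ) = l)
    (hlt : (σ i : ℕ) < l) : σ i = i ∧ T i * mat F m L L = 1 ∧ mat F m L K = 0 := by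
  have hi : ¬ IsMid l i := by unfold IsMid; omega
  have hmK : IsMid l K := Or.inl hK
  have hmL : IsMid l L := Or.inr hL
  have ha := hm.not_mid i hi
  have vdi := val_dualIdx hi
  have vda := val_dualIdx ha
  have key : ∀ x : Fin (2 * l) → F, (∀ k, ¬ IsMid l k → x k = 0) →
      ψ (ρ / 2 * x L) =
        ψ (if (σ i : ℕ) + 2 = l then ρ / 2 * (T i * (mat F m *ᵥ x) L) else 0) := by
    intro x hx
    have hy : ∀ k, ¬ IsMid l k → (T i • (mat F m *ᵥ x)) k = 0 := fun k hk => by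
      rw [Pi.smul_apply, hm.mulVec_mid hx hk, smul_zero]
    have hE := mul_soEich h2 hρ ha hi (hm.col i hi) x (hx _ (isMid_dualIdx.not.mpr hi)) _ rfl
      (hy _ (isMid_dualIdx.not.mpr ha))
    have hk := hφ.char_eq h0 (soEich_mem h2 hρ hi _ (hx i hi) ?_)
      (soEich_mem h2 hρ ha _ (hy _ ha) ?_) hE
    · rw [soUSum_soEich_mid h2 hρ hL hi x hx, soUSum_soEich_mid h2 hρ hL ha _ hy,
        if_pos hil] at hk
      exact hk
    · intro k hk
      rw [Fin.le_def] at hk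
      exact hx k (by unfold IsMid; omega)
    · intro k hk
      rw [Fin.le_def] at hk
      unfold IsMid at ha
      exact hy k (by unfold IsMid; omega)
  have hmid : ∀ P : Fin (2 * l), IsMid l P → ∀ s : F, ∀ k, ¬ IsMid l k →
      (s • stdVec (F := F) l P) k = 0 := fun P hP s k hk => by
    rw [Pi.smul_apply, stdVec_ne (show k ≠ P from fun h => hk (h.symm ▸ hP)), smul_zero]
  have hρ2 : ρ / 2 ≠ 0 := div_ne_zero hρ h2
  have e1 := eq_of_forall_char_mul_eq hψ (a := ρ / 2)
    (b := if (σ i : ℕ) + 2 = l then ρ / 2 * (T i * mat F m L L) else 0) (fun s => by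
      have h := key _ (hmid L hmL s)
      rw [Matrix.mulVec_smul, mulVec_stdVec, Pi.smul_apply, Pi.smul_apply, Matrix.col_apply,
        stdVec_self, smul_eq_mul, smul_eq_mul, mul_one] at h
      rw [h]
      congr 1
      split_ifs <;> ring)
  have e2 := eq_of_forall_char_mul_eq hψ (a := 0)
    (b := if (σ i : ℕ) + 2 = l then ρ / 2 * (T i * mat F m L K) else 0) (fun s => by
      have h := key _ (hmid K hmK s)
      rw [Matrix.mulVec_smul, mulVec_stdVec, Pi.smul_apply, Pi.smul_apply, Matrix.col_apply,
        stdVec_ne (show L ≠ K by rw [Ne, Fin.ext_iff]; omega), smul_eq_mul, smul_eq_mul, mul_zero,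
        mul_zero] at h
      rw [zero_mul, h]
      congr 1
      split_ifs <;> ring)
  by_cases hc : (σ i : ℕ) + 2 = l
  · rw [if_pos hc] at e1 e2
    refine ⟨Fin.ext (by omega), ?_, ?_⟩
    · exact mul_left_cancel₀ hρ2 (by rw [mul_one, ← e1])
    · have := (mul_eq_zero.mp e2.symm).resolve_left hρ2
      exact (mul_eq_zero.mp this).resolve_left (hm.ne_zero i hi)
  · rw [if_neg hc] at e1
    exact absurd e1 hρ2

end EvenUniqueness

section EvenFlip

variable {l : ℕ} {ρ : F}

theorem reversal_fin {X : Type*} {N : ℕ} (σ : Fin N → Fin N) (s : Fin N → X)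
    (hinj : Function.Injective σ)
    (hasc : ∀ i j : Fin N, (j : ℕ) = i + 1 → σ j < σ i ∨ ((σ j : ℕ) = σ i + 1 ∧ s j = s i)) :
    ∀ i, σ (σ i).rev = i.rev ∧ s (σ i).rev = s i := by
  rcases Nat.eq_zero_or_pos N with rfl | hN
  · exact fun i => i.elim0
  let i0 : Fin N := ⟨0, hN⟩
  let σ' : ℕ → ℕ := fun i => if h : i < N then σ ⟨i, h⟩ else 0
  let s' : ℕ → X := fun i => if h : i < N then s ⟨i, h⟩ else s i0
  have hσ' : ∀ i : Fin N, σ' i = σ i := fun i => dif_pos i.2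
  have hs' : ∀ i : Fin N, s' i = s i := fun i => dif_pos i.2
  have key := reversal_of_unit_ascents N σ' s'
    (fun i hi => by rw [hσ' ⟨i, hi⟩]; exact (σ ⟨i, hi⟩).2)
    (fun i hi j hj h => by
      rw [hσ' ⟨i, hi⟩, hσ' ⟨j, hj⟩] at h
      exact congrArg Fin.val (hinj (Fin.ext h)))
    (fun i hi => by
      have := hasc ⟨i, by omega⟩ ⟨i + 1, hi⟩ rfl
      rw [Fin.lt_def, ← hσ', ← hσ', ← hs', ← hs'] at this
      exact this)
  intro i
  obtain ⟨k1, k2⟩ := key i i.2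
  have hr : N - 1 - σ' i = ((σ i).rev : Fin N) := by rw [hσ', Fin.val_rev]; omega
  rw [hr] at k1 k2
  rw [hσ'] at k1
  rw [hs', hs'] at k2
  exact ⟨Fin.ext (by rw [k1, Fin.val_rev]; omega), k2⟩

/-- The half of the sign pattern living on the lower indices. -/
def halfSign (F : Type) [Field F] (l : ℕ) (i : Fin (2 * l)) : F :=
  if (i : ℕ) ≤ l then 1 else flipSign F l i

theorem halfSign_mul_self (i : Fin (2 * l)) : halfSign F l i * halfSign F l i = 1 := by
  unfold halfSign
  split_ifs
  · rw [one_mul]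
  · exact flipSign_mul_self i

theorem halfSign_mul_dual {i : Fin (2 * l)} (hi : ¬ IsMid l i) :
    halfSign F l i * halfSign F l (dualIdx l i) = flipSign F l i := by
  have h1 := val_dualIdx hi
  have h2 := flipSign_dual (F := F) i
  unfold IsMid at hi
  unfold halfSign
  by_cases h : (i : ℕ) ≤ l
  · rw [if_pos h, if_neg (by omega), one_mul, h2]
  · rw [if_neg h, if_pos (by omega), mul_one]

theorem halfSign_of_le {i : Fin (2 * l)} (h : (i : ℕ) ≤ l) : halfSign F l i = 1 := if_pos h

theorem halfSign_succ {i j : Fin (2 * l)} (hi : l + 1 ≤ (i : ℕ))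
    (hij : (j : ℕ) = i + 1) : halfSign F l j = -halfSign F l i := by
  unfold halfSign
  rw [if_neg (show ¬ (j : ℕ) ≤ l by omega), if_neg (show ¬ (i : ℕ) ≤ l by omega),
    flipSign_of_ge (by omega), flipSign_of_ge (by omega),
    show (j : ℕ) - l = ((i : ℕ) - l) + 1 by omega, pow_succ, mul_neg, mul_one]

theorem gram_mid {K L : Fin (2 * l)} (hK : (K : ℕ) + 1 = l) (hL : (L : ℕ) = l)
    {x : Fin (2 * l) → F} (hx : ∀ i, ¬ IsMid l i → x i = 0) (y : Fin (2 * l) → F) :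
    gram (Jrho F l ρ) x y = x K * y K - ρ * (x L * y L) := by
  have hKL : K ≠ L := by rw [Ne, Fin.ext_iff]; omega
  rw [gram_sum, Finset.sum_eq_add K L hKL]
  · rw [dualIdx_of_isMid (Or.inl hK), dualIdx_of_isMid (Or.inr hL), dualCoef, dualCoef,
      if_neg (show ¬ (K : ℕ) = l by omega), if_pos hL]
    ring
  · rintro k _ ⟨h1, h2⟩
    rw [hx k (by unfold IsMid; rw [Ne, Fin.ext_iff] at h1 h2; omega), zero_mul]
  · simp
  · simp

theorem IsMonomial.col_mid {m : SO2l F l ρ} {σ : Fin (2 * l) → Fin (2 * l)}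
    {T : Fin (2 * l) → F} (hm : IsMonomial m σ T) {P : Fin (2 * l)} (hP : IsMid l P)
    {k : Fin (2 * l)} (hk : ¬ IsMid l k) : mat F m k P = 0 := by
  have h := hm.mulVec_mid (x := stdVec l P)
    (fun i hi => stdVec_ne (show i ≠ P from fun h => hi (h.symm ▸ hP))) hk
  rwa [mulVec_stdVec] at h

theorem IsMonomial.mid_isometry {m : SO2l F l ρ} {σ : Fin (2 * l) → Fin (2 * l)}
    {T : Fin (2 * l) → F} (hm : IsMonomial m σ T) {K L : Fin (2 * l)} (hK : (K : ℕ) + 1 = l)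
    (hL : (L : ℕ) = l) :
    mat F m K K * mat F m K K - ρ * (mat F m L K * mat F m L K) = 1 ∧
    mat F m K K * mat F m K L - ρ * (mat F m L K * mat F m L L) = 0 ∧
    mat F m K L * mat F m K L - ρ * (mat F m L L * mat F m L L) = -ρ := by
  have hmK : IsMid l K := Or.inl hK
  have hmL : IsMid l L := Or.inr hL
  have hKL : K ≠ L := by rw [Ne, Fin.ext_iff]; omega
  have key : ∀ P Q : Fin (2 * l), IsMid l P → mat F m K P * mat F m K Q -
      ρ * (mat F m L P * mat F m L Q) = gram (Jrho F l ρ) (stdVec l P) (stdVec l Q) := by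
    intro P Q hP
    rw [← gram_mat m, mulVec_stdVec, mulVec_stdVec, gram_mid hK hL (x := (mat F m).col P) (fun i hi => hm.col_mid hP hi)]
    rfl
  refine ⟨?_, ?_, ?_⟩
  · rw [key K K hmK, gram_stdVec_left, dualIdx_of_isMid hmK, stdVec_self, dualCoef,
      if_neg (show ¬ (K : ℕ) = l by omega), one_mul]
  · rw [key K L hmK, gram_stdVec_left, dualIdx_of_isMid hmK, stdVec_ne hKL, mul_zero]
  · rw [key L L hmL, gram_stdVec_left, dualIdx_of_isMid hmL, stdVec_self, dualCoef, if_pos hL,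
      mul_one]

theorem BiEquivariant.middle_cases (h2 : (2 : F) ≠ 0) (hρ : ρ ≠ 0) {ψ : AddChar F ℂ} (hψ : ψ ≠ 1)
    {φ : SO2l F l ρ → ℂ} (hφ : BiEquivariant ψ φ) {m : SO2l F l ρ} (h0 : φ m ≠ 0)
    {σ : Fin (2 * l) → Fin (2 * l)} {T : Fin (2 * l) → F} (hm : IsMonomial m σ T)
    {i K L : Fin (2 * l)} (hil : (i : ℕ) + 2 = l) (hK : (K : ℕ) + 1 = l) (hL : (L : ℕ) = l) :
    l + 1 ≤ (σ i : ℕ) ∨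
      σ i = i ∧ mat F m L K = 0 ∧ mat F m L L * mat F m L L = 1 ∧ mat F m L L = T i := by
  have hi : ¬ IsMid l i := by unfold IsMid; omega
  have ha := hm.not_mid i hi
  by_cases h : (σ i : ℕ) < l
  · obtain ⟨h1, h3, h4⟩ := hφ.middle h2 hρ hψ h0 hm hil hK hL h
    obtain ⟨e1, e2, e3⟩ := hm.mid_isometry hK hL
    rw [h4] at e1 e2
    have hp : mat F m K K ≠ 0 := by rintro h; rw [h] at e1; simp at e1
    have hq : mat F m K L = 0 := by
      apply mul_left_cancel₀ hp; linear_combination e2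
    rw [hq] at e3
    have hs : mat F m L L * mat F m L L = 1 := by
      apply mul_left_cancel₀ hρ; linear_combination -e3
    refine Or.inr ⟨h1, h4, hs, ?_⟩
    linear_combination T i * hs - mat F m L L * h3
  · unfold IsMid at ha
    exact Or.inl (by omega)

/-- The scalars attached to the points of a monomial element. -/
def monoSign (m : SO2l F l ρ) (σ : Fin (2 * l) → Fin (2 * l)) (T : Fin (2 * l) → F)
    (L i : Fin (2 * l)) : F :=
  if IsMid l i then mat F m L L else T i * halfSign F l i * halfSign F l (σ i)

theorem BiEquivariant.ascents (h2 : (2 : F) ≠ 0) (hρ : ρ ≠ 0) {ψ : AddChar F ℂ} (hψ : ψ ≠ 1)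
    {φ : SO2l F l ρ → ℂ} (hφ : BiEquivariant ψ φ) {m : SO2l F l ρ} (h0 : φ m ≠ 0)
    {σ : Fin (2 * l) → Fin (2 * l)} {T : Fin (2 * l) → F} (hm : IsMonomial m σ T)
    {L : Fin (2 * l)} (hL : (L : ℕ) = l) (i j : Fin (2 * l)) (hij : (j : ℕ) = i + 1) :
    midExtend σ j < midExtend σ i ∨ ((midExtend σ j : ℕ) = midExtend σ i + 1 ∧
      monoSign m σ T L j = monoSign m σ T L i) := by
  have hi2 := i.2
  have hj2 := j.2
  have hne : i ≠ j := by rw [Ne, Fin.ext_iff]; omega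
  rcases lt_trichotomy ((i : ℕ) + 2) l with h | h | h
  · have hi : ¬ IsMid l i := by unfold IsMid; omega
    have hj : ¬ IsMid l j := by unfold IsMid; omega
    rw [midExtend, midExtend, monoSign, monoSign, if_neg hi, if_neg hj, if_neg hi, if_neg hj]
    rcases lt_trichotomy (σ j) (σ i) with h' | h' | h'
    · exact Or.inl h'
    · exact absurd (hm.perm_injOn hj hi h').symm hne
    · obtain ⟨e1, e2⟩ := hφ.adjacent h2 hρ hψ h0 hm hij h h'
      refine Or.inr ⟨e1, ?_⟩
      rw [halfSign_of_le (show (i : ℕ) ≤ l by omega), halfSign_of_le (show (j : ℕ) ≤ l by omega)]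
      rcases e2 with ⟨e2, e3⟩ | ⟨e2, e3⟩
      · rw [halfSign_of_le (show (σ i : ℕ) ≤ l by omega),
          halfSign_of_le (show (σ j : ℕ) ≤ l by omega), e3]
      · rw [halfSign_succ e2 e1, e3]; ring
  · have hi : ¬ IsMid l i := by unfold IsMid; omega
    have hj : IsMid l j := Or.inl (by omega)
    rw [midExtend, midExtend, monoSign, monoSign, if_neg hi, if_pos hj, if_neg hi, if_pos hj]
    rcases hφ.middle_cases h2 hρ hψ h0 hm h (K := j) (by omega) hL with h' | ⟨e1, e2, e3, e4⟩
    · exact Or.inl (by rw [Fin.lt_def]; omega)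
    · refine Or.inr ⟨by rw [e1, hij], ?_⟩
      rw [e1, halfSign_of_le (by omega), e4, mul_one, mul_one]
  · by_cases hi : IsMid l i
    · by_cases hj : IsMid l j
      · rw [midExtend, midExtend, monoSign, monoSign, if_pos hi, if_pos hj, if_pos hi, if_pos hj]
        exact Or.inr ⟨hij, rfl⟩
      · rw [midExtend, midExtend, monoSign, monoSign, if_pos hi, if_neg hj, if_pos hi, if_neg hj]
        have hdj := val_dualIdx hj
        have hds := val_dualIdx (hm.not_mid j hj)
        have hsj := (σ j).2
        have hjv : (j : ℕ) = l + 1 := by unfold IsMid at hi hj; omega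
        let K : Fin (2 * l) := ⟨l - 1, by omega⟩
        have hK : (K : ℕ) + 1 = l := by show l - 1 + 1 = l; omega
        rcases hφ.middle_cases h2 hρ hψ h0 hm (i := dualIdx l j) (by omega) hK hL with
          h' | ⟨e1, e2, e3, e4⟩
        · rw [hm.perm_dual j hj] at h'
          exact Or.inl (by rw [Fin.lt_def]; unfold IsMid at hi; omega)
        · rw [hm.perm_dual j hj] at e1
          have e5 := dualIdx_injective e1
          refine Or.inr ⟨by rw [e5, hij], ?_⟩
          rw [e5, mul_assoc, halfSign_mul_self, mul_one, e4, hm.coef_dual j hj]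
          rw [hm.coef_dual j hj] at e4
          rw [e4] at e3
          have := hm.ne_zero j hj
          field_simp at e3
          field_simp
          linear_combination -e3
    · have hj : ¬ IsMid l j := by unfold IsMid at hi ⊢; omega
      rw [midExtend, midExtend, monoSign, monoSign, if_neg hi, if_neg hj, if_neg hi, if_neg hj]
      have hdi := val_dualIdx hi
      have hdj := val_dualIdx hj
      have hsi := val_dualIdx (hm.not_mid i hi)
      have hsj := val_dualIdx (hm.not_mid j hj)
      have hi' := hm.not_mid i hi
      have hj' := hm.not_mid j hj
      have bi := (σ i).2
      have bj := (σ j).2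
      rcases lt_trichotomy (σ j) (σ i) with h' | h' | h'
      · exact Or.inl h'
      · exact absurd (hm.perm_injOn hj hi h').symm hne
      · have hiv : l + 1 ≤ (i : ℕ) := by unfold IsMid at hi; omega
        have hkey := hφ.adjacent h2 hρ hψ h0 hm (i := dualIdx l j) (j := dualIdx l i) (by omega)
          (by omega) (by
            rw [hm.perm_dual j hj, hm.perm_dual i hi, Fin.lt_def]
            rw [Fin.lt_def] at h'
            omega)
        rw [hm.perm_dual j hj, hm.perm_dual i hi, hm.coef_dual i hi, hm.coef_dual j hj] at hkey
        obtain ⟨e1, e2⟩ := hkey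
        have e3 : (σ j : ℕ) = σ i + 1 := by omega
        refine Or.inr ⟨e3, ?_⟩
        rw [halfSign_succ hiv hij]
        unfold IsMid at hi' hj'
        rcases e2 with ⟨e2, e4⟩ | ⟨e2, e4⟩
        · rw [halfSign_succ (show l + 1 ≤ (σ i : ℕ) by omega) e3, inv_injective e4]; ring
        · rw [← inv_neg] at e4
          rw [halfSign_of_le (show (σ i : ℕ) ≤ l by omega),
            halfSign_of_le (show (σ j : ℕ) ≤ l by omega), inv_injective e4]; ring

theorem BiEquivariant.involutive (h2 : (2 : F) ≠ 0) (hρ : ρ ≠ 0) {ψ : AddChar F ℂ} (hψ : ψ ≠ 1)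
    {φ : SO2l F l ρ → ℂ} (hφ : BiEquivariant ψ φ) {m : SO2l F l ρ} (h0 : φ m ≠ 0)
    {σ : Fin (2 * l) → Fin (2 * l)} {T : Fin (2 * l) → F} (hm : IsMonomial m σ T)
    {L : Fin (2 * l)} (hL : (L : ℕ) = l) {i : Fin (2 * l)} (hi : ¬ IsMid l i) :
    σ (σ i) = i ∧ T i * T (σ i) * (flipSign F l i * flipSign F l (σ i)) = 1 := by
  obtain ⟨k1, k2⟩ := reversal_fin (midExtend σ) (monoSign m σ T L) hm.midExtend_injective
    (hφ.ascents h2 hρ hψ h0 hm hL) i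
  have hs := hm.not_mid i hi
  rw [midExtend, midExtend, if_neg hi, ← dualIdx_of_not_isMid hs,
    if_neg (isMid_dualIdx.not.mpr hs), ← dualIdx_of_not_isMid hi, hm.perm_dual _ hs] at k1
  have k3 := dualIdx_injective k1
  refine ⟨k3, ?_⟩
  rw [monoSign, monoSign, midExtend, if_neg hi, if_neg hi, ← dualIdx_of_not_isMid hs,
    if_neg (isMid_dualIdx.not.mpr hs), hm.perm_dual _ hs, k3, hm.coef_dual _ hs] at k2
  rw [← halfSign_mul_dual hi, ← halfSign_mul_dual hs]
  have hT := hm.ne_zero _ hs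
  have q1 := halfSign_mul_self (F := F) (dualIdx l i)
  have q2 := halfSign_mul_self (F := F) (dualIdx l (σ i))
  have q3 := mul_inv_cancel₀ hT
  calc _ = (T (σ i) * (halfSign F l (dualIdx l i) * halfSign F l (dualIdx l (σ i)))) *
        (T i * halfSign F l i * halfSign F l (σ i)) := by ring
    _ = (T (σ i) * (T (σ i))⁻¹) * (halfSign F l (dualIdx l i) * halfSign F l (dualIdx l i)) *
        (halfSign F l (dualIdx l (σ i)) * halfSign F l (dualIdx l (σ i))) := by rw [← k2]; ring
    _ = 1 := by rw [q1, q2, q3]; ring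

end EvenFlip

section EvenWhittaker

variable {l : ℕ} {ρ : F}

theorem det_of_two_block {n : Type*} [Fintype n] [DecidableEq n] (M : Matrix n n F) {K L : n}
    (hKL : K ≠ L) (h1 : ∀ j, j ≠ K → j ≠ L → ∀ i, M i j = (1 : Matrix n n F) i j)
    (h2 : ∀ i, i ≠ K → i ≠ L → M i K = 0 ∧ M i L = 0) :
    M.det = M K K * M L L - M K L * M L K := by
  let V : Matrix (Fin 2) n F := Matrix.of fun a j => (M - 1) (if a = 0 then K else L) j
  let U : Matrix n (Fin 2) F := Matrix.of fun i a => (1 : Matrix n n F) i (if a = 0 then K else L)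
  have hV0 : ∀ j, V 0 j = M K j - (1 : Matrix n n F) K j := fun j => rfl
  have hV1 : ∀ j, V 1 j = M L j - (1 : Matrix n n F) L j := fun j => rfl
  have hU0 : ∀ i, U i 0 = (1 : Matrix n n F) i K := fun j => rfl
  have hU1 : ∀ i, U i 1 = (1 : Matrix n n F) i L := fun j => rfl
  have hM : M = 1 + U * V := by
    ext i j
    rw [Matrix.add_apply, Matrix.mul_apply, Fin.sum_univ_two]
    rw [hU0, hU1, hV0, hV1]
    by_cases hiK : i = K
    · subst hiK; rw [Matrix.one_apply_eq, Matrix.one_apply_ne hKL]; ring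
    by_cases hiL : i = L
    · subst hiL; rw [Matrix.one_apply_eq, Matrix.one_apply_ne hKL.symm]; ring
    rw [Matrix.one_apply_ne hiK, Matrix.one_apply_ne hiL]
    by_cases hjK : j = K
    · subst hjK; rw [(h2 i hiK hiL).1, Matrix.one_apply_ne hiK]; ring
    by_cases hjL : j = L
    · subst hjL; rw [(h2 i hiK hiL).2, Matrix.one_apply_ne hiL]; ring
    rw [h1 j hjK hjL]; ring
  have hVU : 1 + V * U = !![M K K, M K L; M L K, M L L] := by
    have hcol : ∀ a i, (∑ k, V a k * (1 : Matrix n n F) k i) = V a i := fun a i => by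
      rw [← Matrix.mul_apply, Matrix.mul_one]
    ext a b
    rw [Matrix.add_apply, Matrix.mul_apply]
    fin_cases a <;> fin_cases b
    · show (1 : Matrix (Fin 2) (Fin 2) F) 0 0 + ∑ k, V 0 k * (1 : Matrix n n F) k K = M K K
      rw [hcol, hV0, Matrix.one_apply_eq, Matrix.one_apply_eq]; ring
    · show (1 : Matrix (Fin 2) (Fin 2) F) 0 1 + ∑ k, V 0 k * (1 : Matrix n n F) k L = M K L
      rw [hcol, hV0, Matrix.one_apply_ne hKL, Matrix.one_apply_ne (by decide)]; ring
    · show (1 : Matrix (Fin 2) (Fin 2) F) 1 0 + ∑ k, V 1 k * (1 : Matrix n n F) k K = M L K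
      rw [hcol, hV1, Matrix.one_apply_ne hKL.symm, Matrix.one_apply_ne (by decide)]; ring
    · show (1 : Matrix (Fin 2) (Fin 2) F) 1 1 + ∑ k, V 1 k * (1 : Matrix n n F) k L = M L L
      rw [hcol, hV1, Matrix.one_apply_eq, Matrix.one_apply_eq]; ring
  calc M.det = (1 + U * V).det := by rw [← hM]
    _ = (1 + V * U).det := Matrix.det_one_add_mul_comm U V
    _ = _ := by rw [hVU, Matrix.det_fin_two_of]

theorem card_isMid (hl : 1 ≤ l) : Fintype.card {i : Fin (2 * l) // IsMid l i} = 2 := by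
  rw [Fintype.card_subtype]
  have : (Finset.univ.filter fun i : Fin (2 * l) => IsMid l i) =
      {⟨l - 1, by omega⟩, ⟨l, by omega⟩} := by
    ext i
    rw [Finset.mem_filter, Finset.mem_insert, Finset.mem_singleton, Fin.ext_iff, Fin.ext_iff]
    unfold IsMid
    refine ⟨fun h => ?_, fun h => ⟨Finset.mem_univ _, ?_⟩⟩
    · have := h.2
      show (i : ℕ) = l - 1 ∨ (i : ℕ) = l
      omega
    · have : (i : ℕ) = l - 1 ∨ (i : ℕ) = l := h
      omega
  rw [this, Finset.card_pair]
  rw [Ne, Fin.ext_iff]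
  show ¬ l - 1 = l
  omega

theorem IsMonomial.prod_coef {m : SO2l F l ρ} {σ : Fin (2 * l) → Fin (2 * l)}
    {T : Fin (2 * l) → F} (hm : IsMonomial m σ T) :
    ∏ i, (if IsMid l i then 1 else T i) = 1 := by
  refine Finset.prod_involution (fun i _ => dualIdx l i) ?_ ?_ ?_ ?_
  · intro i _
    by_cases h : IsMid l i
    · rw [if_pos h, if_pos (isMid_dualIdx.mpr h), mul_one]
    · rw [if_neg h, if_neg (isMid_dualIdx.not.mpr h), hm.coef_dual i h,
        mul_inv_cancel₀ (hm.ne_zero i h)]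
  · intro i _ hi
    by_cases h : IsMid l i
    · exact absurd (if_pos h) hi
    · exact dualIdx_ne_self h
  · intro i _; exact Finset.mem_univ _
  · intro i _; exact dualIdx_dualIdx i

theorem IsMonomial.mid_det {m : SO2l F l ρ} {σ : Fin (2 * l) → Fin (2 * l)}
    {T : Fin (2 * l) → F} (hm : IsMonomial m σ T) (hl : 1 ≤ l)
    (hσ : ∀ i, ¬ IsMid l i → σ (σ i) = i ∧ σ i ≠ i) {K L : Fin (2 * l)} (hK : (K : ℕ) + 1 = l)
    (hL : (L : ℕ) = l) :
    mat F m K K * mat F m L L - mat F m K L * mat F m L K = (-1) ^ (l - 1) := by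
  have hKL : K ≠ L := by rw [Ne, Fin.ext_iff]; omega
  have hmid : ∀ i, i ≠ K → i ≠ L → ¬ IsMid l i := by
    intro i h1 h2; rw [Ne, Fin.ext_iff] at h1 h2; unfold IsMid; omega
  let s : Equiv.Perm (Fin (2 * l)) :=
    Equiv.ofBijective _ (Finite.injective_iff_bijective.mp hm.midExtend_injective)
  have hs : ∀ i, s i = midExtend σ i := fun _ => rfl
  have hs2 : s ^ 2 = 1 := by
    ext i
    rw [pow_two, Equiv.Perm.mul_apply, hs, hs, Equiv.Perm.one_apply]
    by_cases h : IsMid l i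
    · rw [midExtend, midExtend, if_pos h, if_pos h]
    · rw [midExtend, midExtend, if_neg h, if_neg (hm.not_mid i h), (hσ i h).1]
  have hfix : Function.fixedPoints s = {i | IsMid l i} := by
    ext i
    rw [Function.mem_fixedPoints, Function.IsFixedPt, hs, Set.mem_ofPred_eq, midExtend]
    by_cases h : IsMid l i
    · simp [h]
    · simp [h, (hσ i h).2]
  have hsign : Equiv.Perm.sign s = (-1) ^ (l - 1) := by
    rw [Equiv.Perm.sign_of_pow_two_eq_one hs2]
    congr 1
    have : Fintype.card (Function.fixedPoints s) = 2 := by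
      refine Eq.trans ?_ (card_isMid (l := l) hl)
      rw [← Nat.card_eq_fintype_card, ← Nat.card_eq_fintype_card, hfix]
      rfl
    rw [this, Fintype.card_fin]
    omega
  let B : Matrix (Fin (2 * l)) (Fin (2 * l)) F := Matrix.of fun i j =>
    if IsMid l j then mat F m i j else (1 : Matrix _ _ F) i j
  have hBdet := det_of_two_block B hKL
    (fun j h1 h2 i => if_neg (hmid j h1 h2))
    (fun i h1 h2 => ⟨(if_pos (Or.inl hK)).trans (hm.col_mid (Or.inl hK) (hmid i h1 h2)),
      (if_pos (Or.inr hL)).trans (hm.col_mid (Or.inr hL) (hmid i h1 h2))⟩)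
  have hBK : ∀ i, B i K = mat F m i K := fun i => if_pos (Or.inl hK)
  have hBL : ∀ i, B i L = mat F m i L := fun i => if_pos (Or.inr hL)
  rw [hBK, hBK, hBL, hBL] at hBdet
  let T' : Fin (2 * l) → F := fun i => if IsMid l i then 1 else T i
  have hfac : mat F m = (Matrix.diagonal T' * Equiv.Perm.permMatrix F s)ᵀ * B := by
    ext i j
    have hN : ∀ i k, (Matrix.diagonal T' * Equiv.Perm.permMatrix F s)ᵀ i k =
        if i = midExtend σ k then T' k else 0 := by
      intro i k
      rw [Matrix.transpose_apply, Matrix.diagonal_mul, Equiv.Perm.permMatrix,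
        PEquiv.toMatrix_apply]
      by_cases h : i = midExtend σ k
      · simp [h, hs]
      · simp [h, hs, Ne.symm h]
    rw [Matrix.mul_apply]
    simp only [hN, ite_mul, zero_mul]
    by_cases hj : IsMid l j
    · have hBj : ∀ k, B k j = mat F m k j := fun k => if_pos hj
      rw [Finset.sum_eq_single i]
      · rw [hBj]
        by_cases hi : IsMid l i
        · simp [T', midExtend, hi]
        · rw [hm.col_mid hj hi]; simp
      · intro k _ hk
        rw [hBj]
        by_cases hk' : IsMid l k
        · rw [midExtend, if_pos hk', if_neg hk.symm]
        · rw [hm.col_mid hj hk']; simp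
      · simp
    · have hBj : ∀ k, B k j = (1 : Matrix _ _ F) k j := fun k => if_neg hj
      rw [Finset.sum_eq_single j]
      · have h := congrFun (hm.col j hj) i
        rw [mulVec_stdVec, Matrix.col_apply] at h
        rw [h, hBj, Matrix.one_apply_eq, mul_one, midExtend, if_neg hj, Pi.smul_apply]
        by_cases h' : i = σ j
        · rw [h', stdVec_self, if_pos rfl]; simp [T', hj]
        · rw [stdVec_ne h', if_neg h', smul_zero]
      · intro k _ hk
        rw [hBj, Matrix.one_apply_ne hk]; simp
      · simp
  have hdet := congrArg Matrix.det hfac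
  rw [mat_det, Matrix.det_mul, Matrix.det_transpose, Matrix.det_mul, Matrix.det_diagonal,
    Matrix.det_permutation, hsign, hBdet] at hdet
  have hT' : ∏ i, T' i = 1 := hm.prod_coef
  rw [hT'] at hdet
  push_cast at hdet
  have h1 : ((-1 : F) ^ (l - 1)) * (-1) ^ (l - 1) = 1 := by rw [← mul_pow]; simp
  linear_combination -(-1 : F) ^ (l - 1) * hdet - (mat F m K K * mat F m L L - mat F m K L * mat F m L K) * h1

end EvenWhittaker

section EvenUniqueness

variable {l : ℕ} {ρ : F}

theorem BiEquivariant.all_moved (h2 : (2 : F) ≠ 0) (hρ : ρ ≠ 0) {ψ : AddChar F ℂ} (hψ : ψ ≠ 1)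
    {φ : SO2l F l ρ → ℂ} (hφ : BiEquivariant ψ φ) {m : SO2l F l ρ} (h0 : φ m ≠ 0)
    {σ : Fin (2 * l) → Fin (2 * l)} {T : Fin (2 * l) → F} (hm : IsMonomial m σ T)
    {i₀ : Fin (2 * l)} (hi₀ : (i₀ : ℕ) + 2 = l) (hs : l + 1 ≤ (σ i₀ : ℕ)) (i : Fin (2 * l))
    (hi : ¬ IsMid l i) : σ i ≠ i := by
  have key : ∀ d : ℕ, ∀ i : Fin (2 * l), (i : ℕ) + d + 2 = l → l + 1 ≤ (σ i : ℕ) := by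
    intro d
    induction d with
    | zero =>
      intro i hi
      rwa [show i = i₀ from Fin.ext (by omega)]
    | succ d ih =>
      intro i hi
      have hj := ih ⟨i + 1, by omega⟩ (by show (i : ℕ) + 1 + d + 2 = l; omega)
      by_contra hlt
      have := hφ.adjacent h2 hρ hψ h0 hm (i := i) (j := ⟨i + 1, by omega⟩) rfl (by omega)
        (by rw [Fin.lt_def]; omega)
      have hn := hm.not_mid i (by unfold IsMid; omega)
      unfold IsMid at hn
      omega
  intro h
  rcases lt_or_ge (i : ℕ) l with hil | hil
  · have hi' := hi
    unfold IsMid at hi'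
    have := key (l - 2 - i) i (by omega)
    rw [h] at this
    omega
  · have hi' := hi
    unfold IsMid at hi'
    have hv := val_dualIdx hi
    have h2i := i.2
    have := key (l - 2 - dualIdx l i) (dualIdx l i) (by omega)
    rw [hm.perm_dual i hi, h] at this
    omega

theorem BiEquivariant.middle_flip (h2 : (2 : F) ≠ 0) (hρ : ρ ≠ 0) {ψ : AddChar F ℂ} (hψ : ψ ≠ 1)
    {φ : SO2l F l ρ → ℂ} (hφ : BiEquivariant ψ φ) {m : SO2l F l ρ} (h0 : φ m ≠ 0)
    {σ : Fin (2 * l) → Fin (2 * l)} {T : Fin (2 * l) → F} (hm : IsMonomial m σ T) (hl : 2 ≤ l)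
    {K L : Fin (2 * l)} (hK : (K : ℕ) + 1 = l) (hL : (L : ℕ) = l) :
    mat F m K K * mat F m K K + (-1) ^ l * (mat F m K L * mat F m L K) = 1 ∧
    mat F m K L * (mat F m K K + (-1) ^ l * mat F m L L) = 0 ∧
    mat F m L K * ((-1) ^ l * mat F m K K + mat F m L L) = 0 ∧
    (-1) ^ l * (mat F m L K * mat F m K L) + mat F m L L * mat F m L L = 1 := by
  obtain ⟨e1, e2, e3⟩ := hm.mid_isometry hK hL
  let i₀ : Fin (2 * l) := ⟨l - 2, by omega⟩
  have hi₀ : (i₀ : ℕ) + 2 = l := by show l - 2 + 2 = l; omega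
  rcases hφ.middle_cases h2 hρ hψ h0 hm hi₀ hK hL with h | ⟨-, hr, hs, -⟩
  · have hmv := hφ.all_moved h2 hρ hψ h0 hm hi₀ h
    have hd := hm.mid_det (by omega)
      (fun i hi => ⟨(hφ.involutive h2 hρ hψ h0 hm hL hi).1, hmv i hi⟩) hK hL
    have hpow : (-1 : F) ^ l = -(-1) ^ (l - 1) := by
      obtain ⟨k, rfl⟩ : ∃ k, l = k + 1 := ⟨l - 1, by omega⟩
      rw [Nat.add_sub_cancel, pow_succ]; ring
    have hδ : (-1 : F) ^ (l - 1) * (-1) ^ (l - 1) = 1 := by rw [← mul_pow]; simp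
    rw [hpow]
    obtain ⟨δ, hδ'⟩ : ∃ δ : F, δ = (-1) ^ (l - 1) := ⟨_, rfl⟩
    rw [← hδ'] at hd hδ ⊢
    generalize mat F m K K = p at *
    generalize mat F m K L = q at *
    generalize mat F m L K = r at *
    generalize mat F m L L = s at *
    have hsp : s = δ * p := by linear_combination (-s) * e1 + r * e2 + p * hd
    have hps : p = δ * s := by rw [hsp]; linear_combination (-p) * hδ
    refine ⟨?_, ?_, ?_, ?_⟩
    · linear_combination p * hps + δ * hd + hδ
    · linear_combination q * hps
    · linear_combination r * hsp
    · linear_combination s * hsp + δ * hd + hδ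
  · have hp : mat F m K K * mat F m K K = 1 := by rw [hr] at e1; linear_combination e1
    have hq : mat F m K L = 0 := by
      rw [hr] at e2; linear_combination (-mat F m K L) * hp + mat F m K K * e2
    rw [hr, hq]
    refine ⟨?_, ?_, ?_, ?_⟩
    · linear_combination hp
    · ring
    · ring
    · linear_combination hs

theorem BiEquivariant.soFlip_eq (h2 : (2 : F) ≠ 0) (hρ : ρ ≠ 0) {ψ : AddChar F ℂ} (hψ : ψ ≠ 1)
    {φ : SO2l F l ρ → ℂ} (hφ : BiEquivariant ψ φ) {m : SO2l F l ρ} (h0 : φ m ≠ 0)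
    {σ : Fin (2 * l) → Fin (2 * l)} {T : Fin (2 * l) → F} (hm : IsMonomial m σ T) (hl : 2 ≤ l) :
    soFlip l ρ m = m := by
  have hkey : signConj l ρ m * m = 1 := by
    apply mat_injective
    obtain ⟨K, hK⟩ : ∃ K : Fin (2 * l), (K : ℕ) + 1 = l := ⟨⟨l - 1, by omega⟩, by
      show l - 1 + 1 = l; omega⟩
    obtain ⟨L, hL⟩ : ∃ L : Fin (2 * l), (L : ℕ) = l := ⟨⟨l, by omega⟩, rfl⟩
    have hKL : K ≠ L := by rw [Ne, Fin.ext_iff]; omega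
    have hdK : flipSign F l K = (-1) ^ l := if_pos hK
    have hdL : flipSign F l L = 1 := by rw [flipSign_of_ge (by omega), hL]; simp
    obtain ⟨f1, f2, f3, f4⟩ := hφ.middle_flip h2 hρ hψ h0 hm hl hK hL
    have hε : ((-1 : F) ^ l) * (-1) ^ l = 1 := by rw [← mul_pow]; simp
    have hcases : ∀ i : Fin (2 * l), IsMid l i → i = K ∨ i = L := by
      intro i hi
      rcases hi with hi | hi
      · exact Or.inl (Fin.ext (by omega))
      · exact Or.inr (Fin.ext (by omega))
    ext i j
    rw [mat_mul, mat_one, Matrix.mul_apply]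
    simp only [signConj_apply]
    have hentry : ∀ j, ¬ IsMid l j → ∀ i, mat F m i j = if i = σ j then T j else 0 := by
      intro j hj i
      have h := congrFun (hm.col j hj) i
      rw [mulVec_stdVec, Matrix.col_apply] at h
      rw [h, Pi.smul_apply]
      split_ifs with h'
      · rw [h', stdVec_self, smul_eq_mul, mul_one]
      · rw [stdVec_ne h', smul_zero]
    by_cases hj : IsMid l j
    · rw [Finset.sum_eq_add K L hKL (fun k _ hk => by
        rw [hm.col_mid hj (fun h => (hcases k h).elim hk.1 hk.2), mul_zero]) (by simp) (by simp),
        hdK, hdL]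
      by_cases hi : IsMid l i
      · rcases hcases i hi with hi | hi <;> rcases hcases j hj with hj | hj
        · rw [hi, hj, hdK, Matrix.one_apply_eq]
          linear_combination f1 + mat F m K K ^ 2 * hε
        · rw [hi, hj, hdK, Matrix.one_apply_ne hKL]
          linear_combination f2 + mat F m K K * mat F m K L * hε
        · rw [hi, hj, hdL, Matrix.one_apply_ne hKL.symm]
          linear_combination f3
        · rw [hi, hj, hdL, Matrix.one_apply_eq]; linear_combination f4
      · rw [hm.col_mid (Or.inl hK) hi, hm.col_mid (Or.inr hL) hi,
          Matrix.one_apply_ne (show i ≠ j from fun h => hi (h.symm ▸ hj))]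
        ring
    · obtain ⟨g1, g2⟩ := hφ.involutive h2 hρ hψ h0 hm hL hj
      rw [Finset.sum_eq_single (σ j)]
      · rw [hentry j hj, if_pos rfl, hentry _ (hm.not_mid j hj), g1]
        by_cases hij : i = j
        · rw [if_pos hij, hij, Matrix.one_apply_eq]; linear_combination g2
        · rw [if_neg hij, Matrix.one_apply_ne hij]; ring
      · intro k _ hk
        rw [hentry j hj, if_neg hk, mul_zero]
      · simp
  rw [soFlip, map_inv]
  exact inv_eq_of_mul_eq_one_right hkey

theorem so_whittaker_unique (h2 : (2 : F) ≠ 0) (hρ : ∀ x : F, x ^ 2 ≠ ρ) (hl : 2 ≤ l)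
    {ψ : AddChar F ℂ} (hψ : ψ ≠ 1) {V : Type*} [AddCommGroup V] [Module ℂ V]
    {π : Representation ℂ (SO2l F l ρ) V} (hπ : IsIrrep π) {Γ Γ' : V →ₗ[ℂ] ℂ}
    (hΓ : IsWhittaker F l ρ ψ π Γ)
    (hΓ' : ∀ u ∈ USet F l ρ, ∀ v : V, Γ' (π u v) = psiU F l ψ (mat F u) * Γ' v) :
    ∃ c : ℂ, Γ' = c • Γ := by
  have hρ0 : ρ ≠ 0 := fun h => hρ 0 (by rw [h]; simp)
  have hne : ∀ a : F, ψ a ≠ 0 := fun a => (AddChar.val_isUnit ψ a).ne_zero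
  obtain ⟨χ, hχ⟩ : ∃ χ : SO2l F l ρ → ℂ, ∀ u, χ u = ψ (soUSum l (mat F u)) := ⟨_, fun _ => rfl⟩
  have hmul : ∀ u ∈ soUnip l ρ, ∀ u' ∈ soUnip l ρ, χ (u * u') = χ u * χ u' := by
    intro u hu u' hu'
    rw [hχ, hχ, hχ, soUSum_mul hu hu', AddChar.map_add_eq_mul]
  refine equivariant_functional_unique (U := soUnip l ρ) (χ := χ) hπ
    (fun u _ => by rw [hχ]; exact hne _) hmul (soFlip l ρ) soFlip_mul soFlip_soFlip
    (fun u hu => soFlip_mem hu) (fun u hu => by rw [hχ, hχ, soUSum_soFlip hu]) ?_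
    Γ Γ' hΓ.1
    (fun u hu v => by rw [hχ]; exact hΓ.2 u hu v) (fun u hu v => by rw [hχ]; exact hΓ' u hu v)
  simp only [hχ]
  intro φ hφl hφr g
  have hφ : BiEquivariant ψ φ := ⟨hφl, hφr⟩
  have hφ' : BiEquivariant ψ fun g => φ (soFlip l ρ g) := by
    refine ⟨fun u hu g => ?_, fun u hu g => ?_⟩
    · show φ (soFlip l ρ (u * g)) = _
      rw [soFlip_mul, hφr _ (soFlip_mem hu), soUSum_soFlip hu]
    · show φ (soFlip l ρ (g * u)) = _
      rw [soFlip_mul, hφl _ (soFlip_mem hu), soUSum_soFlip hu]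
  obtain ⟨u, hu, u', hu', hm⟩ := exists_partMono h2 hρ g (l - 1) (by omega)
  obtain ⟨m, hmdef⟩ : ∃ m, m = u * g * u' := ⟨_, rfl⟩
  rw [← hmdef] at hm
  obtain ⟨σ, T, hmono⟩ := hm.isMonomial
  have hfix : φ (soFlip l ρ m) = φ m := by
    by_cases h0 : φ m = 0
    · by_cases h1 : φ (soFlip l ρ m) = 0
      · rw [h0, h1]
      · rw [hφ'.soFlip_eq h2 hρ0 hψ h1 hmono hl]
    · rw [hφ.soFlip_eq h2 hρ0 hψ h0 hmono hl]
  have e1 : φ m = ψ (soUSum l (mat F u')) * (ψ (soUSum l (mat F u)) * φ g) := by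
    rw [hmdef, hφ.right _ hu', hφ.left _ hu]
  have e2 : φ (soFlip l ρ m) =
      ψ (soUSum l (mat F u')) * (ψ (soUSum l (mat F u)) * φ (soFlip l ρ g)) := by
    have e3 := hφ'.right _ hu' (u * g)
    have e4 := hφ'.left _ hu g
    rw [hmdef, e3, e4]
  rw [e1, e2] at hfix
  exact mul_left_cancel₀ (hne _) (mul_left_cancel₀ (hne _) hfix)

end EvenUniqueness

section Embedding

variable {l : ℕ} {ρ : F}

/-- The central index of `2l + 1`. -/
def ctr (l : ℕ) : Fin (2 * l + 1) := ⟨l, by omega⟩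

theorem val_succAbove (i : Fin (2 * l)) :
    (((ctr l).succAbove i : Fin (2 * l + 1)) : ℕ) = if (i : ℕ) < l then (i : ℕ) else i + 1 := by
  unfold Fin.succAbove
  by_cases h : (i : ℕ) < l
  · rw [if_pos (show i.castSucc < ctr l from h), if_pos h]; rfl
  · rw [if_neg (show ¬ i.castSucc < ctr l from h), if_neg h]; rfl

/-- The component of a vector in the `2l`-dimensional space. -/
def projW (l : ℕ) (ρ : F) : (Fin (2 * l + 1) → F) →ₗ[F] (Fin (2 * l) → F) :=
  LinearMap.funLeft F F (ctr l).succAbove ∘ₗ (Mtop F l ρ).mulVecLin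

/-- The component of a vector on the anisotropic line fixed by `SO_{2l}`. -/
def projL (l : ℕ) (ρ : F) : (Fin (2 * l + 1) → F) →ₗ[F] F :=
  LinearMap.proj (ctr l) ∘ₗ (Mtop F l ρ).mulVecLin

theorem projW_eq (x : Fin (2 * l + 1) → F) (i : Fin (2 * l)) :
    projW l ρ x i = (Mtop F l ρ *ᵥ x) ((ctr l).succAbove i) := rfl

theorem projL_eq (x : Fin (2 * l + 1) → F) : projL l ρ x = (Mtop F l ρ *ᵥ x) (ctr l) := rfl

theorem mulVec_eq_single {n : Type*} [Fintype n] [DecidableEq n] {A : Matrix n n F} {x : n → F}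
    {i a : n} {s : F} (h : ∀ j, A i j = if j = a then s else 0) : (A *ᵥ x) i = s * x a := by
  rw [Matrix.mulVec, dotProduct]
  simp [h]

theorem mulVec_eq_pair {n : Type*} [Fintype n] [DecidableEq n] {A : Matrix n n F} {x : n → F}
    {i a b : n} {s t : F} (hab : a ≠ b)
    (h : ∀ j, A i j = if j = a then s else if j = b then t else 0) :
    (A *ᵥ x) i = s * x a + t * x b := by
  rw [Matrix.mulVec, dotProduct, Finset.sum_eq_add a b hab]
  · rw [h, h, if_pos rfl, if_neg hab.symm, if_pos rfl]
  · intro c _ hc; rw [h, if_neg hc.1, if_neg hc.2, zero_mul]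
  · simp
  · simp

theorem projW_of_not_isMid (x : Fin (2 * l + 1) → F) {i : Fin (2 * l)} (hi : ¬ IsMid l i) :
    projW l ρ x i = x ((ctr l).succAbove i) := by
  have hv := val_succAbove (l := l) i
  unfold IsMid at hi
  rw [projW_eq, mulVec_eq_single (a := (ctr l).succAbove i) (s := 1), one_mul]
  intro j
  rw [Mtop, Matrix.of_apply]
  split_ifs at hv with h
  · rw [if_neg (by omega), if_neg (by omega), if_neg (by omega)]
    simp only [eq_comm]
  · rw [if_neg (by omega), if_neg (by omega), if_neg (by omega)]
    simp only [eq_comm]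

theorem projW_left {K : Fin (2 * l)} (hK : (K : ℕ) + 1 = l) (x : Fin (2 * l + 1) → F) :
    projW l ρ x K = x (ctr l) := by
  have hv := val_succAbove (l := l) K
  rw [if_pos (by omega)] at hv
  rw [projW_eq, mulVec_eq_single (a := ctr l) (s := 1), one_mul]
  intro j
  rw [Mtop, Matrix.of_apply, if_pos (by omega)]
  exact if_congr (by rw [Fin.ext_iff]; rfl) rfl rfl

theorem projW_right {L : Fin (2 * l)} (hL : (L : ℕ) = l) {a b : Fin (2 * l + 1)}
    (ha : (a : ℕ) + 1 = l) (hb : (b : ℕ) = l + 1) (x : Fin (2 * l + 1) → F) :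
    projW l ρ x L = 2⁻¹ * x a - (2 * (ρ / 2))⁻¹ * x b := by
  have hv := val_succAbove (l := l) L
  rw [if_neg (by omega)] at hv
  rw [projW_eq, mulVec_eq_pair (a := a) (b := b) (s := 2⁻¹) (t := -(2 * (ρ / 2))⁻¹)]
  · ring
  · rw [Ne, Fin.ext_iff]; omega
  intro j
  rw [Mtop, Matrix.of_apply, if_neg (by omega), if_neg (by omega), if_pos (by omega)]
  refine if_congr (by rw [Fin.ext_iff]; omega) rfl (if_congr (by rw [Fin.ext_iff]; omega) rfl rfl)

theorem projL_apply {a b : Fin (2 * l + 1)}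
    (ha : (a : ℕ) + 1 = l) (hb : (b : ℕ) = l + 1) (x : Fin (2 * l + 1) → F) :
    projL l ρ x = 2⁻¹ * x a + (2 * (ρ / 2))⁻¹ * x b := by
  have hv : (ctr l : ℕ) = l := rfl
  rw [projL_eq, mulVec_eq_pair (a := a) (b := b) (s := 2⁻¹) (t := (2 * (ρ / 2))⁻¹)]
  · rw [Ne, Fin.ext_iff]; omega
  intro j
  rw [Mtop, Matrix.of_apply, if_neg (by omega), if_pos (by omega)]
  refine if_congr (by rw [Fin.ext_iff]; omega) rfl (if_congr (by rw [Fin.ext_iff]; omega) rfl rfl)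

theorem proj_injective (h2 : (2 : F) ≠ 0) (hρ : ρ ≠ 0) (hl : 1 ≤ l) {x y : Fin (2 * l + 1) → F}
    (hW : projW l ρ x = projW l ρ y) (hL : projL l ρ x = projL l ρ y) : x = y := by
  rw [← sub_eq_zero] at hW hL ⊢
  rw [← map_sub] at hW hL
  generalize x - y = z at *
  obtain ⟨a, ha⟩ : ∃ a : Fin (2 * l + 1), (a : ℕ) + 1 = l := ⟨⟨l - 1, by omega⟩, by
    show l - 1 + 1 = l; omega⟩
  obtain ⟨b, hb⟩ : ∃ b : Fin (2 * l + 1), (b : ℕ) = l + 1 := ⟨⟨l + 1, by omega⟩, rfl⟩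
  let K : Fin (2 * l) := ⟨l - 1, by omega⟩
  have hK : (K : ℕ) + 1 = l := by show l - 1 + 1 = l; omega
  let L : Fin (2 * l) := ⟨l, by omega⟩
  have e1 := congrFun hW K
  have e2 := congrFun hW L
  rw [projW_left hK] at e1
  rw [projW_right (L := L) rfl ha hb] at e2
  rw [projL_apply ha hb] at hL
  simp only [Pi.zero_apply] at e1 e2
  have e3 : z a = 0 := by
    have : 2⁻¹ * z a * 2 = 0 := by linear_combination e2 + hL
    rwa [mul_right_comm, inv_mul_cancel₀ h2, one_mul] at this
  have e4 : z b = 0 := by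
    rw [e3, mul_zero, zero_add] at hL
    refine (mul_eq_zero.mp hL).resolve_left (inv_ne_zero ?_)
    exact mul_ne_zero h2 (div_ne_zero hρ h2)
  funext i
  rw [Pi.zero_apply]
  rcases eq_or_ne i (ctr l) with h | h
  · rw [h, e1]
  obtain ⟨j, rfl⟩ := Fin.exists_succAbove_eq h
  have hv := val_succAbove (l := l) j
  by_cases hj : IsMid l j
  · rcases hj with hj | hj
    · rw [show (ctr l).succAbove j = a from Fin.ext (by rw [hv, if_pos (by omega)]; omega), e3]
    · rw [show (ctr l).succAbove j = b from Fin.ext (by rw [hv, if_neg (by omega)]; omega), e4]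
  · rw [← projW_of_not_isMid (ρ := ρ) z hj, hW]; rfl

theorem Mtop_isUnit (h2 : (2 : F) ≠ 0) (hρ : ρ ≠ 0) (hl : 1 ≤ l) : IsUnit (Mtop F l ρ) := by
  rw [← Matrix.mulVec_injective_iff_isUnit]
  intro x y h
  refine proj_injective h2 hρ hl ?_ ?_
  · funext i; rw [projW_eq, projW_eq, h]
  · rw [projL_eq, projL_eq, h]

theorem insTop_succAbove (g : Matrix (Fin (2 * l)) (Fin (2 * l)) F) (i j : Fin (2 * l)) :
    insTop F l g ((ctr l).succAbove i) ((ctr l).succAbove j) = g i j := by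
  have hi := val_succAbove (l := l) i
  have hj := val_succAbove (l := l) j
  rw [insTop, Matrix.of_apply, dif_neg (by split_ifs at hi <;> omega),
    dif_neg (by split_ifs at hj <;> omega)]
  congr 1
  · refine Fin.ext ?_
    show (if _ < l then _ else _) = (i : ℕ)
    split_ifs at hi ⊢ <;> omega
  · refine Fin.ext ?_
    show (if _ < l then _ else _) = (j : ℕ)
    split_ifs at hj ⊢ <;> omega

theorem insTop_ctr (g : Matrix (Fin (2 * l)) (Fin (2 * l)) F) (j : Fin (2 * l + 1)) :
    insTop F l g (ctr l) j = if j = ctr l then 1 else 0 := by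
  rw [insTop, Matrix.of_apply, dif_pos (show ((ctr l : Fin (2 * l + 1)) : ℕ) = l from rfl)]
  exact if_congr (by rw [Fin.ext_iff]; rfl) rfl rfl

theorem insTop_succAbove_ctr (g : Matrix (Fin (2 * l)) (Fin (2 * l)) F) (i : Fin (2 * l)) :
    insTop F l g ((ctr l).succAbove i) (ctr l) = 0 := by
  have hi := val_succAbove (l := l) i
  rw [insTop, Matrix.of_apply, dif_neg (by split_ifs at hi <;> omega),
    dif_pos (show ((ctr l : Fin (2 * l + 1)) : ℕ) = l from rfl)]

theorem insTop_det (g : Matrix (Fin (2 * l)) (Fin (2 * l)) F) : (insTop F l g).det = g.det := by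
  rw [Matrix.det_succ_row _ (ctr l), Finset.sum_eq_single (ctr l)]
  · rw [insTop_ctr, if_pos rfl, ← two_mul, pow_mul]
    have : (insTop F l g).submatrix (ctr l).succAbove (ctr l).succAbove = g := by
      ext i j; exact insTop_succAbove g i j
    rw [this]; simp
  · intro j _ hj
    rw [insTop_ctr, if_neg hj]; simp
  · simp

theorem Mtop_mul_embTop (h2 : (2 : F) ≠ 0) (hρ : ρ ≠ 0) (hl : 1 ≤ l)
    (g : Matrix (Fin (2 * l)) (Fin (2 * l)) F) :
    Mtop F l ρ * embTop F l ρ g = insTop F l g * Mtop F l ρ := by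
  have h := (Matrix.isUnit_iff_isUnit_det _).mp (Mtop_isUnit h2 hρ hl)
  rw [embTop, ← mul_assoc, ← mul_assoc, Matrix.mul_nonsing_inv _ h, one_mul]

theorem projW_embTop (h2 : (2 : F) ≠ 0) (hρ : ρ ≠ 0) (hl : 1 ≤ l)
    (g : Matrix (Fin (2 * l)) (Fin (2 * l)) F) (x : Fin (2 * l + 1) → F) :
    projW l ρ (embTop F l ρ g *ᵥ x) = g *ᵥ projW l ρ x := by
  funext i
  rw [projW_eq, Matrix.mulVec_mulVec, Mtop_mul_embTop h2 hρ hl, ← Matrix.mulVec_mulVec,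
    Matrix.mulVec, dotProduct, Fin.sum_univ_succAbove _ (ctr l), insTop_succAbove_ctr, zero_mul,
    zero_add]
  simp only [insTop_succAbove]
  rfl

theorem projL_embTop (h2 : (2 : F) ≠ 0) (hρ : ρ ≠ 0) (hl : 1 ≤ l)
    (g : Matrix (Fin (2 * l)) (Fin (2 * l)) F) (x : Fin (2 * l + 1) → F) :
    projL l ρ (embTop F l ρ g *ᵥ x) = projL l ρ x := by
  rw [projL_eq, Matrix.mulVec_mulVec, Mtop_mul_embTop h2 hρ hl, ← Matrix.mulVec_mulVec,
    mulVec_eq_single (a := ctr l) (s := 1) (insTop_ctr g), one_mul, projL_eq]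

theorem embTop_det (h2 : (2 : F) ≠ 0) (hρ : ρ ≠ 0) (hl : 1 ≤ l)
    (g : Matrix (Fin (2 * l)) (Fin (2 * l)) F) : (embTop F l ρ g).det = g.det := by
  have h := (Matrix.isUnit_iff_isUnit_det _).mp (Mtop_isUnit h2 hρ hl)
  have e := congrArg Matrix.det (Mtop_mul_embTop h2 hρ hl g)
  rw [Matrix.det_mul, Matrix.det_mul, insTop_det, mul_comm] at e
  exact mul_right_cancel₀ h.ne_zero e

theorem gram_Jmat {m : ℕ} (x y : Fin m → F) : gram (Jmat F m) x y = ∑ i, x i * y i.rev := by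
  rw [gram_eq, dotProduct]
  refine Finset.sum_congr rfl fun i _ => ?_
  rw [mulVec_eq_single (a := i.rev) (s := 1), one_mul]
  intro j
  rw [Jmat, Matrix.of_apply]
  exact if_congr (by rw [Fin.ext_iff, Fin.val_rev]; omega) rfl rfl

theorem gram_odd_eq (h2 : (2 : F) ≠ 0) (hρ : ρ ≠ 0) (hl : 1 ≤ l) (x y : Fin (2 * l + 1) → F) :
    gram (Jmat F (2 * l + 1)) x y =
      gram (Jrho F l ρ) (projW l ρ x) (projW l ρ y) + ρ * (projL l ρ x * projL l ρ y) := by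
  obtain ⟨a, ha⟩ : ∃ a : Fin (2 * l + 1), (a : ℕ) + 1 = l := ⟨⟨l - 1, by omega⟩, by
    show l - 1 + 1 = l; omega⟩
  obtain ⟨b, hb⟩ : ∃ b : Fin (2 * l + 1), (b : ℕ) = l + 1 := ⟨⟨l + 1, by omega⟩, rfl⟩
  obtain ⟨K, hK⟩ : ∃ K : Fin (2 * l), (K : ℕ) + 1 = l := ⟨⟨l - 1, by omega⟩, by
    show l - 1 + 1 = l; omega⟩
  obtain ⟨L, hL⟩ : ∃ L : Fin (2 * l), (L : ℕ) = l := ⟨⟨l, by omega⟩, rfl⟩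
  have hKL : K ≠ L := by rw [Ne, Fin.ext_iff]; omega
  have hmK : IsMid l K := Or.inl hK
  have hmL : IsMid l L := Or.inr hL
  have hsK : (ctr l).succAbove K = a := Fin.ext (by rw [val_succAbove, if_pos (by omega)]; omega)
  have hsL : (ctr l).succAbove L = b := Fin.ext (by rw [val_succAbove, if_neg (by omega)]; omega)
  have hra : a.rev = b := Fin.ext (by rw [Fin.val_rev]; omega)
  have hrb : b.rev = a := by rw [← hra, Fin.rev_rev]
  have hrc : (ctr l).rev = ctr l := Fin.ext (by rw [Fin.val_rev]; show 2 * l + 1 - (l + 1) = l; omega)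
  rw [gram_Jmat, gram_sum, Fin.sum_univ_succAbove _ (ctr l), hrc]
  have hsplit : ∀ f : Fin (2 * l) → F, ∑ i, f i =
      f K + f L + ∑ i ∈ Finset.univ.filter (fun i => ¬ IsMid l i), f i := by
    intro f
    rw [← Finset.sum_filter_add_sum_filter_not Finset.univ (IsMid l) f]
    congr 1
    have : (Finset.univ.filter (IsMid l)) = {K, L} := by
      ext i
      rw [Finset.mem_filter, Finset.mem_insert, Finset.mem_singleton, Fin.ext_iff, Fin.ext_iff]
      unfold IsMid
      refine ⟨fun h => ?_, fun h => ⟨Finset.mem_univ _, ?_⟩⟩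
      · have := h.2
        omega
      · have := h
        omega
    rw [this, Finset.sum_pair hKL]
  rw [hsplit, hsplit (fun i => projW l ρ x i * _)]
  have hrest : ∑ i ∈ Finset.univ.filter (fun i => ¬ IsMid l i),
      x ((ctr l).succAbove i) * y ((ctr l).succAbove i).rev =
      ∑ i ∈ Finset.univ.filter (fun i => ¬ IsMid l i),
        projW l ρ x i * (dualCoef l ρ i * projW l ρ y (dualIdx l i)) := by
    refine Finset.sum_congr rfl fun i hi => ?_
    have hi' : ¬ IsMid l i := (Finset.mem_filter.mp hi).2
    rw [projW_of_not_isMid x hi', projW_of_not_isMid y (isMid_dualIdx.not.mpr hi'),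
      dualCoef_of_not_isMid hi', one_mul]
    congr 2
    refine Fin.ext ?_
    have hd := val_dualIdx hi'
    have h2i := i.2
    unfold IsMid at hi'
    rw [Fin.val_rev, val_succAbove, val_succAbove]
    split_ifs <;> omega
  rw [hrest, hsK, hsL, hra, hrb, dualIdx_of_isMid hmK, dualIdx_of_isMid hmL, projW_left hK,
    projW_left hK, projW_right hL ha hb, projW_right hL ha hb, projL_apply ha hb,
    projL_apply ha hb, dualCoef, dualCoef, if_pos hL, if_neg (by omega)]
  field_simp
  ring

/-- The embedding of `SO_{2l}` into `SO_{2l+1}` as a group homomorphism. -/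
def embHom (h2 : (2 : F) ≠ 0) (hρ : ρ ≠ 0) (hl : 1 ≤ l) : SO2l F l ρ →* SOodd F l where
  toFun g := soMk (embTop F l ρ (mat F g)) ((embTop_det h2 hρ hl _).trans (mat_det g)) (by
    rw [transpose_mul_mul_eq_iff]
    intro x y
    rw [gram_odd_eq h2 hρ hl, projW_embTop h2 hρ hl, projW_embTop h2 hρ hl,
      projL_embTop h2 hρ hl, projL_embTop h2 hρ hl, gram_mat, ← gram_odd_eq h2 hρ hl])
  map_one' := by
    apply mat_injective
    apply Matrix.toLin'.injective
    apply LinearMap.ext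
    intro x
    rw [Matrix.toLin'_apply, Matrix.toLin'_apply, mat_soMk, mat_one]
    refine proj_injective h2 hρ hl ?_ ?_
    · rw [projW_embTop h2 hρ hl, mat_one, Matrix.one_mulVec, Matrix.one_mulVec]
    · rw [projL_embTop h2 hρ hl, mat_one, Matrix.one_mulVec]
  map_mul' g h := by
    apply mat_injective
    apply Matrix.toLin'.injective
    apply LinearMap.ext
    intro x
    rw [Matrix.toLin'_apply, Matrix.toLin'_apply]
    show embTop F l ρ (mat F g * mat F h) *ᵥ x =
      (embTop F l ρ (mat F g) * embTop F l ρ (mat F h)) *ᵥ x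
    rw [← Matrix.mulVec_mulVec]
    refine proj_injective h2 hρ hl ?_ ?_
    · rw [projW_embTop h2 hρ hl, projW_embTop h2 hρ hl, projW_embTop h2 hρ hl,
        Matrix.mulVec_mulVec]
    · rw [projL_embTop h2 hρ hl, projL_embTop h2 hρ hl, projL_embTop h2 hρ hl]

theorem mat_embHom (h2 : (2 : F) ≠ 0) (hρ : ρ ≠ 0) (hl : 1 ≤ l) (g : SO2l F l ρ) :
    mat F (embHom h2 hρ hl g) = embTop F l ρ (mat F g) := rfl

theorem projW_embHom (h2 : (2 : F) ≠ 0) (hρ : ρ ≠ 0) (hl : 1 ≤ l) (g : SO2l F l ρ)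
    (x : Fin (2 * l + 1) → F) :
    projW l ρ (mat F (embHom h2 hρ hl g) *ᵥ x) = mat F g *ᵥ projW l ρ x :=
  projW_embTop h2 hρ hl _ x

theorem projL_embHom (h2 : (2 : F) ≠ 0) (hρ : ρ ≠ 0) (hl : 1 ≤ l) (g : SO2l F l ρ)
    (x : Fin (2 * l + 1) → F) :
    projL l ρ (mat F (embHom h2 hρ hl g) *ᵥ x) = projL l ρ x :=
  projL_embTop h2 hρ hl _ x

end Embedding

section Orbit

variable {l : ℕ} {ρ : F}

theorem exists_stdVec_to (h2 : (2 : F) ≠ 0) (hρ : ρ ≠ 0) {k : ℕ}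
    {w : Fin (2 * l) → F} (hiso : gram (Jrho F l ρ) w w = 0)
    (hwk : ∀ j : Fin (2 * l), (j : ℕ) < k → w j = 0 ∧ w (dualIdx l j) = 0)
    {b : Fin (2 * l)} (hb : ¬ IsMid l b) (hwb : w b ≠ 0) :
    ∃ u : SO2l F l ρ, mat F u *ᵥ stdVec l b = (w b)⁻¹ • w ∧
      ∀ j : Fin (2 * l), (j : ℕ) < k → mat F u *ᵥ stdVec l j = stdVec l j := by
  have hc : ¬ IsMid l (dualIdx l b) := isMid_dualIdx.not.mpr hb
  have hwb' : w (dualIdx l (dualIdx l b)) ≠ 0 := by rwa [dualIdx_dualIdx]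
  obtain ⟨u, -, hu, -, hfix⟩ := exists_clear h2 hρ hc hiso hwb'
  rw [dualIdx_dualIdx, Matrix.mulVec_smul] at hu
  refine ⟨u, ?_, fun j hj => hfix j ?_ ?_ (hwk j hj).2⟩
  · exact (eq_inv_smul_iff₀ hwb).mpr hu
  · rintro rfl
    exact hwb (by have := (hwk _ hj).2; rwa [dualIdx_dualIdx] at this)
  · rw [dualIdx_dualIdx]
    rintro rfl
    exact hwb (hwk _ hj).1

theorem exists_stdVec_to_stdVec (h2 : (2 : F) ≠ 0) (hρ : ρ ≠ 0) {k b : Fin (2 * l)}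
    (hk : (k : ℕ) + 1 < l) (hb : ¬ IsMid l b) (hbk : (k : ℕ) ≤ b)
    (hbk' : (b : ℕ) + k < 2 * l) :
    ∃ (g : SO2l F l ρ) (s : F), mat F g *ᵥ stdVec l k = s • stdVec l b ∧
      ∀ j : Fin (2 * l), (j : ℕ) < k → mat F g *ᵥ stdVec l j = stdVec l j := by
  have hkm : ¬ IsMid l k := by unfold IsMid; omega
  have hdk := val_dualIdx hkm
  by_cases hbk2 : b = k
  · subst hbk2
    exact ⟨1, 1, by rw [mat_one, Matrix.one_mulVec, one_smul], fun j _ => by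
      rw [mat_one, Matrix.one_mulVec]⟩
  have key : ∀ w : Fin (2 * l) → F, gram (Jrho F l ρ) w w = 0 → w b ≠ 0 → w k ≠ 0 →
      (∀ j : Fin (2 * l), (j : ℕ) < k → w j = 0 ∧ w (dualIdx l j) = 0) →
      ∃ (g : SO2l F l ρ) (s : F), mat F g *ᵥ stdVec l k = s • stdVec l b ∧
      ∀ j : Fin (2 * l), (j : ℕ) < k → mat F g *ᵥ stdVec l j = stdVec l j := by
    intro w h0 hwb hwk hw
    obtain ⟨u, hu, hfix⟩ := exists_stdVec_to h2 hρ (k := k) h0 hw hb hwb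
    obtain ⟨u', hu', hfix'⟩ := exists_stdVec_to h2 hρ (k := k) h0 hw hkm hwk
    refine ⟨u⁻¹ * u', (w k)⁻¹ * w b, ?_, fun j hj => ?_⟩
    · have hw' : mat F u *ᵥ (w b • stdVec l b) = w := by
        rw [Matrix.mulVec_smul]; exact (eq_inv_smul_iff₀ hwb).mp hu
      rw [mat_mul, ← Matrix.mulVec_mulVec, hu', Matrix.mulVec_smul, mulVec_inv_eq u hw', smul_smul]
    · rw [mat_mul, ← Matrix.mulVec_mulVec, hfix' j hj, mulVec_inv_eq u (hfix j hj)]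
  have hcoord : ∀ {i j : Fin (2 * l)}, j ≠ i → stdVec (F := F) l i j = 0 := fun h => stdVec_ne h
  by_cases hbd : b = dualIdx l k
  · obtain ⟨K, hK⟩ : ∃ K : Fin (2 * l), (K : ℕ) + 1 = l := ⟨⟨l - 1, by omega⟩, by
      show l - 1 + 1 = l; omega⟩
    have hKm : IsMid l K := Or.inl hK
    have hKd : dualIdx l K = K := dualIdx_of_isMid hKm
    have hKb : K ≠ b := by rintro rfl; exact hb hKm
    have hKk : K ≠ k := by rintro rfl; exact hkm hKm
    have hdb : dualIdx l b = k := by rw [hbd, dualIdx_dualIdx]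
    refine key (stdVec l b + (2 : F) • stdVec l K + (-2 : F) • stdVec l k) ?_ ?_ ?_ ?_
    · have hcK : dualCoef l ρ K = 1 := by rw [dualCoef, if_neg (by omega)]
      simp only [map_add, map_smul, LinearMap.add_apply, LinearMap.smul_apply, smul_eq_mul,
        gram_stdVec_left, hKd, hdb, ← hbd, hcK, dualCoef_of_not_isMid hb,
        dualCoef_of_not_isMid hkm, stdVec_self, hcoord hKb, hcoord hKk, hcoord hbk2,
        hcoord (Ne.symm hKb), hcoord (Ne.symm hKk), hcoord (Ne.symm hbk2)]
      ring
    · simp [hcoord (Ne.symm hKb), hcoord hbk2]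
    · simp only [Pi.add_apply, Pi.smul_apply, hcoord (Ne.symm hbk2), hcoord (Ne.symm hKk),
        stdVec_self, smul_eq_mul]
      simpa using h2
    · intro j hj
      have hjm : ¬ IsMid l j := by unfold IsMid; omega
      have hdj := val_dualIdx hjm
      have hbv := congrArg Fin.val hbd
      have : ∀ a : Fin (2 * l), (a = j ∨ a = dualIdx l j) →
          (stdVec l b + (2 : F) • stdVec l K + (-2 : F) • stdVec l k : Fin (2 * l) → F) a = 0 := by
        intro a ha
        have hav : (a : ℕ) = j ∨ (a : ℕ) = 2 * l - 1 - j := by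
          rcases ha with h | h
          · exact Or.inl (congrArg _ h)
          · exact Or.inr ((congrArg _ h).trans hdj)
        simp only [Pi.add_apply, Pi.smul_apply]
        rw [hcoord (show a ≠ b by rw [Ne, Fin.ext_iff]; omega),
          hcoord (show a ≠ K by rw [Ne, Fin.ext_iff]; omega),
          hcoord (show a ≠ k by rw [Ne, Fin.ext_iff]; omega)]
        simp
      exact ⟨this _ (Or.inl rfl), this _ (Or.inr rfl)⟩
  · have hbm : dualIdx l b ≠ k := fun h => hbd (dualIdx_eq_iff.mp h)
    refine key (stdVec l b + stdVec l k) ?_ ?_ ?_ ?_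
    · simp only [map_add, LinearMap.add_apply, gram_stdVec_left,
        hcoord (dualIdx_ne_self hb), hcoord (dualIdx_ne_self hkm), hcoord hbm,
        hcoord (Ne.symm hbd)]
      ring
    · simp [hcoord hbk2]
    · simp [hcoord (Ne.symm hbk2)]
    · intro j hj
      have hjm : ¬ IsMid l j := by unfold IsMid; omega
      have hdj := val_dualIdx hjm
      have hbv : (b : ℕ) ≠ 2 * l - 1 - k := fun h => hbd (Fin.ext (h.trans hdk.symm))
      have : ∀ a : Fin (2 * l), (a = j ∨ a = dualIdx l j) →
          (stdVec l b + stdVec l k : Fin (2 * l) → F) a = 0 := by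
        intro a ha
        have hav : (a : ℕ) = j ∨ (a : ℕ) = 2 * l - 1 - j := by
          rcases ha with h | h
          · exact Or.inl (congrArg _ h)
          · exact Or.inr ((congrArg _ h).trans hdj)
        simp only [Pi.add_apply]
        rw [hcoord (show a ≠ b by rw [Ne, Fin.ext_iff]; omega),
          hcoord (show a ≠ k by rw [Ne, Fin.ext_iff]; omega)]
        simp
      exact ⟨this _ (Or.inl rfl), this _ (Or.inr rfl)⟩

/-- Witt's theorem for isotropic vectors, relative to the first basis vectors. -/
theorem exists_stdVec_to_isotropic (h2 : (2 : F) ≠ 0) (hρ : ∀ x : F, x ^ 2 ≠ ρ)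
    {k : Fin (2 * l)} (hk : (k : ℕ) + 1 < l) {w : Fin (2 * l) → F} (hw0 : w ≠ 0)
    (hiso : gram (Jrho F l ρ) w w = 0)
    (hwk : ∀ j : Fin (2 * l), (j : ℕ) < k → w j = 0 ∧ w (dualIdx l j) = 0) :
    ∃ (g : SO2l F l ρ) (s : F), mat F g *ᵥ stdVec l k = s • w ∧
      ∀ j : Fin (2 * l), (j : ℕ) < k → mat F g *ᵥ stdVec l j = stdVec l j := by
  have hρ0 : ρ ≠ 0 := fun h => hρ 0 (by rw [h]; ring)
  obtain ⟨b, hb, hwb, -⟩ := exists_last_coord hρ hw0 hiso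
  have hb1 : (k : ℕ) ≤ b := by
    by_contra h
    exact hwb (hwk b (by omega)).1
  have hb2 : (b : ℕ) + k < 2 * l := by
    by_contra h
    have hdb := val_dualIdx hb
    have := (hwk (dualIdx l b) (by omega)).2
    rw [dualIdx_dualIdx] at this
    exact hwb this
  obtain ⟨u, hu, hfix⟩ := exists_stdVec_to h2 hρ0 (k := k) hiso hwk hb hwb
  obtain ⟨g, s, hg, hfix'⟩ := exists_stdVec_to_stdVec h2 hρ0 hk hb hb1 hb2
  refine ⟨u * g, s * (w b)⁻¹, ?_, fun j hj => ?_⟩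
  · rw [mat_mul, ← Matrix.mulVec_mulVec, hg, Matrix.mulVec_smul, hu, smul_smul]
  · rw [mat_mul, ← Matrix.mulVec_mulVec, hfix' j hj, hfix j hj]

end Orbit

section OddOrbit

variable {l : ℕ} {ρ : F}

/-- The first `k` columns of `y` vanish in the rows from `l` on. -/
def LowZero (k : ℕ) (y : SOodd F l) : Prop :=
  ∀ i j : Fin (2 * l + 1), l ≤ (i : ℕ) → (j : ℕ) < k → mat F y i j = 0

theorem exists_ne_zero_of_lin (hl : 1 ≤ l) (A : Matrix (Fin (2 * l + 1)) (Fin (2 * l + 1)) F)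
    (φ : (Fin (2 * l + 1) → F) →ₗ[F] (Fin (l - 1) → F)) :
    ∃ z, z ≠ 0 ∧ φ z = 0 ∧ ∀ i : Fin (2 * l + 1), l ≤ (i : ℕ) → (A *ᵥ z) i = 0 := by
  let χ : (Fin (2 * l + 1) → F) →ₗ[F] (Fin (l + 1) → F) :=
    LinearMap.funLeft F F (fun i => ⟨l + i, by omega⟩) ∘ₗ A.mulVecLin
  have hlt : Module.finrank F ((Fin (l - 1) → F) × (Fin (l + 1) → F)) <
      Module.finrank F (Fin (2 * l + 1) → F) := by
    rw [Module.finrank_prod, Module.finrank_fin_fun, Module.finrank_fin_fun,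
      Module.finrank_fin_fun]
    omega
  have hker := LinearMap.ker_ne_bot_of_finrank_lt (f := φ.prod χ) hlt
  obtain ⟨z, hz, hz0⟩ := Submodule.exists_mem_ne_zero_of_ne_bot hker
  rw [LinearMap.mem_ker, LinearMap.prod_apply] at hz
  replace hz := Prod.mk_eq_zero.mp hz
  refine ⟨z, hz0, hz.1, fun i hi => ?_⟩
  have h := congrFun hz.2 ⟨i - l, by omega⟩
  have hi' : (⟨l + ((i : ℕ) - l), by omega⟩ : Fin (2 * l + 1)) = i :=
    Fin.ext (by show l + ((i : ℕ) - l) = i; omega)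
  exact (congrArg (A *ᵥ z) hi').symm.trans h

theorem gram_eq_zero_of_low (y : SOodd F l) {x x' : Fin (2 * l + 1) → F}
    (hx : ∀ i : Fin (2 * l + 1), l ≤ (i : ℕ) → (mat F y *ᵥ x) i = 0)
    (hx' : ∀ i : Fin (2 * l + 1), l ≤ (i : ℕ) → (mat F y *ᵥ x') i = 0) :
    gram (Jmat F (2 * l + 1)) x x' = 0 := by
  rw [← gram_mat y, gram_Jmat]
  refine Finset.sum_eq_zero fun i _ => ?_
  by_cases hi : l ≤ (i : ℕ)
  · rw [hx i hi, zero_mul]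
  · rw [hx' _ (by rw [Fin.val_rev]; omega), mul_zero]

theorem gram_single_left {m : ℕ} (j : Fin m) (z : Fin m → F) :
    gram (Jmat F m) (Pi.single j 1) z = z j.rev := by
  rw [gram_Jmat, Finset.sum_eq_single j]
  · rw [Pi.single_eq_same, one_mul]
  · intro i _ hi; rw [Pi.single_eq_of_ne hi, zero_mul]
  · simp

theorem mulVec_single_apply {m : ℕ} (A : Matrix (Fin m) (Fin m) F) (i j : Fin m) :
    (A *ᵥ Pi.single j 1) i = A i j := by simp

theorem LowZero.mulVec {k : ℕ} {y : SOodd F l} (hy : LowZero k y) {j : Fin (2 * l + 1)}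
    (hj : (j : ℕ) < k) (i : Fin (2 * l + 1)) (hi : l ≤ (i : ℕ)) :
    (mat F y *ᵥ Pi.single j 1) i = 0 := by
  rw [mulVec_single_apply, hy i j hi hj]

theorem succAbove_dualIdx {i : Fin (2 * l)} (hi : ¬ IsMid l i) :
    (ctr l).succAbove (dualIdx l i) = ((ctr l).succAbove i).rev := by
  refine Fin.ext ?_
  have hd := val_dualIdx hi
  have h2i := i.2
  unfold IsMid at hi
  rw [Fin.val_rev, val_succAbove, val_succAbove]
  split_ifs <;> omega

theorem projW_single (hl : 1 ≤ l) {i : Fin (2 * l)} (hi : ¬ IsMid l i) :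
    projW l ρ (Pi.single ((ctr l).succAbove i) 1) = stdVec l i := by
  obtain ⟨a, ha⟩ : ∃ a : Fin (2 * l + 1), (a : ℕ) + 1 = l := ⟨⟨l - 1, by omega⟩, by
    show l - 1 + 1 = l; omega⟩
  obtain ⟨b, hb⟩ : ∃ b : Fin (2 * l + 1), (b : ℕ) = l + 1 := ⟨⟨l + 1, by omega⟩, rfl⟩
  have hv := val_succAbove (l := l) i
  funext j
  by_cases hj : IsMid l j
  · rw [stdVec_ne (by rintro rfl; exact hi hj)]
    unfold IsMid at hi
    rcases hj with hj | hj
    · rw [projW_left hj, Pi.single_eq_of_ne (Fin.ne_succAbove _ _)]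
    · rw [projW_right hj ha hb, Pi.single_eq_of_ne, Pi.single_eq_of_ne]
      · ring
      · rw [Ne, Fin.ext_iff, hv]; split_ifs <;> omega
      · rw [Ne, Fin.ext_iff, hv]; split_ifs <;> omega
  · rw [projW_of_not_isMid _ hj, Pi.single_apply, stdVec, Pi.single_apply]
    exact if_congr Fin.succAbove_right_inj rfl rfl

theorem projL_single (hl : 1 ≤ l) {i : Fin (2 * l)} (hi : ¬ IsMid l i) :
    projL l ρ (Pi.single ((ctr l).succAbove i) 1) = 0 := by
  obtain ⟨a, ha⟩ : ∃ a : Fin (2 * l + 1), (a : ℕ) + 1 = l := ⟨⟨l - 1, by omega⟩, by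
    show l - 1 + 1 = l; omega⟩
  obtain ⟨b, hb⟩ : ∃ b : Fin (2 * l + 1), (b : ℕ) = l + 1 := ⟨⟨l + 1, by omega⟩, rfl⟩
  have hv := val_succAbove (l := l) i
  unfold IsMid at hi
  rw [projL_apply ha hb, Pi.single_eq_of_ne, Pi.single_eq_of_ne]
  · ring
  · rw [Ne, Fin.ext_iff, hv]; split_ifs <;> omega
  · rw [Ne, Fin.ext_iff, hv]; split_ifs <;> omega

/-- Index of the even space, viewed among the first `l - 1` indices of the odd space. -/
theorem exists_succAbove_of_lt {j : Fin (2 * l + 1)} (hj : (j : ℕ) + 1 < l) :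
    ∃ i : Fin (2 * l), (i : ℕ) = j ∧ ¬ IsMid l i ∧ (ctr l).succAbove i = j := by
  refine ⟨⟨j, by omega⟩, rfl, ?_, Fin.ext ?_⟩
  · unfold IsMid; show ¬ ((j : ℕ) + 1 = l ∨ (j : ℕ) = l); omega
  · rw [val_succAbove]; show (if (j : ℕ) < l then _ else _) = _; rw [if_pos (by omega)]

theorem embHom_single (h2 : (2 : F) ≠ 0) (hρ : ρ ≠ 0) (hl : 1 ≤ l) {g : SO2l F l ρ}
    {i : Fin (2 * l)} (hi : ¬ IsMid l i) {z : Fin (2 * l + 1) → F} (hz : projL l ρ z = 0)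
    (h : mat F g *ᵥ stdVec l i = projW l ρ z) :
    mat F (embHom h2 hρ hl g) *ᵥ Pi.single ((ctr l).succAbove i) 1 = z := by
  refine proj_injective h2 hρ hl ?_ ?_
  · rw [projW_embHom, projW_single hl hi, h]
  · rw [projL_embHom, projL_single hl hi, hz]

theorem LowZero.succ (h2 : (2 : F) ≠ 0) (hρ : ∀ x : F, x ^ 2 ≠ ρ) (hρ0 : ρ ≠ 0) (hl : 1 ≤ l)
    {k : ℕ} (hk : k + 1 < l) {y : SOodd F l} (hy : LowZero k y) :
    ∃ g : SO2l F l ρ, LowZero (k + 1) (y * embHom h2 hρ0 hl g) := by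
  obtain ⟨z, hz0, hφ, hyz⟩ := exists_ne_zero_of_lin hl (mat F y)
    (LinearMap.pi fun i : Fin (l - 1) =>
      if (i : ℕ) < k then LinearMap.proj (⟨i, by omega⟩ : Fin (2 * l + 1)) else projL l ρ)
  have hzj : ∀ j : Fin (2 * l + 1), (j : ℕ) < k → z j = 0 := by
    intro j hj
    have := congrFun hφ ⟨j, by omega⟩
    rw [LinearMap.pi_apply, if_pos (show (j : ℕ) < k from hj)] at this
    exact this
  have hzL : projL l ρ z = 0 := by
    have := congrFun hφ ⟨k, by omega⟩
    rw [LinearMap.pi_apply, if_neg (show ¬ k < k by omega)] at this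
    exact this
  have hzr : ∀ j : Fin (2 * l + 1), (j : ℕ) < k → z j.rev = 0 := by
    intro j hj
    rw [← gram_single_left j z]
    exact gram_eq_zero_of_low y (hy.mulVec hj) hyz
  have hw0 : projW l ρ z ≠ 0 := fun h => hz0 (proj_injective h2 hρ0 hl
    (by rw [h, map_zero]) (by rw [hzL, map_zero]))
  have hiso : gram (Jrho F l ρ) (projW l ρ z) (projW l ρ z) = 0 := by
    have := gram_odd_eq h2 hρ0 hl z z
    rw [gram_eq_zero_of_low y hyz hyz, hzL] at this
    linear_combination -this
  have hwk : ∀ j : Fin (2 * l), (j : ℕ) < k →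
      projW l ρ z j = 0 ∧ projW l ρ z (dualIdx l j) = 0 := by
    intro j hj
    have hjm : ¬ IsMid l j := by unfold IsMid; omega
    have hv : ((ctr l).succAbove j : ℕ) < k := by rw [val_succAbove, if_pos (by omega)]; exact hj
    rw [projW_of_not_isMid _ hjm, projW_of_not_isMid _ (isMid_dualIdx.not.mpr hjm),
      succAbove_dualIdx hjm]
    exact ⟨hzj _ hv, hzr _ hv⟩
  obtain ⟨g, s, hg, hfix⟩ := exists_stdVec_to_isotropic h2 hρ (k := ⟨k, by omega⟩) hk hw0 hiso hwk
  refine ⟨g, fun i j hi hj => ?_⟩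
  obtain ⟨j', hj1, hj2, hj3⟩ := exists_succAbove_of_lt (l := l) (j := j) (by omega)
  rw [← mulVec_single_apply (mat F _) i j, mat_mul, ← Matrix.mulVec_mulVec, ← hj3]
  rcases Nat.lt_succ_iff_lt_or_eq.mp hj with h | h
  · rw [embHom_single h2 hρ0 hl hj2 (projL_single hl hj2)
      ((hfix j' (by rw [hj1]; exact h)).trans (projW_single hl hj2).symm), hj3]
    exact hy.mulVec h i hi
  · have hj' : j' = ⟨k, by omega⟩ := Fin.ext (hj1.trans h)
    rw [embHom_single h2 hρ0 hl hj2 (z := s • z) (by rw [map_smul, hzL, smul_zero])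
      (by rw [hj', hg, map_smul]), Matrix.mulVec_smul, Pi.smul_apply, hyz i hi, smul_zero]

theorem gram_split {K L : Fin (2 * l)} (hK : (K : ℕ) + 1 = l) (hL : (L : ℕ) = l)
    (x y : Fin (2 * l) → F) :
    gram (Jrho F l ρ) x y = x K * y K - ρ * (x L * y L) +
      ∑ i ∈ Finset.univ.filter (fun i => ¬ IsMid l i), x i * y (dualIdx l i) := by
  have hKL : K ≠ L := by rw [Ne, Fin.ext_iff]; omega
  rw [gram_sum, ← Finset.sum_filter_add_sum_filter_not Finset.univ (IsMid l)]
  have : (Finset.univ.filter (IsMid l)) = {K, L} := by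
    ext i
    rw [Finset.mem_filter, Finset.mem_insert, Finset.mem_singleton, Fin.ext_iff, Fin.ext_iff]
    unfold IsMid
    refine ⟨fun h => ?_, fun h => ⟨Finset.mem_univ _, ?_⟩⟩
    · have := h.2
      omega
    · have := h
      omega
  rw [this, Finset.sum_pair hKL, dualIdx_of_isMid (Or.inl hK), dualIdx_of_isMid (Or.inr hL),
    dualCoef, dualCoef, if_pos hL, if_neg (show ¬ (K : ℕ) = l by omega)]
  refine congrArg₂ _ (by ring) (Finset.sum_congr rfl fun i hi => ?_)
  rw [dualCoef_of_not_isMid (Finset.mem_filter.mp hi).2, one_mul]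

/-- Rotation of the anisotropic plane. -/
theorem exists_rotation {K L : Fin (2 * l)} (hK : (K : ℕ) + 1 = l)
    (hL : (L : ℕ) = l) {a b : F} (hab : a ^ 2 - b ^ 2 * ρ = 1) :
    ∃ g : SO2l F l ρ, mat F g *ᵥ stdVec l L = (b * ρ) • stdVec l K + a • stdVec l L ∧
      mat F g *ᵥ stdVec l K = a • stdVec l K + b • stdVec l L ∧
      ∀ j, ¬ IsMid l j → mat F g *ᵥ stdVec l j = stdVec l j := by
  have hKL : K ≠ L := by rw [Ne, Fin.ext_iff]; omega
  let M : Matrix (Fin (2 * l)) (Fin (2 * l)) F := Matrix.of fun i j =>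
    if j = K then (if i = K then a else if i = L then b else 0)
    else if j = L then (if i = K then b * ρ else if i = L then a else 0)
    else if i = j then 1 else 0
  have hMK : M *ᵥ stdVec l K = a • stdVec l K + b • stdVec l L := by
    funext i
    rw [mulVec_stdVec]
    show (if K = K then _ else _) = _
    rw [if_pos rfl]
    simp only [Pi.add_apply, Pi.smul_apply, stdVec, Pi.single_apply, smul_eq_mul]
    split_ifs with h1 h2 <;> simp_all
  have hML : M *ᵥ stdVec l L = (b * ρ) • stdVec l K + a • stdVec l L := by
    funext i
    rw [mulVec_stdVec]
    show (if L = K then _ else if L = L then _ else _) = _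
    rw [if_neg hKL.symm, if_pos rfl]
    simp only [Pi.add_apply, Pi.smul_apply, stdVec, Pi.single_apply, smul_eq_mul]
    split_ifs with h1 h2 <;> simp_all
  have hMj : ∀ j, ¬ IsMid l j → M *ᵥ stdVec l j = stdVec l j := by
    intro j hj
    funext i
    rw [mulVec_stdVec]
    show (if j = K then _ else if j = L then _ else _) = _
    rw [if_neg (by rintro rfl; exact hj (Or.inl hK)), if_neg (by rintro rfl; exact hj (Or.inr hL)),
      stdVec, Pi.single_apply]
  have hdet : M.det = 1 := by
    rw [det_of_two_block M hKL]
    · show (if K = K then if K = K then a else _ else _) * (if L = K then _ else if L = L then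
        if L = K then _ else if L = L then a else _ else _) - (if L = K then _ else if L = L then
        if K = K then _ else _ else _) * (if K = K then if L = K then _ else if L = L then b else _
        else _) = 1
      simp only [if_true, if_neg hKL.symm]
      linear_combination hab
    · intro j hjK hjL i
      show (if j = K then _ else if j = L then _ else _) = _
      rw [if_neg hjK, if_neg hjL, Matrix.one_apply]
    · intro i hiK hiL
      constructor
      · show (if K = K then _ else _) = _
        rw [if_pos rfl, if_neg hiK, if_neg hiL]
      · show (if L = K then _ else if L = L then _ else _) = _
        rw [if_neg hKL.symm, if_pos rfl, if_neg hiK, if_neg hiL]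
  have hcK : ∀ x : Fin (2 * l) → F, (M *ᵥ x) K = a * x K + b * ρ * x L := fun x =>
    mulVec_eq_pair hKL fun j => by
      show (if j = K then if K = K then a else _ else if j = L then if K = K then b * ρ else _
        else if K = j then 1 else 0) = _
      split_ifs <;> simp_all
  have hcL : ∀ x : Fin (2 * l) → F, (M *ᵥ x) L = b * x K + a * x L := fun x =>
    mulVec_eq_pair hKL fun j => by
      show (if j = K then if L = K then a else if L = L then b else _ else if j = L then
        if L = K then b * ρ else if L = L then a else _ else if L = j then 1 else 0) = _
      split_ifs <;> simp_all
  have hcj : ∀ (x : Fin (2 * l) → F) (i : Fin (2 * l)), ¬ IsMid l i → (M *ᵥ x) i = x i := by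
    intro x i hi
    have hiK : i ≠ K := by rintro rfl; exact hi (Or.inl hK)
    have hiL : i ≠ L := by rintro rfl; exact hi (Or.inr hL)
    rw [mulVec_eq_single (a := i) (s := 1), one_mul]
    intro j
    show (if j = K then if i = K then a else if i = L then b else 0 else if j = L then
      if i = K then b * ρ else if i = L then a else 0 else if i = j then 1 else 0) = _
    rw [if_neg hiK, if_neg hiL, if_neg hiK, if_neg hiL]
    by_cases hjK : j = K
    · rw [if_pos hjK, if_neg (by rw [hjK]; exact hiK.symm)]
    by_cases hjL : j = L
    · rw [if_neg hjK, if_pos hjL, if_neg (by rw [hjL]; exact hiL.symm)]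
    rw [if_neg hjK, if_neg hjL]
    exact if_congr eq_comm rfl rfl
  refine ⟨soMk M hdet ?_, hML, hMK, hMj⟩
  rw [transpose_mul_mul_eq_iff]
  intro x y
  rw [gram_split hK hL, gram_split hK hL x y, hcK, hcK, hcL, hcL]
  refine congrArg₂ _ ?_ (Finset.sum_congr rfl fun i hi => ?_)
  · linear_combination (x K * y K - ρ * (x L * y L)) * hab
  · have hi' := (Finset.mem_filter.mp hi).2
    rw [hcj x i hi', hcj y _ (isMid_dualIdx.not.mpr hi')]

theorem LowZero.last (h2 : (2 : F) ≠ 0) (hρ : ∀ x : F, x ^ 2 ≠ ρ) (hρ0 : ρ ≠ 0) (hl : 1 ≤ l)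
    {y : SOodd F l} (hy : LowZero (l - 1) y) :
    ∃ g : SO2l F l ρ, LowZero l (y * embHom h2 hρ0 hl g) := by
  obtain ⟨K, hK⟩ : ∃ K : Fin (2 * l), (K : ℕ) + 1 = l := ⟨⟨l - 1, by omega⟩, by
    show l - 1 + 1 = l; omega⟩
  obtain ⟨L, hL⟩ : ∃ L : Fin (2 * l), (L : ℕ) = l := ⟨⟨l, by omega⟩, rfl⟩
  obtain ⟨a, ha⟩ : ∃ a : Fin (2 * l + 1), (a : ℕ) + 1 = l := ⟨⟨l - 1, by omega⟩, by
    show l - 1 + 1 = l; omega⟩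
  obtain ⟨b, hb⟩ : ∃ b : Fin (2 * l + 1), (b : ℕ) = l + 1 := ⟨⟨l + 1, by omega⟩, rfl⟩
  obtain ⟨z, hz0, hφ, hyz⟩ := exists_ne_zero_of_lin hl (mat F y)
    (LinearMap.pi fun i : Fin (l - 1) => LinearMap.proj (⟨i, by omega⟩ : Fin (2 * l + 1)))
  have hzj : ∀ j : Fin (2 * l + 1), (j : ℕ) < l - 1 → z j = 0 := fun j hj =>
    congrFun hφ ⟨j, hj⟩
  have hzr : ∀ j : Fin (2 * l + 1), (j : ℕ) < l - 1 → z j.rev = 0 := by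
    intro j hj
    rw [← gram_single_left j z]
    exact gram_eq_zero_of_low y (hy.mulVec hj) hyz
  have hwm : ∀ i : Fin (2 * l), ¬ IsMid l i → projW l ρ z i = 0 := by
    intro i hi
    rw [projW_of_not_isMid _ hi]
    have hi' := hi
    unfold IsMid at hi'
    have h2i := i.2
    by_cases h : (i : ℕ) < l
    · exact hzj _ (by rw [val_succAbove, if_pos h]; omega)
    · rw [← Fin.rev_rev ((ctr l).succAbove i)]
      exact hzr _ (by rw [Fin.val_rev, val_succAbove, if_neg h]; omega)
  have hgr := gram_odd_eq h2 hρ0 hl z z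
  rw [gram_eq_zero_of_low y hyz hyz, gram_mid hK hL hwm] at hgr
  obtain ⟨s, hs⟩ : ∃ s, s = projL l ρ z := ⟨_, rfl⟩
  rw [← hs] at hgr
  have hs0 : s ≠ 0 := by
    intro h
    rw [h] at hgr
    have hwL : projW l ρ z L = 0 := by
      by_contra hne
      refine hρ (projW l ρ z K * (projW l ρ z L)⁻¹) ?_
      rw [mul_pow, inv_pow, ← div_eq_mul_inv, div_eq_iff (pow_ne_zero 2 hne)]
      linear_combination -hgr
    have hwK : projW l ρ z K = 0 := by
      rw [hwL] at hgr
      exact pow_eq_zero_iff (two_ne_zero) |>.mp (by linear_combination -hgr)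
    refine hz0 (proj_injective h2 hρ0 hl ?_ (by rw [← hs, h, map_zero]))
    rw [map_zero]
    funext i
    by_cases hi : IsMid l i
    · rcases hi with hi | hi
      · rw [show i = K from Fin.ext (by omega), hwK]; rfl
      · rw [show i = L from Fin.ext (by omega), hwL]; rfl
    · exact hwm i hi
  have hab : (s⁻¹ * projW l ρ z L) ^ 2 - (s⁻¹ * projW l ρ z K / ρ) ^ 2 * ρ = 1 := by
    field_simp
    linear_combination hgr
  obtain ⟨g, hgL, -, hgj⟩ := exists_rotation hK hL hab
  have hstd : projW l ρ ((2 : F) • Pi.single a 1) = stdVec l L := by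
    funext i
    rw [map_smul, Pi.smul_apply, smul_eq_mul]
    by_cases hi : IsMid l i
    · rcases hi with hi | hi
      · rw [projW_left hi, Pi.single_eq_of_ne, stdVec_ne, mul_zero]
        · rw [Ne, Fin.ext_iff]; omega
        · rw [Ne, Fin.ext_iff]; show ¬ l = _; omega
      · rw [projW_right hi ha hb, show i = L from Fin.ext (by omega), stdVec_self,
          Pi.single_eq_same, Pi.single_eq_of_ne]
        · rw [mul_zero, sub_zero, mul_one, mul_inv_cancel₀ h2]
        · rw [Ne, Fin.ext_iff]; omega
    · rw [projW_of_not_isMid _ hi, Pi.single_eq_of_ne, stdVec_ne, mul_zero]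
      · rintro rfl; exact hi (Or.inr hL)
      · unfold IsMid at hi
        rw [Ne, Fin.ext_iff, val_succAbove]; split_ifs <;> omega
  have hstdL : projL l ρ ((2 : F) • Pi.single a 1) = 1 := by
    rw [map_smul, smul_eq_mul, projL_apply ha hb, Pi.single_eq_same, Pi.single_eq_of_ne]
    · rw [mul_zero, add_zero, mul_one, mul_inv_cancel₀ h2]
    · rw [Ne, Fin.ext_iff]; omega
  have himg : mat F (embHom h2 hρ0 hl g) *ᵥ ((2 : F) • Pi.single a 1) = s⁻¹ • z := by
    refine proj_injective h2 hρ0 hl ?_ ?_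
    · rw [projW_embHom, hstd, hgL, map_smul]
      funext i
      simp only [Pi.add_apply, Pi.smul_apply, smul_eq_mul]
      by_cases hi : IsMid l i
      · rcases hi with hi | hi
        · rw [show i = K from Fin.ext (by omega), stdVec_self, stdVec_ne (show K ≠ L by
            rw [Ne, Fin.ext_iff]; omega)]
          field_simp
          ring
        · rw [show i = L from Fin.ext (by omega), stdVec_self, stdVec_ne (show L ≠ K by
            rw [Ne, Fin.ext_iff]; omega)]
          ring
      · rw [hwm i hi, stdVec_ne (by rintro rfl; exact hi (Or.inl hK)),
          stdVec_ne (by rintro rfl; exact hi (Or.inr hL))]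
        ring
    · rw [projL_embHom, hstdL, map_smul, ← hs, smul_eq_mul, inv_mul_cancel₀ hs0]
  refine ⟨g, fun i j hi hj => ?_⟩
  rw [← mulVec_single_apply (mat F _) i j, mat_mul, ← Matrix.mulVec_mulVec]
  by_cases hja : j = a
  · have h3 : mat F y *ᵥ (mat F (embHom h2 hρ0 hl g) *ᵥ Pi.single a 1) =
        (2 : F)⁻¹ • (mat F y *ᵥ (s⁻¹ • z)) := by
      rw [← himg, Matrix.mulVec_smul, Matrix.mulVec_smul, smul_smul, inv_mul_cancel₀ h2, one_smul]
    rw [hja, h3, Matrix.mulVec_smul, Pi.smul_apply, Pi.smul_apply, hyz i hi, smul_zero, smul_zero]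
  · have hj' : (j : ℕ) + 1 < l := by
      rw [Fin.ext_iff] at hja; omega
    obtain ⟨j', hj1, hj2, hj3⟩ := exists_succAbove_of_lt hj'
    rw [← hj3, embHom_single h2 hρ0 hl hj2 (projL_single hl hj2)
      ((hgj j' hj2).trans (projW_single hl hj2).symm), hj3]
    exact hy.mulVec (by omega) i hi

/-- The group `SO_{2l}` acts transitively on the Siegel flag variety of `SO_{2l+1}`. -/
theorem exists_lowZero_mul (h2 : (2 : F) ≠ 0) (hρ : ∀ x : F, x ^ 2 ≠ ρ) (hρ0 : ρ ≠ 0) (hl : 1 ≤ l)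
    (y : SOodd F l) : ∃ g : SO2l F l ρ, LowZero l (y * embHom h2 hρ0 hl g) := by
  have key : ∀ k, k < l → ∃ g : SO2l F l ρ, LowZero k (y * embHom h2 hρ0 hl g) := by
    intro k
    induction k with
    | zero => exact fun _ => ⟨1, fun _ j _ hj => absurd hj (Nat.not_lt_zero _)⟩
    | succ k ih =>
      intro hk
      obtain ⟨g, hg⟩ := ih (by omega)
      obtain ⟨g', hg'⟩ := hg.succ h2 hρ hρ0 hl hk
      exact ⟨g * g', by rwa [map_mul, ← mul_assoc]⟩
  obtain ⟨g, hg⟩ := key (l - 1) (by omega)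
  obtain ⟨g', hg'⟩ := hg.last h2 hρ hρ0 hl
  exact ⟨g * g', by rwa [map_mul, ← mul_assoc]⟩

end OddOrbit

section Siegel

variable {l : ℕ}

/-- The first `l` indices. -/
def lowIdx (l : ℕ) (i : Fin l) : Fin (2 * l + 1) := ⟨i, by omega⟩

theorem lowIdx_injective : Function.Injective (lowIdx l) := fun _ _ h =>
  Fin.ext (congrArg (fun x : Fin (2 * l + 1) => (x : ℕ)) h)

theorem exists_lowIdx {i : Fin (2 * l + 1)} (h : (i : ℕ) < l) : ∃ k, lowIdx l k = i :=
  ⟨⟨i, h⟩, rfl⟩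

theorem exists_rev_lowIdx {i : Fin (2 * l + 1)} (h : l < (i : ℕ)) : ∃ k, (lowIdx l k).rev = i := by
  obtain ⟨k, hk⟩ := exists_lowIdx (i := i.rev) (by rw [Fin.val_rev]; omega)
  exact ⟨k, by rw [hk, Fin.rev_rev]⟩

/-- The index map for the block decomposition `l + 1 + l`. -/
def blockIdx (l : ℕ) : Fin l ⊕ (Unit ⊕ Fin l) → Fin (2 * l + 1)
  | .inl k => lowIdx l k
  | .inr (.inl _) => ctr l
  | .inr (.inr k) => (lowIdx l k).rev

theorem blockIdx_bijective : Function.Bijective (blockIdx l) := by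
  have h1 : ∀ k, (lowIdx l k : ℕ) = k := fun _ => rfl
  have h2 : (ctr l : ℕ) = l := rfl
  have h3 : ∀ k, ((lowIdx l k).rev : ℕ) = 2 * l - k := fun k => by rw [Fin.val_rev, h1]; omega
  constructor
  · intro a b h
    have h' := congrArg Fin.val h
    rcases a with a | _ | a <;> rcases b with b | _ | b <;>
      simp only [blockIdx, h1, h2, h3] at h' <;> try omega
    · rw [Fin.ext h']
    · rfl
    · rw [show a = b from Fin.ext (by omega)]
  · intro i
    rcases lt_trichotomy (i : ℕ) l with h | h | h
    · obtain ⟨k, hk⟩ := exists_lowIdx h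
      exact ⟨.inl k, hk⟩
    · exact ⟨.inr (.inl ()), Fin.ext h.symm⟩
    · obtain ⟨k, hk⟩ := exists_rev_lowIdx h
      exact ⟨.inr (.inr k), hk⟩

/-- The block decomposition of the index set of `SO_{2l+1}`. -/
def blockEquiv (l : ℕ) : Fin l ⊕ (Unit ⊕ Fin l) ≃ Fin (2 * l + 1) :=
  Equiv.ofBijective _ blockIdx_bijective

theorem aStar_rev (a : Matrix (Fin l) (Fin l) F) (i j : Fin l) :
    aStar F l a i.rev j.rev = a⁻¹ j i := by
  rw [aStar, mul_Jmat_apply, Jmat_mul_apply, Matrix.transpose_apply, Fin.rev_rev, Fin.rev_rev]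

theorem lnMat_submatrix (a : Matrix (Fin l) (Fin l) F) :
    (lnMat F l a).submatrix (blockEquiv l) (blockEquiv l) =
      Matrix.fromBlocks a 0 0 (Matrix.fromBlocks 1 0 0 (a⁻¹)ᵀ) := by
  have h2 : (ctr l : ℕ) = l := rfl
  have h1 : ∀ k, (lowIdx l k : ℕ) = k := fun _ => rfl
  have h3 : ∀ k, ((lowIdx l k).rev : ℕ) = 2 * l - k := fun k => by rw [Fin.val_rev, h1]; omega
  have hc : ∀ k, lowIdx l k ≠ ctr l := fun k => by rw [Ne, Fin.ext_iff, h1, h2]; omega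
  have hc' : ∀ k, (lowIdx l k).rev ≠ ctr l := fun k => by rw [Ne, Fin.ext_iff, h3, h2]; omega
  ext i j
  rcases i with i | _ | i
  · show (if hi : (lowIdx l i : ℕ) < l then _ else _ : F) = _
    rw [dif_pos (show (lowIdx l i : ℕ) < l from i.2)]
    rcases j with j | _ | j
    · show (if hi : (lowIdx l j : ℕ) < l then _ else _ : F) = _
      rw [dif_pos (show (lowIdx l j : ℕ) < l from j.2)]; rfl
    · show (if hi : (ctr l : ℕ) < l then _ else _ : F) = _
      rw [dif_neg (by rw [h2]; omega)]; rfl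
    · show (if hi : ((lowIdx l j).rev : ℕ) < l then _ else _ : F) = _
      rw [dif_neg (by rw [h3]; omega)]; rfl
  · show (if hi : (ctr l : ℕ) < l then _ else if hi2 : (ctr l : ℕ) = l then _ else _ : F) = _
    rw [dif_neg (by rw [h2]; omega), dif_pos h2]
    rcases j with j | _ | j
    · exact if_neg (hc j).symm
    · exact if_pos rfl
    · exact if_neg (hc' j).symm
  · show (if hi : ((lowIdx l i).rev : ℕ) < l then _ else if hi2 : ((lowIdx l i).rev : ℕ) = l then _
      else _ : F) = _
    rw [dif_neg (by rw [h3]; omega), dif_neg (by rw [h3]; omega)]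
    rcases j with j | _ | j
    · show (if hi : l + 1 ≤ (lowIdx l j : ℕ) then _ else _ : F) = _
      rw [dif_neg (by rw [h1]; omega)]; rfl
    · show (if hi : l + 1 ≤ (ctr l : ℕ) then _ else _ : F) = _
      rw [dif_neg (by rw [h2]; omega)]; rfl
    · show (if hi : l + 1 ≤ ((lowIdx l j).rev : ℕ) then _ else _ : F) = _
      rw [dif_pos (by rw [h3]; omega)]
      show _ = a⁻¹ j i
      rw [← aStar_rev]
      congr 1
      · refine Fin.ext ?_
        show ((lowIdx l i).rev : ℕ) - (l + 1) = (i.rev : ℕ)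
        rw [h3, Fin.val_rev]; omega
      · refine Fin.ext ?_
        show ((lowIdx l j).rev : ℕ) - (l + 1) = (j.rev : ℕ)
        rw [h3, Fin.val_rev]; omega

theorem Jmat_submatrix : (Jmat F (2 * l + 1)).submatrix (blockEquiv l) (blockEquiv l) =
    Matrix.fromBlocks 0 (Matrix.fromCols 0 1) (Matrix.fromRows 0 1)
      (Matrix.fromBlocks 1 0 0 0) := by
  have h2 : (ctr l : ℕ) = l := rfl
  have h1 : ∀ k, (lowIdx l k : ℕ) = k := fun _ => rfl
  have h3 : ∀ k, ((lowIdx l k).rev : ℕ) = 2 * l - k := fun k => by rw [Fin.val_rev, h1]; omega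
  ext i j
  rcases i with i | _ | i <;> rcases j with j | _ | j
  · exact if_neg (show ¬ (lowIdx l i : ℕ) + (lowIdx l j : ℕ) + 1 = _ by rw [h1, h1]; omega)
  · exact if_neg (show ¬ (lowIdx l i : ℕ) + (ctr l : ℕ) + 1 = _ by rw [h1, h2]; omega)
  · exact if_congr (show (lowIdx l i : ℕ) + ((lowIdx l j).rev : ℕ) + 1 = _ ↔ i = j by
      rw [h1, h3, Fin.ext_iff]; omega) rfl rfl
  · exact if_neg (show ¬ (ctr l : ℕ) + (lowIdx l j : ℕ) + 1 = _ by rw [h1, h2]; omega)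
  · exact if_pos (show (ctr l : ℕ) + (ctr l : ℕ) + 1 = _ by rw [h2]; omega)
  · exact if_neg (show ¬ (ctr l : ℕ) + ((lowIdx l j).rev : ℕ) + 1 = _ by rw [h3, h2]; omega)
  · exact if_congr (show ((lowIdx l i).rev : ℕ) + (lowIdx l j : ℕ) + 1 = _ ↔ i = j by
      rw [h1, h3, Fin.ext_iff]; omega) rfl rfl
  · exact if_neg (show ¬ ((lowIdx l i).rev : ℕ) + (ctr l : ℕ) + 1 = _ by rw [h3, h2]; omega)
  · exact if_neg (show ¬ ((lowIdx l i).rev : ℕ) + ((lowIdx l j).rev : ℕ) + 1 = _ by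
      rw [h3, h3]; omega)

theorem lnMat_det {a : Matrix (Fin l) (Fin l) F} (ha : IsUnit a.det) : (lnMat F l a).det = 1 := by
  rw [← Matrix.det_submatrix_equiv_self (blockEquiv l), lnMat_submatrix,
    Matrix.det_fromBlocks_zero₂₁, Matrix.det_fromBlocks_zero₂₁, Matrix.det_one, one_mul,
    Matrix.det_transpose, ← Matrix.det_mul, Matrix.mul_nonsing_inv _ ha, Matrix.det_one]

theorem lnMat_isometry {a : Matrix (Fin l) (Fin l) F} (ha : IsUnit a.det) :
    (lnMat F l a)ᵀ * Jmat F (2 * l + 1) * lnMat F l a = Jmat F (2 * l + 1) := by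
  have h := (Matrix.reindex (blockEquiv l).symm (blockEquiv l).symm).injective
    (a₁ := (lnMat F l a)ᵀ * Jmat F (2 * l + 1) * lnMat F l a) (a₂ := Jmat F (2 * l + 1))
  refine h ?_
  show ((lnMat F l a)ᵀ * Jmat F (2 * l + 1) * lnMat F l a).submatrix (blockEquiv l) (blockEquiv l) =
    (Jmat F (2 * l + 1)).submatrix (blockEquiv l) (blockEquiv l)
  have e1 : a⁻¹ * a = 1 := Matrix.nonsing_inv_mul _ ha
  have e2 : aᵀ * (a⁻¹)ᵀ = 1 := by rw [← Matrix.transpose_mul, e1, Matrix.transpose_one]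
  rw [← Matrix.submatrix_mul_equiv _ _ _ (blockEquiv l),
    ← Matrix.submatrix_mul_equiv _ _ _ (blockEquiv l), ← Matrix.transpose_submatrix,
    lnMat_submatrix, Jmat_submatrix]
  simp [Matrix.fromBlocks_transpose, Matrix.fromBlocks_multiply, Matrix.mul_fromCols,
    Matrix.fromRows_mul, Matrix.fromCols_mul_fromBlocks, Matrix.fromBlocks_mul_fromRows, e1, e2]

/-- The Levi element `l_l(a)` of `SO_{2l+1}`. -/
def lnEl (a : GL (Fin l) F) : SOodd F l :=
  soMk (lnMat F l a) (lnMat_det (Matrix.GeneralLinearGroup.det a).isUnit)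
    (lnMat_isometry (Matrix.GeneralLinearGroup.det a).isUnit)

theorem mat_lnEl (a : GL (Fin l) F) : mat F (lnEl a) = lnMat F l a := rfl

end Siegel

section SiegelParabolic

variable {l : ℕ}

theorem LowZero.mul {y z : SOodd F l} (hy : LowZero l y) (hz : LowZero l z) :
    LowZero l (y * z) := by
  intro i j hi hj
  rw [mat_mul, Matrix.mul_apply]
  refine Finset.sum_eq_zero fun k _ => ?_
  by_cases hk : (k : ℕ) < l
  · rw [hy i k hi hk, zero_mul]
  · rw [hz k j (by omega) hj, mul_zero]

/-- The Siegel parabolic subgroup of `SO_{2l+1}`. -/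
def siegel (l : ℕ) : Subgroup (SOodd F l) :=
  finiteSubgroup {y | LowZero l y}
    (fun i j hi hj => by
      rw [mat_one, Matrix.one_apply_ne]
      intro h
      rw [h] at hi
      omega)
    (fun _ hy _ hz => LowZero.mul hy hz)

theorem mem_siegel {y : SOodd F l} : y ∈ siegel l ↔ LowZero l y := Iff.rfl

/-- The upper left block of an element of `SO_{2l+1}`. -/
def topLeft (y : SOodd F l) : Matrix (Fin l) (Fin l) F :=
  (mat F y).submatrix (lowIdx l) (lowIdx l)

theorem sum_lowIdx {R : Type*} [AddCommMonoid R] (f : Fin (2 * l + 1) → R)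
    (hf : ∀ k : Fin (2 * l + 1), l ≤ (k : ℕ) → f k = 0) : ∑ k, f k = ∑ k, f (lowIdx l k) := by
  refine (Finset.sum_of_injOn (lowIdx l) lowIdx_injective.injOn (fun _ _ => Finset.mem_univ _)
    (fun k _ hk => hf k ?_) (fun _ _ => rfl)).symm
  by_contra h
  obtain ⟨i, hi⟩ := exists_lowIdx (i := k) (by omega)
  exact hk ⟨i, Finset.mem_coe.mpr (Finset.mem_univ i), hi⟩

theorem topLeft_mul {y z : SOodd F l} (hz : LowZero l z) :
    topLeft (y * z) = topLeft y * topLeft z := by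
  ext i j
  rw [topLeft, Matrix.submatrix_apply, mat_mul, Matrix.mul_apply, Matrix.mul_apply]
  refine sum_lowIdx _ fun k hk => ?_
  rw [hz k _ hk j.2, mul_zero]

theorem topLeft_one : topLeft (1 : SOodd F l) = 1 := by
  rw [topLeft, mat_one, Matrix.submatrix_one _ lowIdx_injective]

/-- The Levi projection of the Siegel parabolic. -/
def leviHom (l : ℕ) : siegel (F := F) l →* GL (Fin l) F :=
  MonoidHom.toHomUnits
    { toFun := fun y => topLeft y.1
      map_one' := topLeft_one
      map_mul' := fun _ z => topLeft_mul z.2 }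

theorem coe_leviHom (y : siegel (F := F) l) :
    (leviHom l y : Matrix (Fin l) (Fin l) F) = topLeft y.1 := rfl

theorem lnMat_lowIdx (a : Matrix (Fin l) (Fin l) F) (i j : Fin l) :
    lnMat F l a (lowIdx l i) (lowIdx l j) = a i j := by
  have := congrFun (congrFun (lnMat_submatrix a) (.inl i)) (.inl j)
  exact this

theorem topLeft_lnEl (a : GL (Fin l) F) : topLeft (lnEl a) = a := by
  ext i j
  exact lnMat_lowIdx _ i j

theorem lowZero_lnEl (a : GL (Fin l) F) : LowZero l (lnEl a) := by
  intro i j hi hj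
  show (if hi : (i : ℕ) < l then _ else if hi2 : (i : ℕ) = l then _ else _ : F) = 0
  rw [dif_neg (by omega)]
  by_cases h : (i : ℕ) = l
  · rw [dif_pos h, if_neg (fun e => by rw [e] at hi; omega)]
  · rw [dif_neg h, dif_neg (by omega)]

theorem mulVec_single_of_topLeft {y : SOodd F l} (hy : LowZero l y) (h1 : topLeft y = 1)
    (j : Fin l) : mat F y *ᵥ Pi.single (lowIdx l j) 1 = Pi.single (lowIdx l j) 1 := by
  funext i
  rw [mulVec_single_apply]
  by_cases hi : (i : ℕ) < l
  · obtain ⟨k, rfl⟩ := exists_lowIdx hi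
    have := congrFun (congrFun h1 k) j
    rw [topLeft, Matrix.submatrix_apply] at this
    rw [this, Matrix.one_apply, Pi.single_apply]
    exact if_congr (lowIdx_injective.eq_iff).symm rfl rfl
  · rw [hy i _ (by omega) j.2, Pi.single_apply, if_neg]
    intro h
    rw [h] at hi
    exact hi j.2

theorem row_rev_of_topLeft {y : SOodd F l} (hy : LowZero l y) (h1 : topLeft y = 1)
    (j : Fin l) (k : Fin (2 * l + 1)) :
    mat F y (lowIdx l j).rev k = if (lowIdx l j).rev = k then 1 else 0 := by
  have h := gram_mat y (Pi.single (lowIdx l j) 1) (Pi.single k 1)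
  rw [mulVec_single_of_topLeft hy h1, gram_single_left, gram_single_left,
    mulVec_single_apply, Pi.single_apply] at h
  exact h

theorem mem_VnSet_of_topLeft {y : SOodd F l} (hy : LowZero l y) (h1 : topLeft y = 1) :
    mat F y ∈ VnSet F l := by
  have hc : mat F y (ctr l) (ctr l) = 1 := by
    have hd := mat_det y
    have e : (mat F y).submatrix (blockEquiv l) (blockEquiv l) =
        Matrix.fromBlocks 1 (Matrix.of fun i j => mat F y (lowIdx l i) (blockEquiv l (.inr j))) 0
          (Matrix.fromBlocks (Matrix.of fun _ _ => mat F y (ctr l) (ctr l))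
            (Matrix.of fun _ j => mat F y (ctr l) (lowIdx l j).rev) 0 1) := by
      ext i j
      rcases i with i | _ | i <;> rcases j with j | _ | j
      · exact congrFun (congrFun h1 i) j
      · rfl
      · rfl
      · exact hy _ _ le_rfl j.2
      · rfl
      · rfl
      · exact hy _ _ (by
          show l ≤ ((lowIdx l i).rev : ℕ)
          rw [Fin.val_rev]; show l ≤ 2 * l + 1 - ((i : ℕ) + 1); omega) j.2
      · refine (row_rev_of_topLeft hy h1 i _).trans (if_neg fun h => ?_)
        have := congrArg Fin.val h
        rw [Fin.val_rev] at this
        change 2 * l + 1 - ((i : ℕ) + 1) = l at this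
        omega
      · refine (row_rev_of_topLeft hy h1 i _).trans (if_congr ?_ rfl rfl)
        exact (Fin.rev_injective.comp lowIdx_injective).eq_iff
    rw [← Matrix.det_submatrix_equiv_self (blockEquiv l), e, Matrix.det_fromBlocks_zero₂₁,
      Matrix.det_fromBlocks_zero₂₁, Matrix.det_one, one_mul,
      mul_one, Matrix.det_unique] at hd
    exact hd
  refine ⟨⟨mat_det y, mat_isom y⟩, fun i j hij => ?_⟩
  rcases lt_trichotomy (i : ℕ) l with hi | hi | hi
  · have hj : (j : ℕ) < l := by
      unfold blkSiegel at hij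
      by_contra hj
      rw [if_neg hj, if_pos hi] at hij
      split_ifs at hij <;> omega
    obtain ⟨i, rfl⟩ := exists_lowIdx hi
    obtain ⟨j, rfl⟩ := exists_lowIdx hj
    have := congrFun (congrFun h1 i) j
    rw [Matrix.one_apply] at this
    exact this.trans (if_congr lowIdx_injective.eq_iff.symm rfl rfl)
  · by_cases hj : (j : ℕ) < l
    · rw [hy i j hi.ge hj, if_neg (fun h => by rw [h] at hi; omega)]
    · have hj : (j : ℕ) = l := by
        unfold blkSiegel at hij
        by_contra hj'
        rw [if_neg hj, if_neg hj', if_neg (show ¬ (i : ℕ) < l by omega), if_pos hi] at hij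
        omega
      rw [show i = ctr l from Fin.ext hi, show j = ctr l from Fin.ext hj, hc, if_pos rfl]
  · obtain ⟨k, rfl⟩ := exists_rev_lowIdx hi
    exact row_rev_of_topLeft hy h1 k j

theorem exists_siegel_decomp {y : SOodd F l} (hy : LowZero l y) :
    ∃ u ∈ VnSet F l, mat F y = lnMat F l (leviHom l ⟨y, hy⟩) * u := by
  set a := leviHom l ⟨y, hy⟩ with ha
  have hm : (lnEl a)⁻¹ * y ∈ siegel l :=
    (siegel l).mul_mem ((siegel l).inv_mem (lowZero_lnEl a)) hy
  have ht : topLeft (lnEl a * ((lnEl a)⁻¹ * y)) = topLeft y := by rw [mul_inv_cancel_left]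
  rw [topLeft_mul hm, topLeft_lnEl, ← coe_leviHom ⟨y, hy⟩, ← ha] at ht
  have h1 : topLeft ((lnEl a)⁻¹ * y) = 1 := by
    have h := congrArg (fun M => ((a⁻¹ : GL (Fin l) F) : Matrix (Fin l) (Fin l) F) * M) ht
    simpa [← mul_assoc] using h
  refine ⟨_, mem_VnSet_of_topLeft hm h1, ?_⟩
  rw [← mat_lnEl, ← mat_mul, mul_inv_cancel_left]

theorem IndTau.apply_siegel {Wτ : Type*} [AddCommGroup Wτ] [Module ℂ Wτ]
    {τ : Representation ℂ (GL (Fin l) F) Wτ}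
    {ξ : Matrix (Fin (2 * l + 1)) (Fin (2 * l + 1)) F → Wτ} (hξ : ξ ∈ IndTau F l τ)
    (y : siegel (F := F) l) (m : Matrix (Fin (2 * l + 1)) (Fin (2 * l + 1)) F) :
    ξ (mat F y.1 * m) = τ (leviHom l y) (ξ m) := by
  obtain ⟨u, hu, h⟩ := exists_siegel_decomp y.2
  rw [h]
  exact hξ.2 _ u hu m

end SiegelParabolic

section Mirabolic

variable {l : ℕ} {ρ : F}

/-- The position in `F^{2l}` of the `j`-th vector of the isotropic flag of `SO_{2l+1}`. -/
def flagIdx (l : ℕ) (j : Fin l) : Fin (2 * l) :=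
  if (j : ℕ) + 1 < l then ⟨j, by have := j.2; omega⟩ else ⟨l, by have := j.2; omega⟩

/-- The coefficient of the `j`-th projected flag vector. -/
def flagCoef (F : Type) [Field F] (l : ℕ) (j : Fin l) : F := if (j : ℕ) + 1 < l then 1 else 2⁻¹

theorem flagIdx_of_lt {j : Fin l} (h : (j : ℕ) + 1 < l) :
    flagIdx l j = (⟨(j : ℕ), by have := j.2; omega⟩ : Fin (2 * l)) := if_pos h

theorem val_flagIdx_of_lt {j : Fin l} (h : (j : ℕ) + 1 < l) : (flagIdx l j : ℕ) = j := by
  rw [flagIdx_of_lt h]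

theorem val_flagIdx_of_not_lt {j : Fin l} (h : ¬ (j : ℕ) + 1 < l) : (flagIdx l j : ℕ) = l := by
  rw [flagIdx, if_neg h]

theorem not_isMid_flagIdx {j : Fin l} (h : (j : ℕ) + 1 < l) : ¬ IsMid l (flagIdx l j) := by
  unfold IsMid
  rw [val_flagIdx_of_lt h]
  omega

theorem flagIdx_strictMono : StrictMono (flagIdx l) := by
  intro i j h
  rw [Fin.lt_def] at h ⊢
  have := j.2
  by_cases hj : (j : ℕ) + 1 < l
  · rw [val_flagIdx_of_lt hj, val_flagIdx_of_lt (by omega)]; exact h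
  · rw [val_flagIdx_of_not_lt hj, val_flagIdx_of_lt (by omega)]; omega

theorem flagIdx_injective : Function.Injective (flagIdx l) := flagIdx_strictMono.injective

theorem exists_flagIdx {p : Fin (2 * l)} (hp : (p : ℕ) + 1 < l ∨ (p : ℕ) = l) :
    ∃ i, flagIdx l i = p := by
  rcases hp with hp | hp
  · exact ⟨⟨p, by omega⟩, by rw [flagIdx_of_lt (show (p : ℕ) + 1 < l from hp)]⟩
  · have := p.2
    refine ⟨⟨l - 1, by omega⟩, Fin.ext ?_⟩
    rw [val_flagIdx_of_not_lt (show ¬ l - 1 + 1 < l by omega), hp]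

theorem flagCoef_ne_zero (h2 : (2 : F) ≠ 0) (j : Fin l) : flagCoef F l j ≠ 0 := by
  unfold flagCoef
  split_ifs
  · exact one_ne_zero
  · exact inv_ne_zero h2

theorem projW_flag (hl : 1 ≤ l) (j : Fin l) :
    projW l ρ (Pi.single (lowIdx l j) 1) = flagCoef F l j • stdVec l (flagIdx l j) := by
  by_cases h : (j : ℕ) + 1 < l
  · have hs : (ctr l).succAbove (flagIdx l j) = lowIdx l j := Fin.ext (by
      rw [val_succAbove, val_flagIdx_of_lt h, if_pos j.2]; rfl)
    rw [← hs, projW_single hl (not_isMid_flagIdx h), flagCoef, if_pos h, one_smul]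
  · have hj : (j : ℕ) + 1 = l := by omega
    funext p
    rw [flagCoef, if_neg h, Pi.smul_apply, smul_eq_mul]
    by_cases hp : IsMid l p
    · rcases hp with hp | hp
      · rw [projW_left hp, stdVec_ne (fun e => ?_), mul_zero, Pi.single_eq_of_ne]
        · intro e
          have e' := congrArg Fin.val e
          change l = (j : ℕ) at e'
          omega
        · have := val_flagIdx_of_not_lt h
          rw [← e] at this
          omega
      · have e : p = flagIdx l j := Fin.ext (by rw [val_flagIdx_of_not_lt h, hp])
        rw [projW_right hp (a := lowIdx l j) (b := ⟨l + 1, by omega⟩) hj rfl, Pi.single_eq_same,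
          Pi.single_eq_of_ne, e, stdVec_self]
        · ring
        · intro e
          have e' := congrArg Fin.val e
          change l + 1 = (j : ℕ) at e'
          omega
    · rw [projW_of_not_isMid _ hp, stdVec_ne (fun e => ?_), mul_zero, Pi.single_eq_of_ne]
      · intro e
        have e' := congrArg Fin.val e
        rw [val_succAbove] at e'
        change _ = (j : ℕ) at e'
        unfold IsMid at hp
        split_ifs at e' <;> omega
      · have := val_flagIdx_of_not_lt h
        rw [← e] at this
        exact hp (Or.inr this)

theorem projL_flag (hl : 1 ≤ l) (j : Fin l) :
    projL l ρ (Pi.single (lowIdx l j) 1) = if (j : ℕ) + 1 < l then 0 else 2⁻¹ := by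
  by_cases h : (j : ℕ) + 1 < l
  · have hs : (ctr l).succAbove (flagIdx l j) = lowIdx l j := Fin.ext (by
      rw [val_succAbove, val_flagIdx_of_lt h, if_pos j.2]; rfl)
    rw [← hs, projL_single hl (not_isMid_flagIdx h), if_pos h]
  · have hj : (j : ℕ) + 1 = l := by omega
    rw [projL_apply (a := lowIdx l j) (b := ⟨l + 1, by omega⟩) hj rfl, Pi.single_eq_same,
      Pi.single_eq_of_ne, if_neg h]
    · ring
    · intro e
      have e' := congrArg Fin.val e
      change l + 1 = (j : ℕ) at e'
      omega

theorem mulVec_eq_sum_of_lowZero {y : SOodd F l} (hy : LowZero l y) (j : Fin l) :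
    mat F y *ᵥ Pi.single (lowIdx l j) 1 =
      ∑ i, topLeft y i j • (Pi.single (lowIdx l i) 1 : Fin (2 * l + 1) → F) := by
  funext p
  rw [mulVec_single_apply, Finset.sum_apply]
  by_cases hp : (p : ℕ) < l
  · obtain ⟨k, rfl⟩ := exists_lowIdx hp
    rw [Finset.sum_eq_single k]
    · rw [Pi.smul_apply, Pi.single_eq_same, smul_eq_mul, mul_one]; rfl
    · intro i _ hi
      rw [Pi.smul_apply, Pi.single_eq_of_ne (lowIdx_injective.ne hi.symm), smul_zero]
    · exact fun h => absurd (Finset.mem_univ k) h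
  · rw [hy p _ (by omega) j.2, Finset.sum_eq_zero]
    intro i _
    rw [Pi.smul_apply, Pi.single_eq_of_ne, smul_zero]
    intro e
    rw [e] at hp
    exact hp i.2

variable (h2 : (2 : F) ≠ 0) (hρ0 : ρ ≠ 0) (hl : 1 ≤ l)

/-- The intersection of `SO_{2l}` with the Siegel parabolic of `SO_{2l+1}`. -/
def mirSub : Subgroup (SO2l F l ρ) := (siegel l).comap (embHom h2 hρ0 hl)

/-- The Levi projection restricted to `SO_{2l}`; its image is the mirabolic subgroup. -/
def mirHom : mirSub h2 hρ0 hl →* GL (Fin l) F :=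
  (leviHom l).comp ((embHom h2 hρ0 hl).subgroupComap (siegel l))

theorem coe_mirHom (h : mirSub h2 hρ0 hl) :
    (mirHom h2 hρ0 hl h : Matrix (Fin l) (Fin l) F) = topLeft (embHom h2 hρ0 hl h.1) := rfl

variable {h2 hρ0 hl}

theorem mirHom_mulVec (h : mirSub h2 hρ0 hl) (j : Fin l) :
    mat F h.1 *ᵥ (flagCoef F l j • stdVec l (flagIdx l j)) =
      ∑ i, (mirHom h2 hρ0 hl h : Matrix (Fin l) (Fin l) F) i j •
        (flagCoef F l i • stdVec l (flagIdx l i)) := by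
  have e := congrArg (projW l ρ) (mulVec_eq_sum_of_lowZero h.2 j)
  rw [projW_embHom, map_sum, projW_flag hl] at e
  rw [e]
  refine Finset.sum_congr rfl fun i _ => ?_
  rw [map_smul, projW_flag hl]
  rfl

theorem mirHom_last (h : mirSub h2 hρ0 hl) {i : Fin l} (hi : (i : ℕ) + 1 = l) (j : Fin l) :
    (mirHom h2 hρ0 hl h : Matrix (Fin l) (Fin l) F) i j = if i = j then 1 else 0 := by
  have e := congrArg (projL l ρ) (mulVec_eq_sum_of_lowZero h.2 j)
  rw [projL_embHom, map_sum, projL_flag hl, Finset.sum_eq_single i] at e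
  · rw [map_smul, projL_flag hl, if_neg (show ¬ (i : ℕ) + 1 < l by omega), smul_eq_mul] at e
    rw [coe_mirHom]
    have h2' := inv_ne_zero h2
    by_cases hj : (j : ℕ) + 1 < l
    · rw [if_pos hj] at e
      rw [if_neg (fun h => by rw [h] at hi; omega)]
      exact (mul_eq_zero.mp e.symm).resolve_right h2'
    · rw [if_neg hj] at e
      rw [if_pos (Fin.ext (by omega))]
      exact mul_right_cancel₀ h2' (by rw [one_mul]; exact e.symm)
  · intro k _ hk
    rw [map_smul, projL_flag hl, if_pos, smul_zero]
    have : (k : ℕ) ≠ i := fun e => hk (Fin.ext e)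
    omega
  · exact fun h => absurd (Finset.mem_univ i) h

theorem exists_mirHom_eq {g : SO2l F l ρ} {A : Matrix (Fin l) (Fin l) F}
    (hA : ∀ i : Fin l, (i : ℕ) + 1 = l → ∀ j, A i j = if i = j then 1 else 0)
    (hg : ∀ j, mat F g *ᵥ (flagCoef F l j • stdVec l (flagIdx l j)) =
      ∑ i, A i j • (flagCoef F l i • stdVec l (flagIdx l i))) :
    ∃ h : mirSub h2 hρ0 hl, h.1 = g ∧ (mirHom h2 hρ0 hl h : Matrix (Fin l) (Fin l) F) = A := by
  have key : ∀ j : Fin l, mat F (embHom h2 hρ0 hl g) *ᵥ Pi.single (lowIdx l j) 1 =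
      ∑ i, A i j • (Pi.single (lowIdx l i) 1 : Fin (2 * l + 1) → F) := by
    intro j
    refine proj_injective h2 hρ0 hl ?_ ?_
    · rw [projW_embHom, projW_flag hl, hg, map_sum]
      refine Finset.sum_congr rfl fun i _ => ?_
      rw [map_smul, projW_flag hl]
    · have hlt : l - 1 < l := by omega
      rw [projL_embHom, map_sum, projL_flag hl, Finset.sum_eq_single ⟨l - 1, hlt⟩]
      · rw [map_smul, projL_flag hl, if_neg (show ¬ l - 1 + 1 < l by omega),
          hA _ (show l - 1 + 1 = l by omega)]
        by_cases hj : (j : ℕ) + 1 < l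
        · rw [if_pos hj, if_neg (fun e => ?_), zero_smul]
          rw [← e] at hj
          change l - 1 + 1 < l at hj
          omega
        · have := j.2
          rw [if_neg hj, if_pos (Fin.ext (show l - 1 = j by omega)), one_smul]
      · intro k _ hk
        have : (k : ℕ) ≠ l - 1 := fun e => hk (Fin.ext e)
        rw [map_smul, projL_flag hl, if_pos (by omega), smul_zero]
      · exact fun h => absurd (Finset.mem_univ _) h
  have hent : ∀ (p : Fin (2 * l + 1)) (j : Fin l), mat F (embHom h2 hρ0 hl g) p (lowIdx l j) =
      ∑ i, A i j * if p = lowIdx l i then 1 else 0 := by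
    intro p j
    have := congrFun (key j) p
    rw [mulVec_single_apply, Finset.sum_apply] at this
    rw [this]
    refine Finset.sum_congr rfl fun i _ => ?_
    rw [Pi.smul_apply, Pi.single_apply, smul_eq_mul]
  have hlow : LowZero l (embHom h2 hρ0 hl g) := by
    intro p j hp hj
    obtain ⟨j, rfl⟩ := exists_lowIdx hj
    rw [hent]
    refine Finset.sum_eq_zero fun i _ => ?_
    rw [if_neg, mul_zero]
    intro e
    rw [e] at hp
    exact absurd i.2 (not_lt.mpr hp)
  refine ⟨⟨g, hlow⟩, rfl, ?_⟩
  ext i j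
  rw [coe_mirHom, topLeft, Matrix.submatrix_apply, hent, Finset.sum_eq_single i, if_pos rfl,
    mul_one]
  · intro k _ hk
    rw [if_neg (lowIdx_injective.ne hk.symm), mul_zero]
  · exact fun h => absurd (Finset.mem_univ i) h

theorem mirHom_entry (h : mirSub h2 hρ0 hl) (i j : Fin l) :
    mat F h.1 (flagIdx l i) (flagIdx l j) * flagCoef F l j =
      (mirHom h2 hρ0 hl h : Matrix (Fin l) (Fin l) F) i j * flagCoef F l i := by
  have e := congrFun (mirHom_mulVec h j) (flagIdx l i)
  rw [Matrix.mulVec_smul, Pi.smul_apply, mulVec_single_apply, Finset.sum_apply,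
    Finset.sum_eq_single i] at e
  · rw [Pi.smul_apply, Pi.smul_apply, stdVec_self, smul_eq_mul, smul_eq_mul, smul_eq_mul,
      mul_one] at e
    rw [← e, mul_comm]
  · intro k _ hk
    rw [Pi.smul_apply, Pi.smul_apply, stdVec_ne (flagIdx_injective.ne hk.symm), smul_zero,
      smul_zero]
  · exact fun h => absurd (Finset.mem_univ i) h

theorem mirHom_entry_eq_zero (h : mirSub h2 hρ0 hl) {p : Fin (2 * l)} (j : Fin l)
    (hp : ∀ i, flagIdx l i ≠ p) : mat F h.1 p (flagIdx l j) = 0 := by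
  have e := congrFun (mirHom_mulVec h j) p
  rw [Matrix.mulVec_smul, Pi.smul_apply, mulVec_single_apply, Finset.sum_apply,
    Finset.sum_eq_zero] at e
  · exact (smul_eq_zero.mp e).resolve_left (flagCoef_ne_zero h2 j)
  · intro k _
    rw [Pi.smul_apply, Pi.smul_apply, stdVec_ne (hp k).symm, smul_zero, smul_zero]

end Mirabolic

section MirabolicUnipotent

variable {l : ℕ} {ρ : F} {h2 : (2 : F) ≠ 0} {hρ0 : ρ ≠ 0} {hl : 1 ≤ l}

theorem mem_mirSub_of_mem_USet {u : SO2l F l ρ} (hu : u ∈ USet F l ρ) :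
    u ∈ mirSub h2 hρ0 hl := by
  have hA : ∀ i : Fin l, (i : ℕ) + 1 = l → ∀ j, Matrix.of (fun i j => mat F u (flagIdx l i)
      (flagIdx l j) * flagCoef F l j / flagCoef F l i) i j = if i = j then 1 else 0 := by
    intro i hi j
    have hle : flagIdx l j ≤ flagIdx l i := flagIdx_strictMono.monotone (by
      rw [Fin.le_def]; have := j.2; omega)
    rw [Matrix.of_apply, hu _ _ hle]
    by_cases hij : i = j
    · rw [if_pos (congrArg _ hij), if_pos hij, one_mul, hij, div_self (flagCoef_ne_zero h2 j)]
    · rw [if_neg (flagIdx_injective.ne hij), if_neg hij, zero_mul, zero_div]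
  obtain ⟨h, hh, -⟩ := exists_mirHom_eq (h2 := h2) (hρ0 := hρ0) (hl := hl) (g := u) hA (by
    intro j
    funext p
    rw [Matrix.mulVec_smul, Pi.smul_apply, mulVec_single_apply, Finset.sum_apply, smul_eq_mul]
    by_cases hp : ∃ i, flagIdx l i = p
    · obtain ⟨k, rfl⟩ := hp
      rw [Finset.sum_eq_single k]
      · rw [Pi.smul_apply, Pi.smul_apply, stdVec_self, smul_eq_mul, smul_eq_mul, mul_one,
          Matrix.of_apply, div_mul_cancel₀ _ (flagCoef_ne_zero h2 k), mul_comm]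
      · intro i _ hi
        rw [Pi.smul_apply, Pi.smul_apply, stdVec_ne (flagIdx_injective.ne hi.symm), smul_zero,
          smul_zero]
      · exact fun h => absurd (Finset.mem_univ k) h
    · rw [Finset.sum_eq_zero]
      · have h0 : mat F u p (flagIdx l j) = 0 := by
          have hp1 : ¬ ((p : ℕ) + 1 < l ∨ (p : ℕ) = l) := fun h => hp (exists_flagIdx h)
          have hj2 := j.2
          by_cases hj : (j : ℕ) + 1 < l
          · have e := val_flagIdx_of_lt hj
            rw [hu p _ (by omega), if_neg (fun h => hp ⟨j, h.symm⟩)]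
          · have e := val_flagIdx_of_not_lt hj
            by_cases hpK : (p : ℕ) + 1 = l
            · exact mid_entry_eq_zero hu hpK e
            · rw [hu p _ (by omega), if_neg (fun h => hp ⟨j, h.symm⟩)]
        rw [h0, mul_zero]
      · intro i _
        rw [Pi.smul_apply, Pi.smul_apply, stdVec_ne (fun h => hp ⟨i, h.symm⟩), smul_zero,
          smul_zero])
  rw [← hh]; exact h.2

theorem upUnip_mirHom {h : mirSub h2 hρ0 hl} (hu : h.1 ∈ USet F l ρ) :
    upUnip F (mirHom h2 hρ0 hl h : Matrix (Fin l) (Fin l) F) := by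
  intro i j hji
  have e := mirHom_entry h i j
  rw [hu _ _ (flagIdx_strictMono.monotone hji)] at e
  by_cases hij : i = j
  · rw [if_pos (congrArg _ hij), hij] at e
    rw [if_pos hij, hij]
    exact (mul_right_cancel₀ (flagCoef_ne_zero h2 j) e).symm
  · rw [if_neg (flagIdx_injective.ne hij), zero_mul] at e
    rw [if_neg hij]
    exact (mul_eq_zero.mp e.symm).resolve_right (flagCoef_ne_zero h2 i)

theorem sum_flagIdx {R : Type*} [AddCommMonoid R] (f : Fin (2 * l) → R)
    (hf : ∀ p, (∀ i, flagIdx l i ≠ p) → f p = 0) : ∑ p, f p = ∑ i, f (flagIdx l i) := by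
  refine (Finset.sum_of_injOn (flagIdx l) flagIdx_injective.injOn (fun _ _ => Finset.mem_univ _)
    (fun k _ hk => hf k fun i hi => ?_) (fun _ _ => rfl)).symm
  exact hk ⟨i, Finset.mem_coe.mpr (Finset.mem_univ i), hi⟩

theorem soWt_eq_zero_left {p q : Fin (2 * l)} (hp : ∀ i, flagIdx l i ≠ p) : soWt F l p q = 0 := by
  have hp1 : ¬ ((p : ℕ) + 1 < l ∨ (p : ℕ) = l) := fun h => by
    obtain ⟨i, hi⟩ := exists_flagIdx h
    exact hp i hi
  unfold soWt
  rw [if_neg (by omega), if_neg (by omega)]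

theorem soWt_eq_zero_right {p q : Fin (2 * l)} (hq : ∀ i, flagIdx l i ≠ q) :
    soWt F l p q = 0 := by
  have hp1 : ¬ ((q : ℕ) + 1 < l ∨ (q : ℕ) = l) := fun h => by
    obtain ⟨i, hi⟩ := exists_flagIdx h
    exact hq i hi
  unfold soWt
  rw [if_neg (by omega), if_neg (by omega)]

theorem soWt_flagIdx (i j : Fin l) :
    soWt F l (flagIdx l i) (flagIdx l j) =
      if (j : ℕ) = i + 1 then flagCoef F l j / flagCoef F l i else 0 := by
  have hi := i.2
  have hj := j.2
  unfold soWt flagCoef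
  by_cases h1 : (j : ℕ) + 1 < l <;> by_cases h3 : (i : ℕ) + 1 < l <;>
    simp only [h1, h3, if_true, if_false, val_flagIdx_of_lt, val_flagIdx_of_not_lt,
      not_false_eq_true] <;> split_ifs <;>
    first | omega | (exfalso; simp only [and_true] at *; omega) | simp

theorem glUSum_mirHom (h : mirSub h2 hρ0 hl) :
    glUSum F l (mirHom h2 hρ0 hl h : Matrix (Fin l) (Fin l) F) = soUSum l (mat F h.1) := by
  rw [soUSum_eq, sum_flagIdx]
  · refine Finset.sum_congr rfl fun i _ => ?_
    rw [sum_flagIdx]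
    · refine Finset.sum_congr rfl fun j _ => ?_
      rw [soWt_flagIdx]
      split_ifs
      · rw [div_mul_eq_mul_div, eq_div_iff (flagCoef_ne_zero h2 i), ← mirHom_entry, mul_comm]
      · rw [zero_mul]
    · intro q hq
      rw [soWt_eq_zero_right hq, zero_mul]
  · intro p hp
    refine Finset.sum_eq_zero fun q _ => ?_
    rw [soWt_eq_zero_left hp, zero_mul]

theorem col_of_upUnip {h : mirSub h2 hρ0 hl}
    (hA : upUnip F (mirHom h2 hρ0 hl h : Matrix (Fin l) (Fin l) F)) {p q : Fin (2 * l)}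
    (hq : (q : ℕ) + 1 < l ∨ (q : ℕ) = l) (hp : q ≤ p ∨ (p : ℕ) + 1 = l) :
    mat F h.1 p q = if p = q then 1 else 0 := by
  obtain ⟨j, rfl⟩ := exists_flagIdx hq
  by_cases hpi : ∃ i, flagIdx l i = p
  · obtain ⟨i, rfl⟩ := hpi
    have hji : j ≤ i := by
      rcases hp with hp | hp
      · exact flagIdx_strictMono.le_iff_le.mp hp
      · exfalso
        by_cases hi : (i : ℕ) + 1 < l
        · rw [val_flagIdx_of_lt hi] at hp; omega
        · rw [val_flagIdx_of_not_lt hi] at hp; omega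
    have e := mirHom_entry h i j
    rw [hA i j hji] at e
    by_cases hij : i = j
    · rw [if_pos hij, hij] at e
      rw [if_pos (congrArg _ hij), hij]
      exact mul_right_cancel₀ (flagCoef_ne_zero h2 j) e
    · rw [if_neg hij, zero_mul] at e
      rw [if_neg (flagIdx_injective.ne hij)]
      exact (mul_eq_zero.mp e).resolve_right (flagCoef_ne_zero h2 j)
  · rw [mirHom_entry_eq_zero h j (fun i hi => hpi ⟨i, hi⟩), if_neg (fun e => hpi ⟨j, e.symm⟩)]

theorem row_of_upUnip {h : mirSub h2 hρ0 hl}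
    (hA : upUnip F (mirHom h2 hρ0 hl h : Matrix (Fin l) (Fin l) F)) {p q : Fin (2 * l)}
    (hp : l ≤ (p : ℕ)) (hq : q ≤ p) :
    mat F h.1 p q = if p = q then 1 else 0 := by
  have hA' : upUnip F (mirHom h2 hρ0 hl h⁻¹ : Matrix (Fin l) (Fin l) F) := by
    rw [map_inv]
    exact (glUnip (F := F) l).inv_mem hA
  have hd : (dualIdx l p : ℕ) + 1 < l ∨ (dualIdx l p : ℕ) = l := by
    by_cases h : IsMid l p
    · rw [dualIdx_of_isMid h]
      rcases h with h | h
      · omega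
      · exact Or.inr h
    · rw [val_dualIdx h]
      unfold IsMid at h
      omega
  have e := gram_mat_inv h.1 (stdVec l (dualIdx l p)) (stdVec l q)
  rw [gram_stdVec_left, dualIdx_dualIdx, dualCoef_dualIdx, mulVec_single_apply,
    gram_stdVec_right, mulVec_single_apply] at e
  have hc : dualCoef l ρ p ≠ 0 := by
    unfold dualCoef; split_ifs
    · exact neg_ne_zero.mpr hρ0
    · exact one_ne_zero
  have hcol := col_of_upUnip hA' (p := dualIdx l q) hd (by
    have hqp : (q : ℕ) ≤ p := hq
    have h1 := p.2
    by_cases hq1 : (q : ℕ) + 1 = l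
    · right
      rw [dualIdx_of_isMid (Or.inl hq1), hq1]
    · left
      rw [Fin.le_def]
      by_cases hmp : IsMid l p <;> by_cases hmq : IsMid l q
      · rw [dualIdx_of_isMid hmp, dualIdx_of_isMid hmq]
        unfold IsMid at hmp hmq
        omega
      · rw [dualIdx_of_isMid hmp, val_dualIdx hmq]
        unfold IsMid at hmp hmq
        omega
      · rw [dualIdx_of_isMid hmq, val_dualIdx hmp]
        unfold IsMid at hmp hmq
        omega
      · rw [val_dualIdx hmq, val_dualIdx hmp]
        omega)
  change dualCoef l ρ q * mat F h.1⁻¹ _ _ = _ at e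
  rw [show mat F h.1⁻¹ (dualIdx l q) (dualIdx l p) = _ from hcol] at e
  by_cases hpq : p = q
  · subst hpq
    rw [if_pos rfl] at e ⊢
    exact (mul_left_cancel₀ hc e).symm
  · rw [if_neg (fun h => hpq (dualIdx_injective h).symm), mul_zero] at e
    rw [if_neg hpq]
    exact (mul_eq_zero.mp e.symm).resolve_left hc

theorem mem_USet_of_upUnip {h : mirSub h2 hρ0 hl}
    (hA : upUnip F (mirHom h2 hρ0 hl h : Matrix (Fin l) (Fin l) F)) : h.1 ∈ USet F l ρ := by
  have hoff : ∀ p q : Fin (2 * l), ¬ ((p : ℕ) + 1 = l ∧ (q : ℕ) + 1 = l) → q ≤ p →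
      mat F h.1 p q = if p = q then 1 else 0 := by
    intro p q hpq hqp
    by_cases hp : l ≤ (p : ℕ)
    · exact row_of_upUnip hA hp hqp
    · exact col_of_upUnip hA (Or.inl (by have : (q : ℕ) ≤ p := hqp; omega)) (Or.inl hqp)
  intro p q hqp
  by_cases hpq : (p : ℕ) + 1 = l ∧ (q : ℕ) + 1 = l
  · have hd := mat_det h.1
    rw [Matrix.det_of_isUpperTriangular, Finset.prod_eq_single p] at hd
    · rw [show q = p from Fin.ext (by omega), if_pos rfl, hd]
    · intro r _ hr
      rw [hoff r r (fun e => hr (Fin.ext (by omega))) le_rfl, if_pos rfl]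
    · exact fun h => absurd (Finset.mem_univ p) h
    · intro r s hsr
      have hsr : s < r := hsr
      rw [hoff r s (fun e => hsr.ne (Fin.ext (by omega))) hsr.le, if_neg hsr.ne']
  · exact hoff p q hpq hqp

end MirabolicUnipotent

section MirabolicSurjective

variable {l : ℕ} {ρ : F} {h2 : (2 : F) ≠ 0} {hρ0 : ρ ≠ 0} {hl : 1 ≤ l}

theorem exists_mirHom_transvection (h2 : (2 : F) ≠ 0) (hρ0 : ρ ≠ 0) (hl : 1 ≤ l) {i j : Fin l}
    (hij : i ≠ j) (hi : (i : ℕ) + 1 < l) (s : F) :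
    ∃ h : mirSub h2 hρ0 hl, (mirHom h2 hρ0 hl h : Matrix (Fin l) (Fin l) F) =
      Matrix.transvection i j s := by
  have hc := not_isMid_flagIdx hi
  have hdc : dualCoef l ρ (flagIdx l j) ≠ 0 := by
    unfold dualCoef; split_ifs
    · exact neg_ne_zero.mpr hρ0
    · exact one_ne_zero
  have hne : ∀ {k : Fin l}, k ≠ j → dualIdx l (flagIdx l k) ≠ dualIdx l (flagIdx l j) :=
    fun h e => h (flagIdx_injective (dualIdx_injective e))
  have hx : ((-(s / (flagCoef F l j * dualCoef l ρ (flagIdx l j)))) •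
      stdVec l (dualIdx l (flagIdx l j)) : Fin (2 * l) → F) (dualIdx l (flagIdx l i)) = 0 := by
    rw [Pi.smul_apply, stdVec_ne (hne hij), smul_zero]
  have hT : ∀ p k : Fin l, Matrix.transvection i j s p k =
      (if p = k then 1 else 0) + if p = i ∧ k = j then s else 0 := by
    intro p k
    rw [Matrix.transvection, Matrix.add_apply, Matrix.one_apply, Matrix.single_apply]
    simp only [eq_comm]
  obtain ⟨h, -, hh⟩ := exists_mirHom_eq (h2 := h2) (hρ0 := hρ0) (hl := hl)
    (g := soEich h2 hρ0 hc _ hx) (A := Matrix.transvection i j s) (by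
      intro p hp k
      rw [hT, if_neg (fun e : p = i ∧ k = j => ?_), add_zero]
      rw [e.1] at hp
      omega) (by
      intro k
      have h0 : (flagCoef F l k • stdVec l (flagIdx l k) : Fin (2 * l) → F)
          (dualIdx l (flagIdx l i)) = 0 := by
        rw [Pi.smul_apply, stdVec_ne, smul_zero]
        intro e
        have e' := congrArg Fin.val e
        rw [val_dualIdx hc, val_flagIdx_of_lt hi] at e'
        by_cases hk : (k : ℕ) + 1 < l
        · rw [val_flagIdx_of_lt hk] at e'; omega
        · rw [val_flagIdx_of_not_lt hk] at e'; omega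
      rw [soEich_mulVec, h0, zero_smul, mul_zero, add_zero, add_zero, map_smul, map_smul,
        LinearMap.smul_apply, gram_stdVec_left]
      simp only [hT, add_smul, Finset.sum_add_distrib, ite_smul, one_smul, zero_smul,
        Finset.sum_ite_eq', Finset.mem_univ, if_true]
      rw [Finset.sum_eq_single i (fun p _ hp => if_neg (fun h => hp h.1))
        (fun h => absurd (Finset.mem_univ i) h), sub_eq_add_neg]
      congr 1
      by_cases hk : k = j
      · subst hk
        rw [if_pos ⟨rfl, rfl⟩, stdVec_self, show flagCoef F l i = 1 from if_pos hi, one_smul,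
          ← neg_smul]
        congr 1
        have := flagCoef_ne_zero h2 k
        simp only [smul_eq_mul]
        field_simp
      · rw [if_neg (fun h => hk h.2), stdVec_ne (hne hk)]
        simp)
  exact ⟨h, hh⟩

theorem exists_mirHom_diagonal (h2 : (2 : F) ≠ 0) (hρ0 : ρ ≠ 0) (hl : 1 ≤ l) {d : Fin l → F}
    (hd : ∀ i, d i ≠ 0) (hd1 : ∀ i : Fin l, (i : ℕ) + 1 = l → d i = 1) :
    ∃ h : mirSub h2 hρ0 hl, (mirHom h2 hρ0 hl h : Matrix (Fin l) (Fin l) F) =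
      Matrix.diagonal d := by
  set D : Fin (2 * l) → F := fun p => if h : (p : ℕ) + 1 < l then d ⟨p, by omega⟩ else
    if h : (p : ℕ) = l ∨ (p : ℕ) + 1 = l then 1 else (d ⟨2 * l - 1 - p, by
      have := p.2; omega⟩)⁻¹ with hD
  have hmid : ∀ p, IsMid l p → D p = 1 := by
    intro p hp
    unfold IsMid at hp
    simp only [hD]
    rw [dif_neg (by omega), dif_pos (by omega)]
  have hpair : ∀ p, D p * D (dualIdx l p) = 1 := by
    intro p
    by_cases hp : IsMid l p
    · rw [dualIdx_of_isMid hp, hmid p hp, one_mul]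
    · have hv := val_dualIdx hp
      unfold IsMid at hp
      simp only [hD]
      by_cases h : (p : ℕ) + 1 < l
      · rw [dif_pos h, dif_neg (by omega), dif_neg (by omega)]
        have e : (⟨2 * l - 1 - (dualIdx l p : ℕ), by omega⟩ : Fin l) = ⟨p, by omega⟩ :=
          Fin.ext (by simp only; omega)
        rw [e, mul_inv_cancel₀ (hd _)]
      · have := p.2
        rw [dif_neg h, dif_neg (by omega), dif_pos (by omega)]
        have e : (⟨(dualIdx l p : ℕ), by omega⟩ : Fin l) = ⟨2 * l - 1 - p, by omega⟩ :=
          Fin.ext (by simp only; omega)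
        rw [e, inv_mul_cancel₀ (hd _)]
  have hdet : (Matrix.diagonal D).det = 1 := by
    rw [Matrix.det_diagonal]
    refine Finset.prod_involution (fun p _ => dualIdx l p) (fun p _ => hpair p)
      (fun p _ h e => h (hmid p ?_)) (fun _ _ => Finset.mem_univ _)
      (fun p _ => dualIdx_dualIdx p)
    by_contra hp
    exact dualIdx_ne_self hp e
  obtain ⟨h, -, hh⟩ := exists_mirHom_eq (h2 := h2) (hρ0 := hρ0) (hl := hl)
    (g := soMk (Matrix.diagonal D) hdet (diagonal_isometry hpair)) (A := Matrix.diagonal d) (by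
      intro i hi j
      rw [Matrix.diagonal_apply, hd1 i hi]) (by
      intro j
      rw [mat_soMk, Matrix.mulVec_smul, Matrix.mulVec_single_one, Finset.sum_eq_single j,
        Matrix.diagonal_apply_eq, smul_comm]
      · congr 1
        funext p
        rw [Matrix.col_apply, Matrix.diagonal_apply, Pi.smul_apply, smul_eq_mul]
        by_cases hp : p = flagIdx l j
        · rw [if_pos hp, hp, stdVec_self, mul_one]
          simp only [hD]
          by_cases hj : (j : ℕ) + 1 < l
          · have e := val_flagIdx_of_lt hj
            rw [dif_pos (by omega)]
            exact congrArg d (Fin.ext e)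
          · have e := val_flagIdx_of_not_lt hj
            have := j.2
            rw [dif_neg (by omega), dif_pos (Or.inl e), hd1 j (by omega)]
        · rw [if_neg hp, stdVec_ne hp, mul_zero]
      · intro k _ hk
        rw [Matrix.diagonal_apply_ne _ hk, zero_smul]
      · exact fun h => absurd (Finset.mem_univ j) h)
  exact ⟨h, hh⟩

/-- The block matrix `[[A, c], [0, 1]]` of size `m + 1`. -/
def mirBlock {m : ℕ} (A : Matrix (Fin m) (Fin m) F) (c : Matrix (Fin m) (Fin 1) F) :
    Matrix (Fin (m + 1)) (Fin (m + 1)) F :=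
  (Matrix.fromBlocks A c 0 1).reindex finSumFinEquiv finSumFinEquiv

theorem mirBlock_mul {m : ℕ} (A B : Matrix (Fin m) (Fin m) F) (c d : Matrix (Fin m) (Fin 1) F) :
    mirBlock A c * mirBlock B d = mirBlock (A * B) (A * d + c) := by
  simp only [mirBlock, Matrix.reindex_apply]
  rw [Matrix.submatrix_mul_equiv, Matrix.fromBlocks_multiply]
  simp

theorem mirBlock_transvection_left {m : ℕ} (t : Matrix.TransvectionStruct (Fin m) F) :
    mirBlock t.toMatrix 0 = Matrix.transvection (finSumFinEquiv (n := 1) (Sum.inl t.i))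
      (finSumFinEquiv (Sum.inl t.j)) t.c := by
  rw [mirBlock, ← Matrix.TransvectionStruct.toMatrix_sumInl (Fin 1) t]
  exact (Matrix.TransvectionStruct.toMatrix_reindexEquiv (finSumFinEquiv (n := 1)) _).symm

theorem mirBlock_transvection_right {m : ℕ} (i : Fin m) (s : F) :
    mirBlock 1 (Matrix.single i 0 s) = Matrix.transvection (finSumFinEquiv (n := 1) (Sum.inl i))
      (finSumFinEquiv (Sum.inr 0)) s := by
  have h : Matrix.fromBlocks 1 (Matrix.single i (0 : Fin 1) s) 0 1 =
      Matrix.transvection (Sum.inl i : Fin m ⊕ Fin 1) (Sum.inr 0) s := by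
    ext (p | p) (q | q) <;>
      simp [Matrix.transvection, Matrix.single_apply, Matrix.one_apply]
  rw [mirBlock, h]
  ext p q
  obtain ⟨p, rfl⟩ := (finSumFinEquiv (m := m) (n := 1)).surjective p
  obtain ⟨q, rfl⟩ := (finSumFinEquiv (m := m) (n := 1)).surjective q
  simp only [Matrix.reindex_apply, Matrix.submatrix_apply, Equiv.symm_apply_apply,
    Matrix.transvection, Matrix.add_apply, Matrix.one_apply, Matrix.single_apply,
    EmbeddingLike.apply_eq_iff_eq]

theorem exists_mirHom_mirBlock {m : ℕ} (h2 : (2 : F) ≠ 0) (hρ0 : ρ ≠ 0) (hl : 1 ≤ m + 1)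
    {A : Matrix (Fin m) (Fin m) F} (hA : A.det ≠ 0) (c : Matrix (Fin m) (Fin 1) F) :
    ∃ h : mirSub h2 hρ0 hl, (mirHom h2 hρ0 hl h : Matrix (Fin (m + 1)) (Fin (m + 1)) F) =
      mirBlock A c := by
  have hinl : ∀ i : Fin m, ((finSumFinEquiv (n := 1) (Sum.inl i) : Fin (m + 1)) : ℕ) = i :=
    fun i => rfl
  have hinr : ((finSumFinEquiv (m := m) (Sum.inr (0 : Fin 1)) : Fin (m + 1)) : ℕ) = m := rfl
  have hmul : ∀ {X Y : Matrix (Fin (m + 1)) (Fin (m + 1)) F},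
      (∃ h : mirSub h2 hρ0 hl, (mirHom h2 hρ0 hl h : Matrix _ _ F) = X) →
      (∃ h : mirSub h2 hρ0 hl, (mirHom h2 hρ0 hl h : Matrix _ _ F) = Y) →
      ∃ h : mirSub h2 hρ0 hl, (mirHom h2 hρ0 hl h : Matrix _ _ F) = X * Y := by
    rintro X Y ⟨h, rfl⟩ ⟨k, rfl⟩
    exact ⟨h * k, by rw [map_mul]; rfl⟩
  have hleft : ∃ h : mirSub h2 hρ0 hl, (mirHom h2 hρ0 hl h : Matrix _ _ F) = mirBlock A 0 := by
    refine Matrix.diagonal_transvection_induction_of_det_ne_zero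
      (fun A => ∃ h : mirSub h2 hρ0 hl, (mirHom h2 hρ0 hl h : Matrix _ _ F) = mirBlock A 0)
      A hA ?_ ?_ ?_
    · intro D hD
      rw [Matrix.det_diagonal, Finset.prod_ne_zero_iff] at hD
      have e : mirBlock (Matrix.diagonal D) 0 =
          Matrix.diagonal (Sum.elim D (fun _ => 1) ∘ (finSumFinEquiv (m := m) (n := 1)).symm) := by
        rw [mirBlock, ← Matrix.diagonal_one, Matrix.fromBlocks_diagonal, Matrix.reindex_apply,
          Matrix.submatrix_diagonal_equiv]
      rw [e]
      refine exists_mirHom_diagonal h2 hρ0 hl (fun i => ?_) (fun i hi => ?_)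
      · obtain ⟨i | i, rfl⟩ := (finSumFinEquiv (m := m) (n := 1)).surjective i
        · rw [Function.comp_apply, Equiv.symm_apply_apply]
          exact hD i (Finset.mem_univ i)
        · rw [Function.comp_apply, Equiv.symm_apply_apply]
          exact one_ne_zero
      · obtain ⟨i | i, rfl⟩ := (finSumFinEquiv (m := m) (n := 1)).surjective i
        · rw [hinl] at hi
          have := i.2
          omega
        · rw [Function.comp_apply, Equiv.symm_apply_apply]
          rfl
    · intro t
      rw [mirBlock_transvection_left]
      exact exists_mirHom_transvection h2 hρ0 hl (fun e => t.hij (by simpa using e))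
        (by rw [hinl]; have := t.i.2; omega) _
    · intro A B _ _ hA hB
      have := hmul hA hB
      rwa [mirBlock_mul, Matrix.mul_zero, add_zero] at this
  have hright : ∀ S : Finset (Fin m), ∃ h : mirSub h2 hρ0 hl, (mirHom h2 hρ0 hl h : Matrix _ _ F) =
      mirBlock 1 (∑ i ∈ S, Matrix.single i 0 (c i 0)) := by
    intro S
    induction S using Finset.induction_on with
    | empty =>
      refine ⟨1, ?_⟩
      rw [map_one, Finset.sum_empty, mirBlock, Matrix.fromBlocks_one, Matrix.reindex_apply,
        Matrix.submatrix_one_equiv]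
      rfl
    | insert i S hi ih =>
      have := hmul ih (exists_mirHom_transvection h2 hρ0 hl
        (i := finSumFinEquiv (n := 1) (Sum.inl i)) (j := finSumFinEquiv (Sum.inr 0))
        (finSumFinEquiv.injective.ne Sum.inl_ne_inr)
        (by rw [hinl]; have := i.2; omega) (c i 0))
      rw [← mirBlock_transvection_right, mirBlock_mul, Matrix.one_mul, Matrix.one_mul] at this
      rwa [Finset.sum_insert hi]
  have hc : ∑ i, Matrix.single i 0 (c i 0) = c := by
    ext p q
    rw [Subsingleton.elim q 0, Matrix.sum_apply]
    simp [Matrix.single_apply]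
  have := hmul (hright Finset.univ) hleft
  rwa [hc, mirBlock_mul, Matrix.one_mul, Matrix.one_mul, zero_add] at this

theorem exists_mirHom_of_last_row (h2 : (2 : F) ≠ 0) (hρ0 : ρ ≠ 0) (hl : 1 ≤ l)
    {A : Matrix (Fin l) (Fin l) F} (hA : A.det ≠ 0)
    (hr : ∀ i : Fin l, (i : ℕ) + 1 = l → ∀ j, A i j = if i = j then 1 else 0) :
    ∃ h : mirSub h2 hρ0 hl, (mirHom h2 hρ0 hl h : Matrix (Fin l) (Fin l) F) = A := by
  obtain ⟨m, rfl⟩ : ∃ m, l = m + 1 := ⟨l - 1, by omega⟩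
  have e : A = mirBlock (A.submatrix (finSumFinEquiv ∘ Sum.inl) (finSumFinEquiv ∘ Sum.inl))
      (A.submatrix (finSumFinEquiv ∘ Sum.inl) (finSumFinEquiv ∘ Sum.inr)) := by
    ext p q
    obtain ⟨p | p, rfl⟩ := (finSumFinEquiv (m := m) (n := 1)).surjective p
    · obtain ⟨q | q, rfl⟩ := (finSumFinEquiv (m := m) (n := 1)).surjective q <;>
        simp [mirBlock]
    · have hp : ((finSumFinEquiv (m := m) (Sum.inr p) : Fin (m + 1)) : ℕ) + 1 = m + 1 := by
        rw [Subsingleton.elim p 0]; rfl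
      rw [hr _ hp]
      obtain ⟨q | q, rfl⟩ := (finSumFinEquiv (m := m) (n := 1)).surjective q
      · rw [if_neg (finSumFinEquiv.injective.ne Sum.inr_ne_inl)]
        simp [mirBlock]
      · simp [mirBlock, Matrix.one_apply]
  rw [e] at hA ⊢
  refine exists_mirHom_mirBlock h2 hρ0 hl ?_ _
  rw [mirBlock, Matrix.det_reindex_self, Matrix.det_fromBlocks_zero₂₁, Matrix.det_one,
    mul_one] at hA
  exact hA

end MirabolicSurjective

section Derivatives

variable {m : ℕ}

/-- Upper unipotent matrices whose leading `k` columns are those of the identity. -/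
def TopId (k : ℕ) (A : Matrix (Fin m) (Fin m) F) : Prop :=
  ∀ p q : Fin m, ((q : ℕ) < k ∨ q ≤ p) → A p q = if p = q then 1 else 0

/-- The linear form `Σ_{p < κ} χ_p A_{p,κ}`. -/
def colSum (κ : Fin m) (χ : Fin m → F) (A : Matrix (Fin m) (Fin m) F) : F :=
  ∑ p, if p < κ then χ p * A p κ else 0

/-- The sum of the superdiagonal entries in rows `≥ k`. -/
def supSum (k : ℕ) (A : Matrix (Fin m) (Fin m) F) : F :=
  ∑ p : Fin m, ∑ q : Fin m, if k ≤ (p : ℕ) ∧ (q : ℕ) = p + 1 then A p q else 0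

/-- Matrices of the form `diag(B, 1)` with `B` of size `k`. -/
def IsTopBlock (k : ℕ) (A : Matrix (Fin m) (Fin m) F) : Prop :=
  ∀ p q : Fin m, (k ≤ (p : ℕ) ∨ k ≤ (q : ℕ)) → A p q = if p = q then 1 else 0

theorem topId_one_iff {A : Matrix (Fin m) (Fin m) F} : TopId 1 A ↔ upUnip F A := by
  refine ⟨fun h p q hqp => h p q (Or.inr hqp), fun h p q hqp => h p q ?_⟩
  rcases hqp with hqp | hqp
  · omega
  · exact hqp

theorem topId_size_iff {A : Matrix (Fin m) (Fin m) F} : TopId m A ↔ A = 1 := by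
  refine ⟨fun h => ?_, ?_⟩
  · ext p q
    rw [h p q (Or.inl q.2), Matrix.one_apply]
  · rintro rfl p q -
    rw [Matrix.one_apply]

theorem TopId.mono {k : ℕ} {A : Matrix (Fin m) (Fin m) F} (h : TopId (k + 1) A) : TopId k A :=
  fun p q hpq => h p q (hpq.imp_left fun h => by omega)

theorem topId_succ_iff {κ : Fin m} {A : Matrix (Fin m) (Fin m) F} :
    TopId ((κ : ℕ) + 1) A ↔ TopId κ A ∧ ∀ p, p < κ → A p κ = 0 := by
  refine ⟨fun h => ⟨h.mono, fun p hp => ?_⟩, fun h p q hpq => ?_⟩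
  · rw [h p κ (Or.inl (Nat.lt_succ_self _)), if_neg hp.ne]
  · by_cases hq : (q : ℕ) < κ ∨ q ≤ p
    · exact h.1 p q hq
    · have hqκ : q = κ := Fin.ext (by omega)
      subst hqκ
      have hpq' : p < q := by omega
      rw [h.2 p hpq', if_neg hpq'.ne]

theorem IsTopBlock.mul_apply {k : ℕ} {A : Matrix (Fin m) (Fin m) F} (hA : IsTopBlock k A)
    (B : Matrix (Fin m) (Fin m) F) {p q : Fin m} (hp : k ≤ (p : ℕ)) : (A * B) p q = B p q := by
  rw [Matrix.mul_apply, Finset.sum_eq_single p, hA p p (Or.inl hp), if_pos rfl, one_mul]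
  · intro r _ hr
    rw [hA p r (Or.inl hp), if_neg hr.symm, zero_mul]
  · exact fun h => absurd (Finset.mem_univ p) h

theorem IsTopBlock.mul_apply' {k : ℕ} {A : Matrix (Fin m) (Fin m) F} (hA : IsTopBlock k A)
    (B : Matrix (Fin m) (Fin m) F) {p q : Fin m} (hq : k ≤ (q : ℕ)) : (B * A) p q = B p q := by
  rw [Matrix.mul_apply, Finset.sum_eq_single q, hA q q (Or.inl hq), if_pos rfl, mul_one]
  · intro r _ hr
    rw [hA r q (Or.inr hq), if_neg hr, mul_zero]
  · exact fun h => absurd (Finset.mem_univ q) h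

theorem IsTopBlock.of_mul_eq_one {k : ℕ} {A B : Matrix (Fin m) (Fin m) F} (hA : IsTopBlock k A)
    (hAB : A * B = 1) (hBA : B * A = 1) : IsTopBlock k B := by
  rintro p q (h | h)
  · rw [← hA.mul_apply B h, hAB, Matrix.one_apply]
  · rw [← hA.mul_apply' B h, hBA, Matrix.one_apply]

theorem IsTopBlock.topId_conj {k : ℕ} {A B X : Matrix (Fin m) (Fin m) F} (hA : IsTopBlock k A)
    (hB : IsTopBlock k B) (hAB : A * B = 1) (hX : TopId k X) : TopId k (A * X * B) := by
  intro p q hpq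
  by_cases hq : (q : ℕ) < k
  · have e : A * X * B = 1 + A * (X - 1) * B := by
      rw [Matrix.mul_sub, Matrix.mul_one, Matrix.sub_mul, hAB]; abel
    rw [e, Matrix.add_apply, Matrix.one_apply, add_eq_left, Matrix.mul_apply]
    refine Finset.sum_eq_zero fun r _ => ?_
    by_cases hr : (r : ℕ) < k
    · rw [Matrix.mul_apply, Finset.sum_eq_zero, zero_mul]
      intro s _
      rw [Matrix.sub_apply, hX s r (Or.inl hr), Matrix.one_apply, sub_self, mul_zero]
    · rw [hB r q (Or.inl (not_lt.mp hr)), if_neg (fun h => hr (by rw [h]; exact hq)), mul_zero]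
  · have hqp : q ≤ p := hpq.resolve_left hq
    have hp : k ≤ (p : ℕ) := (not_lt.mp hq).trans hqp
    rw [hB.mul_apply' _ (not_lt.mp hq), hA.mul_apply _ hp, hX p q (Or.inr hqp)]

theorem supSum_pred (κ : Fin m) {k' : Fin m} (hk : (k' : ℕ) + 1 = κ)
    (A : Matrix (Fin m) (Fin m) F) : supSum k' A = A k' κ + supSum κ A := by
  have e : ∀ p q : Fin m, (if (k' : ℕ) ≤ p ∧ (q : ℕ) = p + 1 then A p q else 0) =
      (if p = k' ∧ q = κ then A p q else 0) +
        if (κ : ℕ) ≤ p ∧ (q : ℕ) = p + 1 then A p q else 0 := by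
    intro p q
    by_cases h : p = k' ∧ q = κ
    · obtain ⟨rfl, rfl⟩ := h
      rw [if_pos ⟨le_rfl, hk.symm⟩, if_pos ⟨rfl, rfl⟩, if_neg (by omega), add_zero]
    · rw [if_neg h, zero_add]
      refine if_congr ?_ rfl rfl
      rw [Fin.ext_iff, Fin.ext_iff] at h
      omega
  unfold supSum
  simp only [e, Finset.sum_add_distrib]
  congr 1
  rw [Finset.sum_eq_single k', Finset.sum_eq_single κ, if_pos ⟨rfl, rfl⟩]
  · exact fun q _ hq => if_neg (fun h => hq h.2)
  · exact fun h => absurd (Finset.mem_univ κ) h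
  · exact fun p _ hp => Finset.sum_eq_zero fun q _ => if_neg (fun h => hp h.1)
  · exact fun h => absurd (Finset.mem_univ k') h

theorem supSum_congr {k : ℕ} {A B : Matrix (Fin m) (Fin m) F}
    (h : ∀ p q : Fin m, k ≤ (p : ℕ) → k ≤ (q : ℕ) → A p q = B p q) : supSum k A = supSum k B := by
  refine Finset.sum_congr rfl fun p _ => Finset.sum_congr rfl fun q _ => ?_
  by_cases hpq : k ≤ (p : ℕ) ∧ (q : ℕ) = p + 1
  · rw [if_pos hpq, if_pos hpq, h p q hpq.1 (by omega)]
  · rw [if_neg hpq, if_neg hpq]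

theorem IsTopBlock.supSum_conj {κ k' : Fin m} (hk : (k' : ℕ) + 1 = κ)
    {A B X : Matrix (Fin m) (Fin m) F} (hA : IsTopBlock κ A) (hB : IsTopBlock κ B) :
    supSum k' (A * X * B) = colSum κ (A k') X + supSum κ X := by
  rw [supSum_pred κ hk, hB.mul_apply' _ le_rfl, Matrix.mul_apply]
  congr 1
  · refine Finset.sum_congr rfl fun p _ => ?_
    split_ifs with hp
    · rfl
    · have hp' : (κ : ℕ) ≤ p := not_lt.mp hp
      rw [hA k' p (Or.inr hp'), if_neg (by rw [Fin.ext_iff]; omega), zero_mul]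
  · refine supSum_congr fun p q hp hq => ?_
    rw [hB.mul_apply' _ hq, hA.mul_apply _ hp]

theorem exists_isTopBlock {κ k' : Fin m} (hk : (k' : ℕ) + 1 = κ) {χ : Fin m → F}
    (hχ : ∃ p, p < κ ∧ χ p ≠ 0) : ∃ A : Matrix (Fin m) (Fin m) F, A.det ≠ 0 ∧ IsTopBlock κ A ∧
      ∀ p, p < κ → A k' p = χ p := by
  obtain ⟨s, hs, hχs⟩ := hχ
  set ν : Fin m → F := fun p => if p < κ then χ p else 0 with hν
  have hsk : (s : ℕ) < κ := hs
  have hrow : ∀ p q : Fin m, ((1 : Matrix (Fin m) (Fin m) F).updateRow s ν).submatrix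
      (Equiv.swap s k') id p q = if p = k' then ν q else
        if p = s then (if k' = q then 1 else 0) else if p = q then 1 else 0 := by
    intro p q
    rw [Matrix.submatrix_apply, id]
    by_cases h : p = k'
    · rw [if_pos h, h, Equiv.swap_apply_right, Matrix.updateRow_self]
    · rw [if_neg h, Matrix.updateRow_ne, Matrix.one_apply]
      · by_cases h' : p = s
        · rw [if_pos h', h', Equiv.swap_apply_left]
        · rw [if_neg h', Equiv.swap_apply_of_ne_of_ne h' h]
      · intro e
        exact h ((Equiv.swap s k').injective (e.trans (Equiv.swap_apply_right s k').symm))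
  refine ⟨((1 : Matrix (Fin m) (Fin m) F).updateRow s ν).submatrix (Equiv.swap s k') id,
    ?_, ?_, ?_⟩
  · rw [Matrix.det_permute, ← Matrix.cramer_transpose_apply, Matrix.transpose_one,
      Matrix.cramer_one]
    refine mul_ne_zero ?_ ?_
    · rcases Int.units_eq_one_or (Equiv.Perm.sign (Equiv.swap s k')) with h | h <;> rw [h] <;> simp
    · change ν s ≠ 0
      simp only [hν]
      rwa [if_pos hs]
  · intro p q hpq
    rw [hrow]
    by_cases hp : p = k'
    · have hq : (κ : ℕ) ≤ q := by
        rcases hpq with h | h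
        · rw [hp] at h; omega
        · exact h
      rw [if_pos hp, hν]
      simp only
      rw [if_neg (show ¬ q < κ from not_lt.mpr hq), if_neg (by rw [Fin.ext_iff, hp]; omega)]
    · rw [if_neg hp]
      by_cases hps : p = s
      · have hq : (κ : ℕ) ≤ q := by
          rcases hpq with h | h
          · rw [hps] at h; omega
          · exact h
        rw [if_pos hps, if_neg (by rw [Fin.ext_iff]; omega),
          if_neg (by rw [Fin.ext_iff, hps]; omega)]
      · rw [if_neg hps]
  · intro p hp
    rw [hrow, if_pos rfl]
    exact if_pos hp

theorem sum_char_colSum {ψ : AddChar F ℂ} (hψ : ψ ≠ 1) (κ : Fin m)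
    (A : Matrix (Fin m) (Fin m) F) [Decidable (∀ p, p < κ → A p κ = 0)] :
    ∑ χ : Fin m → F, ψ (-(colSum κ χ A)) =
      if ∀ p, p < κ → A p κ = 0 then (Fintype.card (Fin m → F) : ℂ) else 0 := by
  split_ifs with h
  · have e : ∀ χ : Fin m → F, ψ (-(colSum κ χ A)) = 1 := by
      intro χ
      rw [colSum, Finset.sum_eq_zero, neg_zero, AddChar.map_zero_eq_one]
      intro p _
      split_ifs with hp
      · rw [h p hp, mul_zero]
      · rfl
    simp only [e, Finset.sum_const, Finset.card_univ, nsmul_eq_mul, mul_one]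
  · push Not at h
    obtain ⟨p, hp, hA⟩ := h
    obtain ⟨a, ha⟩ := (AddChar.ne_one_iff).mp hψ
    have hshift : ∀ χ : Fin m → F, colSum κ (χ + Pi.single p (-a / A p κ)) A =
        colSum κ χ A - a := by
      intro χ
      have e : ∀ r : Fin m, (if r < κ then
          (χ + Pi.single p (-a / A p κ) : Fin m → F) r * A r κ else 0) =
          (if r < κ then χ r * A r κ else 0) + if r = p then -a else 0 := by
        intro r
        by_cases hr : r = p
        · subst hr
          rw [if_pos hp, if_pos hp, if_pos rfl, Pi.add_apply, Pi.single_eq_same]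
          field_simp
        · rw [if_neg hr, Pi.add_apply, Pi.single_eq_of_ne hr, add_zero, add_zero]
      unfold colSum
      simp only [e, Finset.sum_add_distrib, Finset.sum_ite_eq', Finset.mem_univ, if_true]
      ring
    have hsum : ∑ χ : Fin m → F, ψ (-(colSum κ χ A)) =
        ψ a * ∑ χ : Fin m → F, ψ (-(colSum κ χ A)) := by
      conv_lhs => rw [← Equiv.sum_comp (Equiv.addRight (Pi.single p (-a / A p κ)))]
      rw [Finset.mul_sum]
      refine Finset.sum_congr rfl fun χ _ => ?_
      rw [Equiv.coe_addRight, hshift, neg_sub, sub_eq_add_neg, AddChar.map_add_eq_mul]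
    by_contra hne
    exact ha (mul_right_cancel₀ hne (by rw [one_mul]; exact hsum.symm))

end Derivatives

section DerivativeVanishing

open Classical in
/-- The coefficient function `1_{TopId k}(a h) ψ(-s(a h))`. -/
def topCoef {m : ℕ} {H : Type*} (ψ : AddChar F ℂ) (a : H → Matrix (Fin m) (Fin m) F) (k : ℕ)
    (s : Matrix (Fin m) (Fin m) F → F) (h : H) : ℂ :=
  if TopId k (a h) then ψ (-(s (a h))) else 0

/-- The operator `Σ_h f(h) π(h)`. -/
def weightedSum {H V : Type*} [Group H] [Fintype H] [AddCommGroup V] [Module ℂ V]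
    (π : Representation ℂ H V) (f : H → ℂ) : V →ₗ[ℂ] V := ∑ h, f h • π h

variable {m : ℕ} {H V : Type*} [Group H] [Fintype H] [AddCommGroup V] [Module ℂ V]
  {π : Representation ℂ H V} {a : H →* GL (Fin m) F} {ψ : AddChar F ℂ}

theorem weightedSum_apply (f : H → ℂ) (v : V) : weightedSum π f v = ∑ h, f h • π h v := by
  rw [weightedSum, LinearMap.sum_apply]
  rfl

theorem weightedSum_left {f : H → ℂ} {n : H} (hf : ∀ h, f (n * h) = f h) (v : V) :
    π n (weightedSum π f v) = weightedSum π f v := by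
  rw [weightedSum_apply, map_sum]
  conv_rhs => rw [← Equiv.sum_comp (Equiv.mulLeft n)]
  refine Finset.sum_congr rfl fun h _ => ?_
  rw [Equiv.coe_mulLeft, hf, map_smul, map_mul]
  rfl

theorem weightedSum_conj {f f' : H → ℂ} {n : H} (hf : ∀ h, f (n * h * n⁻¹) = f' h) (v : V) :
    weightedSum π f' v = π n⁻¹ (weightedSum π f (π n v)) := by
  rw [weightedSum_apply, weightedSum_apply, map_sum]
  conv_rhs => rw [← Equiv.sum_comp (MulAut.conj n).toEquiv]
  refine Finset.sum_congr rfl fun h _ => ?_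
  change _ = π n⁻¹ (f (n * h * n⁻¹) • π (n * h * n⁻¹) (π n v))
  rw [hf, map_smul, ← Module.End.mul_apply, ← Module.End.mul_apply, ← map_mul, ← map_mul]
  congr 3
  group

theorem topCoef_conj {κ k' : Fin m} (hk : (k' : ℕ) + 1 = κ) {n : H}
    (hn : IsTopBlock κ (a n : Matrix (Fin m) (Fin m) F)) {χ : Fin m → F}
    (hχ : ∀ p, p < κ → (a n : Matrix (Fin m) (Fin m) F) k' p = χ p) (h : H) :
    topCoef ψ (fun h => (a h : Matrix (Fin m) (Fin m) F)) κ (supSum k') (n * h * n⁻¹) =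
      topCoef ψ (fun h => (a h : Matrix (Fin m) (Fin m) F)) κ
        (fun A => colSum κ χ A + supSum κ A) h := by
  have h1 : (a n : Matrix (Fin m) (Fin m) F) * (a n⁻¹ : GL (Fin m) F) = 1 := by
    rw [map_inv]; exact Units.mul_inv _
  have h2 : ((a n⁻¹ : GL (Fin m) F) : Matrix (Fin m) (Fin m) F) * (a n : GL (Fin m) F) = 1 := by
    rw [map_inv]; exact Units.inv_mul _
  have hn' := hn.of_mul_eq_one h1 h2
  have e : (a (n * h * n⁻¹) : Matrix (Fin m) (Fin m) F) =
      (a n : Matrix (Fin m) (Fin m) F) * (a h : GL (Fin m) F) * (a n⁻¹ : GL (Fin m) F) := by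
    rw [map_mul, map_mul]; rfl
  have hiff : TopId κ (a (n * h * n⁻¹) : Matrix (Fin m) (Fin m) F) ↔
      TopId κ (a h : Matrix (Fin m) (Fin m) F) := by
    rw [e]
    refine ⟨fun hX => ?_, fun hX => hn.topId_conj hn' h1 hX⟩
    have := hn'.topId_conj hn h2 hX
    rwa [← Matrix.mul_assoc, ← Matrix.mul_assoc, h2, Matrix.one_mul, Matrix.mul_assoc, h2,
      Matrix.mul_one] at this
  unfold topCoef
  by_cases hX : TopId κ (a h : Matrix (Fin m) (Fin m) F)
  · rw [if_pos hX, if_pos (hiff.mpr hX)]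
    beta_reduce
    rw [e, hn.supSum_conj hk hn']
    congr 3
    refine Finset.sum_congr rfl fun p _ => ?_
    split_ifs with hp
    · rw [hχ p hp]
    · rfl
  · rw [if_neg hX, if_neg (mt hiff.mp hX)]

/-- The matrices `[[1, *], [0, 1]]` with blocks of sizes `k` and `m - k`. -/
def IsRadical (k : ℕ) (A : Matrix (Fin m) (Fin m) F) : Prop :=
  ∀ p q : Fin m, (k ≤ (p : ℕ) ∨ (q : ℕ) < k) → A p q = if p = q then 1 else 0

theorem IsRadical.mul_apply {k : ℕ} {A : Matrix (Fin m) (Fin m) F} (hA : IsRadical k A)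
    (B : Matrix (Fin m) (Fin m) F) {p q : Fin m} (hp : k ≤ (p : ℕ)) : (A * B) p q = B p q := by
  rw [Matrix.mul_apply, Finset.sum_eq_single p, hA p p (Or.inl hp), if_pos rfl, one_mul]
  · intro r _ hr
    rw [hA p r (Or.inl hp), if_neg hr.symm, zero_mul]
  · exact fun h => absurd (Finset.mem_univ p) h

theorem IsRadical.mul_apply' {k : ℕ} {A : Matrix (Fin m) (Fin m) F} (hA : IsRadical k A)
    {B : Matrix (Fin m) (Fin m) F} {q : Fin m} (hB : ∀ r : Fin m, k ≤ (r : ℕ) → B r q = 0)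
    (p : Fin m) : (A * B) p q = B p q := by
  have e : A * B = B + (A - 1) * B := by rw [Matrix.sub_mul, Matrix.one_mul]; abel
  rw [e, Matrix.add_apply, add_eq_left, Matrix.mul_apply]
  refine Finset.sum_eq_zero fun r _ => ?_
  by_cases hr : (r : ℕ) < k
  · rw [Matrix.sub_apply, hA p r (Or.inr hr), Matrix.one_apply, sub_self, zero_mul]
  · rw [hB r (not_lt.mp hr), mul_zero]

theorem IsRadical.topId_mul_iff {k : ℕ} {A : Matrix (Fin m) (Fin m) F} (hA : IsRadical k A)
    (B : Matrix (Fin m) (Fin m) F) : TopId k (A * B) ↔ TopId k B := by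
  have key : ∀ p q : Fin m, ((q : ℕ) < k ∨ q ≤ p) →
      (TopId k (A * B) ∨ TopId k B) → (A * B) p q = B p q := by
    intro p q hpq h
    by_cases hp : k ≤ (p : ℕ)
    · exact hA.mul_apply B hp
    · have hq : (q : ℕ) < k := by omega
      refine hA.mul_apply' (fun r hr => ?_) p
      have hne : r ≠ q := fun e => by rw [e] at hr; omega
      rcases h with h | h
      · rw [← hA.mul_apply B hr, h r q (Or.inl hq), if_neg hne]
      · rw [h r q (Or.inl hq), if_neg hne]
  exact ⟨fun h p q hpq => (key p q hpq (Or.inl h)).symm.trans (h p q hpq),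
    fun h p q hpq => (key p q hpq (Or.inr h)).trans (h p q hpq)⟩

theorem topCoef_mul_left {κ : Fin m} {n : H}
    (hn : IsRadical κ (a n : Matrix (Fin m) (Fin m) F)) {χ : Fin m → F}
    (hχ : ∀ p, p < κ → χ p = 0) (h : H) :
    topCoef ψ (fun h => (a h : Matrix (Fin m) (Fin m) F)) κ
        (fun A => colSum κ χ A + supSum κ A) (n * h) =
      topCoef ψ (fun h => (a h : Matrix (Fin m) (Fin m) F)) κ
        (fun A => colSum κ χ A + supSum κ A) h := by
  have e : (a (n * h) : Matrix (Fin m) (Fin m) F) =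
      (a n : Matrix (Fin m) (Fin m) F) * (a h : GL (Fin m) F) := by
    rw [map_mul]; rfl
  have hz : ∀ A : Matrix (Fin m) (Fin m) F, colSum κ χ A = 0 := fun A =>
    Finset.sum_eq_zero fun p _ => by
      split_ifs with hp
      · rw [hχ p hp, zero_mul]
      · rfl
  have hs : supSum κ (a (n * h) : Matrix (Fin m) (Fin m) F) =
      supSum κ (a h : Matrix (Fin m) (Fin m) F) := by
    rw [e]
    exact supSum_congr fun p q hp _ => hn.mul_apply _ hp
  have hiff : TopId κ (a (n * h) : Matrix (Fin m) (Fin m) F) ↔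
      TopId κ (a h : Matrix (Fin m) (Fin m) F) := by
    rw [e]
    exact hn.topId_mul_iff _
  unfold topCoef
  by_cases hX : TopId κ (a h : Matrix (Fin m) (Fin m) F)
  · rw [if_pos hX, if_pos (hiff.mpr hX)]
    beta_reduce
    rw [hz, hz, zero_add, zero_add, hs]
  · rw [if_neg hX, if_neg (mt hiff.mp hX)]

theorem sum_topCoef (hψ : ψ ≠ 1) (κ : Fin m) (h : H) :
    ∑ χ : Fin m → F, topCoef ψ (fun h => (a h : Matrix (Fin m) (Fin m) F)) κ
        (fun A => colSum κ χ A + supSum κ A) h = (Fintype.card (Fin m → F) : ℂ) *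
      topCoef ψ (fun h => (a h : Matrix (Fin m) (Fin m) F)) (κ + 1) (supSum κ) h := by
  classical
  unfold topCoef
  by_cases hX : TopId κ (a h : Matrix (Fin m) (Fin m) F)
  · simp only [if_pos hX, neg_add, AddChar.map_add_eq_mul, ← Finset.sum_mul]
    rw [sum_char_colSum hψ]
    by_cases hc : ∀ p, p < κ → (a h : Matrix (Fin m) (Fin m) F) p κ = 0
    · rw [if_pos hc, if_pos (topId_succ_iff.mpr ⟨hX, hc⟩)]
    · rw [if_neg hc, if_neg (fun h => hc (topId_succ_iff.mp h).2), zero_mul, mul_zero]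
  · simp only [if_neg hX, Finset.sum_const_zero]
    rw [if_neg (fun h => hX h.mono), mul_zero]

/-- If the leading columns can be conjugated freely and the unipotent radicals act without
invariants, then a stable subspace containing the Whittaker sums contains all sums over the
kernel. -/
theorem weightedSum_ker_mem (hψ : ψ ≠ 1) (hm : 1 ≤ m)
    (hsurj : ∀ A : Matrix (Fin m) (Fin m) F, A.det ≠ 0 →
      (∀ i : Fin m, (i : ℕ) + 1 = m → ∀ j, A i j = if i = j then 1 else 0) →
      ∃ h, (a h : Matrix (Fin m) (Fin m) F) = A)
    (hcusp : ∀ κ : Fin m, 1 ≤ (κ : ℕ) → ∃ S : Finset H, S.Nonempty ∧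
      (∀ n ∈ S, IsRadical κ (a n : Matrix (Fin m) (Fin m) F)) ∧ ∀ v, ∑ n ∈ S, π n v = 0)
    {Z : Submodule ℂ V} (hZ : ∀ h, ∀ v ∈ Z, π h v ∈ Z)
    (h1 : ∀ v, weightedSum π
      (topCoef ψ (fun h => (a h : Matrix (Fin m) (Fin m) F)) 1 (supSum 0)) v ∈ Z) (v : V) :
    weightedSum π (topCoef ψ (fun h => (a h : Matrix (Fin m) (Fin m) F)) m (supSum (m - 1))) v
      ∈ Z := by
  have step : ∀ κ : ℕ, κ < m → ∀ v, weightedSum π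
      (topCoef ψ (fun h => (a h : Matrix (Fin m) (Fin m) F)) (κ + 1) (supSum κ)) v ∈ Z := by
    intro κ
    induction κ with
    | zero => exact fun _ => h1
    | succ k ih =>
      intro hκ v
      have hk := ih (by omega)
      obtain ⟨κ, hκe⟩ : ∃ κ : Fin m, (κ : ℕ) = k + 1 := ⟨⟨k + 1, hκ⟩, rfl⟩
      obtain ⟨k', hk'⟩ : ∃ k' : Fin m, (k' : ℕ) = k := ⟨⟨k, by omega⟩, rfl⟩
      have hkk : (k' : ℕ) + 1 = κ := by omega
      rw [← hκe]
      rw [← hκe, ← hk'] at hk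
      have hχ : ∀ χ : Fin m → F, weightedSum π (topCoef ψ
          (fun h => (a h : Matrix (Fin m) (Fin m) F)) κ
          (fun A => colSum κ χ A + supSum κ A)) v ∈ Z := by
        intro χ
        by_cases h : ∃ p, p < κ ∧ χ p ≠ 0
        · obtain ⟨A, hA, hAb, hAr⟩ := exists_isTopBlock hkk h
          obtain ⟨n, rfl⟩ := hsurj A hA (fun i hi j => hAb i j (Or.inl (by
            have := κ.2; omega)))
          rw [weightedSum_conj (topCoef_conj hkk hAb hAr)]
          exact hZ _ _ (hk _)
        · push Not at h
          obtain ⟨S, hS, hSr, hS0⟩ := hcusp κ (by omega)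
          have hfix : ∀ n ∈ S, π n (weightedSum π (topCoef ψ
              (fun h => (a h : Matrix (Fin m) (Fin m) F)) κ
              (fun A => colSum κ χ A + supSum κ A)) v) = weightedSum π (topCoef ψ
              (fun h => (a h : Matrix (Fin m) (Fin m) F)) κ
              (fun A => colSum κ χ A + supSum κ A)) v :=
            fun n hn => weightedSum_left (topCoef_mul_left (hSr n hn) h) v
          have h0 := hS0 (weightedSum π (topCoef ψ
              (fun h => (a h : Matrix (Fin m) (Fin m) F)) κ
              (fun A => colSum κ χ A + supSum κ A)) v)
          rw [Finset.sum_congr rfl hfix, Finset.sum_const, ← Nat.cast_smul_eq_nsmul ℂ,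
            smul_eq_zero] at h0
          rw [h0.resolve_left (Nat.cast_ne_zero.mpr (Finset.card_ne_zero.mpr hS))]
          exact Z.zero_mem
      have hcard : (Fintype.card (Fin m → F) : ℂ) ≠ 0 := Nat.cast_ne_zero.mpr Fintype.card_ne_zero
      have e : weightedSum π (topCoef ψ (fun h => (a h : Matrix (Fin m) (Fin m) F)) (κ + 1)
          (supSum κ)) v = (Fintype.card (Fin m → F) : ℂ)⁻¹ • ∑ χ : Fin m → F, weightedSum π (topCoef ψ
          (fun h => (a h : Matrix (Fin m) (Fin m) F)) κ
          (fun A => colSum κ χ A + supSum κ A)) v := by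
        rw [eq_inv_smul_iff₀ hcard]
        simp only [weightedSum_apply]
        rw [Finset.sum_comm, Finset.smul_sum]
        refine Finset.sum_congr rfl fun h _ => ?_
        rw [← Finset.sum_smul, sum_topCoef hψ, smul_smul]
      rw [e]
      exact Z.smul_mem _ (Z.sum_mem fun χ _ => hχ χ)
  have := step (m - 1) (by omega) v
  rwa [Nat.sub_add_cancel hm] at this

end DerivativeVanishing

section WhittakerVectors

variable {m : ℕ}

theorem inverse_row_eq {A B : Matrix (Fin m) (Fin m) F} (hAB : A * B = 1) {r : ℕ}
    (hA : ∀ p q : Fin m, r < (p : ℕ) → q ≤ p → A p q = if p = q then 1 else 0)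
    {p q : Fin m} (hp : r < (p : ℕ)) (hq : q ≤ p) : B p q = if p = q then 1 else 0 := by
  have key : ∀ d : ℕ, ∀ p q : Fin m, m - (p : ℕ) = d → r < (p : ℕ) → q ≤ p →
      B p q = if p = q then 1 else 0 := by
    intro d
    induction d using Nat.strong_induction_on with
    | _ d ih =>
      intro p q hd hp hq
      have h := congrFun (congrFun hAB p) q
      rw [Matrix.mul_apply, Finset.sum_eq_single p, hA p p hp le_rfl, if_pos rfl, one_mul,
        Matrix.one_apply] at h
      · exact h
      · intro t _ ht
        rcases lt_or_gt_of_ne ht with h' | h'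
        · rw [hA p t hp h'.le, if_neg ht.symm, zero_mul]
        · have hqt : q < t := hq.trans_lt h'
          have := p.2
          have := t.2
          rw [ih (m - (t : ℕ)) (by omega) t q rfl (by omega) hqt.le, if_neg hqt.ne', mul_zero]
      · exact fun h => absurd (Finset.mem_univ p) h
  exact key _ p q rfl hp hq

theorem mul_transvection_mul_apply {A B : Matrix (Fin m) (Fin m) F} (hAB : A * B = 1)
    (j k : Fin m) (s : F) (p q : Fin m) :
    (A * Matrix.transvection j k s * B) p q = (if p = q then 1 else 0) + s * (A p j * B k q) := by
  rw [Matrix.transvection, Matrix.mul_add, Matrix.mul_one, Matrix.add_mul, hAB, Matrix.add_apply,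
    Matrix.one_apply, Matrix.mul_assoc, Matrix.mul_apply, Finset.sum_eq_single j]
  · rw [Matrix.single_mul_apply_same]
    ring
  · intro t _ ht
    rw [Matrix.single_mul_apply_of_ne (h := ht), mul_zero]
  · exact fun h => absurd (Finset.mem_univ j) h

variable {H V : Type*} [Group H] [AddCommGroup V] [Module ℂ V]
  {π : Representation ℂ H V} {a : H →* GL (Fin m) F} {ψ : AddChar F ℂ}

/-- A linear form transforms under the elements with unipotent image by the character `ψ`. -/
def IsUnipEquivariant (π : Representation ℂ H V) (a : H →* GL (Fin m) F) (ψ : AddChar F ℂ)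
    (Γ : V →ₗ[ℂ] ℂ) : Prop :=
  ∀ n, upUnip F (a n : Matrix (Fin m) (Fin m) F) → ∀ v,
    Γ (π n v) = ψ (glUSum F m (a n : Matrix (Fin m) (Fin m) F)) * Γ v

/-- A vector transforms under the elements with unipotent image by the character `ψ`. -/
def IsUnipEigenvector (π : Representation ℂ H V) (a : H →* GL (Fin m) F) (ψ : AddChar F ℂ)
    (w : V) : Prop :=
  ∀ n, upUnip F (a n : Matrix (Fin m) (Fin m) F) →
    π n w = ψ (glUSum F m (a n : Matrix (Fin m) (Fin m) F)) • w

/-- Whittaker functions of Whittaker vectors are supported on unipotent images. -/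
theorem upUnip_of_whittaker_ne_zero (hψ : ψ ≠ 1)
    (hsurj : ∀ A : Matrix (Fin m) (Fin m) F, upUnip F A →
      ∃ h, (a h : Matrix (Fin m) (Fin m) F) = A)
    (hlast : ∀ h, ∀ i : Fin m, (i : ℕ) + 1 = m → ∀ j,
      (a h : Matrix (Fin m) (Fin m) F) i j = if i = j then 1 else 0)
    {Γ : V →ₗ[ℂ] ℂ} (hΓ : IsUnipEquivariant π a ψ Γ) {w : V} (hw : IsUnipEigenvector π a ψ w)
    {h : H} (hne : Γ (π h w) ≠ 0) : upUnip F (a h : Matrix (Fin m) (Fin m) F) := by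
  generalize hA : (a h : Matrix (Fin m) (Fin m) F) = A
  generalize hB : ((a h⁻¹ : GL (Fin m) F) : Matrix (Fin m) (Fin m) F) = B
  have hAB : A * B = 1 := by
    rw [← hA, ← hB, map_inv]; exact Units.mul_inv _
  have key : ∀ d : ℕ, ∀ p q : Fin m, m - 1 - (p : ℕ) = d → q ≤ p →
      A p q = if p = q then 1 else 0 := by
    intro d
    induction d using Nat.strong_induction_on with
    | _ d ih =>
      intro r j hd hj
      have hr2 := r.2
      by_cases hr : (r : ℕ) + 1 = m
      · rw [← hA]
        exact hlast h r hr j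
      obtain ⟨k, hk⟩ : ∃ k : Fin m, (k : ℕ) = r + 1 := ⟨⟨r + 1, by omega⟩, rfl⟩
      have hrows : ∀ p q : Fin m, (r : ℕ) < (p : ℕ) → q ≤ p → A p q = if p = q then 1 else 0 :=
        fun p q hp hq => ih (m - 1 - (p : ℕ)) (by have := p.2; omega) p q rfl hq
      have hBk : ∀ q, q ≤ k → B k q = if k = q then 1 else 0 :=
        fun q hq => inverse_row_eq hAB hrows (by omega) hq
      have hjk : j < k := by omega
      have hAj : ∀ p : Fin m, (r : ℕ) < p → A p j = 0 := fun p hp => by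
        have hjp : j < p := by omega
        rw [hrows p j hp hjp.le, if_neg hjp.ne']
      have hBq : ∀ q : Fin m, q < k → B k q = 0 := fun q hq => by
        rw [hBk q hq.le, if_neg hq.ne']
      have hBkk : B k k = 1 := by rw [hBk k le_rfl, if_pos rfl]
      have hs : ∀ s : F, ψ (A r j * s) = ψ ((if r = j then 1 else 0) * s) := by
        intro s
        obtain ⟨y, hy⟩ := hsurj _ (upUnip_transvection hjk s)
        have hc : ((a (h * y * h⁻¹) : GL (Fin m) F) : Matrix (Fin m) (Fin m) F) =
            A * Matrix.transvection j k s * B := by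
          rw [map_mul, map_mul, Units.val_mul, Units.val_mul, hA, hy, hB]
        have hup : upUnip F (A * Matrix.transvection j k s * B) := by
          intro p q hqp
          rw [mul_transvection_mul_apply hAB, add_eq_left]
          by_cases hp : (r : ℕ) < p
          · rw [hAj p hp, zero_mul, mul_zero]
          · rw [hBq q (show (q : ℕ) < k by omega), mul_zero, mul_zero]
        have hsum : glUSum F m (A * Matrix.transvection j k s * B) = A r j * s := by
          unfold glUSum
          rw [Finset.sum_eq_single r, Finset.sum_eq_single k, if_pos hk,
            mul_transvection_mul_apply hAB, hBkk, if_neg (show ¬ r = k from fun e => by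
              rw [e] at hk; omega)]
          · ring
          · intro q _ hq
            exact if_neg fun e => hq (Fin.ext (e.trans hk.symm))
          · exact fun h => absurd (Finset.mem_univ k) h
          · intro p _ hp
            refine Finset.sum_eq_zero fun q _ => ?_
            split_ifs with hq
            · have hpr : (p : ℕ) ≠ r := fun e => hp (Fin.ext e)
              rw [mul_transvection_mul_apply hAB, if_neg (show ¬ p = q from fun e => by
                rw [e] at hq; omega)]
              by_cases hp' : (r : ℕ) < p
              · rw [hAj p hp', zero_mul, mul_zero, add_zero]
              · rw [hBq q (show (q : ℕ) < k by omega), mul_zero, mul_zero, add_zero]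
            · rfl
          · exact fun h => absurd (Finset.mem_univ r) h
        have e1 := hΓ (h * y * h⁻¹) (by rw [hc]; exact hup) (π h w)
        rw [hc, hsum, ← Module.End.mul_apply, ← map_mul, inv_mul_cancel_right, map_mul,
          Module.End.mul_apply, hw y (by rw [hy]; exact upUnip_transvection hjk s), hy,
          glUSum_transvection hjk, map_smul, map_smul, smul_eq_mul] at e1
        have e2 := mul_right_cancel₀ hne e1
        rw [← e2]
        congr 1
        by_cases hrj : r = j
        · rw [if_pos (by rw [← hrj]; exact hk), if_pos hrj, one_mul]
        · rw [if_neg (fun e => hrj (Fin.ext (by omega))), if_neg hrj, zero_mul]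
      exact eq_of_forall_char_mul_eq hψ hs
  exact fun p q hqp => key _ p q rfl hqp

variable [Fintype H]

open Classical in
theorem sum_whittaker_pairing {W : Type*} [AddCommGroup W] [Module ℂ W]
    {τ : Representation ℂ H W} (hψ : ψ ≠ 1)
    (hsurj : ∀ A : Matrix (Fin m) (Fin m) F, upUnip F A →
      ∃ h, (a h : Matrix (Fin m) (Fin m) F) = A)
    (hlast : ∀ h, ∀ i : Fin m, (i : ℕ) + 1 = m → ∀ j,
      (a h : Matrix (Fin m) (Fin m) F) i j = if i = j then 1 else 0)
    {Γ : V →ₗ[ℂ] ℂ} (hΓ : IsUnipEquivariant π a ψ Γ) {w : V} (hw : IsUnipEigenvector π a ψ w)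
    {Λ : W →ₗ[ℂ] ℂ} (hΛ : IsUnipEquivariant τ a ψ⁻¹ Λ) (x : W) :
    ∑ h, Γ (π h w) * Λ (τ h x) =
      ((Finset.univ.filter fun h => upUnip F (a h : Matrix (Fin m) (Fin m) F)).card : ℂ) *
        (Γ w * Λ x) := by
  rw [← Finset.sum_filter_of_ne (p := fun h => upUnip F (a h : Matrix (Fin m) (Fin m) F)),
    Finset.sum_congr rfl (g := fun _ => Γ w * Λ x), Finset.sum_const, nsmul_eq_mul]
  · intro h hh
    rw [Finset.mem_filter] at hh
    rw [hΓ h hh.2, hΛ h hh.2, AddChar.inv_apply, AddChar.map_neg_eq_inv]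
    have := (AddChar.val_isUnit ψ (glUSum F m (a h : Matrix (Fin m) (Fin m) F))).ne_zero
    generalize ψ (glUSum F m (a h : Matrix (Fin m) (Fin m) F)) = z at *
    field_simp
  · intro h _ hne
    exact upUnip_of_whittaker_ne_zero hψ hsurj hlast hΓ hw (left_ne_zero_of_mul hne)

/-- The projection onto Whittaker vectors, up to a scalar. -/
def whitSum (π : Representation ℂ H V) (a : H →* GL (Fin m) F) (ψ : AddChar F ℂ) : V →ₗ[ℂ] V :=
  weightedSum π (topCoef ψ (fun h => (a h : Matrix (Fin m) (Fin m) F)) 1 (supSum 0))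

theorem supSum_zero (A : Matrix (Fin m) (Fin m) F) : supSum 0 A = glUSum F m A := by
  unfold supSum glUSum
  refine Finset.sum_congr rfl fun p _ => Finset.sum_congr rfl fun q _ => ?_
  by_cases h : (q : ℕ) = p + 1
  · rw [if_pos ⟨Nat.zero_le _, h⟩, if_pos h]
  · rw [if_neg (fun h' => h h'.2), if_neg h]

theorem whitCoef_mul_left {n : H} (hn : upUnip F (a n : Matrix (Fin m) (Fin m) F)) (h : H) :
    topCoef ψ (fun h => (a h : Matrix (Fin m) (Fin m) F)) 1 (supSum 0) (n * h) =
      ψ (-(glUSum F m (a n : Matrix (Fin m) (Fin m) F))) *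
        topCoef ψ (fun h => (a h : Matrix (Fin m) (Fin m) F)) 1 (supSum 0) h := by
  have e : (a (n * h) : Matrix (Fin m) (Fin m) F) =
      (a n : Matrix (Fin m) (Fin m) F) * (a h : GL (Fin m) F) := by
    rw [map_mul]; rfl
  have hiff : upUnip F (a (n * h) : Matrix (Fin m) (Fin m) F) ↔
      upUnip F (a h : Matrix (Fin m) (Fin m) F) := by
    have := (glUnip (F := F) m).mul_mem_cancel_left (x := a n) (y := a h) hn
    rwa [mem_glUnip, mem_glUnip, ← map_mul] at this
  unfold topCoef
  by_cases hX : upUnip F (a h : Matrix (Fin m) (Fin m) F)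
  · rw [if_pos (topId_one_iff.mpr hX), if_pos (topId_one_iff.mpr (hiff.mpr hX))]
    beta_reduce
    rw [supSum_zero, supSum_zero, e, glUSum_mul hn hX, neg_add, AddChar.map_add_eq_mul]
  · rw [if_neg (fun h' => hX (topId_one_iff.mp h')),
      if_neg (fun h' => hX (hiff.mp (topId_one_iff.mp h'))), mul_zero]

theorem whitCoef_mul_right {n : H} (hn : upUnip F (a n : Matrix (Fin m) (Fin m) F)) (h : H) :
    topCoef ψ (fun h => (a h : Matrix (Fin m) (Fin m) F)) 1 (supSum 0) (h * n) =
      ψ (-(glUSum F m (a n : Matrix (Fin m) (Fin m) F))) *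
        topCoef ψ (fun h => (a h : Matrix (Fin m) (Fin m) F)) 1 (supSum 0) h := by
  have e : (a (h * n) : Matrix (Fin m) (Fin m) F) =
      (a h : Matrix (Fin m) (Fin m) F) * (a n : GL (Fin m) F) := by
    rw [map_mul]; rfl
  have hiff : upUnip F (a (h * n) : Matrix (Fin m) (Fin m) F) ↔
      upUnip F (a h : Matrix (Fin m) (Fin m) F) := by
    have := (glUnip (F := F) m).mul_mem_cancel_right (x := a n) (y := a h) hn
    rwa [mem_glUnip, mem_glUnip, ← map_mul] at this
  unfold topCoef
  by_cases hX : upUnip F (a h : Matrix (Fin m) (Fin m) F)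
  · rw [if_pos (topId_one_iff.mpr hX), if_pos (topId_one_iff.mpr (hiff.mpr hX))]
    beta_reduce
    rw [supSum_zero, supSum_zero, e, glUSum_mul hX hn, neg_add_rev, AddChar.map_add_eq_mul]
  · rw [if_neg (fun h' => hX (topId_one_iff.mp h')),
      if_neg (fun h' => hX (hiff.mp (topId_one_iff.mp h'))), mul_zero]

theorem char_mul_char_neg (s : F) : ψ s * ψ (-s) = 1 := by
  rw [← AddChar.map_add_eq_mul, add_neg_cancel, AddChar.map_zero_eq_one]

theorem isUnipEigenvector_whitSum (v : V) : IsUnipEigenvector π a ψ (whitSum π a ψ v) := by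
  intro n hn
  rw [whitSum, weightedSum_apply, map_sum, Finset.smul_sum]
  conv_rhs => rw [← Equiv.sum_comp (Equiv.mulLeft n)]
  refine Finset.sum_congr rfl fun h _ => ?_
  rw [Equiv.coe_mulLeft, whitCoef_mul_left hn, smul_smul, ← mul_assoc, char_mul_char_neg, one_mul,
    map_smul, map_mul]
  rfl

theorem whitSum_apply {n : H} (hn : upUnip F (a n : Matrix (Fin m) (Fin m) F)) (v : V) :
    whitSum π a ψ (π n v) =
      ψ (glUSum F m (a n : Matrix (Fin m) (Fin m) F)) • whitSum π a ψ v := by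
  rw [whitSum, weightedSum_apply, weightedSum_apply, Finset.smul_sum]
  conv_rhs => rw [← Equiv.sum_comp (Equiv.mulRight n)]
  refine Finset.sum_congr rfl fun h _ => ?_
  rw [Equiv.coe_mulRight, whitCoef_mul_right hn, smul_smul, ← mul_assoc, char_mul_char_neg,
    one_mul, map_mul]
  rfl

open Classical in
theorem whittaker_whitSum {Γ : V →ₗ[ℂ] ℂ} (hΓ : IsUnipEquivariant π a ψ Γ) (v : V) :
    Γ (whitSum π a ψ v) =
      ((Finset.univ.filter fun h => upUnip F (a h : Matrix (Fin m) (Fin m) F)).card : ℂ) * Γ v := by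
  rw [whitSum, weightedSum_apply, map_sum, ← nsmul_eq_mul, ← Finset.sum_const, Finset.sum_filter]
  refine Finset.sum_congr rfl fun h _ => ?_
  unfold topCoef
  by_cases hX : upUnip F (a h : Matrix (Fin m) (Fin m) F)
  · rw [if_pos (topId_one_iff.mpr hX), if_pos hX]
    beta_reduce
    rw [map_smul, hΓ h hX, supSum_zero, smul_eq_mul, ← mul_assoc, mul_comm (ψ _), char_mul_char_neg,
      one_mul]
  · rw [if_neg (fun h' => hX (topId_one_iff.mp h')), if_neg hX, zero_smul, map_zero]

end WhittakerVectors

section InvariantPairings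

variable {m : ℕ} {H V W : Type*} [Group H] [Fintype H] [AddCommGroup V] [Module ℂ V]
  [AddCommGroup W] [Module ℂ W] {π : Representation ℂ H V} {a : H →* GL (Fin m) F}
  {τ : Representation ℂ (GL (Fin m) F) W} {ψ : AddChar F ℂ}

theorem supSum_pred_one (hm : 1 ≤ m) : supSum (m - 1) (1 : Matrix (Fin m) (Fin m) F) = 0 := by
  unfold supSum
  refine Finset.sum_eq_zero fun p _ => Finset.sum_eq_zero fun q _ => if_neg fun h => ?_
  have := q.2
  omega

/-- An invariant pairing vanishing on Whittaker vectors vanishes. -/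
theorem pairing_eq_zero_of_whitSum (hψ : ψ ≠ 1) (hm : 1 ≤ m)
    (hsurj : ∀ A : Matrix (Fin m) (Fin m) F, A.det ≠ 0 →
      (∀ i : Fin m, (i : ℕ) + 1 = m → ∀ j, A i j = if i = j then 1 else 0) →
      ∃ h, (a h : Matrix (Fin m) (Fin m) F) = A)
    (hcusp : ∀ κ : Fin m, 1 ≤ (κ : ℕ) → ∃ S : Finset H, S.Nonempty ∧
      (∀ n ∈ S, IsRadical κ (a n : Matrix (Fin m) (Fin m) F)) ∧ ∀ v, ∑ n ∈ S, π n v = 0)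
    {b : V →ₗ[ℂ] W →ₗ[ℂ] ℂ} (hb : ∀ h v x, b (π h v) (τ (a h) x) = b v x)
    (h0 : ∀ v, b (whitSum π a ψ v) = 0) : b = 0 := by
  classical
  have hZ : ∀ h, ∀ v ∈ LinearMap.ker b, π h v ∈ LinearMap.ker b := by
    intro h v hv
    rw [LinearMap.mem_ker] at hv ⊢
    ext x
    have h1 : τ (a h) (τ (a h)⁻¹ x) = x := τ.self_inv_apply _ _
    rw [← h1, hb, hv, LinearMap.zero_apply, LinearMap.zero_apply]
  ext v x
  have hker := weightedSum_ker_mem (π := π) (a := a) hψ hm hsurj hcusp hZ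
    (fun v => LinearMap.mem_ker.mpr (h0 v)) v
  rw [LinearMap.mem_ker] at hker
  have hx := LinearMap.congr_fun hker x
  rw [weightedSum_apply, map_sum, LinearMap.sum_apply, Finset.sum_congr rfl
    (g := fun h => if a h = 1 then b v x else 0), ← Finset.sum_filter, Finset.sum_const,
    nsmul_eq_mul, LinearMap.zero_apply, mul_eq_zero] at hx
  · refine hx.resolve_left (Nat.cast_ne_zero.mpr (Finset.card_ne_zero.mpr ⟨1, ?_⟩))
    rw [Finset.mem_filter]
    exact ⟨Finset.mem_univ _, map_one a⟩
  · intro h _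
    rw [map_smul, LinearMap.smul_apply]
    unfold topCoef
    by_cases hh : a h = 1
    · have hc : (a h : Matrix (Fin m) (Fin m) F) = 1 := by rw [hh]; rfl
      rw [if_pos hh, if_pos (topId_size_iff.mpr hc)]
      beta_reduce
      rw [hc, supSum_pred_one hm, neg_zero, AddChar.map_zero_eq_one, one_smul]
      have := hb h v x
      rwa [hh, map_one] at this
    · rw [if_neg hh, if_neg, zero_smul]
      exact fun h' => hh (Units.ext (topId_size_iff.mp h'))

/-- The pairing `Σ_h Γ(π(h)v) Λ(τ(a(h))x)`. -/
def whitPairing (π : Representation ℂ H V) (a : H →* GL (Fin m) F)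
    (τ : Representation ℂ (GL (Fin m) F) W) (Γ : V →ₗ[ℂ] ℂ) (Λ : W →ₗ[ℂ] ℂ) :
    V →ₗ[ℂ] W →ₗ[ℂ] ℂ :=
  ∑ h, (LinearMap.mul ℂ ℂ).compl₁₂ (Γ ∘ₗ π h) (Λ ∘ₗ τ (a h))

theorem whitPairing_apply (Γ : V →ₗ[ℂ] ℂ) (Λ : W →ₗ[ℂ] ℂ) (v : V) (x : W) :
    whitPairing π a τ Γ Λ v x = ∑ h, Γ (π h v) * Λ (τ (a h) x) := by
  rw [whitPairing, LinearMap.sum_apply, LinearMap.sum_apply]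
  rfl

theorem whitPairing_invariant (Γ : V →ₗ[ℂ] ℂ) (Λ : W →ₗ[ℂ] ℂ) (n : H) (v : V) (x : W) :
    whitPairing π a τ Γ Λ (π n v) (τ (a n) x) = whitPairing π a τ Γ Λ v x := by
  rw [whitPairing_apply, whitPairing_apply]
  conv_rhs => rw [← Equiv.sum_comp (Equiv.mulRight n)]
  refine Finset.sum_congr rfl fun h _ => ?_
  rw [Equiv.coe_mulRight, map_mul, map_mul, map_mul]
  rfl

/-- Uniqueness of invariant pairings between a cuspidal representation and a generic one. -/
theorem invariant_pairing_eq_smul (hψ : ψ ≠ 1) (hm : 1 ≤ m)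
    (hsurj : ∀ A : Matrix (Fin m) (Fin m) F, A.det ≠ 0 →
      (∀ i : Fin m, (i : ℕ) + 1 = m → ∀ j, A i j = if i = j then 1 else 0) →
      ∃ h, (a h : Matrix (Fin m) (Fin m) F) = A)
    (hlast : ∀ h, ∀ i : Fin m, (i : ℕ) + 1 = m → ∀ j,
      (a h : Matrix (Fin m) (Fin m) F) i j = if i = j then 1 else 0)
    (hcusp : ∀ κ : Fin m, 1 ≤ (κ : ℕ) → ∃ S : Finset H, S.Nonempty ∧
      (∀ n ∈ S, IsRadical κ (a n : Matrix (Fin m) (Fin m) F)) ∧ ∀ v, ∑ n ∈ S, π n v = 0)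
    {Γ : V →ₗ[ℂ] ℂ} (hΓ0 : Γ ≠ 0) (hΓ : IsUnipEquivariant π a ψ Γ)
    (huΓ : ∀ Γ', IsUnipEquivariant π a ψ Γ' → ∃ c : ℂ, Γ' = c • Γ)
    {Λ : W →ₗ[ℂ] ℂ} (hΛ : IsUnipEquivariant (τ.comp a) a ψ⁻¹ Λ)
    (huΛ : ∀ Λ', IsUnipEquivariant (τ.comp a) a ψ⁻¹ Λ' → ∃ c : ℂ, Λ' = c • Λ)
    {b : V →ₗ[ℂ] W →ₗ[ℂ] ℂ} (hb : ∀ h v x, b (π h v) (τ (a h) x) = b v x) :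
    ∃ c : ℂ, b = c • whitPairing π a τ Γ Λ := by
  classical
  have hsurj' : ∀ A : Matrix (Fin m) (Fin m) F, upUnip F A →
      ∃ h, (a h : Matrix (Fin m) (Fin m) F) = A := by
    intro A hA
    refine hsurj A (by rw [hA.det]; exact one_ne_zero) fun i hi j => hA i j ?_
    have := j.2
    omega
  have hleft : ∀ x, ∃ c : ℂ, ∀ v, b (whitSum π a ψ v) x = c * Γ v := by
    intro x
    obtain ⟨c, hc⟩ := huΓ ((b.flip x) ∘ₗ whitSum π a ψ) (fun n hn v => by
      rw [LinearMap.comp_apply, whitSum_apply hn, map_smul]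
      rfl)
    exact ⟨c, fun v => LinearMap.congr_fun hc v⟩
  obtain ⟨v₀, hv₀⟩ : ∃ v₀, Γ v₀ ≠ 0 := by
    by_contra h
    push Not at h
    exact hΓ0 (LinearMap.ext h)
  obtain ⟨d, hd⟩ := huΛ (b (whitSum π a ψ v₀)) (fun n hn x => by
    have h1 := hb n (whitSum π a ψ v₀) x
    rw [isUnipEigenvector_whitSum v₀ n hn, map_smul, LinearMap.smul_apply, smul_eq_mul] at h1
    rw [← h1, AddChar.inv_apply, ← mul_assoc, mul_comm (ψ (-_)), char_mul_char_neg, one_mul]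
    rfl)
  have hβ : ∀ v x, b (whitSum π a ψ v) x = d * (Γ v₀)⁻¹ * (Γ v * Λ x) := by
    intro v x
    obtain ⟨c, hc⟩ := hleft x
    have h1 := LinearMap.congr_fun hd x
    rw [hc, LinearMap.smul_apply, smul_eq_mul] at h1
    rw [hc, eq_div_of_mul_eq hv₀ h1]
    field_simp
  set N : ℂ := ((Finset.univ.filter fun h =>
    upUnip F (a h : Matrix (Fin m) (Fin m) F)).card : ℂ) with hN
  have hN0 : N ≠ 0 := by
    rw [hN]
    refine Nat.cast_ne_zero.mpr (Finset.card_ne_zero.mpr ⟨1, ?_⟩)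
    rw [Finset.mem_filter, map_one]
    exact ⟨Finset.mem_univ _, upUnip_one m⟩
  have hP : ∀ v x, whitPairing π a τ Γ Λ (whitSum π a ψ v) x = N * (N * Γ v * Λ x) := by
    intro v x
    rw [whitPairing_apply, ← whittaker_whitSum hΓ]
    exact sum_whittaker_pairing (τ := τ.comp a) hψ hsurj' hlast hΓ
      (isUnipEigenvector_whitSum v) hΛ x
  refine ⟨d * (Γ v₀)⁻¹ / (N * N), sub_eq_zero.mp ?_⟩
  refine pairing_eq_zero_of_whitSum hψ hm hsurj hcusp (π := π) (τ := τ) (a := a)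
    (fun h v x => ?_) fun v => ?_
  · rw [LinearMap.sub_apply, LinearMap.sub_apply, LinearMap.sub_apply, LinearMap.sub_apply, hb,
      LinearMap.smul_apply, LinearMap.smul_apply, LinearMap.smul_apply, LinearMap.smul_apply,
      whitPairing_invariant]
  · ext x
    rw [LinearMap.sub_apply, LinearMap.sub_apply, hβ, LinearMap.smul_apply, LinearMap.smul_apply,
      hP, smul_eq_mul, LinearMap.zero_apply]
    field_simp
    ring

end InvariantPairings

section MirabolicPairing

variable {l : ℕ} {ρ : F}

theorem blkCut_singleton (κ i : ℕ) :
    blkCut l {κ} i = (if κ ≤ i then 1 else 0) + (if 2 * l - κ ≤ i then 1 else 0) := by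
  unfold blkCut
  rw [Finset.filter_singleton, Finset.filter_singleton]
  split_ifs <;> rfl

theorem cuspUnip_subset_USet (C : Finset ℕ) {u : SO2l F l ρ} (hu : u ∈ cuspUnip F l ρ C) :
    u ∈ USet F l ρ := by
  intro i j hij
  refine hu i j (add_le_add (Finset.card_le_card ?_) (Finset.card_le_card ?_)) <;>
  · intro c hc
    rw [Finset.mem_filter] at hc ⊢
    exact ⟨hc.1, hc.2.trans hij⟩

variable {h2 : (2 : F) ≠ 0} {hρ0 : ρ ≠ 0} {hl : 1 ≤ l}

theorem isRadical_mirHom {h : mirSub h2 hρ0 hl} {κ : ℕ} (hκ : 1 ≤ κ) (hκl : κ < l)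
    (hh : h.1 ∈ cuspUnip F l ρ {κ}) :
    IsRadical κ (mirHom h2 hρ0 hl h : Matrix (Fin l) (Fin l) F) := by
  have hval : ∀ i : Fin l, ((flagIdx l i : Fin (2 * l)) : ℕ) = if (i : ℕ) + 1 < l then (i : ℕ)
      else l := by
    intro i
    split_ifs with hi
    · exact val_flagIdx_of_lt hi
    · exact val_flagIdx_of_not_lt hi
  intro p q hpq
  have e := mirHom_entry h p q
  rw [hh _ _ (by
    rw [blkCut_singleton, blkCut_singleton, hval, hval]
    have := p.2
    have := q.2
    split_ifs <;> omega)] at e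
  by_cases hij : p = q
  · rw [if_pos (congrArg _ hij), hij] at e
    rw [if_pos hij, hij]
    exact (mul_right_cancel₀ (flagCoef_ne_zero h2 q) e).symm
  · rw [if_neg (flagIdx_injective.ne hij), zero_mul] at e
    rw [if_neg hij]
    exact (mul_eq_zero.mp e.symm).resolve_right (flagCoef_ne_zero h2 p)

theorem exists_radical_sum_eq_zero {V : Type*} [AddCommGroup V] [Module ℂ V]
    {π : Representation ℂ (SO2l F l ρ) V} (hπ : IsCuspidal F l ρ π) (κ : Fin l)
    (hκ : 1 ≤ (κ : ℕ)) : ∃ S : Finset (mirSub h2 hρ0 hl), S.Nonempty ∧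
      (∀ n ∈ S, IsRadical κ (mirHom h2 hρ0 hl n : Matrix (Fin l) (Fin l) F)) ∧
      ∀ v, ∑ n ∈ S, π n.1 v = 0 := by
  classical
  have : Fintype (mirSub h2 hρ0 hl) := Fintype.ofFinite _
  refine ⟨Finset.univ.filter fun h => h.1 ∈ cuspUnip F l ρ {(κ : ℕ)}, ⟨1, ?_⟩, ?_, ?_⟩
  · rw [Finset.mem_filter]
    refine ⟨Finset.mem_univ _, fun i j _ => ?_⟩
    change mat F (1 : SO2l F l ρ) i j = _
    rw [mat_one, Matrix.one_apply]
  · intro n hn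
    rw [Finset.mem_filter] at hn
    exact isRadical_mirHom hκ κ.2 hn.2
  · intro v
    have hκl := κ.2
    have h0 := hπ {(κ : ℕ)} (Finset.singleton_nonempty _) (fun c hc => by
      rw [Finset.mem_singleton] at hc; omega) v
    rw [show cuspUnip F l ρ {(κ : ℕ)} = ((((Finset.univ.filter fun h : mirSub h2 hρ0 hl =>
        h.1 ∈ cuspUnip F l ρ {(κ : ℕ)}).map (Function.Embedding.subtype _) :
          Finset (SO2l F l ρ)) : Set (SO2l F l ρ))) from ?_, finsum_mem_coe_finset,
      Finset.sum_map] at h0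
    · exact h0
    · ext u
      rw [Finset.coe_map, Set.mem_image]
      refine ⟨fun hu => ⟨⟨u, mem_mirSub_of_mem_USet (cuspUnip_subset_USet _ hu)⟩, ?_, rfl⟩, ?_⟩
      · rw [Finset.mem_coe, Finset.mem_filter]
        exact ⟨Finset.mem_univ _, hu⟩
      · rintro ⟨y, hy, rfl⟩
        rw [Finset.mem_coe, Finset.mem_filter] at hy
        exact hy.2

/-- Pairings between a cuspidal generic representation and a generic representation of the
general linear group that are invariant under the mirabolic subgroup are unique. -/
theorem mirabolic_pairing_eq_smul [Fintype (mirSub h2 hρ0 hl)] {ψ : AddChar F ℂ} (hψ : ψ ≠ 1)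
    (hl2 : 2 ≤ l) (hρ : ∀ x : F, x ^ 2 ≠ ρ) {V W : Type*} [AddCommGroup V] [Module ℂ V]
    [AddCommGroup W] [Module ℂ W]
    {π : Representation ℂ (SO2l F l ρ) V} (hπ : IsIrrep π) (hcusp : IsCuspidal F l ρ π)
    {Γ : V →ₗ[ℂ] ℂ} (hΓ : IsWhittaker F l ρ ψ π Γ)
    {τ : Representation ℂ (GL (Fin l) F) W} (hτ : IsIrrep τ) {Λ : W →ₗ[ℂ] ℂ}
    (hΛ : IsGenericGLinv F l ψ τ Λ) {b : V →ₗ[ℂ] W →ₗ[ℂ] ℂ}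
    (hb : ∀ (h : mirSub h2 hρ0 hl) v x, b (π h.1 v) (τ (mirHom h2 hρ0 hl h) x) = b v x) :
    ∃ c : ℂ, b = c • whitPairing (π.comp (mirSub h2 hρ0 hl).subtype) (mirHom h2 hρ0 hl) τ Γ Λ := by
  have hψs : ∀ h : mirSub h2 hρ0 hl, psiU F l ψ (mat F h.1) =
      ψ (glUSum F l (mirHom h2 hρ0 hl h : Matrix (Fin l) (Fin l) F)) := fun h => by
    rw [glUSum_mirHom]; rfl
  have hsurj : ∀ A : Matrix (Fin l) (Fin l) F, upUnip F A →
      ∃ h : mirSub h2 hρ0 hl, (mirHom h2 hρ0 hl h : Matrix (Fin l) (Fin l) F) = A := by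
    intro A hA
    refine exists_mirHom_of_last_row h2 hρ0 hl (by rw [hA.det]; exact one_ne_zero)
      fun i hi j => hA i j ?_
    have := j.2
    omega
  refine invariant_pairing_eq_smul (ψ := ψ) hψ hl
    (fun A hA hr => exists_mirHom_of_last_row h2 hρ0 hl hA hr) (fun h i hi j => mirHom_last h hi j)
    (fun κ hκ => exists_radical_sum_eq_zero hcusp κ hκ) hΓ.1 ?_ ?_ ?_ ?_ hb
  · intro n hn v
    rw [← hψs]
    exact hΓ.2 _ (mem_USet_of_upUnip hn) v
  · intro Γ' hΓ'
    refine so_whittaker_unique h2 hρ hl2 hψ hπ hΓ fun u hu v => ?_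
    have := hΓ' ⟨u, mem_mirSub_of_mem_USet hu⟩ (upUnip_mirHom hu) v
    rwa [← hψs] at this
  · intro n hn x
    rw [AddChar.inv_apply]
    exact hΛ.2 _ hn x
  · intro Λ' hΛ'
    refine gl_whittaker_unique hψ hτ hΛ fun u hu x => ?_
    obtain ⟨h, hh⟩ := hsurj _ hu
    obtain rfl : mirHom h2 hρ0 hl h = u := Units.ext hh
    have := hΛ' h hu x
    rwa [AddChar.inv_apply] at this

end MirabolicPairing

section Sections

variable {l : ℕ} {W : Type*} [AddCommGroup W] [Module ℂ W]
  {τ : Representation ℂ (GL (Fin l) F) W}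

/-- Right translation of functions on matrices by an element of `SO_{2l+1}`. -/
def rightTrans (W : Type*) [AddCommGroup W] [Module ℂ W] (k : SOodd F l) :
    (Matrix (Fin (2 * l + 1)) (Fin (2 * l + 1)) F → W) →ₗ[ℂ]
      (Matrix (Fin (2 * l + 1)) (Fin (2 * l + 1)) F → W) :=
  LinearMap.funLeft ℂ W (fun m => m * mat F k)

theorem rightTrans_apply (k : SOodd F l) (ξ : Matrix (Fin (2 * l + 1)) (Fin (2 * l + 1)) F → W)
    (m : Matrix (Fin (2 * l + 1)) (Fin (2 * l + 1)) F) :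
    rightTrans W k ξ m = ξ (m * mat F k) := rfl

theorem rightTrans_rightTrans (k k' : SOodd F l)
    (ξ : Matrix (Fin (2 * l + 1)) (Fin (2 * l + 1)) F → W) :
    rightTrans W k (rightTrans W k' ξ) = rightTrans W (k * k') ξ := by
  funext m
  rw [rightTrans_apply, rightTrans_apply, rightTrans_apply, mat_mul, mul_assoc]

open Classical in
/-- The element of `I(τ)` supported on the Siegel parabolic with a given value at `1`. -/
def siegelSection (τ : Representation ℂ (GL (Fin l) F) W) :
    W →ₗ[ℂ] (Matrix (Fin (2 * l + 1)) (Fin (2 * l + 1)) F → W) :=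
  LinearMap.pi fun m =>
    if h : ∃ y : siegel (F := F) l, mat F y.1 = m then τ (leviHom l h.choose) else 0

theorem siegelSection_mat (x : W) (y : siegel (F := F) l) :
    siegelSection τ x (mat F y.1) = τ (leviHom l y) x := by
  have h : ∃ z : siegel (F := F) l, mat F z.1 = mat F y.1 := ⟨y, rfl⟩
  have hz : h.choose = y := Subtype.ext (mat_injective h.choose_spec)
  rw [siegelSection, LinearMap.pi_apply, dif_pos h, hz]

theorem siegelSection_eq_zero (x : W) {m : Matrix (Fin (2 * l + 1)) (Fin (2 * l + 1)) F}
    (h : ¬ ∃ y : siegel (F := F) l, mat F y.1 = m) : siegelSection τ x m = 0 := by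
  rw [siegelSection, LinearMap.pi_apply, dif_neg h, LinearMap.zero_apply]

theorem siegelSection_mat_of_notMem (x : W) {y : SOodd F l} (hy : y ∉ siegel l) :
    siegelSection τ x (mat F y) = 0 := by
  refine siegelSection_eq_zero x ?_
  rintro ⟨z, hz⟩
  exact hy (mat_injective hz ▸ z.2)

theorem mem_SOset_iff {m : Matrix (Fin (2 * l + 1)) (Fin (2 * l + 1)) F} :
    m ∈ SOset F (2 * l + 1) (Jmat F (2 * l + 1)) ↔ ∃ y : SOodd F l, mat F y = m := by
  constructor
  · rintro ⟨h1, h2⟩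
    exact ⟨soMk m h1 h2, mat_soMk m h1 h2⟩
  · rintro ⟨y, rfl⟩
    exact ⟨mat_det y, mat_isom y⟩

theorem exists_mat_eq_of_mul {m : Matrix (Fin (2 * l + 1)) (Fin (2 * l + 1)) F} {k y : SOodd F l}
    (h : mat F y = m * mat F k) : mat F (y * k⁻¹) = m := by
  rw [mat_mul, h, mul_assoc, mat_mul_inv, mul_one]

theorem rightTrans_siegelSection (x : W) (y : siegel (F := F) l) :
    rightTrans W y.1 (siegelSection τ x) = siegelSection τ (τ (leviHom l y) x) := by
  funext m
  rw [rightTrans_apply]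
  by_cases h : ∃ z : siegel (F := F) l, mat F z.1 = m
  · obtain ⟨z, rfl⟩ := h
    have e : mat F z.1 * mat F y.1 = mat F (z * y).1 := (mat_mul _ _).symm
    rw [e, siegelSection_mat, siegelSection_mat, map_mul, map_mul]
    rfl
  · rw [siegelSection_eq_zero _ h, siegelSection_eq_zero]
    rintro ⟨z, hz⟩
    exact h ⟨z * y⁻¹, exists_mat_eq_of_mul hz⟩

variable {ρ : F} {h2 : (2 : F) ≠ 0} {hρ0 : ρ ≠ 0} {hl : 1 ≤ l}
  [Fintype (SO2l F l ρ)]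

theorem siegelSection_value {ξ : Matrix (Fin (2 * l + 1)) (Fin (2 * l + 1)) F → W}
    (hξ : ξ ∈ IndTau F l τ) {y k : SOodd F l} (h : y * k⁻¹ ∈ siegel l) :
    siegelSection τ (ξ (mat F k)) (mat F (y * k⁻¹)) = ξ (mat F y) := by
  have h1 := siegelSection_mat (τ := τ) (ξ (mat F k)) ⟨y * k⁻¹, h⟩
  have h3 := IndTau.apply_siegel hξ ⟨y * k⁻¹, h⟩ (mat F k)
  rw [← h3] at h1
  dsimp only at h1
  rw [← mat_mul, inv_mul_cancel_right] at h1
  with_reducible exact h1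

theorem mul_mem_mirSub_iff {y : SOodd F l} {g₀ : SO2l F l ρ}
    (hg₀ : y * embHom h2 hρ0 hl g₀ ∈ siegel l) (g : SO2l F l ρ) :
    g * g₀ ∈ mirSub h2 hρ0 hl ↔ y * (embHom h2 hρ0 hl g)⁻¹ ∈ siegel l := by
  have e1 : y * embHom h2 hρ0 hl g₀ = y * (embHom h2 hρ0 hl g)⁻¹ *
      embHom h2 hρ0 hl (g * g₀) := by
    rw [map_mul, mul_assoc, inv_mul_cancel_left]
  rw [e1] at hg₀
  constructor
  · intro h
    exact ((siegel l).mul_mem_cancel_right (x := embHom h2 hρ0 hl (g * g₀)) h).mp hg₀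
  · intro h
    exact ((siegel l).mul_mem_cancel_left h).mp hg₀

open Classical in
theorem siegelSection_translate {ξ : Matrix (Fin (2 * l + 1)) (Fin (2 * l + 1)) F → W}
    (hξ : ξ ∈ IndTau F l τ) {y : SOodd F l} {g₀ : SO2l F l ρ}
    (hg₀ : y * embHom h2 hρ0 hl g₀ ∈ siegel l) (g : SO2l F l ρ) :
    rightTrans W (embHom h2 hρ0 hl g)⁻¹
      (siegelSection τ (ξ (mat F (embHom h2 hρ0 hl g)))) (mat F y) =
      if g * g₀ ∈ mirSub h2 hρ0 hl then ξ (mat F y) else 0 := by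
  have e := mul_mem_mirSub_iff hg₀ g
  rw [rightTrans_apply, ← mat_mul]
  obtain ⟨k, hk⟩ : ∃ k, embHom h2 hρ0 hl g = k := ⟨_, rfl⟩
  rw [hk] at e ⊢
  by_cases h : g * g₀ ∈ mirSub h2 hρ0 hl
  · rw [if_pos h]
    have h' := e.mp h
    have h3 := siegelSection_value hξ h'
    with_reducible exact h3
  · rw [if_neg h]
    exact siegelSection_mat_of_notMem _ (fun h' => h (e.mpr h'))

theorem card_smul_eq_sum_siegelSection [Fintype (mirSub h2 hρ0 hl)] (hρ : ∀ x : F, x ^ 2 ≠ ρ)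
    {ξ : Matrix (Fin (2 * l + 1)) (Fin (2 * l + 1)) F → W} (hξ : ξ ∈ IndTau F l τ) :
    (Fintype.card (mirSub h2 hρ0 hl) : ℂ) • ξ =
      ∑ g : SO2l F l ρ, rightTrans W (embHom h2 hρ0 hl g)⁻¹
        (siegelSection τ (ξ (mat F (embHom h2 hρ0 hl g)))) := by
  classical
  funext m
  rw [Finset.sum_apply, Pi.smul_apply]
  by_cases hm : m ∈ SOset F (2 * l + 1) (Jmat F (2 * l + 1))
  · obtain ⟨y, rfl⟩ := mem_SOset_iff.mp hm
    obtain ⟨g₀, hg₀⟩ := exists_lowZero_mul h2 hρ hρ0 hl y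
    rw [Finset.sum_congr rfl fun g _ => siegelSection_translate hξ (mem_siegel.mpr hg₀) g]
    generalize ξ (mat F y) = w
    conv_rhs => rw [← Equiv.sum_comp (Equiv.mulRight g₀⁻¹)]
    simp only [Equiv.coe_mulRight, inv_mul_cancel_right]
    rw [← Finset.sum_filter, Finset.sum_const, ← Nat.cast_smul_eq_nsmul ℂ, Fintype.card_subtype]
  · rw [hξ.1 m hm, smul_zero]
    refine (Finset.sum_eq_zero fun g _ => ?_).symm
    rw [rightTrans_apply]
    refine siegelSection_eq_zero _ ?_
    rintro ⟨z, hz⟩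
    exact hm (mem_SOset_iff.mpr ⟨_, exists_mat_eq_of_mul hz⟩)

variable {V : Type*} [AddCommGroup V] [Module ℂ V]

/-- The zeta sum of a Whittaker function against the linear form `Θ` of the translates of a
section. -/
def zetaForm (h2 : (2 : F) ≠ 0) (hρ0 : ρ ≠ 0) (hl : 1 ≤ l) (π : Representation ℂ (SO2l F l ρ) V)
    (Γ : V →ₗ[ℂ] ℂ) (Θ : (Matrix (Fin (2 * l + 1)) (Fin (2 * l + 1)) F → W) →ₗ[ℂ] ℂ) :
    V →ₗ[ℂ] (Matrix (Fin (2 * l + 1)) (Fin (2 * l + 1)) F → W) →ₗ[ℂ] ℂ :=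
  ∑ g, (LinearMap.mul ℂ ℂ).compl₁₂ (Γ ∘ₗ π g) (Θ ∘ₗ rightTrans W (embHom h2 hρ0 hl g))

variable {π : Representation ℂ (SO2l F l ρ) V} {Γ : V →ₗ[ℂ] ℂ}
  {Θ Θ' : (Matrix (Fin (2 * l + 1)) (Fin (2 * l + 1)) F → W) →ₗ[ℂ] ℂ}

theorem zetaForm_apply (v : V) (ξ : Matrix (Fin (2 * l + 1)) (Fin (2 * l + 1)) F → W) :
    zetaForm h2 hρ0 hl π Γ Θ v ξ =
      ∑ g, Γ (π g v) * Θ (rightTrans W (embHom h2 hρ0 hl g) ξ) := by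
  rw [zetaForm, LinearMap.sum_apply, LinearMap.sum_apply]
  rfl

theorem zetaForm_rightTrans (h : SO2l F l ρ) (v : V)
    (ξ : Matrix (Fin (2 * l + 1)) (Fin (2 * l + 1)) F → W) :
    zetaForm h2 hρ0 hl π Γ Θ (π h v) (rightTrans W (embHom h2 hρ0 hl h) ξ) =
      zetaForm h2 hρ0 hl π Γ Θ v ξ := by
  rw [zetaForm_apply, zetaForm_apply]
  conv_rhs => rw [← Equiv.sum_comp (Equiv.mulRight h)]
  refine Finset.sum_congr rfl fun g _ => ?_
  rw [Equiv.coe_mulRight, map_mul, map_mul, rightTrans_rightTrans]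
  rfl

/-- The pairing of `π` and `τ` given by the zeta sums of the sections supported on the Siegel
parabolic. -/
def sectionPairing (h2 : (2 : F) ≠ 0) (hρ0 : ρ ≠ 0) (hl : 1 ≤ l)
    (π : Representation ℂ (SO2l F l ρ) V) (Γ : V →ₗ[ℂ] ℂ) (τ : Representation ℂ (GL (Fin l) F) W)
    (Θ : (Matrix (Fin (2 * l + 1)) (Fin (2 * l + 1)) F → W) →ₗ[ℂ] ℂ) : V →ₗ[ℂ] W →ₗ[ℂ] ℂ :=
  (zetaForm h2 hρ0 hl π Γ Θ).compl₂ (siegelSection τ)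

theorem sectionPairing_apply (v : V) (x : W) : sectionPairing h2 hρ0 hl π Γ τ Θ v x =
    zetaForm h2 hρ0 hl π Γ Θ v (siegelSection τ x) := rfl

theorem sectionPairing_invariant (h : mirSub h2 hρ0 hl) (v : V) (x : W) :
    sectionPairing h2 hρ0 hl π Γ τ Θ (π h.1 v) (τ (mirHom h2 hρ0 hl h) x) =
      sectionPairing h2 hρ0 hl π Γ τ Θ v x := by
  have hm : mirHom h2 hρ0 hl h = leviHom l ⟨embHom h2 hρ0 hl h.1, h.2⟩ := rfl
  have hs := rightTrans_siegelSection (τ := τ) x ⟨embHom h2 hρ0 hl h.1, h.2⟩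
  dsimp only at hs
  rw [sectionPairing_apply, sectionPairing_apply, ← zetaForm_rightTrans h.1 v, hs, hm]

theorem zetaForm_eq_sum_sectionPairing [Fintype (mirSub h2 hρ0 hl)] (hρ : ∀ x : F, x ^ 2 ≠ ρ)
    {ξ : Matrix (Fin (2 * l + 1)) (Fin (2 * l + 1)) F → W} (hξ : ξ ∈ IndTau F l τ) (v : V) :
    (Fintype.card (mirSub h2 hρ0 hl) : ℂ) * zetaForm h2 hρ0 hl π Γ Θ v ξ =
      ∑ g, sectionPairing h2 hρ0 hl π Γ τ Θ (π g v) (ξ (mat F (embHom h2 hρ0 hl g))) := by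
  rw [← smul_eq_mul, ← map_smul, card_smul_eq_sum_siegelSection hρ hξ, map_sum]
  refine Finset.sum_congr rfl fun g _ => ?_
  rw [sectionPairing_apply, ← zetaForm_rightTrans g⁻¹ (π g v), ← Module.End.mul_apply, ← map_mul,
    inv_mul_cancel, map_one, Module.End.one_apply, map_inv]

theorem zetaForm_eq_mul [Fintype (mirSub h2 hρ0 hl)] {c : ℂ} (hρ : ∀ x : F, x ^ 2 ≠ ρ)
    (hc : ∀ v x, sectionPairing h2 hρ0 hl π Γ τ Θ' v x = c * sectionPairing h2 hρ0 hl π Γ τ Θ v x)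
    {ξ : Matrix (Fin (2 * l + 1)) (Fin (2 * l + 1)) F → W} (hξ : ξ ∈ IndTau F l τ) (v : V) :
    zetaForm h2 hρ0 hl π Γ Θ' v ξ = c * zetaForm h2 hρ0 hl π Γ Θ v ξ := by
  have h0 : (Fintype.card (mirSub h2 hρ0 hl) : ℂ) ≠ 0 := Nat.cast_ne_zero.mpr Fintype.card_ne_zero
  refine mul_left_cancel₀ h0 ?_
  rw [zetaForm_eq_sum_sectionPairing hρ hξ, mul_left_comm, zetaForm_eq_sum_sectionPairing hρ hξ,
    Finset.mul_sum]
  exact Finset.sum_congr rfl fun g _ => hc _ _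

end Sections

section GammaFactor

variable {l : ℕ} {W : Type*} [AddCommGroup W] [Module ℂ W]
  {τ : Representation ℂ (GL (Fin l) F) W}

theorem tauApp_coe (τ : Representation ℂ (GL (Fin l) F) W) (a : GL (Fin l) F) :
    tauApp F l τ (a : Matrix (Fin l) (Fin l) F) = τ a := by
  have h : ∃ g : GL (Fin l) F, (g : Matrix (Fin l) (Fin l) F) = a := ⟨a, rfl⟩
  have ha : h.choose = a := Units.ext h.choose_spec
  rw [tauApp, matFun, dif_pos h, ha]

theorem tauApp_one (τ : Representation ℂ (GL (Fin l) F) W) : tauApp F l τ 1 = LinearMap.id := by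
  have h := tauApp_coe τ 1
  rw [Units.val_one, map_one] at h
  exact h

/-- The linear form on sections underlying the zeta integral. -/
def zetaLin (ρ : F) (τ : Representation ℂ (GL (Fin l) F) W) (Λ : W →ₗ[ℂ] ℂ) :
    (Matrix (Fin (2 * l + 1)) (Fin (2 * l + 1)) F → W) →ₗ[ℂ] ℂ :=
  Λ ∘ₗ tauApp F l τ 1 ∘ₗ LinearMap.proj (wllMat F l ρ)

/-- The linear form on sections underlying the zeta integral of an intertwined section. -/
def zetaLinM (ρ : F) (τ : Representation ℂ (GL (Fin l) F) W) (Λ : W →ₗ[ℂ] ℂ) :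
    (Matrix (Fin (2 * l + 1)) (Fin (2 * l + 1)) F → W) →ₗ[ℂ] ℂ :=
  ∑ u ∈ (VnSet F l).toFinite.toFinset, Λ ∘ₗ tauApp F l τ (dnMat F l * aStar F l 1) ∘ₗ
    LinearMap.proj (wnOddMat F l * u * wllMat F l ρ)

theorem zetaLin_apply (ρ : F) (Λ : W →ₗ[ℂ] ℂ)
    (ξ : Matrix (Fin (2 * l + 1)) (Fin (2 * l + 1)) F → W) :
    zetaLin ρ τ Λ ξ = Λ (ξ (wllMat F l ρ)) := by
  rw [zetaLin, tauApp_one]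
  rfl

theorem zetaLinM_apply (ρ : F) (Λ : W →ₗ[ℂ] ℂ)
    (ξ : Matrix (Fin (2 * l + 1)) (Fin (2 * l + 1)) F → W) :
    zetaLinM ρ τ Λ ξ = ∑ u ∈ (VnSet F l).toFinite.toFinset,
      Λ (tauApp F l τ (dnMat F l * aStar F l 1) (ξ (wnOddMat F l * u * wllMat F l ρ))) := by
  rw [zetaLinM, LinearMap.sum_apply]
  rfl

/-- The function on `SO_{2l+1} × GL_l` attached to a section. -/
def sectionFun (τ : Representation ℂ (GL (Fin l) F) W) (Λ : W →ₗ[ℂ] ℂ)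
    (ξ : Matrix (Fin (2 * l + 1)) (Fin (2 * l + 1)) F → W) :
    Matrix (Fin (2 * l + 1)) (Fin (2 * l + 1)) F → Matrix (Fin l) (Fin l) F → ℂ :=
  fun g a => Λ (tauApp F l τ a (ξ g))

variable {ρ : F} {h2 : (2 : F) ≠ 0} {hρ0 : ρ ≠ 0} {hl : 1 ≤ l}
  {V : Type*} [AddCommGroup V] [Module ℂ V] {π : Representation ℂ (SO2l F l ρ) V} {Γ : V →ₗ[ℂ] ℂ}

theorem Zeta_self (φ : SO2l F l ρ → ℂ)
    (f : Matrix (Fin (2 * l + 1)) (Fin (2 * l + 1)) F → Matrix (Fin l) (Fin l) F → ℂ) :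
    Zeta F l ρ l φ f = ZetaTop F l ρ φ f := by
  rw [Zeta, if_neg (lt_irrefl l), dif_pos rfl]
  rfl

section Zeta

variable [Fintype (SO2l F l ρ)]

theorem zetaTop_sectionFun (Λ : W →ₗ[ℂ] ℂ) (v : V)
    (ξ : Matrix (Fin (2 * l + 1)) (Fin (2 * l + 1)) F → W) :
    ZetaTop F l ρ (fun g => Γ (π g v)) (sectionFun τ Λ ξ) =
      (Nat.card (USet F l ρ) : ℂ)⁻¹ * zetaForm h2 hρ0 hl π Γ (zetaLin ρ τ Λ) v ξ := by
  rw [ZetaTop, finsum_eq_sum_of_fintype, zetaForm_apply]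
  rfl

theorem zetaTop_MOp_sectionFun (Λ : W →ₗ[ℂ] ℂ) (v : V)
    (ξ : Matrix (Fin (2 * l + 1)) (Fin (2 * l + 1)) F → W) :
    ZetaTop F l ρ (fun g => Γ (π g v)) (MOp F l (sectionFun τ Λ ξ)) =
      (Nat.card (USet F l ρ) : ℂ)⁻¹ * zetaForm h2 hρ0 hl π Γ (zetaLinM ρ τ Λ) v ξ := by
  rw [ZetaTop, finsum_eq_sum_of_fintype, zetaForm_apply]
  congr 1
  refine Finset.sum_congr rfl fun g _ => ?_
  congr 1
  rw [zetaLinM_apply, MOp, finsum_mem_eq_finite_toFinset_sum _ (VnSet F l).toFinite]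
  refine Finset.sum_congr rfl fun u _ => ?_
  rw [rightTrans_apply, mat_embHom, mul_assoc (wnOddMat F l * u)]
  rfl

theorem isGamma_iff (Λ : W →ₗ[ℂ] ℂ) (c : ℂ) : IsGamma F l ρ l π Γ τ Λ c ↔
    ∀ v, ∀ ξ ∈ IndTau F l τ, zetaForm h2 hρ0 hl π Γ (zetaLinM ρ τ Λ) v ξ =
      c * zetaForm h2 hρ0 hl π Γ (zetaLin ρ τ Λ) v ξ := by
  have hN : (Nat.card (USet F l ρ) : ℂ)⁻¹ ≠ 0 := by
    refine inv_ne_zero (Nat.cast_ne_zero.mpr ?_)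
    have : Nonempty (USet F l ρ) := ⟨⟨1, show upUnip F (mat F 1) by rw [mat_one]; exact upUnip_one _⟩⟩
    exact Nat.card_pos.ne'
  have key : ∀ v ξ, (c * Zeta F l ρ l (fun g => Γ (π g v)) (sectionFun τ Λ ξ) =
      Zeta F l ρ l (fun g => Γ (π g v)) (MOp F l (sectionFun τ Λ ξ))) ↔
      zetaForm h2 hρ0 hl π Γ (zetaLinM ρ τ Λ) v ξ =
        c * zetaForm h2 hρ0 hl π Γ (zetaLin ρ τ Λ) v ξ := by
    intro v ξ
    rw [Zeta_self, Zeta_self, zetaTop_sectionFun (h2 := h2) (hρ0 := hρ0) (hl := hl),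
      zetaTop_MOp_sectionFun (h2 := h2) (hρ0 := hρ0) (hl := hl), mul_left_comm,
      mul_right_inj' hN, eq_comm]
  constructor
  · intro h v ξ hξ
    exact (key v ξ).mp (h v _ ⟨ξ, hξ, rfl⟩)
  · rintro h v f ⟨ξ, hξ, rfl⟩
    exact (key v ξ).mpr (h v ξ hξ)

end Zeta

/-- The scalar element `γ·I_l` with `γ = ρ/2`. -/
def halfScalar (l : ℕ) (h2 : (2 : F) ≠ 0) (hρ0 : ρ ≠ 0) : GL (Fin l) F :=
  Units.map (Matrix.scalar (Fin l)).toMonoidHom (Units.mk0 (ρ / 2) (div_ne_zero hρ0 h2))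

theorem coe_halfScalar (h2 : (2 : F) ≠ 0) (hρ0 : ρ ≠ 0) :
    (halfScalar l h2 hρ0 : Matrix (Fin l) (Fin l) F) = Matrix.diagonal fun _ => ρ / 2 := rfl

theorem halfScalar_comm (a : GL (Fin l) F) :
    halfScalar l h2 hρ0 * a = a * halfScalar l h2 hρ0 := by
  refine Units.ext ?_
  rw [Units.val_mul, Units.val_mul, coe_halfScalar]
  ext i j
  rw [Matrix.diagonal_mul, Matrix.mul_diagonal, mul_comm]

theorem mat_lnEl_halfScalar : mat F (lnEl (halfScalar l h2 hρ0)) = wllMat F l ρ := by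
  have hg : ρ / 2 ≠ 0 := div_ne_zero hρ0 h2
  have hinv : (Matrix.diagonal fun _ : Fin l => ρ / 2)⁻¹ =
      Matrix.diagonal fun _ : Fin l => (ρ / 2)⁻¹ := by
    refine Matrix.inv_eq_right_inv ?_
    rw [Matrix.diagonal_mul_diagonal]
    simp only [mul_inv_cancel₀ hg]
    exact Matrix.diagonal_one
  have hw : wllMat F l ρ = Matrix.diagonal fun i : Fin (2 * l + 1) =>
      if (i : ℕ) < l then ρ / 2 else if (i : ℕ) = l then 1 else (ρ / 2)⁻¹ := rfl
  have h := (Matrix.reindex (blockEquiv l).symm (blockEquiv l).symm).injective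
    (a₁ := lnMat F l (halfScalar l h2 hρ0 : Matrix (Fin l) (Fin l) F)) (a₂ := wllMat F l ρ)
  rw [mat_lnEl]
  refine h ?_
  show (lnMat F l (halfScalar l h2 hρ0 : Matrix (Fin l) (Fin l) F)).submatrix (blockEquiv l)
    (blockEquiv l) = (wllMat F l ρ).submatrix (blockEquiv l) (blockEquiv l)
  rw [lnMat_submatrix, coe_halfScalar, hinv, Matrix.diagonal_transpose, hw,
    Matrix.submatrix_diagonal_equiv, ← Matrix.diagonal_one, Matrix.fromBlocks_diagonal,
    Matrix.fromBlocks_diagonal]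
  congr 1
  funext i
  rcases i with i | _ | i
  · exact (if_pos i.2).symm
  · show _ = if (l : ℕ) < l then _ else if (l : ℕ) = l then _ else _
    rw [if_neg (lt_irrefl l), if_pos rfl]
    rfl
  · have e : ((lowIdx l i).rev : ℕ) = 2 * l - i := by
      rw [Fin.val_rev]; show 2 * l + 1 - ((i : ℕ) + 1) = _; omega
    show _ = if ((lowIdx l i).rev : ℕ) < l then _ else if ((lowIdx l i).rev : ℕ) = l then _ else _
    have := i.2
    rw [e, if_neg (show ¬ 2 * l - (i : ℕ) < l by omega),
      if_neg (show ¬ 2 * l - (i : ℕ) = l by omega)]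
    rfl

theorem leviHom_lnEl (a : GL (Fin l) F) : leviHom l ⟨lnEl a, lowZero_lnEl a⟩ = a :=
  Units.ext (topLeft_lnEl a)

theorem IsGenericGLinv.halfScalar {ψ : AddChar F ℂ} {Λ : W →ₗ[ℂ] ℂ}
    (hΛ : IsGenericGLinv F l ψ τ Λ) :
    IsGenericGLinv F l ψ τ (Λ ∘ₗ τ (halfScalar l h2 hρ0)) := by
  refine ⟨fun h => hΛ.1 ?_, fun u hu x => ?_⟩
  · ext x
    have := LinearMap.congr_fun h (τ (ConverseSO.halfScalar l h2 hρ0)⁻¹ x)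
    rwa [LinearMap.comp_apply, ← Module.End.mul_apply, ← map_mul, mul_inv_cancel, map_one] at this
  · rw [LinearMap.comp_apply, ← Module.End.mul_apply, ← map_mul, halfScalar_comm, map_mul,
      Module.End.mul_apply, hΛ.2 u hu]
    rfl

variable [Fintype (SO2l F l ρ)] [Fintype (mirSub h2 hρ0 hl)]

theorem siegelSection_mat_mul (x : W) (a k : siegel (F := F) l) :
    siegelSection τ x (mat F a.1 * mat F k.1) = τ (leviHom l a) (τ (leviHom l k) x) := by
  rw [← rightTrans_apply k.1 (siegelSection τ x) (mat F a.1), rightTrans_siegelSection,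
    siegelSection_mat]

theorem siegelSection_wllMat_mul (x : W) (h : mirSub h2 hρ0 hl) :
    siegelSection τ x (wllMat F l ρ * mat F (embHom h2 hρ0 hl h.1)) =
      τ (halfScalar l h2 hρ0) (τ (mirHom h2 hρ0 hl h) x) := by
  have hm : mirHom h2 hρ0 hl h = leviHom l ⟨embHom h2 hρ0 hl h.1, h.2⟩ := rfl
  have hs := siegelSection_mat_mul (τ := τ) x ⟨lnEl (halfScalar l h2 hρ0), lowZero_lnEl _⟩
    ⟨embHom h2 hρ0 hl h.1, h.2⟩
  rw [leviHom_lnEl, ← hm] at hs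
  dsimp only at hs
  rw [mat_lnEl_halfScalar] at hs
  with_reducible exact hs

theorem siegelSection_wllMat_mul_of_notMem (x : W) {g : SO2l F l ρ} (hg : g ∉ mirSub h2 hρ0 hl) :
    siegelSection τ x (wllMat F l ρ * mat F (embHom h2 hρ0 hl g)) = 0 := by
  have hg' : embHom h2 hρ0 hl g ∉ siegel l := hg
  rw [← mat_lnEl_halfScalar (h2 := h2) (hρ0 := hρ0), ← mat_mul]
  refine siegelSection_mat_of_notMem x fun h => hg' ?_
  exact ((siegel l).mul_mem_cancel_left (lowZero_lnEl _)).mp h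

theorem sectionPairing_zetaLin (Λ : W →ₗ[ℂ] ℂ) :
    sectionPairing h2 hρ0 hl π Γ τ (zetaLin ρ τ Λ) =
      whitPairing (π.comp (mirSub h2 hρ0 hl).subtype) (mirHom h2 hρ0 hl) τ Γ
        (Λ ∘ₗ τ (halfScalar l h2 hρ0)) := by
  classical
  ext v x
  rw [sectionPairing_apply, zetaForm_apply, whitPairing_apply]
  have hz : ∀ g : SO2l F l ρ, zetaLin ρ τ Λ
      (rightTrans W (embHom h2 hρ0 hl g) (siegelSection τ x)) =
      Λ (siegelSection τ x (wllMat F l ρ * mat F (embHom h2 hρ0 hl g))) := fun g => by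
    rw [zetaLin_apply, rightTrans_apply]
  rw [← Finset.sum_filter_of_ne (p := fun g => g ∈ mirSub h2 hρ0 hl), Finset.sum_subtype
    (p := fun g => g ∈ mirSub h2 hρ0 hl) _ (fun g => by
      rw [Finset.mem_filter, and_iff_right (Finset.mem_univ g)])]
  · refine Finset.sum_congr rfl fun h _ => ?_
    rw [hz, siegelSection_wllMat_mul]
    rfl
  · intro g _ hg
    by_contra h
    rw [hz, siegelSection_wllMat_mul_of_notMem x h, map_zero, mul_zero] at hg
    exact hg rfl

/-- Existence of the gamma factor. -/
theorem exists_isGamma {ψ : AddChar F ℂ} (hψ : ψ ≠ 1) (hl2 : 2 ≤ l) (hρ : ∀ x : F, x ^ 2 ≠ ρ)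
    (hπ : IsIrrep π) (hcusp : IsCuspidal F l ρ π) (hΓ : IsWhittaker F l ρ ψ π Γ)
    (hτ : IsIrrep τ) {Λ : W →ₗ[ℂ] ℂ} (hΛ : IsGenericGLinv F l ψ τ Λ) :
    ∃ c, ∀ v, ∀ ξ ∈ IndTau F l τ, zetaForm h2 hρ0 hl π Γ (zetaLinM ρ τ Λ) v ξ =
      c * zetaForm h2 hρ0 hl π Γ (zetaLin ρ τ Λ) v ξ := by
  obtain ⟨c, hc⟩ := mirabolic_pairing_eq_smul hψ hl2 hρ hπ hcusp hΓ hτ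
    (hΛ.halfScalar (h2 := h2) (hρ0 := hρ0))
    (b := sectionPairing h2 hρ0 hl π Γ τ (zetaLinM ρ τ Λ)) sectionPairing_invariant
  rw [← sectionPairing_zetaLin] at hc
  refine ⟨c, fun v ξ hξ => zetaForm_eq_mul hρ (fun v x => ?_) hξ v⟩
  rw [hc]
  rfl

end GammaFactor

section SignAt

variable {m : ℕ}

/-- The diagonal sign vector with a single `-1` at the index `a`. -/
def signAt (F : Type) [Field F] {m : ℕ} (a : ℕ) (i : Fin m) : F := if (i : ℕ) = a then -1 else 1

theorem signAt_self {a : ℕ} {i : Fin m} (h : (i : ℕ) = a) : signAt F a i = -1 := if_pos h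

theorem signAt_ne {a : ℕ} {i : Fin m} (h : (i : ℕ) ≠ a) : signAt F a i = 1 := if_neg h

theorem signAt_mul_self (a : ℕ) (i : Fin m) : signAt F a i * signAt F a i = 1 := by
  unfold signAt; split_ifs <;> ring

theorem prod_signAt {a : ℕ} (ha : a < m) : ∏ i : Fin m, signAt F a i = -1 := by
  rw [Finset.prod_eq_single (⟨a, ha⟩ : Fin m)]
  · exact signAt_self rfl
  · intro i _ hi
    exact signAt_ne fun h => hi (Fin.ext h)
  · intro h
    exact absurd (Finset.mem_univ _) h

/-- The diagonal matrix with a single `-1` at the index `a`. -/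
def signMat (F : Type) [Field F] (m a : ℕ) : Matrix (Fin m) (Fin m) F :=
  Matrix.diagonal (signAt F a)

theorem signMat_mul_self (a : ℕ) : signMat F m a * signMat F m a = 1 := by
  rw [signMat, Matrix.diagonal_mul_diagonal]
  simp only [signAt_mul_self]
  exact Matrix.diagonal_one

theorem signMat_conj_apply (a : ℕ) (M : Matrix (Fin m) (Fin m) F) (i j : Fin m) :
    (signMat F m a * M * signMat F m a) i j = signAt F a i * M i j * signAt F a j := by
  rw [signMat, Matrix.mul_diagonal, Matrix.diagonal_mul]

theorem signMat_conj_conj (a : ℕ) (M : Matrix (Fin m) (Fin m) F) :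
    signMat F m a * (signMat F m a * M * signMat F m a) * signMat F m a = M := by
  ext i j
  rw [signMat_conj_apply, signMat_conj_apply]
  linear_combination (M i j * signAt F a j * signAt F a j) * signAt_mul_self (F := F) a i +
    M i j * signAt_mul_self (F := F) a j

/-- A matrix preserving the decomposition into the index `a` and its complement commutes with
the sign matrix at `a`. -/
theorem signMat_mul_comm {a : ℕ} {M : Matrix (Fin m) (Fin m) F}
    (h : ∀ i j : Fin m, ¬ ((i : ℕ) = a ↔ (j : ℕ) = a) → M i j = 0) :
    signMat F m a * M = M * signMat F m a := by
  ext i j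
  rw [signMat, Matrix.mul_diagonal, Matrix.diagonal_mul]
  by_cases hij : (i : ℕ) = a ↔ (j : ℕ) = a
  · unfold signAt
    rw [if_congr hij rfl rfl, mul_comm]
  · rw [h i j hij]; ring

end SignAt

section EvenSigns

variable {l : ℕ} {ρ : F}

theorem signMat_isometry {a : ℕ} (h : ∀ i : Fin (2 * l), (i : ℕ) = a → IsMid l i) :
    (signMat F (2 * l) a)ᵀ * Jrho F l ρ * signMat F (2 * l) a = Jrho F l ρ := by
  refine diagonal_isometry fun i => ?_
  by_cases hi : IsMid l i
  · rw [dualIdx_of_isMid hi, signAt_mul_self]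
  · rw [signAt_ne fun e => hi (h i e), signAt_ne fun e => isMid_dualIdx.not.mpr hi (h _ e), mul_one]

/-- Conjugation by the sign matrix at the index `l - 1`. -/
def midConj (l : ℕ) (ρ : F) : SO2l F l ρ →* SO2l F l ρ :=
  soConj (signMat F (2 * l) (l - 1)) (signMat_mul_self _)
    (signMat_isometry fun i hi => by unfold IsMid; have := i.2; omega)

theorem mat_midConj (g : SO2l F l ρ) :
    mat F (midConj l ρ g) = signMat F (2 * l) (l - 1) * mat F g * signMat F (2 * l) (l - 1) := rfl

theorem midConj_midConj (g : SO2l F l ρ) : midConj l ρ (midConj l ρ g) = g := soConj_soConj _ _ _ g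

theorem midConj_mem {u : SO2l F l ρ} (hu : u ∈ USet F l ρ) : midConj l ρ u ∈ USet F l ρ := by
  intro i j hij
  rw [mat_midConj, signMat_conj_apply]
  rcases eq_or_ne i j with h | h
  · subst h; rw [upUnip.apply_self hu, if_pos rfl, mul_one, signAt_mul_self]
  · rw [hu i j hij, if_neg h, mul_zero, zero_mul]

theorem soUSum_midConj (g : SO2l F l ρ) :
    soUSum l (mat F (midConj l ρ g)) = soUSum l (mat F g) := by
  rw [soUSum_eq, soUSum_eq]
  refine Finset.sum_congr rfl fun i _ => Finset.sum_congr rfl fun j _ => ?_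
  rw [mat_midConj, signMat_conj_apply]
  by_cases h : soWt F l i j = 0
  · rw [h]; ring
  unfold soWt at h
  have hi := i.2
  by_cases h1 : (j : ℕ) = (i : ℕ) + 1 ∧ (i : ℕ) + 3 ≤ l
  · rw [signAt_ne (i := i) (by omega), signAt_ne (i := j) (by omega)]; ring
  · rw [if_neg h1] at h
    by_cases h2 : (i : ℕ) + 2 = l ∧ (j : ℕ) = l
    · rw [signAt_ne (i := i) (by omega), signAt_ne (i := j) (by omega)]; ring
    · exact absurd (if_neg h2) h

theorem cMat_eq_signMat : cMat F l = signMat F (2 * l) l := by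
  ext i j
  rw [cMat, Matrix.of_apply, signMat, Matrix.diagonal_apply]
  rfl

/-- The torus element with entries `-1` at the two middle indices. -/
def midNeg (l : ℕ) (ρ : F) (hl : 1 ≤ l) : SO2l F l ρ :=
  soMk (signMat F (2 * l) (l - 1) * signMat F (2 * l) l)
    (by
      rw [Matrix.det_mul, signMat, signMat, Matrix.det_diagonal, Matrix.det_diagonal,
        prod_signAt (by omega), prod_signAt (by omega)]
      ring)
    (by
      have h1 := signMat_isometry (F := F) (l := l) (ρ := ρ) (a := l - 1)
        fun i hi => by unfold IsMid; have := i.2; omega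
      have h2 := signMat_isometry (F := F) (l := l) (ρ := ρ) (a := l)
        fun i hi => by unfold IsMid; have := i.2; omega
      rw [Matrix.transpose_mul]
      calc _ = (signMat F (2 * l) l)ᵀ * ((signMat F (2 * l) (l - 1))ᵀ * Jrho F l ρ *
            signMat F (2 * l) (l - 1)) * signMat F (2 * l) l := by simp only [mul_assoc]
        _ = _ := by rw [h1, h2])

theorem mat_midNeg (hl : 1 ≤ l) :
    mat F (midNeg l ρ hl) = signMat F (2 * l) (l - 1) * signMat F (2 * l) l := rfl

theorem signMat_comm (a b : ℕ) :
    signMat F (2 * l) a * signMat F (2 * l) b = signMat F (2 * l) b * signMat F (2 * l) a := by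
  rw [signMat, signMat, Matrix.diagonal_mul_diagonal, Matrix.diagonal_mul_diagonal]
  simp only [mul_comm]

theorem midNeg_mul_self (hl : 1 ≤ l) : midNeg l ρ hl * midNeg l ρ hl = 1 := by
  refine mat_injective ?_
  rw [mat_mul, mat_midNeg, mat_one]
  conv_lhs => rw [signMat_comm, mul_assoc, ← mul_assoc (signMat F (2 * l) (l - 1)),
    signMat_comm (l - 1) l, ← mul_assoc, ← mul_assoc, signMat_mul_self, one_mul, signMat_mul_self]

theorem mat_midNeg_conj (hl : 1 ≤ l) (g : SO2l F l ρ) :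
    mat F (midNeg l ρ hl * midConj l ρ g * midNeg l ρ hl) = cMat F l * mat F g * cMat F l := by
  rw [mat_mul, mat_mul, mat_midNeg, mat_midConj, cMat_eq_signMat]
  calc _ = signMat F (2 * l) (l - 1) * signMat F (2 * l) l * signMat F (2 * l) (l - 1) * mat F g *
        (signMat F (2 * l) (l - 1) * signMat F (2 * l) (l - 1)) * signMat F (2 * l) l := by
        simp only [mul_assoc]
    _ = _ := by
        rw [signMat_mul_self, mul_one, signMat_comm, mul_assoc (signMat F (2 * l) l),
          signMat_mul_self, mul_one]

end EvenSigns

section OddSigns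

variable {l : ℕ} {ρ : F}

/-- The sign matrix at the central index. -/
def ctrSign (F : Type) [Field F] (l : ℕ) : Matrix (Fin (2 * l + 1)) (Fin (2 * l + 1)) F :=
  signMat F (2 * l + 1) l

theorem ctrSign_mul_self : ctrSign F l * ctrSign F l = 1 := signMat_mul_self _

theorem insTop_midConj (g : Matrix (Fin (2 * l)) (Fin (2 * l)) F) :
    insTop F l (signMat F (2 * l) (l - 1) * g * signMat F (2 * l) (l - 1)) =
      signMat F (2 * l + 1) (l - 1) * insTop F l g * signMat F (2 * l + 1) (l - 1) := by
  rcases Nat.eq_zero_or_pos l with rfl | hl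
  · ext i j
    rw [signMat_conj_apply]
    have hi : i = ctr 0 := Fin.ext (by have := i.2; show (i : ℕ) = 0; omega)
    have hj : j = ctr 0 := Fin.ext (by have := j.2; show (j : ℕ) = 0; omega)
    subst hi hj
    rw [insTop_ctr, insTop_ctr, if_pos rfl, mul_one, signAt_mul_self]
  have hc : signAt F (l - 1) (ctr l) = 1 := signAt_ne (by show l ≠ l - 1; omega)
  have hs : ∀ i : Fin (2 * l), signAt F (l - 1) ((ctr l).succAbove i) = signAt F (l - 1) i := by
    intro i
    have hv := val_succAbove (l := l) i
    unfold signAt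
    refine if_congr ?_ rfl rfl
    split_ifs at hv <;> omega
  ext i j
  rw [signMat_conj_apply]
  rcases eq_or_ne i (ctr l) with h | h
  · subst h
    rw [insTop_ctr, insTop_ctr]
    split_ifs with h
    · subst h; rw [mul_one, signAt_mul_self]
    · ring
  obtain ⟨i, rfl⟩ := Fin.exists_succAbove_eq h
  rcases eq_or_ne j (ctr l) with h | h
  · subst h
    rw [insTop_succAbove_ctr, insTop_succAbove_ctr]; ring
  obtain ⟨j, rfl⟩ := Fin.exists_succAbove_eq h
  rw [insTop_succAbove, insTop_succAbove, hs, hs, signMat_conj_apply]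

theorem Mtop_mul_ctrSign (hl : 1 ≤ l) :
    Mtop F l ρ * ctrSign F l = signMat F (2 * l + 1) (l - 1) * Mtop F l ρ := by
  ext i j
  rw [ctrSign, signMat, signMat, Matrix.mul_diagonal, Matrix.diagonal_mul, Mtop, Matrix.of_apply]
  unfold signAt
  by_cases h1 : (i : ℕ) + 2 = l + 1
  · rw [if_pos h1, if_pos (show (i : ℕ) = l - 1 by omega)]
    split_ifs <;> ring
  rw [if_neg h1, if_neg (show ¬ (i : ℕ) = l - 1 by omega), one_mul]
  by_cases h2 : (j : ℕ) = l
  · by_cases h3 : i = j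
    · rw [← h3] at h2
      rw [if_pos h2, ← h3, if_neg (by omega), if_neg (by omega), zero_mul]
    · simp only [if_neg (show ¬ (j : ℕ) + 2 = l + 1 by omega),
        if_neg (show ¬ (j : ℕ) = l + 1 by omega), if_neg h3, ite_self, zero_mul]
  · rw [if_neg h2, mul_one]

theorem embHom_midConj (h2 : (2 : F) ≠ 0) (hρ0 : ρ ≠ 0) (hl : 1 ≤ l) (g : SO2l F l ρ) :
    mat F (embHom h2 hρ0 hl (midConj l ρ g)) =
      ctrSign F l * mat F (embHom h2 hρ0 hl g) * ctrSign F l := by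
  rw [mat_embHom, mat_embHom, mat_midConj]
  refine (Mtop_isUnit h2 hρ0 hl).mul_left_cancel ?_
  rw [Mtop_mul_embTop h2 hρ0 hl, insTop_midConj, ← mul_assoc, ← mul_assoc, Mtop_mul_ctrSign hl,
    mul_assoc _ (Mtop F l ρ), Mtop_mul_embTop h2 hρ0 hl, mul_assoc _ _ (Mtop F l ρ),
    ← Mtop_mul_ctrSign hl]
  simp only [mul_assoc]

theorem ctrSign_mul_wllMat : ctrSign F l * wllMat F l ρ = wllMat F l ρ * ctrSign F l := by
  refine signMat_mul_comm fun i j hij => ?_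
  rw [wllMat, Matrix.of_apply, if_neg]
  rintro rfl
  exact hij Iff.rfl

theorem ctrSign_mul_wnOddMat : ctrSign F l * wnOddMat F l = wnOddMat F l * ctrSign F l := by
  refine signMat_mul_comm fun i j hij => ?_
  rw [wnOddMat, Matrix.of_apply]
  have := i.2
  have := j.2
  by_cases h1 : (i : ℕ) < l
  · rw [if_pos h1, if_neg (by omega)]
  rw [if_neg h1]
  by_cases h2 : (i : ℕ) = l
  · rw [if_pos h2, if_neg]
    rintro rfl
    exact hij Iff.rfl
  · rw [if_neg h2, if_neg (by omega)]

theorem ctrSign_mul_lnMat (a : Matrix (Fin l) (Fin l) F) :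
    ctrSign F l * lnMat F l a = lnMat F l a * ctrSign F l := by
  refine signMat_mul_comm fun i j hij => ?_
  rw [lnMat, Matrix.of_apply]
  by_cases h1 : (i : ℕ) < l
  · rw [dif_pos h1, dif_neg (by omega)]
  rw [dif_neg h1]
  by_cases h2 : (i : ℕ) = l
  · rw [dif_pos h2, if_neg]
    rintro rfl
    exact hij Iff.rfl
  · rw [dif_neg h2, dif_neg (by omega)]

/-- Conjugation of matrices by the central sign matrix. -/
def ctrConj (m : Matrix (Fin (2 * l + 1)) (Fin (2 * l + 1)) F) :
    Matrix (Fin (2 * l + 1)) (Fin (2 * l + 1)) F :=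
  ctrSign F l * m * ctrSign F l

theorem ctrConj_ctrConj (m : Matrix (Fin (2 * l + 1)) (Fin (2 * l + 1)) F) :
    ctrConj (ctrConj m) = m := signMat_conj_conj l m

theorem ctrConj_mul (m m' : Matrix (Fin (2 * l + 1)) (Fin (2 * l + 1)) F) :
    ctrConj (m * m') = ctrConj m * ctrConj m' := by
  unfold ctrConj
  calc _ = ctrSign F l * m * 1 * m' * ctrSign F l := by rw [mul_one]; simp only [mul_assoc]
    _ = _ := by rw [← ctrSign_mul_self (F := F) (l := l)]; simp only [mul_assoc]

theorem ctrConj_of_comm {m : Matrix (Fin (2 * l + 1)) (Fin (2 * l + 1)) F}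
    (h : ctrSign F l * m = m * ctrSign F l) : ctrConj m = m := by
  rw [ctrConj, h, mul_assoc, ctrSign_mul_self, mul_one]

theorem ctrSign_isometry :
    (ctrSign F l)ᵀ * Jmat F (2 * l + 1) * ctrSign F l = Jmat F (2 * l + 1) := by
  have h : (ctrSign F l)ᵀ = ctrSign F l := Matrix.diagonal_transpose _
  rw [h, ctrSign, signMat_mul_comm, mul_assoc, signMat_mul_self, mul_one]
  intro i j hij
  rw [Jmat, Matrix.of_apply, if_neg (by omega)]

theorem ctrConj_mem_SOset {m : Matrix (Fin (2 * l + 1)) (Fin (2 * l + 1)) F}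
    (hm : m ∈ SOset F (2 * l + 1) (Jmat F (2 * l + 1))) :
    ctrConj m ∈ SOset F (2 * l + 1) (Jmat F (2 * l + 1)) := by
  obtain ⟨y, rfl⟩ := mem_SOset_iff.mp hm
  exact mem_SOset_iff.mpr ⟨soConj (ctrSign F l) ctrSign_mul_self ctrSign_isometry y, rfl⟩

theorem ctrConj_mem_VnSet {u : Matrix (Fin (2 * l + 1)) (Fin (2 * l + 1)) F}
    (hu : u ∈ VnSet F l) : ctrConj u ∈ VnSet F l := by
  refine ⟨ctrConj_mem_SOset hu.1, fun i j hij => ?_⟩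
  rw [ctrConj, ctrSign, signMat_conj_apply, hu.2 i j hij]
  split_ifs with h
  · subst h; rw [mul_one, signAt_mul_self]
  · ring

variable {W : Type*} [AddCommGroup W] [Module ℂ W] {τ : Representation ℂ (GL (Fin l) F) W}

theorem comp_ctrConj_mem_IndTau {ξ : Matrix (Fin (2 * l + 1)) (Fin (2 * l + 1)) F → W}
    (hξ : ξ ∈ IndTau F l τ) : ξ ∘ ctrConj ∈ IndTau F l τ := by
  refine ⟨fun g hg => hξ.1 _ fun h => hg ?_, fun a u hu g => ?_⟩
  · have := ctrConj_mem_SOset h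
    rwa [ctrConj_ctrConj] at this
  · rw [Function.comp_apply, Function.comp_apply, ctrConj_mul, ctrConj_mul,
      ctrConj_of_comm (ctrSign_mul_lnMat _), hξ.2 a _ (ctrConj_mem_VnSet hu)]

end OddSigns

section ConjugateRepresentation

variable {l : ℕ} {ρ : F} {h2 : (2 : F) ≠ 0} {hρ0 : ρ ≠ 0} {hl : 1 ≤ l}
  {W : Type*} [AddCommGroup W] [Module ℂ W] {τ : Representation ℂ (GL (Fin l) F) W}
  {ξ : Matrix (Fin (2 * l + 1)) (Fin (2 * l + 1)) F → W}

theorem rightTrans_embHom_midConj (g : SO2l F l ρ) :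
    rightTrans W (embHom h2 hρ0 hl (midConj l ρ g)) ξ =
      rightTrans W (embHom h2 hρ0 hl g) (ξ ∘ ctrConj) ∘ ctrConj := by
  funext m
  have h := embHom_midConj h2 hρ0 hl g
  rw [Function.comp_apply, rightTrans_apply, rightTrans_apply, Function.comp_apply, ctrConj_mul,
    ctrConj_ctrConj, h]
  rfl

theorem zetaLin_comp_ctrConj (Λ : W →ₗ[ℂ] ℂ) : zetaLin ρ τ Λ (ξ ∘ ctrConj) = zetaLin ρ τ Λ ξ := by
  rw [zetaLin_apply, zetaLin_apply, Function.comp_apply, ctrConj_of_comm ctrSign_mul_wllMat]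

theorem zetaLinM_comp_ctrConj (Λ : W →ₗ[ℂ] ℂ) :
    zetaLinM ρ τ Λ (ξ ∘ ctrConj) = zetaLinM ρ τ Λ ξ := by
  rw [zetaLinM_apply, zetaLinM_apply]
  refine Finset.sum_nbij' ctrConj ctrConj ?_ ?_ ?_ ?_ ?_
  · intro u hu
    rw [Set.Finite.mem_toFinset] at hu ⊢
    exact ctrConj_mem_VnSet hu
  · intro u hu
    rw [Set.Finite.mem_toFinset] at hu ⊢
    exact ctrConj_mem_VnSet hu
  · intro u _; exact ctrConj_ctrConj u
  · intro u _; exact ctrConj_ctrConj u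
  · intro u _
    rw [Function.comp_apply, ctrConj_mul, ctrConj_mul, ctrConj_of_comm ctrSign_mul_wllMat,
      ctrConj_of_comm ctrSign_mul_wnOddMat]

variable {V : Type*} [AddCommGroup V] [Module ℂ V] {π πc : Representation ℂ (SO2l F l ρ) V}
  {Γ Γc : V →ₗ[ℂ] ℂ}

theorem conjugate_apply (hl : 1 ≤ l)
    (hconj : ∀ g g' : SO2l F l ρ, mat F g' = cMat F l * mat F g * cMat F l → πc g = π g')
    (g : SO2l F l ρ) (v : V) :
    πc g v = π (midNeg l ρ hl) (π (midConj l ρ g) (π (midNeg l ρ hl) v)) := by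
  rw [hconj g _ (mat_midNeg_conj hl g), map_mul, map_mul]
  rfl

theorem midNeg_apply_midNeg (hl : 1 ≤ l) (v : V) :
    π (midNeg l ρ hl) (π (midNeg l ρ hl) v) = v := by
  rw [← Module.End.mul_apply, ← map_mul, midNeg_mul_self, map_one]
  rfl

theorem exists_whittaker_conjugate (h2 : (2 : F) ≠ 0) {ψ : AddChar F ℂ} (hψ : ψ ≠ 1) (hl2 : 2 ≤ l)
    (hl : 1 ≤ l) (hρ : ∀ x : F, x ^ 2 ≠ ρ) (hπ : IsIrrep π) (hΓ : IsWhittaker F l ρ ψ π Γ)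
    (hconj : ∀ g g' : SO2l F l ρ, mat F g' = cMat F l * mat F g * cMat F l → πc g = π g')
    (hΓc : IsWhittaker F l ρ ψ πc Γc) :
    ∃ κ : ℂ, ∀ g v, Γc (πc g v) = κ * Γ (π (midConj l ρ g) (π (midNeg l ρ hl) v)) := by
  obtain ⟨κ, hκ⟩ := so_whittaker_unique (Γ' := Γc ∘ₗ π (midNeg l ρ hl)) h2 hρ hl2 hψ hπ hΓ
    (by
      intro u hu v
      have h := hΓc.2 _ (midConj_mem hu) (π (midNeg l ρ hl) v)
      rw [conjugate_apply hl hconj, midConj_midConj, midNeg_apply_midNeg, psiU_eq, soUSum_midConj,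
        ← psiU_eq] at h
      exact h)
  refine ⟨κ, fun g v => ?_⟩
  rw [conjugate_apply hl hconj]
  exact LinearMap.congr_fun hκ _

theorem zetaForm_conjugate [Fintype (SO2l F l ρ)] {κ : ℂ}
    (hκ : ∀ g v, Γc (πc g v) = κ * Γ (π (midConj l ρ g) (π (midNeg l ρ hl) v)))
    {Θ : (Matrix (Fin (2 * l + 1)) (Fin (2 * l + 1)) F → W) →ₗ[ℂ] ℂ}
    (hΘ : ∀ η, Θ (η ∘ ctrConj) = Θ η) (v : V) :
    zetaForm h2 hρ0 hl πc Γc Θ v ξ =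
      κ * zetaForm h2 hρ0 hl π Γ Θ (π (midNeg l ρ hl) v) (ξ ∘ ctrConj) := by
  rw [zetaForm_apply, zetaForm_apply, Finset.mul_sum]
  refine Fintype.sum_equiv
    (Function.Involutive.toPerm (midConj l ρ) midConj_midConj) _ _ fun g => ?_
  have hg := rightTrans_embHom_midConj (h2 := h2) (hρ0 := hρ0) (hl := hl) (ξ := ξ) (midConj l ρ g)
  rw [midConj_midConj] at hg
  rw [hκ, hg, hΘ, mul_assoc]
  rfl

end ConjugateRepresentation

theorem two_ne_zero_of_card {p r : ℕ} (hp : p.Prime) (hp2 : p ≠ 2) (hr : 0 < r)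
    (hcard : Fintype.card F = p ^ r) : (2 : F) ≠ 0 := by
  have h : ringChar F = p := by
    have h1 : ((p ^ r : ℕ) : F) = 0 := by rw [← hcard]; exact Nat.cast_card_eq_zero F
    have h2 : (p : F) = 0 := by
      rw [Nat.cast_pow] at h1
      exact pow_eq_zero_iff hr.ne' |>.mp h1
    rcases hp.eq_one_or_self_of_dvd _ (ringChar.dvd h2) with h | h
    · exact absurd h (CharP.ringChar_ne_one (R := F))
    · exact h
  exact Ring.two_ne_zero (by rw [h]; exact hp2)

end

theorem gamma_conjugate_invariance_top
    (F : Type) [Field F] [Fintype F] (p r : ℕ) (hp : p.Prime) (hp2 : p ≠ 2)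
    (hr : 0 < r) (hcard : Fintype.card F = p ^ r)
    (ψ : AddChar F ℂ) (hψ : ψ ≠ 1)
    (l : ℕ) (hl : 2 ≤ l) (ρ : F) (hρ : ∀ x : F, x ^ 2 ≠ ρ)
    (V : Type) [AddCommGroup V] [Module ℂ V]
    (π : Representation ℂ (SO2l F l ρ) V)
    (hπirr : IsIrrep π)
    (hπcusp : IsCuspidal F l ρ π)
    (Γ : V →ₗ[ℂ] ℂ) (hΓ : IsWhittaker F l ρ ψ π Γ)
    (πc : Representation ℂ (SO2l F l ρ) V)
    (hconj : ∀ g g' : SO2l F l ρ, mat F g' = cMat F l * mat F g * cMat F l → πc g = π g')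
    (Γc : V →ₗ[ℂ] ℂ) (hΓc : IsWhittaker F l ρ ψ πc Γc) :
    ∀ (Wτ : Type) [AddCommGroup Wτ] [Module ℂ Wτ],
    ∀ (τ : Representation ℂ (GL (Fin l) F) Wτ) (Λ : Wτ →ₗ[ℂ] ℂ),
      IsIrrep τ → IsGenericGLinv F l ψ τ Λ →
      ∃ c : ℂ, IsGamma F l ρ l π Γ τ Λ c ∧ IsGamma F l ρ l πc Γc τ Λ c := by
  intro Wτ _ _ τ Λ hτ hΛ
  have h2 : (2 : F) ≠ 0 := two_ne_zero_of_card hp hp2 hr hcard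
  have hρ0 : ρ ≠ 0 := fun h => hρ 0 (by rw [h]; exact zero_pow two_ne_zero)
  have hl1 : 1 ≤ l := by omega
  have : Fintype (SO2l F l ρ) := Fintype.ofFinite _
  have : Fintype (mirSub h2 hρ0 hl1) := Fintype.ofFinite _
  obtain ⟨c, hc⟩ := exists_isGamma (h2 := h2) (hρ0 := hρ0) (hl := hl1) hψ hl hρ hπirr hπcusp hΓ
    hτ hΛ
  refine ⟨c, (isGamma_iff (h2 := h2) (hρ0 := hρ0) (hl := hl1) Λ c).mpr hc,
    (isGamma_iff (h2 := h2) (hρ0 := hρ0) (hl := hl1) Λ c).mpr fun v ξ hξ => ?_⟩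
  obtain ⟨κ, hκ⟩ := exists_whittaker_conjugate h2 hψ hl hl1 hρ hπirr hΓ hconj hΓc
  rw [zetaForm_conjugate hκ fun _ => zetaLinM_comp_ctrConj Λ,
    zetaForm_conjugate hκ fun _ => zetaLin_comp_ctrConj Λ, hc _ _ (comp_ctrConj_mem_IndTau hξ),
    mul_left_comm]

end ConverseSO
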